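/- For every positive integer n, the Fourier coefficient c(n) of η(τ)^24/η(2τ)^24 satisfies n·c(n) = ∑_{r∈ℤ} t(n − r²) + (−1)^n ∑_{r ≥ 1, r odd} t(4n − r²) + 24·∑_{d | n, d odd} d, where both sums over r are finite since t(m)=0 for m < −1. -/

import Mathlib

noncomputable section

/-- The weight `k` lattice Eisenstein sum `∑_{(c,d) ≠ (0,0)} 1/(cτ+d)^k`. -/
noncomputable def latticeG (k : ℕ) (τ : ℂ) : ℂ :=
  ∑' p : ℤ × ℤ, if p = 0 then 0 else 1 / ((p.1 : ℂ) * τ + (p.2 : ℂ)) ^ k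

/-- The modular `j`-invariant `j = 1728 E₄³/(E₄³ - E₆²) = 1728 g₂³/(g₂³ - 27 g₃²)`. -/
noncomputable def jInv (τ : ℂ) : ℂ :=
  1728 * (60 * latticeG 4 τ) ^ 3 /
    ((60 * latticeG 4 τ) ^ 3 - 27 * (140 * latticeG 6 τ) ^ 2)

/-- The value of the binary quadratic form `aX² + bXY + cY²` (encoded `(a, b, c)`) at `(x, y)`. -/
def formVal (f : ℤ × ℤ × ℤ) (x y : ℤ) : ℤ :=
  f.1 * x ^ 2 + f.2.1 * x * y + f.2.2 * y ^ 2

/-- `f` is a positive definite integral binary quadratic form of discriminant `-d`. -/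
def IsForm (d : ℤ) (f : ℤ × ℤ × ℤ) : Prop :=
  0 < f.1 ∧ f.2.1 ^ 2 - 4 * f.1 * f.2.2 = -d

/-- Two forms are `SL₂(ℤ)`-equivalent. -/
def FormRel (f f' : ℤ × ℤ × ℤ) : Prop :=
  ∃ g : Matrix.SpecialLinearGroup (Fin 2) ℤ,
    ∀ x y : ℤ,
      formVal f' x y =
        formVal f (g.1 0 0 * x + g.1 0 1 * y) (g.1 1 0 * x + g.1 1 1 * y)

/-- The set of `SL₂(ℤ)`-classes of positive definite forms of discriminant `-d`. -/
abbrev FormClass (d : ℤ) :=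
  Quot (fun f f' : { f : ℤ × ℤ × ℤ // IsForm d f } => FormRel f.1 f'.1)

/-- The root `α_Q = (-b + i√d)/(2a)` in the upper half plane of `Q(X,1) = 0`. -/
noncomputable def formRoot (f : ℤ × ℤ × ℤ) : ℂ :=
  (-(f.2.1 : ℂ) + Complex.I * ((Real.sqrt ((4 * f.1 * f.2.2 - f.2.1 ^ 2 : ℤ) : ℝ) : ℝ) : ℂ)) /
    (2 * (f.1 : ℂ))

/-- `w_Q`: the order of the stabilizer of the form `f` in `PSL₂(ℤ)`, i.e. half the order of
its stabilizer in `SL₂(ℤ)` (the stabilizer always contains `±1`). -/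
noncomputable def formWt (f : ℤ × ℤ × ℤ) : ℕ :=
  Nat.card { g : Matrix.SpecialLinearGroup (Fin 2) ℤ //
    ∀ x y : ℤ,
      formVal f x y =
        formVal f (g.1 0 0 * x + g.1 0 1 * y) (g.1 1 0 * x + g.1 1 1 * y) } / 2

/-- The trace of singular moduli `t(d) = ∑_{Q ∈ Q_d/Γ} (j(α_Q) - 744)/w_Q`, with the
conventions `t(0) = 2`, `t(-1) = -1` and `t(d) = 0` for `d < -1` or `d ≡ 1, 2 (mod 4)`. -/
noncomputable def traceSM (d : ℤ) : ℝ :=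
  if d = 0 then 2
  else if d = -1 then -1
  else if d < -1 ∨ d % 4 = 1 ∨ d % 4 = 2 then 0
  else (∑ᶠ cl : FormClass d,
    (jInv (formRoot (Quot.out cl).1) - 744) / (formWt (Quot.out cl).1 : ℂ)).re

end

open Polynomial

/-- `c : ℤ → ℤ` is the coefficient sequence of the formal Laurent series
`q⁻¹ ∏_{m≥1} (1-q^m)^24 (1-q^{2m})^{-24} = ∑_{n ≥ -1} c(n) qⁿ`:
it vanishes below `-1`, and for every `N` the coefficient of `q^N` in
`(∑_{n=-1}^{N+1} c(n) q^{n+1}) · ∏_{m=1}^{N} (1-q^{2m})^{24}` agrees with that of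
`∏_{m=1}^{N} (1-q^m)^{24}` (factors with `m > N` do not affect this coefficient). -/
def IsEtaQuotCoeff (c : ℤ → ℤ) : Prop :=
  (∀ n : ℤ, n < -1 → c n = 0) ∧
  ∀ N : ℕ,
    ((∑ n ∈ Finset.range (N + 2), C (c ((n : ℤ) - 1)) * X ^ n) *
        ∏ m ∈ Finset.Icc 1 N, ((1 : ℤ[X]) - X ^ (2 * m)) ^ 24).coeff N =
      (∏ m ∈ Finset.Icc 1 N, ((1 : ℤ[X]) - X ^ m) ^ 24).coeff N

namespace Ohta

open Complex Filter Topology Set Matrix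
open scoped UpperHalfPlane MatrixGroups Asymptotics

/-- The upper half plane as a set of complex numbers. -/
def UH : Set ℂ := {z | 0 < z.im}

lemma mem_UH {z : ℂ} : z ∈ UH ↔ 0 < z.im := Iff.rfl

lemma isOpen_UH : IsOpen UH := isOpen_lt continuous_const continuous_im

lemma convex_UH : Convex ℝ UH := convex_halfSpace_im_gt 0

lemma isPreconnected_UH : IsPreconnected UH := convex_UH.isPreconnected

/-- Integral two by two matrices. -/
abbrev M2 := Matrix (Fin 2) (Fin 2) ℤ

/-- The denominator `cz + d` of the Möbius action. -/
noncomputable def den (N : M2) (z : ℂ) : ℂ := N 1 0 * z + N 1 1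

/-- The Möbius action of an integral matrix. -/
noncomputable def mob (N : M2) (z : ℂ) : ℂ := (N 0 0 * z + N 0 1) / den N z

lemma det_eq (N : M2) : N.det = N 0 0 * N 1 1 - N 0 1 * N 1 0 := Matrix.det_fin_two N

lemma det_eq_complex (N : M2) :
    (N.det : ℂ) = N 0 0 * N 1 1 - N 0 1 * N 1 0 := by
  rw [det_eq]; push_cast; ring

lemma UH.ne_zero {z : ℂ} (hz : z ∈ UH) : z ≠ 0 := by
  rintro rfl; simp [UH] at hz

lemma lin_ne_zero {z : ℂ} (hz : z ∈ UH) {c d : ℤ} (h : c ≠ 0 ∨ d ≠ 0) :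
    (c : ℂ) * z + d ≠ 0 := by
  intro h0
  have him : (c : ℝ) * z.im = 0 := by simpa using congrArg Complex.im h0
  have hc : c = 0 := by
    rcases mul_eq_zero.1 him with h1 | h1
    · exact_mod_cast h1
    · exact absurd h1 (ne_of_gt hz)
  subst hc
  simp at h0 h
  exact h h0

lemma den_ne_zero {N : M2} (hN : 0 < N.det) {z : ℂ} (hz : z ∈ UH) : den N z ≠ 0 := by
  apply lin_ne_zero hz
  by_contra! h
  rw [det_eq, h.1, h.2] at hN
  simp at hN

lemma mob_sub_mob {N : M2} {z w : ℂ} (hz : den N z ≠ 0) (hw : den N w ≠ 0) :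
    mob N z - mob N w = N.det * (z - w) / (den N z * den N w) := by
  rw [mob, mob, div_sub_div _ _ hz hw, det_eq_complex]
  congr 1
  simp only [den]
  ring

lemma im_mob (N : M2) (z : ℂ) :
    (mob N z).im = N.det * z.im / normSq (den N z) := by
  have h : (mob N z) = (N 0 0 * z + N 0 1) * (starRingEnd ℂ) (den N z) / (normSq (den N z) : ℂ) :=
      by
    by_cases h : den N z = 0
    · simp [mob, h]
    · rw [mob, div_eq_div_iff h (by exact_mod_cast (normSq_pos.2 h).ne'), mul_assoc,
        normSq_eq_conj_mul_self]
  rw [h, Complex.div_ofReal_im]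
  congr 1
  rw [det_eq]
  simp [den]
  ring

lemma mob_mem {N : M2} (hN : 0 < N.det) {z : ℂ} (hz : z ∈ UH) : mob N z ∈ UH := by
  rw [mem_UH, im_mob]
  have := normSq_pos.2 (den_ne_zero hN hz)
  have h2 : (0 : ℝ) < N.det := by exact_mod_cast hN
  have h3 : 0 < z.im := hz
  positivity

lemma den_mul (A B : M2) {z : ℂ} (hB : den B z ≠ 0) :
    den (A * B) z = den A (mob B z) * den B z := by
  simp only [den, mob] at *
  simp only [Matrix.mul_apply, Fin.sum_univ_two]
  push_cast
  field_simp
  ring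

lemma mob_mul {A B : M2} {z : ℂ} (hB : den B z ≠ 0) :
    mob (A * B) z = mob A (mob B z) := by
  have h : (A * B) 0 0 * z + (A * B) 0 1 =
      (A 0 0 * mob B z + A 0 1) * den B z := by
    simp only [den, mob] at *
    simp only [Matrix.mul_apply, Fin.sum_univ_two]
    push_cast
    field_simp
    ring
  conv_lhs => rw [mob, h, den_mul A B hB, mul_div_mul_right _ _ hB]
  rfl

@[simp] lemma mob_one (z : ℂ) : mob 1 z = z := by simp [mob, den]

@[simp] lemma den_one (z : ℂ) : den 1 z = 1 := by simp [den]

lemma mob_neg (N : M2) (z : ℂ) : mob (-N) z = mob N z := by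
  rw [mob, mob]
  have : den (-N) z = - den N z := by simp [den]; ring
  rw [this, ← neg_div_neg_eq]
  congr 1
  · simp; ring
  · simp

lemma differentiableAt_mob {N : M2} {z : ℂ} (h : den N z ≠ 0) :
    DifferentiableAt ℂ (mob N) z := by
  unfold mob den at *
  fun_prop (disch := assumption)

lemma continuousAt_mob {N : M2} {z : ℂ} (h : den N z ≠ 0) : ContinuousAt (mob N) z :=
  (differentiableAt_mob h).continuousAt

lemma sl_det_pos (γ : SL(2, ℤ)) : 0 < (γ : M2).det := by rw [γ.2]; exact one_pos

lemma sl_mem (γ : SL(2, ℤ)) {z : ℂ} (hz : z ∈ UH) : mob γ z ∈ UH := mob_mem (sl_det_pos γ) hz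

lemma sl_den (γ : SL(2, ℤ)) {z : ℂ} (hz : z ∈ UH) : den γ z ≠ 0 := den_ne_zero (sl_det_pos γ) hz

lemma mob_sl_mul (γ δ : SL(2, ℤ)) {z : ℂ} (hz : z ∈ UH) :
    mob (γ * δ : SL(2, ℤ)) z = mob γ (mob δ z) := by
  rw [Matrix.SpecialLinearGroup.coe_mul, mob_mul (sl_den δ hz)]

lemma mob_sl_inv_mob (γ : SL(2, ℤ)) {z : ℂ} (hz : z ∈ UH) :
    mob (γ⁻¹ : SL(2, ℤ)) (mob γ z) = z := by
  rw [← mob_sl_mul _ _ hz]; simp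

lemma mob_mob_sl_inv (γ : SL(2, ℤ)) {z : ℂ} (hz : z ∈ UH) :
    mob γ (mob (γ⁻¹ : SL(2, ℤ)) z) = z := by
  rw [← mob_sl_mul _ _ hz]; simp

lemma mob_S (z : ℂ) : mob (ModularGroup.S : SL(2, ℤ)) z = -1 / z := by
  simp [mob, den, ModularGroup.S]

lemma mob_T (z : ℂ) : mob (ModularGroup.T : SL(2, ℤ)) z = z + 1 := by
  simp [mob, den, ModularGroup.T]

lemma neg_inv_mem {z : ℂ} (hz : z ∈ UH) : -1 / z ∈ UH := by
  rw [← mob_S]; exact sl_mem _ hz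

lemma add_one_mem {z : ℂ} (hz : z ∈ UH) : z + 1 ∈ UH := by
  rw [← mob_T]; exact sl_mem _ hz

/-- A family permuted by the two generators of the modular group is permuted by the group. -/
lemma equivariant_of_generators {W X : Type*} [MulAction SL(2, ℤ) W] (φ : W → ℂ → X)
    (hS : ∀ v, ∀ z ∈ UH, φ (ModularGroup.S • v) (-1 / z) = φ v z)
    (hT : ∀ v, ∀ z ∈ UH, φ (ModularGroup.T • v) (z + 1) = φ v z) (γ : SL(2, ℤ)) :
    ∀ v, ∀ z ∈ UH, φ (γ • v) (mob γ z) = φ v z := by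
  have h : γ ∈ Subgroup.closure ({ModularGroup.S, ModularGroup.T} : Set SL(2, ℤ)) := by
    rw [SpecialLinearGroup.SL2Z_generators]; trivial
  induction h using Subgroup.closure_induction with
  | mem x hx =>
    rcases hx with rfl | rfl
    · intro v z hz; rw [mob_S]; exact hS v z hz
    · intro v z hz; rw [mob_T]; exact hT v z hz
  | one => intro v z _; simp
  | mul x y _ _ hx hy =>
    intro v z hz
    rw [mob_sl_mul _ _ hz, mul_smul, hx _ _ (sl_mem _ hz), hy _ _ hz]
  | inv x _ hx =>
    intro v z hz
    rw [← hx _ _ (sl_mem x⁻¹ hz), mob_mob_sl_inv _ hz, smul_inv_smul]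

/-- A function on the upper half plane, invariant under the modular group, holomorphic and bounded
near infinity, is constant. -/
lemma const_of_invariant {F : ℂ → ℂ} (hd : DifferentiableOn ℂ F UH)
    (hS : ∀ z ∈ UH, F (-1 / z) = F z) (hT : ∀ z ∈ UH, F (z + 1) = F z)
    (hb : ∃ A C : ℝ, ∀ z : ℂ, A ≤ z.im → z ∈ UH → ‖F z‖ ≤ C) :
    ∃ c, ∀ z ∈ UH, F z = c := by
  let f : ℍ → ℂ := fun z => F z
  have hS' : SlashAction.map (0 : ℤ) ModularGroup.S f = f := by
    ext z
    rw [ModularForm.SL_slash_apply, UpperHalfPlane.modular_S_smul]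
    have := hS z z.2
    rw [neg_div, one_div] at this
    simpa [f, inv_neg] using this
  have hT' : SlashAction.map (0 : ℤ) ModularGroup.T f = f := by
    ext z
    rw [ModularForm.SL_slash_apply, UpperHalfPlane.modular_T_smul]
    have := hT z z.2
    simpa [f, add_comm] using this
  have hbd : UpperHalfPlane.IsBoundedAtImInfty f := by
    obtain ⟨A, C, h⟩ := hb
    exact UpperHalfPlane.isBoundedAtImInfty_iff.2 ⟨C, A, fun z hz => h z hz z.2⟩
  have hSL := SlashInvariantForm.slash_action_generators_SL2Z hS' hT'
  let g : ModularForm 𝒮ℒ 0 :=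
    { toFun := f
      slash_action_eq' := by
        rintro A ⟨A, rfl⟩
        exact hSL A
      holo' := by
        rw [UpperHalfPlane.mdifferentiable_iff]
        refine hd.congr fun z hz => ?_
        simp [f, UpperHalfPlane.ofComplex_apply_of_im_pos hz]
      bdd_at_cusps' := by
        intro c hc
        rw [Subgroup.IsArithmetic.isCusp_iff_isCusp_SL2Z] at hc
        rw [OnePoint.isBoundedAt_iff_forall_SL2Z hc]
        intro γ _
        rw [hSL]
        exact hbd }
  obtain ⟨c, hc⟩ := ModularFormClass.levelOne_weight_zero_const g
  exact ⟨c, fun z hz => congrFun hc ⟨z, hz⟩⟩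

section LevelOne

open UpperHalfPlane hiding I

/-- The nome `exp(2πiz)`. -/
noncomputable def nome (z : ℂ) : ℂ := cexp (2 * Real.pi * I * z)

lemma nome_ne_zero (z : ℂ) : nome z ≠ 0 := Complex.exp_ne_zero _

lemma nome_add (z w : ℂ) : nome (z + w) = nome z * nome w := by
  rw [nome, nome, nome, ← Complex.exp_add]; congr 1; ring

lemma nome_nat_mul (n : ℕ) (z : ℂ) : nome (n * z) = nome z ^ n := by
  rw [nome, nome, ← Complex.exp_nat_mul]; congr 1; ring

@[simp] lemma nome_one : nome 1 = 1 := by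
  rw [nome, mul_one, Complex.exp_two_pi_mul_I]

lemma nome_add_one (z : ℂ) : nome (z + 1) = nome z := by rw [nome_add, nome_one, mul_one]

lemma nome_half : nome (1 / 2) = -1 := by
  rw [nome, ← Complex.exp_pi_mul_I]; congr 1; ring

lemma norm_nome (z : ℂ) : ‖nome z‖ = Real.exp (-2 * Real.pi * z.im) := by
  rw [nome, Complex.norm_exp]; congr 1; simp

lemma norm_nome_lt_one {z : ℂ} (hz : z ∈ UH) : ‖nome z‖ < 1 := by
  rw [norm_nome, Real.exp_lt_one_iff]
  have : 0 < z.im := hz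
  nlinarith [Real.pi_pos, mul_pos Real.pi_pos this]

lemma differentiable_nome : Differentiable ℂ nome := by unfold nome; fun_prop

lemma qParam_one (z : ℂ) : Function.Periodic.qParam 1 z = nome z := by
  simp [Function.Periodic.qParam, nome]

/-- The Euler product `∏ (1 - x^(n+1))`. -/
noncomputable def euler (x : ℂ) : ℂ := ∏' n : ℕ, (1 - x ^ (n + 1))

lemma differentiableOn_euler : DifferentiableOn ℂ euler (Metric.ball 0 1) :=
  ModularForm.differentiableOn_tprod_one_sub_pow

lemma euler_zero : euler 0 = 1 := by simp [euler]

lemma exists_nome_eq {x : ℂ} (hx : ‖x‖ < 1) (h0 : x ≠ 0) : ∃ z ∈ UH, nome z = x := by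
  refine ⟨Complex.log x / (2 * Real.pi * I), ?_, ?_⟩
  · have h1 : Real.log ‖x‖ < 0 := Real.log_neg (norm_pos_iff.2 h0) hx
    have h2 : (Complex.log x / (2 * Real.pi * I)) =
        ((Complex.arg x / (2 * Real.pi) : ℝ) : ℂ) + ((-Real.log ‖x‖ / (2 * Real.pi) : ℝ) : ℂ) * I
            := by
      have hpi : (Real.pi : ℂ) ≠ 0 := by exact_mod_cast Real.pi_ne_zero
      rw [Complex.log]
      push_cast
      field_simp
      linear_combination (Real.log ‖x‖ : ℂ) * Complex.I_sq
    rw [mem_UH, h2]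
    simp only [add_im, ofReal_im, mul_im, ofReal_re, Complex.I_im, Complex.I_re]
    have := Real.pi_pos
    simp only [mul_one, mul_zero, zero_add, add_zero]
    apply div_pos <;> linarith
  · rw [nome, mul_div_cancel₀ _ Complex.two_pi_I_ne_zero, Complex.exp_log h0]

lemma euler_ne_zero {x : ℂ} (hx : ‖x‖ < 1) : euler x ≠ 0 := by
  by_cases h0 : x = 0
  · rw [h0, euler_zero]; exact one_ne_zero
  obtain ⟨z, hz, rfl⟩ := exists_nome_eq hx h0
  have := ModularForm.eta_tprod_ne_zero (z := z) hz
  simpa only [ModularForm.eta_q, qParam_one, euler] using this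

/-- The discriminant as a function of a complex variable. -/
noncomputable def Dl (z : ℂ) : ℂ := nome z * euler (nome z) ^ 24

lemma Dl_coe (z : ℍ) : Dl z = ModularForm.discriminant z := by
  rw [ModularForm.discriminant_eq_q_prod, Dl, qParam_one, euler,
    ← Multipliable.tprod_pow (ModularForm.multipliable_one_sub_pow (norm_nome_lt_one z.2))]
  simp only [ModularForm.eta_q, qParam_one]

lemma Dl_ne_zero {z : ℂ} (hz : z ∈ UH) : Dl z ≠ 0 :=
  mul_ne_zero (nome_ne_zero z) (pow_ne_zero _ (euler_ne_zero (norm_nome_lt_one hz)))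

lemma Dl_add_one (z : ℂ) : Dl (z + 1) = Dl z := by rw [Dl, nome_add_one, Dl]

lemma differentiableOn_Dl : DifferentiableOn ℂ Dl UH := by
  have : DifferentiableOn ℂ (fun z => euler (nome z)) UH :=
    differentiableOn_euler.comp differentiable_nome.differentiableOn
      fun z hz => by simpa using norm_nome_lt_one hz
  exact differentiable_nome.differentiableOn.mul (this.pow 24)

lemma transform_S (k : ℕ) (f : ℍ → ℂ) (hf : SlashAction.map (k : ℤ) ModularGroup.S f = f)
    {z : ℂ} (hz : z ∈ UH) : f ⟨-1 / z, neg_inv_mem hz⟩ = z ^ k * f ⟨z, hz⟩ := by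
  have h := congrFun hf ⟨z, hz⟩
  rw [SlashInvariantForm.slash_S_apply] at h
  have h0 : z ≠ 0 := UH.ne_zero hz
  rw [← h]
  have : f (UpperHalfPlane.mk (-(⟨z, hz⟩ : ℍ) : ℂ)⁻¹ (UpperHalfPlane.im_inv_neg_coe_pos _)) = f ⟨-1
      / z, neg_inv_mem hz⟩ := by
    congr 1
    ext
    simp [neg_div, inv_neg]
  rw [this]
  simp
  field_simp

lemma Dl_neg_inv {z : ℂ} (hz : z ∈ UH) : Dl (-1 / z) = z ^ 12 * Dl z := by
  have := transform_S 12 ModularForm.discriminant ModularForm.discriminant_S_invariant hz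
  rwa [← Dl_coe, ← Dl_coe] at this

/-- The weight four Eisenstein series as a function of a complex variable. -/
noncomputable def F4 (z : ℂ) : ℂ := ModularForm.E₄ (ofComplex z)

/-- The weight six Eisenstein series as a function of a complex variable. -/
noncomputable def F6 (z : ℂ) : ℂ := ModularForm.E₆ (ofComplex z)

lemma differentiableOn_F4 : DifferentiableOn ℂ F4 UH :=
  UpperHalfPlane.mdifferentiable_iff.1 ModularForm.E₄.holo'

lemma F4_apply {z : ℂ} (hz : z ∈ UH) : F4 z = ModularForm.E₄ ⟨z, hz⟩ := by
  rw [F4, ofComplex_apply_of_im_pos hz]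

lemma F6_apply {z : ℂ} (hz : z ∈ UH) : F6 z = ModularForm.E₆ ⟨z, hz⟩ := by
  rw [F6, ofComplex_apply_of_im_pos hz]

lemma F4_neg_inv {z : ℂ} (hz : z ∈ UH) : F4 (-1 / z) = z ^ 4 * F4 z := by
  rw [F4_apply hz, F4_apply (neg_inv_mem hz)]
  exact transform_S 4 _ (ModularForm.E₄.slash_action_eq' _ ⟨ModularGroup.S, rfl⟩) hz

lemma F6_neg_inv {z : ℂ} (hz : z ∈ UH) : F6 (-1 / z) = z ^ 6 * F6 z := by
  rw [F6_apply hz, F6_apply (neg_inv_mem hz)]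
  exact transform_S 6 _ (ModularForm.E₆.slash_action_eq' _ ⟨ModularGroup.S, rfl⟩) hz

/-- `E₄` as a function of the nome. -/
noncomputable def e4 : ℂ → ℂ := UpperHalfPlane.cuspFunction 1 ModularForm.E₄

lemma F4_eq {z : ℂ} (hz : z ∈ UH) : F4 z = e4 (nome z) := by
  rw [F4_apply hz, e4, ← qParam_one]
  exact (SlashInvariantFormClass.eq_cuspFunction ModularForm.E₄ ⟨z, hz⟩
    one_mem_strictPeriods_SL one_ne_zero).symm

lemma analyticAt_e4 : AnalyticAt ℂ e4 0 :=
  ModularFormClass.analyticAt_cuspFunction_zero ModularForm.E₄ one_pos one_mem_strictPeriods_SL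

lemma e4_zero : e4 0 = 1 := by
  have h := EisensteinSeries.E_qExpansion_coeff_zero (k := 4) (by norm_num) ⟨2, rfl⟩
  rw [UpperHalfPlane.qExpansion_coeff] at h
  simpa [e4] using h

lemma deriv_e4_zero : deriv e4 0 = 240 := by
  have h := ModularForm.E₄_qExpansion_coeff_one
  rw [UpperHalfPlane.qExpansion_coeff] at h
  simpa [e4] using h

lemma F4_add_one {z : ℂ} (hz : z ∈ UH) : F4 (z + 1) = F4 z := by
  rw [F4_eq hz, F4_eq (add_one_mem hz), nome_add_one]

lemma Dl_eq {z : ℂ} (hz : z ∈ UH) : 1728 * Dl z = F4 z ^ 3 - F6 z ^ 2 := by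
  have := ModularForm.discriminant_eq_E₄_cube_sub_E₆_sq ⟨z, hz⟩
  rw [← Dl_coe] at this
  rw [F4_apply hz, F6_apply hz]
  linear_combination 1728 * this

lemma latticeG_eq {k : ℕ} (hk : 3 ≤ k) (z : ℍ) :
    latticeG k z = 2 * riemannZeta k * ModularForm.E hk z := by
  have h := tsum_eisSummand_eq_riemannZeta_mul_eisensteinSeries hk z
  have hE : ModularForm.E hk z = (1 / 2 : ℂ) * eisensteinSeries (N := 1) 0 k z := rfl
  rw [hE]
  have : latticeG k z = ∑' v : Fin 2 → ℤ, EisensteinSeries.eisSummand k v z := by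
    rw [← (finTwoArrowEquiv ℤ).symm.tsum_eq, latticeG]
    congr 1
    ext p
    by_cases hp : p = 0
    · subst hp
      have hk0 : k ≠ 0 := by omega
      simp [EisensteinSeries.eisSummand, hk0]
    · simp [hp, EisensteinSeries.eisSummand]
  rw [this, h]
  ring

lemma g2_eq {z : ℂ} (hz : z ∈ UH) :
    60 * latticeG 4 z = 4 * Real.pi ^ 4 / 3 * F4 z := by
  have := latticeG_eq (k := 4) (by norm_num) ⟨z, hz⟩
  rw [F4_apply hz, show (60 : ℂ) * latticeG 4 z = 60 * latticeG 4 ((⟨z, hz⟩ : ℍ) : ℂ) from rfl,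
      this]
  push_cast
  rw [riemannZeta_four]
  ring

lemma g3_eq {z : ℂ} (hz : z ∈ UH) :
    140 * latticeG 6 z = 8 * Real.pi ^ 6 / 27 * F6 z := by
  have := latticeG_eq (k := 6) (by norm_num) ⟨z, hz⟩
  rw [F6_apply hz, show (140 : ℂ) * latticeG 6 z = 140 * latticeG 6 ((⟨z, hz⟩ : ℍ) : ℂ) from rfl,
      this]
  have h6 : riemannZeta (6 : ℕ) = Real.pi ^ 6 / 945 := by
    have := riemannZeta_two_mul_nat (k := 3) (by norm_num)
    norm_num at this ⊢
    rw [this, show _root_.bernoulli 6 = 1 / 42 by decide +kernel]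
    norm_num [Nat.factorial]
    ring
  rw [h6]
  ring

lemma jInv_eq {z : ℂ} (hz : z ∈ UH) : jInv z = F4 z ^ 3 / Dl z := by
  have hpi : (Real.pi : ℂ) ≠ 0 := by exact_mod_cast Real.pi_ne_zero
  have hd := Dl_ne_zero hz
  rw [jInv, g2_eq hz, g3_eq hz]
  have h : (4 * Real.pi ^ 4 / 3 * F4 z) ^ 3 - 27 * (8 * Real.pi ^ 6 / 27 * F6 z) ^ 2 =
      64 * Real.pi ^ 12 / 27 * (1728 * Dl z) := by rw [Dl_eq hz]; ring
  rw [h]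
  field_simp
  ring

lemma jInv_neg_inv {z : ℂ} (hz : z ∈ UH) : jInv (-1 / z) = jInv z := by
  rw [jInv_eq hz, jInv_eq (neg_inv_mem hz), F4_neg_inv hz, Dl_neg_inv hz]
  have := UH.ne_zero hz
  have := Dl_ne_zero hz
  field_simp

lemma jInv_add_one {z : ℂ} (hz : z ∈ UH) : jInv (z + 1) = jInv z := by
  rw [jInv_eq hz, jInv_eq (add_one_mem hz), F4_add_one hz, Dl_add_one]

lemma differentiableOn_jInv : DifferentiableOn ℂ jInv UH :=
  ((differentiableOn_F4.pow 3).div differentiableOn_Dl fun _ hz => Dl_ne_zero hz).congr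
    fun _ hz => jInv_eq hz

lemma I_mem_UH : I ∈ UH := by simp [UH]

lemma jInv_I : jInv I = 1728 := by
  have h6 : F6 I = 0 := by
    have h := F6_neg_inv I_mem_UH
    rw [show (-1 : ℂ) / I = I by field_simp; simp] at h
    have h6 : (I : ℂ) ^ 6 = -1 := by
      rw [show (6 : ℕ) = 2 + 4 by rfl, pow_add, I_pow_four, I_sq]
      ring
    rw [h6] at h
    linear_combination h / 2
  have hD := Dl_eq I_mem_UH
  rw [jInv_eq I_mem_UH, div_eq_iff (Dl_ne_zero I_mem_UH), hD, h6]
  ring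

/-- The primitive cube root of unity in the upper half plane. -/
noncomputable def rho : ℂ := -1 / 2 + Real.sqrt 3 / 2 * I

lemma rho_mem : rho ∈ UH := by
  simp [UH, rho]

lemma rho_sq : rho ^ 2 + rho + 1 = 0 := by
  have h3 : ((Real.sqrt 3 : ℝ) : ℂ) ^ 2 = 3 := by
    rw [← ofReal_pow, Real.sq_sqrt (by norm_num)]; norm_num
  rw [rho]
  linear_combination (1 / 4 : ℂ) * (Real.sqrt 3 : ℂ) ^ 2 * I_sq - (1 / 4 : ℂ) * h3

lemma jInv_rho : jInv rho = 0 := by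
  have h0 := UH.ne_zero rho_mem
  have h := F4_neg_inv rho_mem
  rw [show (-1 : ℂ) / rho = rho + 1 by field_simp; linear_combination -rho_sq,
    F4_add_one rho_mem] at h
  have h1 : rho ^ 4 = rho := by linear_combination (rho ^ 2 - rho) * rho_sq
  rw [h1] at h
  have h2 : rho ≠ 1 := by
    intro h; have := rho_sq; rw [h] at this; norm_num at this
  have h4 : F4 rho = 0 := by
    have : (rho - 1) * F4 rho = 0 := by linear_combination -h
    exact (mul_eq_zero.1 this).resolve_left (sub_ne_zero.2 h2)
  rw [jInv_eq rho_mem, h4]; simp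

end LevelOne

/-- Two solutions of the Weierstrass equation with principal part `z⁻²` coincide. -/
lemma weierstrass_local_unique {p₁ p₂ : ℂ → ℂ} (h₁ : AnalyticAt ℂ p₁ 0) (h₂ : AnalyticAt ℂ p₂ 0)
    (a b : ℂ)
    (e₁ : ∀ᶠ z in 𝓝[≠] (0 : ℂ), (deriv p₁ z - 2 / z ^ 3) ^ 2 =
      4 * (p₁ z + 1 / z ^ 2) ^ 3 - a * (p₁ z + 1 / z ^ 2) - b)
    (e₂ : ∀ᶠ z in 𝓝[≠] (0 : ℂ), (deriv p₂ z - 2 / z ^ 3) ^ 2 =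
      4 * (p₂ z + 1 / z ^ 2) ^ 3 - a * (p₂ z + 1 / z ^ 2) - b) :
    ∀ᶠ z in 𝓝 (0 : ℂ), p₁ z = p₂ z := by
  have hw : AnalyticAt ℂ (fun z => p₁ z - p₂ z) 0 := h₁.sub h₂
  by_contra hne
  have hne' : analyticOrderAt (fun z => p₁ z - p₂ z) 0 ≠ ⊤ := by
    rw [ne_eq, analyticOrderAt_eq_top]
    simpa [sub_eq_zero] using hne
  obtain ⟨g, hg, hg0, he⟩ := hw.analyticOrderAt_ne_top.1 hne'
  set m := analyticOrderNatAt (fun z => p₁ z - p₂ z) 0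
  simp only [sub_zero, smul_eq_mul] at he
  let A : ℂ → ℂ := fun z => z ^ 3 * (deriv p₁ z + deriv p₂ z) - 4
  let u : ℂ → (ℂ → ℂ) → ℂ := fun z p => z ^ 2 * p z + 1
  let B : ℂ → ℂ := fun z => 4 * (u z p₁ ^ 2 + u z p₁ * u z p₂ + u z p₂ ^ 2) - a * z ^ 4
  have hcA : ContinuousAt A 0 := by
    have := h₁.deriv.continuousAt
    have := h₂.deriv.continuousAt
    fun_prop
  have hcB : ContinuousAt B 0 := by
    have := h₁.continuousAt
    have := h₂.continuousAt
    fun_prop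
  have hcg := hg.continuousAt
  have hcg' := hg.deriv.continuousAt
  have hL : ContinuousAt (fun z => (m * g z + z * deriv g z) * A z - g z * B z) 0 := by fun_prop
  have hz : ∀ᶠ z in 𝓝[≠] (0 : ℂ), (m * g z + z * deriv g z) * A z - g z * B z = 0 := by
    have hd := he.eventually_nhds
    have hgd := hg.eventually_analyticAt
    have hd1 := h₁.eventually_analyticAt
    have hd2 := h₂.eventually_analyticAt
    filter_upwards [e₁, e₂, self_mem_nhdsWithin, hd.filter_mono nhdsWithin_le_nhds,
      hgd.filter_mono nhdsWithin_le_nhds, hd1.filter_mono nhdsWithin_le_nhds,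
      hd2.filter_mono nhdsWithin_le_nhds] with z e₁ e₂ hz0 hd hgd hd1 hd2
    have hz0 : z ≠ 0 := hz0
    have hdw : deriv p₁ z - deriv p₂ z = m * z ^ (m - 1) * g z + z ^ m * deriv g z := by
      have h1 := (hd1.differentiableAt.hasDerivAt.sub hd2.differentiableAt.hasDerivAt).deriv
      have h2 := ((hasDerivAt_pow m z).mul hgd.differentiableAt.hasDerivAt).deriv
      rw [← h1, ← h2]
      exact Filter.EventuallyEq.deriv_eq hd
    have hwz : p₁ z - p₂ z = z ^ m * g z := hd.self_of_nhds
    have hzm : z * (m * z ^ (m - 1)) = m * z ^ m := by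
      rcases m with _ | m
      · simp
      · simp; ring
    have key : z ^ 6 * ((deriv p₁ z - 2 / z ^ 3) ^ 2 - (deriv p₂ z - 2 / z ^ 3) ^ 2) =
      z ^ 6 * (4 * (p₁ z + 1 / z ^ 2) ^ 3 - a * (p₁ z + 1 / z ^ 2) - b - (
      4 * (p₂ z + 1 / z ^ 2) ^ 3 - a * (p₂ z + 1 / z ^ 2) - b)) := by rw [e₁, e₂]
    have hl : z ^ 6 * ((deriv p₁ z - 2 / z ^ 3) ^ 2 - (deriv p₂ z - 2 / z ^ 3) ^ 2) =
        z ^ 3 * (deriv p₁ z - deriv p₂ z) * A z := by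
      simp only [A]; field_simp; ring
    have hr : z ^ 6 * (4 * (p₁ z + 1 / z ^ 2) ^ 3 - a * (p₁ z + 1 / z ^ 2) - b - (
      4 * (p₂ z + 1 / z ^ 2) ^ 3 - a * (p₂ z + 1 / z ^ 2) - b)) =
        z ^ 2 * (p₁ z - p₂ z) * B z := by
      simp only [B, u]; field_simp; ring
    rw [hl, hr, hdw, hwz] at key
    have hzz : z ^ 2 * z ^ m ≠ 0 := mul_ne_zero (pow_ne_zero _ hz0) (pow_ne_zero _ hz0)
    apply mul_left_cancel₀ hzz
    rw [mul_zero]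
    linear_combination key + (-z ^ 2 * g z * A z) * hzm
  have h0 := tendsto_nhds_unique (hL.tendsto.mono_left nhdsWithin_le_nhds)
    ((tendsto_const_nhds (x := (0 : ℂ))).congr' (hz.mono fun z h => h.symm))
  simp only [A, B, u] at h0
  have : ((m : ℂ) + 3) * g 0 = 0 := by linear_combination -h0 / 4
  rcases mul_eq_zero.1 this with h | h
  · have : (m : ℂ) + 3 ≠ 0 := by exact_mod_cast Nat.succ_ne_zero (m + 2)
    exact this h
  · exact hg0 h

open PeriodPair in
lemma lattice_le_of_invariants {L L' : PeriodPair} (h2 : L.g₂ = L'.g₂) (h3 : L.g₃ = L'.g₃) :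
    L.lattice ≤ L'.lattice := by
  have key (M : PeriodPair) : ∀ᶠ z in 𝓝[≠] (0 : ℂ),
      (deriv (M.weierstrassPExcept 0) z - 2 / z ^ 3) ^ 2 =
      4 * (M.weierstrassPExcept 0 z + 1 / z ^ 2) ^ 3
        - M.g₂ * (M.weierstrassPExcept 0 z + 1 / z ^ 2) - M.g₃ ∧
      M.weierstrassP z = M.weierstrassPExcept 0 z + 1 / z ^ 2 := by
    filter_upwards [self_mem_nhdsWithin,
      nhdsWithin_le_nhds (M.compl_lattice_sdiff_singleton_mem_nhds 0)] with z hz hz'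
    have e1 : M.weierstrassP z = M.weierstrassPExcept 0 z + 1 / z ^ 2 := by
      have := M.weierstrassPExcept_add 0 z
      simp at this
      rw [← this]; simp
    have e2 : M.derivWeierstrassP z = deriv (M.weierstrassPExcept 0) z - 2 / z ^ 3 := by
      have := M.derivWeierstrassPExcept_sub 0 z
      simp at this
      rw [← this, M.eqOn_deriv_weierstrassPExcept_derivWeierstrassPExcept 0 hz']
    have hn : z ∉ M.lattice := fun h => hz' ⟨h, hz⟩
    exact ⟨by rw [← e1, ← e2, M.derivWeierstrassP_sq z hn], e1⟩
  have hloc := weierstrass_local_unique (L.analyticAt_weierstrassPExcept 0)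
    (L'.analyticAt_weierstrassPExcept 0) L.g₂ L.g₃ ((key L).mono fun z h => h.1)
    (by rw [h2, h3]; exact (key L').mono fun z h => h.1)
  have hm : Meromorphic (L.weierstrassP - L'.weierstrassP) :=
    L.meromorphic_weierstrassP.sub L'.meromorphic_weierstrassP
  have h0 : meromorphicOrderAt (L.weierstrassP - L'.weierstrassP) 0 = ⊤ := by
    rw [meromorphicOrderAt_eq_top_iff]
    filter_upwards [key L, key L', hloc.filter_mono nhdsWithin_le_nhds] with z h h' h''
    simp [h.2, h'.2, h'']
  have hall : ∀ z, meromorphicOrderAt (L.weierstrassP - L'.weierstrassP) z = ⊤ := by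
    by_contra! hex
    exact (hm.exists_meromorphicOrderAt_ne_top_iff_forall).1 hex 0 h0
  intro l hl
  by_contra hl'
  have h1 := L.order_weierstrassP l hl
  have h4 : L.weierstrassP =ᶠ[𝓝[≠] l] L'.weierstrassP := by
    filter_upwards [meromorphicOrderAt_eq_top_iff.1 (hall l)] with z hz
    exact sub_eq_zero.1 hz
  have h5 := (L'.analyticOnNhd_weierstrassP l hl').meromorphicOrderAt_nonneg
  rw [← meromorphicOrderAt_congr h4, h1] at h5
  exact absurd h5 (by decide)

/-- The period pair `(μτ, μ)`. -/
noncomputable def scaledPair (τ μ : ℂ) (hτ : τ ∈ UH) (hμ : μ ≠ 0) : PeriodPair where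
  ω₁ := μ * τ
  ω₂ := μ
  indep := by
    rw [LinearIndependent.pair_iff]
    intro s t h
    have h1 : μ * (s * τ + t) = 0 := by
      rw [Complex.real_smul, Complex.real_smul] at h
      linear_combination h
    have h2 := (mul_eq_zero.1 h1).resolve_left hμ
    have h3 : s * τ.im = 0 := by simpa using congrArg Complex.im h2
    have hs : s = 0 := (mul_eq_zero.1 h3).resolve_right (ne_of_gt hτ)
    subst hs
    simpa using h2

lemma scaledPair_G {τ μ : ℂ} (hτ : τ ∈ UH) (hμ : μ ≠ 0) {k : ℕ} (hk : k ≠ 0) :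
    (scaledPair τ μ hτ hμ).G k = (μ⁻¹) ^ k * latticeG k τ := by
  rw [PeriodPair.G, latticeG, ← tsum_mul_left,
    ← (scaledPair τ μ hτ hμ).latticeEquivProd.symm.toEquiv.tsum_eq]
  congr 1
  ext p
  have : (((scaledPair τ μ hτ hμ).latticeEquivProd.symm.toEquiv p : (scaledPair τ μ hτ hμ).lattice)
      : ℂ)
      = μ * (p.1 * τ + p.2) := by
    refine (PeriodPair.latticeEquiv_symm_apply _ p).trans ?_
    simp only [scaledPair]; ring
  rw [this]
  split_ifs with h
  · simp [h, hk]
  · rw [mul_pow, mul_inv, inv_pow, one_div]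

lemma exists_scale {a b a' b' : ℂ} (h : a ^ 3 - b ^ 2 ≠ 0) (h' : a' ^ 3 - b' ^ 2 ≠ 0)
    (he : a ^ 3 * b' ^ 2 = a' ^ 3 * b ^ 2) :
    ∃ ν : ℂ, ν ≠ 0 ∧ ν ^ 4 * a = a' ∧ ν ^ 6 * b = b' := by
  by_cases ha : a = 0
  · have hb : b ≠ 0 := by rintro rfl; simp [ha] at h
    have ha' : a' = 0 := by simpa [ha, hb] using he
    have hb' : b' ≠ 0 := by rintro rfl; simp [ha'] at h'
    obtain ⟨ν, hν⟩ := IsAlgClosed.exists_pow_nat_eq (b' / b) (n := 6) (by norm_num)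
    refine ⟨ν, ?_, by simp [ha, ha'], by rw [hν, div_mul_cancel₀ _ hb]⟩
    rintro rfl
    exact (div_ne_zero hb' hb) (by rw [← hν]; norm_num)
  by_cases hb : b = 0
  · have hb' : b' = 0 := by simpa [hb, ha] using he
    have ha' : a' ≠ 0 := by rintro rfl; simp [hb'] at h'
    obtain ⟨ν, hν⟩ := IsAlgClosed.exists_pow_nat_eq (a' / a) (n := 4) (by norm_num)
    refine ⟨ν, ?_, by rw [hν, div_mul_cancel₀ _ ha], by simp [hb, hb']⟩
    rintro rfl
    exact (div_ne_zero ha' ha) (by rw [← hν]; norm_num)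
  have ha' : a' ≠ 0 := by
    rintro rfl
    have : b' = 0 := by simpa [ha] using he
    simp [this] at h'
  have hb' : b' ≠ 0 := by
    rintro rfl
    have : a' = 0 := by simpa [hb] using he
    simp [this] at h'
  obtain ⟨ν, hν⟩ := IsAlgClosed.exists_pow_nat_eq ((b' / b) / (a' / a)) (n := 2) (by norm_num)
  refine ⟨ν, ?_, ?_, ?_⟩
  · rintro rfl
    exact (div_ne_zero (div_ne_zero hb' hb) (div_ne_zero ha' ha)) (by rw [← hν]; norm_num)
  · rw [show ν ^ 4 = (ν ^ 2) ^ 2 by ring, hν]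
    field_simp
    linear_combination he
  · rw [show ν ^ 6 = (ν ^ 2) ^ 3 by ring, hν]
    field_simp
    linear_combination he

/-- The modular invariant separates orbits of the modular group. -/
theorem jInv_injective {τ τ' : ℂ} (hτ : τ ∈ UH) (hτ' : τ' ∈ UH) (h : jInv τ = jInv τ') :
    ∃ γ : SL(2, ℤ), mob γ τ = τ' := by
  have hD := Dl_ne_zero hτ
  have hD' := Dl_ne_zero hτ'
  have hr := Dl_eq hτ
  have hr' := Dl_eq hτ'
  obtain ⟨ν, hν, h4, h6⟩ := exists_scale (a := F4 τ) (b := F6 τ) (a' := F4 τ') (b' := F6 τ')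
    (by rw [← hr]; simpa using hD) (by rw [← hr']; simpa using hD') (by
      rw [jInv_eq hτ, jInv_eq hτ', div_eq_div_iff hD hD'] at h
      linear_combination (F4 τ ^ 3) * hr' - F4 τ' ^ 3 * hr - 1728 * h)
  have h4' : ν ^ 4 * (60 * latticeG 4 τ) = 60 * latticeG 4 τ' := by
    rw [g2_eq hτ, g2_eq hτ', ← h4]; ring
  have h6' : ν ^ 6 * (140 * latticeG 6 τ) = 140 * latticeG 6 τ' := by
    rw [g3_eq hτ, g3_eq hτ', ← h6]; ring
  set L := scaledPair τ ν⁻¹ hτ (inv_ne_zero hν) with hL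
  set L' := scaledPair τ' 1 hτ' one_ne_zero with hL'
  have e2 : L.g₂ = L'.g₂ := by
    rw [PeriodPair.g₂, PeriodPair.g₂, hL, hL', scaledPair_G _ _ (by norm_num),
      scaledPair_G _ _ (by norm_num)]
    simp only [inv_inv, inv_one, one_pow, one_mul]
    linear_combination h4'
  have e3 : L.g₃ = L'.g₃ := by
    rw [PeriodPair.g₃, PeriodPair.g₃, hL, hL', scaledPair_G _ _ (by norm_num),
      scaledPair_G _ _ (by norm_num)]
    simp only [inv_inv, inv_one, one_pow, one_mul]
    linear_combination h6'
  have l1 := lattice_le_of_invariants e2 e3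
  have l2 := lattice_le_of_invariants e2.symm e3.symm
  obtain ⟨a, b, hab⟩ := PeriodPair.mem_lattice.1 (l2 L'.ω₁_mem_lattice)
  obtain ⟨c, d, hcd⟩ := PeriodPair.mem_lattice.1 (l2 L'.ω₂_mem_lattice)
  obtain ⟨p, q, hpq⟩ := PeriodPair.mem_lattice.1 (l1 L.ω₁_mem_lattice)
  obtain ⟨r, s, hrs⟩ := PeriodPair.mem_lattice.1 (l1 L.ω₂_mem_lattice)
  simp only [hL, hL', scaledPair, mul_one, one_mul] at hab hcd hpq hrs
  have hcd' : (c : ℂ) * τ + d = ν := by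
    field_simp at hcd; linear_combination hcd
  have hab' : (a : ℂ) * τ + b = ν * τ' := by
    field_simp at hab; linear_combination hab
  have hpq' : ν * (p * τ' + q) = τ := by
    rw [hpq]; field_simp
  have hrs' : ν * (r * τ' + s) = 1 := by
    rw [hrs]; field_simp
  have uniq (x y : ℤ) (h : (x : ℂ) * τ + y = 0) : x = 0 ∧ y = 0 := by
    by_contra hne
    exact lin_ne_zero hτ (by tauto) h
  have u1 := uniq (p * a + q * c - 1) (p * b + q * d) (by
    push_cast; linear_combination hpq' + p * hab' + q * hcd')
  have u2 := uniq (r * a + s * c) (r * b + s * d - 1) (by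
    push_cast; linear_combination hrs' + r * hab' + s * hcd')
  have hdet : (p * s - q * r) * (a * d - b * c) = 1 := by
    linear_combination (1 + (r * b + s * d - 1)) * u1.1 - (r * a + s * c) * u1.2 + u2.2
  let A : M2 := !![a, b; c, d]
  have hm : mob A τ = τ' := by
    simp only [mob, den, A, Matrix.of_apply, Matrix.cons_val', Matrix.cons_val_zero,
      Matrix.cons_val_one, Matrix.cons_val_fin_one]
    rw [hab', hcd', mul_div_cancel_left₀ _ hν]
  have hpos : 0 < A.det := by
    have hi := im_mob A τ
    rw [hm] at hi
    by_contra! hneg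
    have h0 : (A.det : ℝ) ≤ 0 := by exact_mod_cast hneg
    have h1 : 0 < τ'.im := hτ'
    have h2 : 0 < τ.im := hτ
    have h3 : A.det * τ.im / normSq (den A τ) ≤ 0 :=
      div_nonpos_of_nonpos_of_nonneg (mul_nonpos_of_nonpos_of_nonneg h0 h2.le) (normSq_nonneg _)
    linarith
  have hdet1 : A.det = 1 := by
    have hd : A.det = a * d - b * c := by simp [A, Matrix.det_fin_two]
    rw [← hd] at hdet
    exact Int.eq_one_of_mul_eq_one_left hpos.le hdet
  exact ⟨⟨A, hdet1⟩, hm⟩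

/-- The action of integral matrices on column vectors modulo `ℓ`. -/
def act {ℓ : ℕ} (N : M2) (v : Fin 2 → ZMod ℓ) : Fin 2 → ZMod ℓ :=
  (N.map (Int.cast : ℤ → ZMod ℓ)).mulVec v

lemma act_apply {ℓ : ℕ} (N : M2) (v : Fin 2 → ZMod ℓ) (i : Fin 2) :
    act N v i = N i 0 * v 0 + N i 1 * v 1 := by
  simp [act, Matrix.mulVec, dotProduct, Fin.sum_univ_two]

lemma act_mul {ℓ : ℕ} (M N : M2) (v : Fin 2 → ZMod ℓ) : act (M * N) v = act M (act N v) := by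
  funext i
  simp only [act_apply, Matrix.mul_apply, Fin.sum_univ_two]
  push_cast; ring

lemma act_one {ℓ : ℕ} (v : Fin 2 → ZMod ℓ) : act 1 v = v := by
  funext i
  fin_cases i <;> simp [act_apply]

lemma act_zero {ℓ : ℕ} (N : M2) : act N (0 : Fin 2 → ZMod ℓ) = 0 := by
  funext i; simp [act_apply]

lemma act_neg {ℓ : ℕ} (N : M2) (v : Fin 2 → ZMod ℓ) : act (-N) v = - act N v := by
  funext i; simp [act_apply]; ring

lemma act_sl_mul {ℓ : ℕ} (M N : SL(2, ℤ)) (v : Fin 2 → ZMod ℓ) :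
    act (M * N : SL(2, ℤ)) v = act M (act N v) := by
  rw [Matrix.SpecialLinearGroup.coe_mul, act_mul]

lemma act_sl_one {ℓ : ℕ} (v : Fin 2 → ZMod ℓ) : act ((1 : SL(2, ℤ)) : M2) v = v := by
  rw [Matrix.SpecialLinearGroup.coe_one, act_one]

lemma act_sl_inv_act {ℓ : ℕ} (γ : SL(2, ℤ)) (v : Fin 2 → ZMod ℓ) :
    act (γ⁻¹ : SL(2, ℤ)) (act γ v) = v := by
  rw [← act_sl_mul, inv_mul_cancel, act_sl_one]

lemma act_act_sl_inv {ℓ : ℕ} (γ : SL(2, ℤ)) (v : Fin 2 → ZMod ℓ) :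
    act γ (act (γ⁻¹ : SL(2, ℤ)) v) = v := by
  rw [← act_sl_mul, mul_inv_cancel, act_sl_one]

lemma act_sl_ne_zero {ℓ : ℕ} (γ : SL(2, ℤ)) {v : Fin 2 → ZMod ℓ} (h : v ≠ 0) : act γ v ≠ 0 := by
  intro h0
  apply h
  rw [← act_sl_inv_act γ v, h0, act_zero]

lemma equivariant_act {ℓ : ℕ} {X : Type*} (φ : (Fin 2 → ZMod ℓ) → ℂ → X)
    (hS : ∀ v, ∀ z ∈ UH, φ (act (ModularGroup.S : SL(2, ℤ)) v) (-1 / z) = φ v z)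
    (hT : ∀ v, ∀ z ∈ UH, φ (act (ModularGroup.T : SL(2, ℤ)) v) (z + 1) = φ v z) (γ : SL(2, ℤ)) :
    ∀ v, ∀ z ∈ UH, φ (act γ v) (mob γ z) = φ v z := by
  let _ : MulAction SL(2, ℤ) (Fin 2 → ZMod ℓ) :=
    { smul := fun γ v => act γ v
      one_smul := act_sl_one
      mul_smul := act_sl_mul }
  exact equivariant_of_generators φ hS hT γ

lemma mem_nonzero_iff {v : Fin 2 → ZMod 2} :
    v ≠ 0 ↔ v = ![1, 0] ∨ v = ![0, 1] ∨ v = ![1, 1] := by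
  have h : ∀ a b : ZMod 2, ¬ (a = 0 ∧ b = 0) ↔
      (a = 1 ∧ b = 0) ∨ (a = 0 ∧ b = 1) ∨ (a = 1 ∧ b = 1) := by decide
  simpa [funext_iff, Fin.forall_fin_two] using h (v 0) (v 1)

lemma act_S (v : Fin 2 → ZMod 2) : act (ModularGroup.S : SL(2, ℤ)) v = ![v 1, v 0] := by
  funext i
  have h : ∀ x : ZMod 2, -x = x := by decide
  fin_cases i <;> simp [act_apply, ModularGroup.S, h]

lemma act_T (v : Fin 2 → ZMod 2) : act (ModularGroup.T : SL(2, ℤ)) v = ![v 0 + v 1, v 1] := by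
  funext i
  fin_cases i <;> simp [act_apply, ModularGroup.T]

/-! ### Expansions of the Euler product -/

lemma norm_tprod_one_add_sub_one_le {f : ℕ → ℂ} (hf : Summable fun i => ‖f i‖) :
    ‖∏' i, (1 + f i) - 1‖ ≤ Real.exp (∑' i, ‖f i‖) - 1 := by
  have h := (multipliable_one_add_of_summable hf).hasProd
  refine le_of_tendsto (f := fun t : Finset ℕ => ‖∏ i ∈ t, (1 + f i) - 1‖)
    ((Filter.Tendsto.sub_const h 1).norm) (Eventually.of_forall fun t => ?_)
  refine (t.norm_prod_one_add_sub_one_le f).trans ?_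
  have := hf.sum_le_tsum t fun _ _ => norm_nonneg _
  gcongr

lemma summable_norm_pow_tail (N : ℕ) {x : ℂ} (hx : ‖x‖ < 1) :
    Summable fun m : ℕ => ‖-x ^ (m + N + 1)‖ := by
  have := (summable_nat_add_iff (N + 1)).mpr (summable_geometric_of_lt_one (norm_nonneg x) hx)
  simpa [add_assoc] using this

lemma euler_eq_prod_mul_tail (N : ℕ) {x : ℂ} (hx : ‖x‖ < 1) :
    euler x = (∏ m ∈ Finset.range N, (1 - x ^ (m + 1))) * ∏' m : ℕ, (1 - x ^ (m + N + 1)) := by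
  have hm : Multipliable fun m : ℕ => (1 - x ^ (m + N + 1)) := by
    have := multipliable_one_add_of_summable (summable_norm_pow_tail N hx)
    simpa [sub_eq_add_neg] using this
  exact (Multipliable.prod_mul_tprod_nat_mul' (f := fun m : ℕ => (1 - x ^ (m + 1))) hm).symm

lemma tail_isBigO (N : ℕ) :
    (fun x : ℂ => ∏' m : ℕ, (1 - x ^ (m + N + 1)) - 1) =O[𝓝 0] fun x => x ^ (N + 1) := by
  apply Asymptotics.IsBigO.of_bound (Real.exp 2 * 2)
  have hb : Metric.ball (0 : ℂ) (1 / 2) ∈ 𝓝 (0 : ℂ) := Metric.ball_mem_nhds _ (by norm_num)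
  filter_upwards [hb] with x hx
  have hx : ‖x‖ < 1 / 2 := by simpa using hx
  have hx1 : ‖x‖ < 1 := by linarith
  have hs := summable_norm_pow_tail N hx1
  have h1 := norm_tprod_one_add_sub_one_le hs
  have h2 : ∑' m : ℕ, ‖-x ^ (m + N + 1)‖ ≤ 2 * ‖x‖ ^ (N + 1) := by
    have : ∀ m : ℕ, ‖-x ^ (m + N + 1)‖ = ‖x‖ ^ (N + 1) * ‖x‖ ^ m := by
      intro m; rw [norm_neg, norm_pow, ← pow_add]; congr 1; ring
    simp_rw [this]
    rw [tsum_mul_left, tsum_geometric_of_lt_one (norm_nonneg x) hx1, mul_comm]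
    apply mul_le_mul_of_nonneg_right _ (by positivity)
    rw [inv_le_comm₀ (by linarith) (by norm_num)]; linarith
  have h3 : ‖x‖ ^ (N + 1) ≤ 1 := pow_le_one₀ (norm_nonneg x) hx1.le
  set s := ∑' m : ℕ, ‖-x ^ (m + N + 1)‖
  have hs0 : 0 ≤ s := tsum_nonneg fun _ => norm_nonneg _
  have h4 : Real.exp s - 1 ≤ Real.exp 2 * s := by
    have h5 := Real.add_one_le_exp (-s)
    have h6 : Real.exp s * Real.exp (-s) = 1 := by rw [← Real.exp_add]; simp
    have h7 : Real.exp s ≤ Real.exp 2 := Real.exp_le_exp.2 (by linarith)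
    nlinarith [Real.exp_pos s]
  simp only [sub_eq_add_neg (1 : ℂ)] at h1 ⊢
  simp only [sub_eq_add_neg] at h1 h4 ⊢
  rw [norm_pow]
  calc _ ≤ _ := h1
    _ ≤ Real.exp 2 * s := h4
    _ ≤ Real.exp 2 * (2 * ‖x‖ ^ (N + 1)) := by gcongr
    _ = _ := by ring

/-- Agreement of two functions near `0` up to order `n`. -/
def EqMod (n : ℕ) (f g : ℂ → ℂ) : Prop := (fun x => f x - g x) =O[𝓝 0] fun x => x ^ n

namespace EqMod

variable {n : ℕ} {f g h f' g' : ℂ → ℂ}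

lemma refl (n : ℕ) (f : ℂ → ℂ) : EqMod n f f := by
  simp only [EqMod, sub_self]; exact Asymptotics.isBigO_zero _ _

lemma symm (h : EqMod n f g) : EqMod n g f := by
  refine (Asymptotics.IsBigO.neg_left h).congr_left fun x => ?_
  ring

lemma trans (h₁ : EqMod n f g) (h₂ : EqMod n g h) : EqMod n f h := by
  refine (Asymptotics.IsBigO.add h₁ h₂).congr_left fun x => ?_
  ring

lemma of_eventuallyEq (h : f =ᶠ[𝓝 0] g) : EqMod n f g := by
  refine (Asymptotics.isBigO_zero (E' := ℂ) _ _).congr' ?_ EventuallyEq.rfl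
  filter_upwards [h] with x hx
  simp [hx]

lemma mono {m : ℕ} (hmn : m ≤ n) (h : EqMod n f g) : EqMod m f g := by
  refine Asymptotics.IsBigO.trans h ?_
  obtain ⟨k, rfl⟩ := Nat.exists_eq_add_of_le hmn
  have : (fun x : ℂ => x ^ k) =O[𝓝 0] fun _ => (1 : ℂ) :=
    ((continuous_pow k).continuousAt (x := (0 : ℂ))).tendsto.isBigO_one ℂ
  have h2 := (Asymptotics.isBigO_refl (fun x : ℂ => x ^ m) (𝓝 0)).mul this
  simpa [pow_add] using h2

lemma mul (h₁ : EqMod n f g) (h₂ : EqMod n f' g') (hf : ContinuousAt f' 0)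
    (hg : ContinuousAt g 0) :
    EqMod n (fun x => f x * f' x) (fun x => g x * g' x) := by
  have a := (Asymptotics.IsBigO.mul h₁ (hf.tendsto.isBigO_one ℂ))
  have b := (Asymptotics.IsBigO.mul h₂ (hg.tendsto.isBigO_one ℂ))
  simp only [mul_one] at a b
  refine (a.add b).congr_left fun x => ?_
  ring

lemma pow (h : EqMod n f g) (hf : ContinuousAt f 0) (hg : ContinuousAt g 0) (k : ℕ) :
    EqMod n (fun x => f x ^ k) (fun x => g x ^ k) := by
  induction k with
  | zero => simpa using refl n _
  | succ k ih =>
    simp only [pow_succ]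
    exact ih.mul h hf (hg.pow k)

lemma comp_sq (h : EqMod n f g) : EqMod n (fun x => f (x ^ 2)) (fun x => g (x ^ 2)) := by
  have ht : Tendsto (fun x : ℂ => x ^ 2) (𝓝 0) (𝓝 0) := by
    have := (continuous_pow 2).tendsto (0 : ℂ)
    simpa using this
  have h2 := Asymptotics.IsBigO.comp_tendsto h ht
  have h3 : EqMod (2 * n) (fun x => f (x ^ 2)) (fun x => g (x ^ 2)) := by
    refine h2.congr_right fun x => ?_
    simp [pow_mul]
  exact h3.mono (by omega)

end EqMod

lemma eulerProd_eqMod (N : ℕ) :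
    EqMod (N + 1) euler fun x => ∏ m ∈ Finset.range N, (1 - x ^ (m + 1)) := by
  have h1 : EqMod (N + 1) (fun x => ∏' m : ℕ, (1 - x ^ (m + N + 1))) (fun _ => 1) :=
    tail_isBigO N
  have hc : Continuous fun x : ℂ => ∏ m ∈ Finset.range N, (1 - x ^ (m + 1)) := by fun_prop
  have h2 := Asymptotics.IsBigO.mul ((hc.tendsto (0 : ℂ)).isBigO_one ℂ) h1
  simp only [one_mul] at h2
  refine h2.congr' ?_ EventuallyEq.rfl
  filter_upwards [Metric.ball_mem_nhds (0 : ℂ) one_pos] with x hx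
  rw [euler_eq_prod_mul_tail N (by simpa using hx)]
  ring

lemma analyticAt_euler {x : ℂ} (hx : ‖x‖ < 1) : AnalyticAt ℂ euler x :=
  differentiableOn_euler.analyticAt (Metric.isOpen_ball.mem_nhds (by simpa using hx))

/-- The product `∏ (1 - x^m)^24 (1 - x^{2m})^{-24}`. -/
noncomputable def etaQ (x : ℂ) : ℂ := (euler x / euler (x ^ 2)) ^ 24

lemma norm_sq_lt_one {x : ℂ} (hx : ‖x‖ < 1) : ‖x ^ 2‖ < 1 := by
  rw [norm_pow]; exact pow_lt_one₀ (norm_nonneg x) hx two_ne_zero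

lemma analyticAt_etaQ {x : ℂ} (hx : ‖x‖ < 1) : AnalyticAt ℂ etaQ x := by
  have h2 : AnalyticAt ℂ (fun x => euler (x ^ 2)) x :=
    (analyticAt_euler (norm_sq_lt_one hx)).comp_of_eq (by fun_prop) rfl
  exact ((analyticAt_euler hx).div h2 (euler_ne_zero (norm_sq_lt_one hx))).pow 24

lemma etaQ_ne_zero {x : ℂ} (hx : ‖x‖ < 1) : etaQ x ≠ 0 :=
  pow_ne_zero _ (div_ne_zero (euler_ne_zero hx) (euler_ne_zero (norm_sq_lt_one hx)))

lemma etaQ_zero : etaQ 0 = 1 := by simp [etaQ, euler_zero]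

lemma analyticAt_etaQ_zero : AnalyticAt ℂ etaQ 0 := analyticAt_etaQ (by simp)

lemma etaQ_mul {x : ℂ} (hx : ‖x‖ < 1) : etaQ x * euler (x ^ 2) ^ 24 = euler x ^ 24 := by
  rw [etaQ, div_pow, div_mul_cancel₀]
  exact pow_ne_zero _ (euler_ne_zero (norm_sq_lt_one hx))

lemma etaQ_eqMod (N : ℕ) :
    EqMod (N + 1) (fun x => etaQ x * ∏ m ∈ Finset.Icc 1 N, (1 - x ^ (2 * m)) ^ 24)
      (fun x => ∏ m ∈ Finset.Icc 1 N, (1 - x ^ m) ^ 24) := by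
  have he : ContinuousAt euler 0 := (analyticAt_euler (by simp)).continuousAt
  have hc : Continuous fun x : ℂ => ∏ m ∈ Finset.range N, (1 - x ^ (m + 1)) := by fun_prop
  have he2 : ContinuousAt (fun x => euler (x ^ 2)) 0 :=
    ContinuousAt.comp_of_eq (y := 0) he (by fun_prop) (by simp)
  have h1 := (eulerProd_eqMod N).pow he hc.continuousAt 24
  have h2 := (eulerProd_eqMod N).comp_sq.pow he2 (by fun_prop) 24
  have h3 := (EqMod.refl (N + 1) etaQ).mul h2.symm (by fun_prop) analyticAt_etaQ_zero.continuousAt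
  have h4 : EqMod (N + 1) (fun x => etaQ x * euler (x ^ 2) ^ 24) (fun x => euler x ^ 24) := by
    apply EqMod.of_eventuallyEq
    filter_upwards [Metric.ball_mem_nhds (0 : ℂ) one_pos] with x hx
    exact etaQ_mul (by simpa using hx)
  have h5 := (h3.trans h4).trans h1
  have hr (g : ℕ → ℂ) : ∏ m ∈ Finset.Icc 1 N, g m = ∏ m ∈ Finset.range N, g (m + 1) := by
    rw [Finset.range_eq_Ico, Finset.prod_Ico_add' (fun m => g m) 0 N 1]
    rfl
  simp only [Finset.prod_pow] at h5 ⊢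
  simp only [hr, pow_mul]
  exact h5

lemma deriv_eq_of_eqMod_two {f : ℂ → ℂ} (a b : ℂ) (h : EqMod 2 f fun x => a + b * x)
    (hf : ContinuousAt f 0) : HasDerivAt f b 0 := by
  have ha : f 0 = a := by
    have h1 : Tendsto (fun x => f x - (a + b * x)) (𝓝 0) (𝓝 0) := by
      refine Asymptotics.IsBigO.trans_tendsto h ?_
      have := (continuous_pow 2).tendsto (0 : ℂ)
      simpa using this
    have h2 : ContinuousAt (fun x => f x - (a + b * x)) 0 := by fun_prop
    have := tendsto_nhds_unique h2.tendsto h1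
    simp only [mul_zero, add_zero] at this
    exact sub_eq_zero.1 this
  rw [hasDerivAt_iff_isLittleO_nhds_zero]
  have h3 : (fun x : ℂ => x ^ 2) =o[𝓝 0] fun x => x := by
    simpa using Asymptotics.isLittleO_pow_pow (𝕜 := ℂ) one_lt_two
  refine (Asymptotics.IsBigO.trans_isLittleO h h3).congr_left fun x => ?_
  rw [ha]; simp; ring

lemma hasDerivAt_euler_zero : HasDerivAt euler (-1) 0 := by
  apply deriv_eq_of_eqMod_two 1 (-1) _ (analyticAt_euler (by simp)).continuousAt
  refine (eulerProd_eqMod 1).trans (EqMod.of_eventuallyEq (Eventually.of_forall fun x => ?_))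
  simp; ring

lemma hasDerivAt_etaQ_zero : HasDerivAt etaQ (-24) 0 := by
  have h1 : HasDerivAt (fun x => euler (x ^ 2)) 0 0 := by
    have h : HasDerivAt euler (-1) ((fun x : ℂ => x ^ 2) 0) := by
      simpa using hasDerivAt_euler_zero
    have := h.comp (0 : ℂ) (hasDerivAt_pow 2 0)
    simp only [Function.comp_def] at this
    simpa using this
  have := (hasDerivAt_euler_zero.div h1 (by simp [euler_zero])).pow 24
  refine this.congr_deriv ?_
  simp [euler_zero]

/-- A holomorphic modular function which has a limit at the cusp is constant. -/
lemma const_of_cusp {F g : ℂ → ℂ} (hd : DifferentiableOn ℂ F UH)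
    (hS : ∀ z ∈ UH, F (-1 / z) = F z) (hT : ∀ z ∈ UH, F (z + 1) = F z)
    (hg : ContinuousAt g 0) (hF : ∀ z ∈ UH, F z = g (nome (z / 2))) :
    ∀ z ∈ UH, F z = g 0 := by
  have ht : Tendsto (fun y : ℝ => nome (y * I / 2)) atTop (𝓝 0) := by
    rw [tendsto_zero_iff_norm_tendsto_zero]
    simp_rw [norm_nome]
    refine Real.tendsto_exp_atBot.comp ?_
    have : (fun y : ℝ => -2 * Real.pi * ((y : ℂ) * I / 2).im) = fun y => -(Real.pi * y) := by
      funext y; simp; ring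
    rw [this]
    exact tendsto_neg_atTop_atBot.comp (tendsto_id.const_mul_atTop Real.pi_pos)
  obtain ⟨c, hc⟩ := const_of_invariant hd hS hT (by
    obtain ⟨ε, hε, hb⟩ := Metric.eventually_nhds_iff.1
      (hg.norm.eventually (gt_mem_nhds (lt_add_one ‖g 0‖)))
    obtain ⟨A, hA⟩ := (Metric.tendsto_nhds.1 ht ε hε).exists_forall_of_atTop
    refine ⟨A, ‖g 0‖ + 1, fun z hz hzU => ?_⟩
    rw [hF z hzU]
    refine (hb ?_).le
    have := hA z.im hz
    rw [dist_zero_right, norm_nome] at this ⊢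
    simpa using this)
  have hlim : Tendsto (fun y : ℝ => F (y * I)) atTop (𝓝 (g 0)) := by
    refine (hg.tendsto.comp ht).congr' ?_
    filter_upwards [eventually_gt_atTop 0] with y hy
    exact (hF _ (by simpa [UH] using hy)).symm
  have hlim2 : Tendsto (fun y : ℝ => F (y * I)) atTop (𝓝 c) := by
    refine tendsto_const_nhds.congr' ?_
    filter_upwards [eventually_gt_atTop 0] with y hy
    exact (hc _ (by simpa [UH] using hy)).symm
  intro z hz
  rw [hc z hz, tendsto_nhds_unique hlim hlim2]

/-- The three level two modular functions indexed by nonzero vectors modulo two. -/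
noncomputable def lev (v : Fin 2 → ZMod 2) (z : ℂ) : ℂ :=
  if v 1 = 0 then (if v 0 = 0 then 0 else 4096 * Dl (2 * z) / Dl z)
  else (if v 0 = 0 then Dl (z / 2) / Dl z else Dl ((z + 1) / 2) / Dl z)

lemma lev_10 (z : ℂ) : lev ![1, 0] z = 4096 * Dl (2 * z) / Dl z := by simp [lev]
lemma lev_01 (z : ℂ) : lev ![0, 1] z = Dl (z / 2) / Dl z := by simp [lev]
lemma lev_11 (z : ℂ) : lev ![1, 1] z = Dl ((z + 1) / 2) / Dl z := by simp [lev]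
lemma lev_zero (z : ℂ) : lev 0 z = 0 := by simp [lev]

lemma two_mul_mem {z : ℂ} (hz : z ∈ UH) : 2 * z ∈ UH := by
  have : 0 < z.im := hz
  simpa [UH]

lemma half_mem {z : ℂ} (hz : z ∈ UH) : z / 2 ∈ UH := by
  have : 0 < z.im := hz
  simpa [UH]

lemma Dl_half_add_one_neg_inv {z : ℂ} (hz : z ∈ UH) :
    Dl ((-1 / z + 1) / 2) = z ^ 12 * Dl ((z + 1) / 2) := by
  have hz0 := UH.ne_zero hz
  have hw : (z - 1) / 2 ∈ UH := by
    have : 0 < z.im := hz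
    simpa [UH]
  have hw0 := UH.ne_zero hw
  set y := (-1 / z + 1) / 2 with hy
  have hyU : y ∈ UH := half_mem (add_one_mem (neg_inv_mem hz))
  have hy0 := UH.ne_zero hyU
  have hy2 : y * z = (z - 1) / 2 := by rw [hy]; field_simp; ring
  have h1 : -1 / y + 1 + 1 = -1 / ((z - 1) / 2) := by
    have hz1 : z - 1 ≠ 0 := fun h => hw0 (by rw [h]; simp)
    have : y = (z - 1) / (2 * z) := by rw [hy]; field_simp; ring
    rw [this]; field_simp; ring
  have h2 : Dl (-1 / y) = Dl (-1 / ((z - 1) / 2)) := by rw [← h1, Dl_add_one, Dl_add_one]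
  rw [Dl_neg_inv hyU, Dl_neg_inv hw, ← hy2] at h2
  have h3 : Dl ((z + 1) / 2) = Dl (y * z) := by
    rw [hy2, ← Dl_add_one ((z - 1) / 2)]; congr 1; ring
  rw [h3]
  have h4 : y ^ 12 ≠ 0 := pow_ne_zero _ hy0
  apply mul_left_cancel₀ h4
  rw [h2]; ring

lemma lev_S (v : Fin 2 → ZMod 2) {z : ℂ} (hz : z ∈ UH) :
    lev (act (ModularGroup.S : SL(2, ℤ)) v) (-1 / z) = lev v z := by
  have hz0 := UH.ne_zero hz
  have hD := Dl_ne_zero hz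
  rw [act_S]
  by_cases hv : v = 0
  · subst hv; simp [lev]
  rcases mem_nonzero_iff.1 hv with rfl | rfl | rfl
  · change lev ![0, 1] _ = _
    rw [lev_01, lev_10, Dl_neg_inv hz, show -1 / z / 2 = -1 / (2 * z) by field_simp,
      Dl_neg_inv (two_mul_mem hz)]
    field_simp; norm_num; ring
  · change lev ![1, 0] _ = _
    rw [lev_01, lev_10, Dl_neg_inv hz, show 2 * (-1 / z) = -1 / (z / 2) by field_simp,
      Dl_neg_inv (half_mem hz)]
    field_simp; norm_num
  · change lev ![1, 1] _ = _
    rw [lev_11, lev_11, Dl_neg_inv hz, Dl_half_add_one_neg_inv hz]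
    field_simp

lemma lev_T (v : Fin 2 → ZMod 2) (z : ℂ) :
    lev (act (ModularGroup.T : SL(2, ℤ)) v) (z + 1) = lev v z := by
  rw [act_T]
  by_cases hv : v = 0
  · subst hv; simp [lev]
  rcases mem_nonzero_iff.1 hv with rfl | rfl | rfl
  · change lev ![1 + 0, 0] _ = _
    rw [add_zero, lev_10, lev_10, Dl_add_one, show 2 * (z + 1) = 2 * z + 1 + 1 by ring,
      Dl_add_one, Dl_add_one]
  · change lev ![0 + 1, 1] _ = _
    rw [zero_add, lev_11, lev_01, Dl_add_one, show (z + 1 + 1) / 2 = z / 2 + 1 by ring, Dl_add_one]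
  · change lev ![1 + 1, 1] _ = _
    rw [show (1 + 1 : ZMod 2) = 0 by decide, lev_11, lev_01, Dl_add_one]

lemma lev_equivariant (γ : SL(2, ℤ)) (v : Fin 2 → ZMod 2) {z : ℂ} (hz : z ∈ UH) :
    lev (act γ v) (mob γ z) = lev v z :=
  equivariant_act lev (fun v _ hz => lev_S v hz) (fun v z _ => lev_T v z) γ v z hz

lemma differentiableOn_lev (v : Fin 2 → ZMod 2) : DifferentiableOn ℂ (lev v) UH := by
  by_cases hv : v = 0
  · subst hv
    exact (differentiableOn_const 0).congr fun z _ => lev_zero z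
  have hD := fun z (hz : z ∈ UH) => Dl_ne_zero hz
  rcases mem_nonzero_iff.1 hv with rfl | rfl | rfl
  · refine DifferentiableOn.congr (f := fun z => 4096 * Dl (2 * z) / Dl z)
      (DifferentiableOn.div ?_ differentiableOn_Dl hD) fun z _ => lev_10 z
    exact (differentiableOn_Dl.comp (by fun_prop) fun z hz => two_mul_mem hz).const_mul _
  · refine DifferentiableOn.congr (f := fun z => Dl (z / 2) / Dl z)
      (DifferentiableOn.div ?_ differentiableOn_Dl hD) fun z _ => lev_01 z
    exact differentiableOn_Dl.comp (by fun_prop) fun z hz => half_mem hz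
  · refine DifferentiableOn.congr (f := fun z => Dl ((z + 1) / 2) / Dl z)
      (DifferentiableOn.div ?_ differentiableOn_Dl hD) fun z _ => lev_11 z
    exact differentiableOn_Dl.comp (by fun_prop) fun z hz => half_mem (add_one_mem hz)

lemma nome_two_mul (z : ℂ) : nome (2 * z) = nome z ^ 2 := nome_nat_mul 2 z

lemma Dl_div_Dl_two_mul {z : ℂ} (hz : z ∈ UH) : Dl z / Dl (2 * z) = etaQ (nome z) / nome z := by
  have h0 := nome_ne_zero z
  have h2 := euler_ne_zero (norm_sq_lt_one (norm_nome_lt_one hz))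
  rw [Dl, Dl, etaQ, nome_two_mul]
  field_simp

lemma nome_half_add_one (z : ℂ) : nome ((z + 1) / 2) = -nome (z / 2) := by
  rw [add_div, nome_add, nome_half, mul_neg_one]

lemma nome_half_sq (z : ℂ) : nome (z / 2) ^ 2 = nome z := by
  rw [← nome_two_mul]; congr 1; ring

lemma lev_10_eq {z : ℂ} (hz : z ∈ UH) : lev ![1, 0] z = 4096 * (nome z / etaQ (nome z)) := by
  rw [lev_10, mul_div_assoc, ← inv_div (Dl z), Dl_div_Dl_two_mul hz, inv_div]

lemma lev_01_eq {z : ℂ} (hz : z ∈ UH) :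
    lev ![0, 1] z = etaQ (nome (z / 2)) / nome (z / 2) := by
  rw [lev_01, ← Dl_div_Dl_two_mul (half_mem hz)]
  congr 2; ring

lemma lev_11_eq {z : ℂ} (hz : z ∈ UH) :
    lev ![1, 1] z = etaQ (-nome (z / 2)) / (-nome (z / 2)) := by
  have h := Dl_div_Dl_two_mul (half_mem (add_one_mem hz))
  rw [nome_half_add_one] at h
  rw [lev_11, ← h, show 2 * ((z + 1) / 2) = z + 1 by ring, Dl_add_one]

lemma lev_10_neg_inv {z : ℂ} (hz : z ∈ UH) : lev ![1, 0] (-1 / z) = lev ![0, 1] z := by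
  have h := lev_S ![0, 1] hz
  rw [act_S] at h
  exact h

lemma lev_01_neg_inv {z : ℂ} (hz : z ∈ UH) : lev ![0, 1] (-1 / z) = lev ![1, 0] z := by
  have h := lev_S ![1, 0] hz
  rw [act_S] at h
  exact h

lemma lev_11_neg_inv {z : ℂ} (hz : z ∈ UH) : lev ![1, 1] (-1 / z) = lev ![1, 1] z := by
  have h := lev_S ![1, 1] hz
  rw [act_S] at h
  exact h

lemma lev_10_add_one (z : ℂ) : lev ![1, 0] (z + 1) = lev ![1, 0] z := by
  have h := lev_T ![1, 0] z
  rw [act_T] at h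
  simpa using h

lemma lev_01_add_one (z : ℂ) : lev ![0, 1] (z + 1) = lev ![1, 1] z := by
  have h := lev_T ![1, 1] z
  rw [act_T] at h
  simpa [show (1 + 1 : ZMod 2) = 0 by decide] using h

lemma lev_11_add_one (z : ℂ) : lev ![1, 1] (z + 1) = lev ![0, 1] z := by
  have h := lev_T ![0, 1] z
  rw [act_T] at h
  simpa using h

lemma continuousAt_etaQ_comp {u : ℂ → ℂ} (hu : Continuous u) (h0 : u 0 = 0) :
    ContinuousAt (fun p => etaQ (u p)) 0 :=
  ContinuousAt.comp_of_eq analyticAt_etaQ_zero.continuousAt hu.continuousAt h0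

lemma lev_prod {z : ℂ} (hz : z ∈ UH) : lev ![1, 0] z * lev ![0, 1] z * lev ![1, 1] z = -4096 := by
  have h := const_of_cusp (F := fun z => lev ![1, 0] z * lev ![0, 1] z * lev ![1, 1] z)
    (g := fun p => -4096 * (etaQ p * etaQ (-p) / etaQ (p ^ 2)))
    (((differentiableOn_lev _).mul (differentiableOn_lev _)).mul (differentiableOn_lev _))
    (fun z hz => by
      simp only [lev_10_neg_inv hz, lev_01_neg_inv hz, lev_11_neg_inv hz]; ring)
    (fun z hz => by
      simp only [lev_10_add_one, lev_01_add_one, lev_11_add_one]; ring)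
    (by
      have h1 := continuousAt_etaQ_comp continuous_id rfl
      have h2 := continuousAt_etaQ_comp (u := fun p => -p) (by fun_prop) neg_zero
      have h3 := continuousAt_etaQ_comp (u := fun p => p ^ 2) (by fun_prop) (by simp)
      exact continuousAt_const.mul ((h1.mul h2).div h3 (by simp [etaQ_zero])))
    (fun z hz => by
      have h0 := nome_ne_zero (z / 2)
      have he := etaQ_ne_zero (norm_sq_lt_one (norm_nome_lt_one (half_mem hz)))
      simp only [lev_10_eq hz, lev_01_eq hz, lev_11_eq hz, ← nome_half_sq z]
      field_simp) z hz
  simpa [etaQ_zero] using h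

lemma hasDerivAt_etaQ_odd : HasDerivAt (fun p => etaQ p - etaQ (-p)) (-48) 0 := by
  have h1 : HasDerivAt (fun p => etaQ (-p)) 24 0 := by
    have h : HasDerivAt etaQ (-24) ((fun x : ℂ => -x) 0) := by
      simpa using hasDerivAt_etaQ_zero
    have := h.comp (0 : ℂ) (hasDerivAt_neg 0)
    simp only [Function.comp_def] at this
    simpa using this
  exact (hasDerivAt_etaQ_zero.sub h1).congr_deriv (by norm_num)

lemma lev_sum {z : ℂ} (hz : z ∈ UH) : lev ![1, 0] z + lev ![0, 1] z + lev ![1, 1] z = -48 := by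
  have h := const_of_cusp (F := fun z => lev ![1, 0] z + lev ![0, 1] z + lev ![1, 1] z)
    (g := fun p => 4096 * (p ^ 2 / etaQ (p ^ 2)) + dslope (fun p => etaQ p - etaQ (-p)) 0 p)
    (((differentiableOn_lev _).add (differentiableOn_lev _)).add (differentiableOn_lev _))
    (fun z hz => by
      simp only [lev_10_neg_inv hz, lev_01_neg_inv hz, lev_11_neg_inv hz]; ring)
    (fun z hz => by
      simp only [lev_10_add_one, lev_01_add_one, lev_11_add_one]; ring)
    (by
      have h3 := continuousAt_etaQ_comp (u := fun p => p ^ 2) (by fun_prop) (by simp)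
      have h4 : ContinuousAt (fun p : ℂ => p ^ 2) 0 := by fun_prop
      exact (continuousAt_const.mul (h4.div h3 (by simp [etaQ_zero]))).add
        (continuousAt_dslope_same.2 hasDerivAt_etaQ_odd.differentiableAt))
    (fun z hz => by
      have h0 := nome_ne_zero (z / 2)
      have he := etaQ_ne_zero (norm_sq_lt_one (norm_nome_lt_one (half_mem hz)))
      simp only [lev_10_eq hz, lev_01_eq hz, lev_11_eq hz, ← nome_half_sq z]
      rw [dslope_of_ne _ h0, slope_def_field]
      simp only [sub_zero, neg_zero, sub_self]
      field_simp
      ring) z hz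
  simpa [etaQ_zero, hasDerivAt_etaQ_odd.deriv] using h

lemma lev_ne_zero {v : Fin 2 → ZMod 2} (hv : v ≠ 0) {z : ℂ} (hz : z ∈ UH) : lev v z ≠ 0 := by
  have h := lev_prod hz
  intro h0
  rcases mem_nonzero_iff.1 hv with rfl | rfl | rfl <;> rw [h0] at h <;> norm_num at h

lemma hasDerivAt_jInv_defect :
    HasDerivAt (fun q => e4 q ^ 3 / euler q ^ 24 - etaQ q) 768 0 := by
  have h4 : HasDerivAt e4 240 0 := by
    rw [← deriv_e4_zero]; exact analyticAt_e4.differentiableAt.hasDerivAt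
  have := ((h4.pow 3).div (hasDerivAt_euler_zero.pow 24) (by simp [euler_zero])).sub
    hasDerivAt_etaQ_zero
  refine this.congr_deriv ?_
  simp [e4_zero, euler_zero]; norm_num

lemma lev_e2 {z : ℂ} (hz : z ∈ UH) :
    lev ![1, 0] z * lev ![0, 1] z + lev ![1, 0] z * lev ![1, 1] z + lev ![0, 1] z * lev ![1, 1] z
      + jInv z = 768 := by
  have h := const_of_cusp (F := fun z => lev ![1, 0] z * lev ![0, 1] z
      + lev ![1, 0] z * lev ![1, 1] z + lev ![0, 1] z * lev ![1, 1] z + jInv z)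
    (g := fun p => 4096 * (p ^ 2 / etaQ (p ^ 2)) * (-48 - 4096 * (p ^ 2 / etaQ (p ^ 2)))
      + dslope (fun q => e4 q ^ 3 / euler q ^ 24 - etaQ q) 0 (p ^ 2))
    ((((((differentiableOn_lev _).mul (differentiableOn_lev _)).add
      ((differentiableOn_lev _).mul (differentiableOn_lev _)))).add
      ((differentiableOn_lev _).mul (differentiableOn_lev _))).add differentiableOn_jInv)
    (fun z hz => by
      simp only [lev_10_neg_inv hz, lev_01_neg_inv hz, lev_11_neg_inv hz, jInv_neg_inv hz]; ring)
    (fun z hz => by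
      simp only [lev_10_add_one, lev_01_add_one, lev_11_add_one, jInv_add_one hz]; ring)
    (by
      have h3 := continuousAt_etaQ_comp (u := fun p => p ^ 2) (by fun_prop) (by simp)
      have h4 : ContinuousAt (fun p : ℂ => p ^ 2) 0 := by fun_prop
      have h5 : ContinuousAt (fun p : ℂ => 4096 * (p ^ 2 / etaQ (p ^ 2))) 0 :=
        continuousAt_const.mul (h4.div h3 (by simp [etaQ_zero]))
      exact (h5.mul (continuousAt_const.sub h5)).add (ContinuousAt.comp_of_eq (y := 0)
        (continuousAt_dslope_same.2 hasDerivAt_jInv_defect.differentiableAt) h4 (by simp)))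
    (fun z hz => by
      have h0 := nome_ne_zero z
      have he := etaQ_ne_zero (norm_nome_lt_one hz)
      have hu := euler_ne_zero (norm_nome_lt_one hz)
      have hs := lev_sum hz
      have hp := lev_prod hz
      have hA := lev_10_eq hz
      have hB : lev ![0, 1] z * lev ![1, 1] z = - (etaQ (nome z) / nome z) := by
        rw [hA] at hp
        field_simp at hp ⊢
        linear_combination hp
      have hsum : lev ![0, 1] z + lev ![1, 1] z = -48 - lev ![1, 0] z := by
        linear_combination hs
      rw [hB, ← mul_add, hsum, hA, jInv_eq hz, F4_eq hz, Dl, nome_half_sq, dslope_of_ne _ h0,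
        slope_def_field]
      simp only [sub_zero, e4_zero, euler_zero, etaQ_zero]
      field_simp
      ring) z hz
  simpa [etaQ_zero, hasDerivAt_jInv_defect.deriv] using h

lemma lev_cubic (X : ℂ) {z : ℂ} (hz : z ∈ UH) :
    (X - lev ![1, 0] z) * (X - lev ![0, 1] z) * (X - lev ![1, 1] z) =
      (X + 16) ^ 3 - jInv z * X := by
  linear_combination (-X ^ 2) * lev_sum hz + X * lev_e2 hz - lev_prod hz

lemma lev_root {v : Fin 2 → ZMod 2} (hv : v ≠ 0) {z : ℂ} (hz : z ∈ UH) :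
    (lev v z + 16) ^ 3 = jInv z * lev v z := by
  have h := lev_cubic (lev v z) hz
  rw [← sub_eq_zero, ← h]
  rcases mem_nonzero_iff.1 hv with rfl | rfl | rfl <;> simp

lemma mob_ST_rho : mob (ModularGroup.S * ModularGroup.T : SL(2, ℤ)) rho = rho := by
  rw [mob_sl_mul _ _ rho_mem, mob_T, mob_S]
  have h : rho + 1 ≠ 0 := UH.ne_zero (add_one_mem rho_mem)
  rw [div_eq_iff h]
  linear_combination -rho_sq

lemma act_ST (v : Fin 2 → ZMod 2) :
    act (ModularGroup.S * ModularGroup.T : SL(2, ℤ)) v = ![v 1, v 0 + v 1] := by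
  rw [act_sl_mul, act_T, act_S]; rfl

lemma exists_rho_stabilizer (u v : Fin 2 → ZMod 2) (hu : u ≠ 0) (hv : v ≠ 0) :
    ∃ γ : SL(2, ℤ), mob γ rho = rho ∧ act γ u = v := by
  set g : SL(2, ℤ) := ModularGroup.S * ModularGroup.T with hg
  have hfix := mob_ST_rho
  have h2 : mob (g * g : SL(2, ℤ)) rho = rho := by
    rw [mob_sl_mul _ _ rho_mem, hfix, hfix]
  have key : ∀ a b c d : ZMod 2, ¬ (a = 0 ∧ b = 0) → ¬ (c = 0 ∧ d = 0) →
      (a = c ∧ b = d) ∨ (b = c ∧ a + b = d) ∨ (a + b = c ∧ b + (a + b) = d) := by decide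
  rcases key (u 0) (u 1) (v 0) (v 1) (by simpa [funext_iff, Fin.forall_fin_two] using hu)
    (by simpa [funext_iff, Fin.forall_fin_two] using hv) with h | h | h
  · exact ⟨1, by simp [mob_one], by
      rw [act_sl_one]; funext i; fin_cases i <;> simp [h]⟩
  · exact ⟨g, hfix, by rw [act_ST]; funext i; fin_cases i <;> simp [← h.1, ← h.2]⟩
  · exact ⟨g * g, h2, by
      rw [act_sl_mul, act_ST, act_ST]; funext i; fin_cases i <;> simp [← h.1, ← h.2]⟩

lemma lev_I_eq_eight {u v : Fin 2 → ZMod 2} (hu : u ≠ 0) (hv : v ≠ 0) (huv : u ≠ v)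
    (h8 : lev u I = 8) (h8' : lev v I = 8) : act (ModularGroup.S : SL(2, ℤ)) u = v := by
  have hI : -1 / I = I := by
    rw [div_eq_iff I_ne_zero, I_mul_I]
  have hs := lev_sum I_mem_UH
  have hsw := lev_10_neg_inv I_mem_UH
  rw [hI] at hsw
  rw [act_S]
  rcases mem_nonzero_iff.1 hu with rfl | rfl | rfl <;>
    rcases mem_nonzero_iff.1 hv with rfl | rfl | rfl
  · exact absurd rfl huv
  · rfl
  · rw [← hsw, h8, h8'] at hs; norm_num at hs
  · rfl
  · exact absurd rfl huv
  · rw [hsw, h8, h8'] at hs; norm_num at hs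
  · rw [← hsw, h8, h8'] at hs; norm_num at hs
  · rw [hsw, h8, h8'] at hs; norm_num at hs
  · exact absurd rfl huv

/-- A coincidence of two of the three level two functions at one point. -/
lemma lev_double {u v : Fin 2 → ZMod 2} (hu : u ≠ 0) (hv : v ≠ 0) (huv : u ≠ v) {z : ℂ}
    (hz : z ∈ UH) (h : lev u z = lev v z) :
    (lev u z = 8 ∧ jInv z = 1728) ∨ jInv z = 0 := by
  have hs := lev_sum hz
  have hp := lev_prod hz
  have hc := lev_root hu hz
  have key : (lev u z - 8) * (lev u z + 16) ^ 2 = 0 := by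
    have aux (x y : ℂ) (h1 : 2 * x + y = -48) (h2 : x ^ 2 * y = -4096) :
        (x - 8) * (x + 16) ^ 2 = 0 := by
      have : y = -48 - 2 * x := by linear_combination h1
      subst this
      linear_combination -h2 / 2
    rcases mem_nonzero_iff.1 hu with rfl | rfl | rfl <;>
      rcases mem_nonzero_iff.1 hv with rfl | rfl | rfl
    · exact absurd rfl huv
    · exact aux _ (lev ![1, 1] z) (by linear_combination hs + h) (by
        linear_combination hp + lev ![1, 0] z * lev ![1, 1] z * h)
    · exact aux _ (lev ![0, 1] z) (by linear_combination hs + h) (by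
        linear_combination hp + lev ![1, 0] z * lev ![0, 1] z * h)
    · exact aux _ (lev ![1, 1] z) (by linear_combination hs + h) (by
        linear_combination hp + lev ![0, 1] z * lev ![1, 1] z * h)
    · exact absurd rfl huv
    · exact aux _ (lev ![1, 0] z) (by linear_combination hs + h) (by
        linear_combination hp + lev ![0, 1] z * lev ![1, 0] z * h)
    · exact aux _ (lev ![0, 1] z) (by linear_combination hs + h) (by
        linear_combination hp + lev ![1, 1] z * lev ![0, 1] z * h)
    · exact aux _ (lev ![1, 0] z) (by linear_combination hs + h) (by
        linear_combination hp + lev ![1, 1] z * lev ![1, 0] z * h)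
    · exact absurd rfl huv
  rcases mul_eq_zero.1 key with h1 | h1
  · left
    have h8 : lev u z = 8 := by linear_combination h1
    rw [h8] at hc
    exact ⟨h8, by linear_combination -hc / 8⟩
  · right
    have h16 : lev u z = -16 := by linear_combination (pow_eq_zero_iff two_ne_zero).1 h1
    rw [h16] at hc
    linear_combination hc / 16

theorem lev_injective {u v : Fin 2 → ZMod 2} (hu : u ≠ 0) (hv : v ≠ 0) {z w : ℂ} (hz : z ∈ UH)
    (hw : w ∈ UH) (h : lev u z = lev v w) :
    ∃ γ : SL(2, ℤ), mob γ z = w ∧ act γ u = v := by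
  have hj : jInv z = jInv w := by
    apply mul_right_cancel₀ (lev_ne_zero hu hz)
    rw [← lev_root hu hz, h, lev_root hv hw]
  obtain ⟨γ, hγ⟩ := jInv_injective hz hw hj
  by_cases huv : act γ u = v
  · exact ⟨γ, hγ, huv⟩
  have hu' : act γ u ≠ 0 := act_sl_ne_zero γ hu
  have hx : lev (act γ u) w = lev v w := by rw [← h, ← hγ, lev_equivariant γ u hz]
  have key (x : ℂ) (hx : x ∈ UH) (hjx : jInv x = jInv w)
      (hst : ∀ δ : SL(2, ℤ), mob δ x = w → ∃ ε : SL(2, ℤ), mob ε x = x ∧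
        act ε (act (δ⁻¹ : SL(2, ℤ)) (act γ u)) = act (δ⁻¹ : SL(2, ℤ)) v) :
      ∃ γ : SL(2, ℤ), mob γ z = w ∧ act γ u = v := by
    obtain ⟨δ, hδ⟩ := jInv_injective hx hw hjx
    obtain ⟨ε, h1, h2⟩ := hst δ hδ
    refine ⟨δ * (ε * (δ⁻¹ * γ)), ?_, ?_⟩
    · rw [mob_sl_mul _ _ hz, mob_sl_mul _ _ hz, mob_sl_mul _ _ hz, hγ, ← hδ, mob_sl_inv_mob δ hx,
        h1]
    · rw [act_sl_mul, act_sl_mul, act_sl_mul, h2, act_act_sl_inv]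
  rcases lev_double hu' hv huv hw hx with ⟨h8, h1728⟩ | h0
  · refine key I I_mem_UH (by rw [jInv_I, h1728]) fun δ hδ => ?_
    refine ⟨ModularGroup.S, by rw [mob_S, div_eq_iff I_ne_zero, I_mul_I], ?_⟩
    have hl (t : Fin 2 → ZMod 2) : lev (act (δ⁻¹ : SL(2, ℤ)) t) I = lev t w := by
      rw [← lev_equivariant δ⁻¹ t hw, ← hδ, mob_sl_inv_mob δ I_mem_UH]
    apply lev_I_eq_eight (act_sl_ne_zero _ hu') (act_sl_ne_zero _ hv)
    · intro he
      apply huv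
      rw [← act_act_sl_inv δ (act γ u), he, act_act_sl_inv]
    · rw [hl, h8]
    · rw [hl, ← hx, h8]
  · exact key rho rho_mem (by rw [jInv_rho, h0]) fun δ _ =>
      exists_rho_stabilizer _ _ (act_sl_ne_zero _ hu') (act_sl_ne_zero _ hv)

lemma exists_local_root {g : ℂ → ℂ} {α : ℂ} (hg : AnalyticAt ℂ g α) (h0 : g α ≠ 0) {m : ℕ}
    (hm : m ≠ 0) : ∃ k : ℂ → ℂ, AnalyticAt ℂ k α ∧ k α ≠ 0 ∧ ∀ᶠ z in 𝓝 α, k z ^ m = g z := by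
  have hq : AnalyticAt ℂ (fun z => g z / g α) α := hg.div analyticAt_const h0
  have hl : AnalyticAt ℂ (fun z => Complex.log (g z / g α)) α :=
    hq.clog (by simp [div_self h0])
  refine ⟨fun z => g α ^ ((1 : ℂ) / m) * cexp (Complex.log (g z / g α) / m), ?_, ?_, ?_⟩
  · exact analyticAt_const.mul (hl.div analyticAt_const (by exact_mod_cast hm)).cexp
  · exact mul_ne_zero (by simp [cpow_eq_zero_iff, h0]) (exp_ne_zero _)
  · filter_upwards [hg.continuousAt.eventually_ne h0] with z hz
    rw [mul_pow, ← exp_nat_mul, mul_div_cancel₀ _ (by exact_mod_cast hm : (m : ℂ) ≠ 0),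
      exp_log (div_ne_zero hz h0), one_div, cpow_nat_inv_pow _ hm, mul_div_cancel₀ _ h0]

lemma exists_rotation {F : ℂ → ℂ} {α : ℂ} (hF : AnalyticAt ℂ F α) {m : ℕ}
    (hm : analyticOrderAt (fun z => F z - F α) α = m) (ω : ℂ) (hω : ω ^ m = 1) :
    ∃ w : ℂ → ℂ, w α = α ∧ HasDerivAt w ω α ∧ ∀ᶠ z in 𝓝 α, F (w z) = F z := by
  have hF' : AnalyticAt ℂ (fun z => F z - F α) α := hF.sub analyticAt_const
  have hm0 : m ≠ 0 := by
    rintro rfl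
    exact (hF'.analyticOrderAt_eq_zero.1 (by simpa using hm)) (by simp)
  obtain ⟨g, hg, hg0, hFg⟩ := (hF'.analyticOrderAt_eq_natCast).1 hm
  obtain ⟨k, hk, hk0, hkg⟩ := exists_local_root hg hg0 hm0
  set χ : ℂ → ℂ := fun z => (z - α) * k z with hχ
  have hχa : AnalyticAt ℂ χ α := (analyticAt_id.sub analyticAt_const).mul hk
  have hχd : HasStrictDerivAt χ (k α) α := by
    have h1 : HasDerivAt χ (k α) α := by
      have := ((hasDerivAt_id α).sub_const α).mul hk.differentiableAt.hasDerivAt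
      exact this.congr_deriv (by simp)
    rw [← h1.deriv]
    exact hχa.hasStrictDerivAt
  have hχ0 : χ α = 0 := by simp [hχ]
  set ψ := hχd.localInverse χ (k α) α hk0
  have hψ0 : ψ 0 = α := by
    have := HasStrictFDerivAt.localInverse_apply_image
      (hχd.hasStrictFDerivAt_equiv hk0)
    rwa [hχ0] at this
  have hψd : HasStrictDerivAt ψ (k α)⁻¹ 0 := by
    have := hχd.to_localInverse hk0
    rwa [hχ0] at this
  have hψr : ∀ᶠ y in 𝓝 (0 : ℂ), χ (ψ y) = y := by
    have := HasStrictFDerivAt.eventually_right_inverse (hχd.hasStrictFDerivAt_equiv hk0)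
    rwa [hχ0] at this
  have hpow : ∀ᶠ z in 𝓝 α, F z - F α = χ z ^ m := by
    filter_upwards [hFg, hkg] with z h1 h2
    rw [h1, hχ]; simp only [mul_pow, h2, smul_eq_mul]
  have hωχ : HasDerivAt (fun z => ω * χ z) (ω * k α) α := hχd.hasDerivAt.const_mul ω
  have hw : HasDerivAt (fun z => ψ (ω * χ z)) ω α := by
    have h1 : HasDerivAt ψ (k α)⁻¹ (ω * χ α) := by rw [hχ0, mul_zero]; exact hψd.hasDerivAt
    have := h1.comp α hωχ
    simp only [Function.comp_def] at this
    exact this.congr_deriv (by rw [mul_comm ω, inv_mul_cancel_left₀ hk0])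
  have hwα : ψ (ω * χ α) = α := by rw [hχ0, mul_zero, hψ0]
  refine ⟨fun z => ψ (ω * χ z), hwα, hw, ?_⟩
  have t1 : Tendsto (fun z => ω * χ z) (𝓝 α) (𝓝 0) := by
    have := hωχ.continuousAt.tendsto
    rwa [hχ0, mul_zero] at this
  have t2 : Tendsto (fun z => ψ (ω * χ z)) (𝓝 α) (𝓝 α) := by
    have := hw.continuousAt.tendsto
    rwa [hwα] at this
  filter_upwards [t1.eventually hψr, t2.eventually hpow, hpow] with z h1 h2 h3
  rw [h1, mul_pow, hω, one_mul, ← h3] at h2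
  exact sub_left_injective h2

lemma abs_coeff_le {z : ℂ} {c d : ℤ} {ε R B : ℝ} (hε : 0 < ε) (hz : ε ≤ z.im) (hR : ‖z‖ ≤ R)
    (h : ‖(c : ℂ) * z + d‖ ≤ B) : |(c : ℝ)| ≤ B / ε ∧ |(d : ℝ)| ≤ B + B / ε * R := by
  have h1 : |(c : ℝ)| * ε ≤ B := by
    calc |(c : ℝ)| * ε ≤ |(c : ℝ)| * |z.im| := by
          gcongr; exact hz.trans (le_abs_self _)
      _ = |((c : ℂ) * z + d).im| := by simp [abs_mul]
      _ ≤ B := (abs_im_le_norm _).trans h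
  have h2 : |(c : ℝ)| ≤ B / ε := (le_div_iff₀ hε).2 h1
  refine ⟨h2, ?_⟩
  have h3 : (d : ℂ) = ((c : ℂ) * z + d) - c * z := by ring
  calc |(d : ℝ)| = ‖(d : ℂ)‖ := by simp
    _ ≤ ‖(c : ℂ) * z + d‖ + ‖(c : ℂ) * z‖ := by
        conv_lhs => rw [h3]
        exact norm_sub_le _ _
    _ ≤ B + B / ε * R := by
        rw [norm_mul]
        have : ‖(c : ℂ)‖ = |(c : ℝ)| := by simp
        rw [this]
        have : 0 ≤ B / ε := (abs_nonneg _).trans h2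
        gcongr

lemma finite_sl_of_bound (B : ℝ) :
    {γ : SL(2, ℤ) | ∀ i j, |(γ i j : ℝ)| ≤ B}.Finite := by
  have hf : (Set.univ.pi fun _ : Fin 2 => Set.univ.pi fun _ : Fin 2 =>
      Set.Icc (-⌈B⌉) ⌈B⌉ : Set (Fin 2 → Fin 2 → ℤ)).Finite :=
    Set.Finite.pi fun _ => Set.Finite.pi fun _ => Set.finite_Icc _ _
  refine Set.Finite.of_finite_image (f := fun γ : SL(2, ℤ) => fun i j => γ i j) (hf.subset ?_) ?_
  · rintro _ ⟨γ, hγ, rfl⟩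
    intro i _ j _
    have := (hγ i j).trans (Int.le_ceil B)
    exact abs_le.1 (by exact_mod_cast this)
  · intro γ _ δ _ h
    ext i j
    exact congrFun (congrFun h i) j

/-- Only finitely many modular transformations map a small disc to a set meeting it. -/
lemma finite_return {α : ℂ} (hα : α ∈ UH) : ∃ r > 0, Metric.ball α r ⊆ UH ∧
    {γ : SL(2, ℤ) | ∃ z ∈ Metric.ball α r, mob γ z ∈ Metric.ball α r}.Finite := by
  have him : 0 < α.im := hα
  set ε := α.im / 2 with hε
  have hε0 : 0 < ε := by positivity
  set R := ‖α‖ + ε with hR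
  have hb : ∀ z ∈ Metric.ball α ε, ε ≤ z.im ∧ ‖z‖ ≤ R := by
    intro z hz
    rw [mem_ball_iff_norm] at hz
    constructor
    · have := (abs_im_le_norm (z - α)).trans hz.le
      rw [sub_im] at this
      have := (abs_le.1 this).1
      linarith
    · calc ‖z‖ = ‖α + (z - α)‖ := by ring_nf
        _ ≤ ‖α‖ + ‖z - α‖ := norm_add_le _ _
        _ ≤ R := by rw [hR]; gcongr
  have hR0 : 0 < R := by positivity
  refine ⟨ε, hε0, fun z hz => hε0.trans_le (hb z hz).1, ?_⟩
  set B := 1 + R / ε with hB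
  have hB0 : 0 < B := by positivity
  set B' := (1 + R) * B with hB'
  have hBB : B ≤ B' := by rw [hB']; nlinarith
  set M := B' / ε + (B' + B' / ε * R) with hM
  refine (finite_sl_of_bound M).subset ?_
  rintro γ ⟨z, hz, hγz⟩
  obtain ⟨h1, h2⟩ := hb z hz
  obtain ⟨h3, h4⟩ := hb _ hγz
  have hzU : z ∈ UH := hε0.trans_le h1
  have hden := den_ne_zero (sl_det_pos γ) hzU
  have hd : ‖den γ z‖ ≤ B := by
    have h5 := im_mob (N := (γ : M2)) (z := z)
    rw [γ.det_coe] at h5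
    have h6 : 0 < normSq (den γ z) := normSq_pos.2 hden
    have h7 : normSq (den γ z) ≤ R / ε := by
      rw [h5, le_div_iff₀ h6] at h3
      rw [le_div_iff₀ hε0]
      have : z.im ≤ R := (le_abs_self _).trans ((abs_im_le_norm z).trans h2)
      push_cast at h3
      linarith
    rw [normSq_eq_norm_sq] at h7
    have hRe : 0 ≤ R / ε := by positivity
    nlinarith [norm_nonneg (den γ z)]
  have hn : ‖(γ 0 0 : ℂ) * z + γ 0 1‖ ≤ B' := by
    have : (γ 0 0 : ℂ) * z + γ 0 1 = mob γ z * den γ z := by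
      rw [mob, div_mul_cancel₀ _ hden]
    rw [this, norm_mul, hB']
    gcongr
    linarith
  have hn' : ‖(γ 1 0 : ℂ) * z + γ 1 1‖ ≤ B' := hd.trans hBB
  have e1 := abs_coeff_le hε0 h1 h2 hn
  have e2 := abs_coeff_le hε0 h1 h2 hn'
  have p1 : 0 ≤ B' / ε := (abs_nonneg _).trans e1.1
  have p2 : 0 ≤ B' + B' / ε * R := (abs_nonneg _).trans e1.2
  intro i j
  fin_cases i <;> fin_cases j <;> simp only [Fin.zero_eta, Fin.mk_one, hM]
  · linarith [e1.1]
  · linarith [e1.2]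
  · linarith [e2.1]
  · linarith [e2.2]

/-- A family of functions on the upper half plane, indexed by vectors modulo `ℓ`,
that is equivariant under the modular group and separates orbits. -/
structure ModFam (ℓ : ℕ) where
  /-- The functions of the family. -/
  φ : (Fin 2 → ZMod ℓ) → ℂ → ℂ
  /-- The indices that are taken into account. -/
  V : Finset (Fin 2 → ZMod ℓ)
  holo : ∀ v ∈ V, DifferentiableOn ℂ (φ v) UH
  stable : ∀ v ∈ V, ∀ γ : SL(2, ℤ), act γ v ∈ V
  equi : ∀ v, ∀ γ : SL(2, ℤ), ∀ z ∈ UH, φ (act γ v) (mob γ z) = φ v z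
  inj : ∀ u ∈ V, ∀ v ∈ V, ∀ z ∈ UH, ∀ w ∈ UH, φ u z = φ v w →
    ∃ γ : SL(2, ℤ), mob γ z = w ∧ act γ u = v
  neg : ∀ v : Fin 2 → ZMod ℓ, -v = v
  nonconst : ∀ v ∈ V, ¬∃ c, ∀ z ∈ UH, φ v z = c

variable {ℓ : ℕ} (𝓕 : ModFam ℓ)

lemma ModFam.analyticAt {v : Fin 2 → ZMod ℓ} (hv : v ∈ 𝓕.V) {z : ℂ} (hz : z ∈ UH) :
    AnalyticAt ℂ (𝓕.φ v) z :=
  (𝓕.holo v hv).analyticAt (isOpen_UH.mem_nhds hz)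

/-- The ramification index of `φ v` at `α`. -/
noncomputable def ModFam.ram (v : Fin 2 → ZMod ℓ) (α : ℂ) : ℕ :=
  analyticOrderNatAt (fun z => 𝓕.φ v z - 𝓕.φ v α) α

lemma ModFam.order_eq {v : Fin 2 → ZMod ℓ} (hv : v ∈ 𝓕.V) {α : ℂ} (hα : α ∈ UH) :
    analyticOrderAt (fun z => 𝓕.φ v z - 𝓕.φ v α) α = 𝓕.ram v α := by
  refine (Nat.cast_analyticOrderNatAt fun h => ?_).symm
  rw [analyticOrderAt_eq_top] at h
  refine 𝓕.nonconst v hv ⟨𝓕.φ v α, fun z hz => ?_⟩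
  have ha : AnalyticOnNhd ℂ (fun z => 𝓕.φ v z - 𝓕.φ v α) UH := fun z hz =>
    (𝓕.analyticAt hv hz).sub analyticAt_const
  exact sub_eq_zero.1
    (ha.eqOn_zero_of_preconnected_of_eventuallyEq_zero isPreconnected_UH hα h hz)

lemma ModFam.ram_pos {v : Fin 2 → ZMod ℓ} (hv : v ∈ 𝓕.V) {α : ℂ} (hα : α ∈ UH) :
    𝓕.ram v α ≠ 0 := by
  intro h
  have h1 := 𝓕.order_eq hv hα
  rw [h, Nat.cast_zero] at h1
  exact (((𝓕.analyticAt hv hα).sub analyticAt_const).analyticOrderAt_eq_zero.1 h1) (by simp)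

variable {ℓ : ℕ} (𝓕 : ModFam ℓ)

lemma mob_sub_fixed {N : M2} (hN : 0 < N.det) {α z : ℂ} (hα : α ∈ UH) (hz : z ∈ UH)
    (h : mob N α = α) : mob N z - α = (z - α) * (N.det / (den N z * den N α)) := by
  conv_lhs => rw [← h]
  rw [mob_sub_mob (den_ne_zero hN hz) (den_ne_zero hN hα)]
  ring

lemma continuous_den (N : M2) : Continuous (den N) := by
  unfold den; fun_prop

lemma ModFam.exists_stabilizer {v : Fin 2 → ZMod ℓ} (hv : v ∈ 𝓕.V) {α : ℂ} (hα : α ∈ UH)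
    {ω : ℂ} (hω : ω ^ 𝓕.ram v α = 1) :
    ∃ γ : SL(2, ℤ), mob γ α = α ∧ act γ v = v ∧ den γ α ^ 2 * ω = 1 := by
  obtain ⟨w, hwα, hw, hFw⟩ := exists_rotation (𝓕.analyticAt hv hα) (𝓕.order_eq hv hα) ω hω
  obtain ⟨r, hr, hrU, hfin⟩ := finite_return hα
  have hwt : Tendsto w (𝓝 α) (𝓝 α) := by
    have := hw.continuousAt.tendsto
    rwa [hwα] at this
  have hball := Metric.ball_mem_nhds α hr
  have hex : ∀ᶠ z in 𝓝[≠] α, ∃ γ ∈ {γ : SL(2, ℤ) | ∃ z ∈ Metric.ball α r,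
      mob γ z ∈ Metric.ball α r}, z ∈ UH ∧ mob γ z = w z ∧ act γ v = v := by
    refine Filter.Eventually.filter_mono nhdsWithin_le_nhds ?_
    filter_upwards [hFw, hball, hwt.eventually hball] with z h1 h2 h3
    obtain ⟨γ, h4, h5⟩ := 𝓕.inj v hv v hv z (hrU h2) (w z) (hrU h3) h1.symm
    exact ⟨γ, ⟨z, h2, h4 ▸ h3⟩, hrU h2, h4, h5⟩
  obtain ⟨γ, -, hγ⟩ := (Filter.frequently_exists_finite hfin).1 hex.frequently
  have hact : act γ v = v := by
    obtain ⟨z, -, -, h⟩ := hγ.exists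
    exact h
  set l := 𝓝[≠] α ⊓ 𝓟 {z | z ∈ UH ∧ mob γ z = w z ∧ act γ v = v} with hl
  have : l.NeBot := Filter.frequently_mem_iff_neBot.1 hγ
  have hlα : l ≤ 𝓝 α := inf_le_left.trans nhdsWithin_le_nhds
  have hmem : ∀ᶠ z in l, z ∈ UH ∧ mob γ z = w z ∧ act γ v = v :=
    (le_principal_iff.1 inf_le_right : _ ∈ l)
  have hne : ∀ᶠ z in l, z ≠ α := (inf_le_left : l ≤ 𝓝[≠] α) self_mem_nhdsWithin
  have hfix : mob γ α = α := by
    have h1 : Tendsto (fun z => mob γ z) l (𝓝 (mob γ α)) :=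
      (continuousAt_mob (sl_den γ hα)).tendsto.mono_left hlα
    refine tendsto_nhds_unique h1 ((hwt.mono_left hlα).congr' ?_)
    filter_upwards [hmem] with z hz using hz.2.1.symm
  refine ⟨γ, hfix, hact, ?_⟩
  have hd := den_ne_zero (sl_det_pos γ) hα
  have h1 : Tendsto (slope w α) l (𝓝 ω) :=
    hw.tendsto_slope.mono_left inf_le_left
  have h2 : Tendsto (fun z => 1 / (den γ z * den γ α)) l (𝓝 (1 / (den γ α * den γ α))) := by
    have : ContinuousAt (fun z => 1 / (den γ z * den γ α)) α :=
      continuousAt_const.div (((continuous_den _).mul continuous_const).continuousAt)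
        (mul_ne_zero hd hd)
    exact this.tendsto.mono_left hlα
  have h3 : ω = 1 / (den γ α * den γ α) := by
    refine tendsto_nhds_unique h1 (h2.congr' ?_)
    filter_upwards [hmem, hne] with z hz hzα
    have h4 := mob_sub_fixed (sl_det_pos γ) hα hz.1 hfix
    rw [slope_def_field, hwα, ← hz.2.1, h4, γ.det_coe, mul_div_cancel_left₀ _ (sub_ne_zero.2 hzα)]
    simp
  rw [h3]
  field_simp

lemma ModFam.factor_eventually {v : Fin 2 → ZMod ℓ} (hv : v ∈ 𝓕.V) {α : ℂ} (hα : α ∈ UH)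
    {N : M2} (hN : 0 < N.det) (hNα : mob N α = α) :
    ∃ g : ℂ → ℂ, AnalyticAt ℂ g α ∧
      (∀ᶠ z in 𝓝 α, 𝓕.φ v z - 𝓕.φ v (mob N z) = (z - α) ^ 𝓕.ram v α • g z) ∧
      ∃ c ≠ 0, g α = c * (1 - (N.det / den N α ^ 2) ^ 𝓕.ram v α) := by
  obtain ⟨g, hg, hg0, hFg⟩ := (((𝓕.analyticAt hv hα).sub analyticAt_const
    ).analyticOrderAt_eq_natCast).1 (𝓕.order_eq hv hα)
  have hd := den_ne_zero hN hα
  have hmob : AnalyticAt ℂ (mob N) α := by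
    have : AnalyticAt ℂ (fun z : ℂ => ((N 0 0 : ℂ) * z + N 0 1) / ((N 1 0 : ℂ) * z + N 1 1)) α :=
      AnalyticAt.div (by fun_prop) (by fun_prop) hd
    exact this
  have hden : AnalyticAt ℂ (den N) α := by
    have : AnalyticAt ℂ (fun z : ℂ => (N 1 0 : ℂ) * z + N 1 1) α := by fun_prop
    exact this
  refine ⟨fun z => g z - (N.det / (den N z * den N α)) ^ 𝓕.ram v α * g (mob N z), ?_, ?_,
    g α, hg0, ?_⟩
  · refine hg.sub (((analyticAt_const.div (hden.mul analyticAt_const) (mul_ne_zero hd hd)).pow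
      _).mul ?_)
    exact AnalyticAt.fun_comp (by rwa [hNα]) hmob
  · have ht : Tendsto (mob N) (𝓝 α) (𝓝 α) := by
      have := hmob.continuousAt.tendsto
      rwa [hNα] at this
    filter_upwards [hFg, ht.eventually hFg, isOpen_UH.mem_nhds hα] with z h1 h2 h3
    rw [mob_sub_fixed hN hα h3 hNα, mul_pow] at h2
    simp only [smul_eq_mul, Pi.sub_apply] at h1 h2 ⊢
    linear_combination h1 - h2
  · simp only [hNα, pow_two]
    ring

lemma ModFam.den_pow {v : Fin 2 → ZMod ℓ} (hv : v ∈ 𝓕.V) {α : ℂ} (hα : α ∈ UH)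
    {γ : SL(2, ℤ)} (hγ : mob γ α = α) (hγv : act γ v = v) :
    den γ α ^ (2 * 𝓕.ram v α) = 1 := by
  obtain ⟨g, hg, hFg, c, hc, hgα⟩ := 𝓕.factor_eventually hv hα (sl_det_pos γ) hγ
  have h0 : g α = 0 := by
    have h1 : Tendsto g (𝓝[≠] α) (𝓝 (g α)) := hg.continuousAt.tendsto.mono_left nhdsWithin_le_nhds
    refine tendsto_nhds_unique h1 (tendsto_const_nhds.congr' ?_)
    filter_upwards [hFg.filter_mono nhdsWithin_le_nhds, self_mem_nhdsWithin,
      nhdsWithin_le_nhds (isOpen_UH.mem_nhds hα)] with z h1 h2 h3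
    have h4 := 𝓕.equi v γ z h3
    rw [hγv] at h4
    rw [h4, sub_self, smul_eq_mul] at h1
    exact ((mul_eq_zero.1 h1.symm).resolve_left (pow_ne_zero _ (sub_ne_zero.2 h2))).symm
  rw [hgα, mul_eq_zero, or_iff_right hc, γ.det_coe, div_pow, sub_eq_zero] at h0
  rw [pow_mul]
  have hd : (den γ α ^ 2) ^ 𝓕.ram v α ≠ 0 := pow_ne_zero _ (pow_ne_zero _
    (den_ne_zero (sl_det_pos γ) hα))
  rw [eq_div_iff hd] at h0
  simpa using h0

lemma sl_ext_of_den {γ δ : SL(2, ℤ)} {α : ℂ} (hα : α ∈ UH) (h : den γ α = den δ α)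
    (hm : mob γ α = mob δ α) : γ = δ := by
  have key : ∀ {a b a' b' : ℤ}, (a : ℂ) * α + b = a' * α + b' → a = a' ∧ b = b' := by
    intro a b a' b' h
    have h1 : ((a - a' : ℤ) : ℂ) * α + ((b - b' : ℤ) : ℂ) = 0 := by
      push_cast; linear_combination h
    by_contra hne
    refine lin_ne_zero hα ?_ h1
    by_contra! h2
    exact hne ⟨by linarith [h2.1], by linarith [h2.2]⟩
  have h2 := key h
  rw [mob, mob, ← h, div_left_inj' (den_ne_zero (sl_det_pos γ) hα)] at hm
  have h1 := key hm
  ext i j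
  fin_cases i <;> fin_cases j
  exacts [h1.1, h1.2, h2.1, h2.2]

lemma card_pow_eq_one (n : ℕ) (hn : n ≠ 0) : Nat.card {u : ℂ // u ^ n = 1} = n := by
  have : NeZero n := ⟨hn⟩
  have h : Nat.card (rootsOfUnity n ℂ) = n := Complex.card_rootsOfUnity n
  conv_rhs => rw [← h]
  refine Nat.card_congr ((rootsOfUnityEquivNthRoots ℂ n).trans
    (Equiv.subtypeEquivRight fun x => ?_)).symm
  rw [Polynomial.mem_nthRoots (Nat.pos_of_ne_zero hn)]

/-- The stabiliser of a point together with a vector has order twice the ramification index. -/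
theorem ModFam.card_stabilizer {v : Fin 2 → ZMod ℓ} (hv : v ∈ 𝓕.V) {α : ℂ} (hα : α ∈ UH) :
    Nat.card {γ : SL(2, ℤ) // mob γ α = α ∧ act γ v = v} = 2 * 𝓕.ram v α := by
  have hm := 𝓕.ram_pos hv hα
  rw [← card_pow_eq_one (2 * 𝓕.ram v α) (by positivity)]
  refine Nat.card_congr (Equiv.ofBijective
    (fun γ => ⟨den γ.1 α, 𝓕.den_pow hv hα γ.2.1 γ.2.2⟩) ⟨?_, ?_⟩)
  · rintro ⟨γ, h1, h2⟩ ⟨δ, h3, h4⟩ h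
    exact Subtype.ext (sl_ext_of_den hα (congrArg Subtype.val h) (h1.trans h3.symm))
  · rintro ⟨u, hu⟩
    have hu0 : u ≠ 0 := by
      rintro rfl
      rw [zero_pow (by positivity)] at hu
      exact zero_ne_one hu
    obtain ⟨γ, h1, h2, h3⟩ := 𝓕.exists_stabilizer hv hα (ω := (u ^ 2)⁻¹)
      (by rw [inv_pow, ← pow_mul, hu, inv_one])
    have h4 : den γ α ^ 2 = u ^ 2 := by
      rw [mul_inv_eq_iff_eq_mul₀ (pow_ne_zero _ hu0), one_mul] at h3
      exact h3
    rcases sq_eq_sq_iff_eq_or_eq_neg.1 h4 with h | h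
    · exact ⟨⟨γ, h1, h2⟩, Subtype.ext h⟩
    · refine ⟨⟨-γ, ?_, ?_⟩, Subtype.ext ?_⟩
      · rw [Matrix.SpecialLinearGroup.coe_neg, mob_neg, h1]
      · rw [Matrix.SpecialLinearGroup.coe_neg, act_neg, h2, 𝓕.neg]
      · simp only [den] at h ⊢
        simp only [Matrix.SpecialLinearGroup.coe_neg, Matrix.neg_apply]
        push_cast
        linear_combination -h

/-- Integral multiples of unimodular matrices. -/
def IsScaled (N : M2) : Prop := ∃ (t : ℤ) (γ : SL(2, ℤ)), N = t • (γ : M2)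

lemma scalar_of_den_sq {M : M2} {α : ℂ} (hα : α ∈ UH) (hM : 0 < M.det) (hMα : mob M α = α)
    (h : den M α ^ 2 = M.det) : M = M 1 1 • (1 : M2) := by
  have hd := den_ne_zero hM hα
  have hre : (den M α).im = 0 := by
    have h1 := congrArg Complex.re h
    have h2 := congrArg Complex.im h
    simp only [pow_two, mul_re, mul_im, intCast_re, intCast_im] at h1 h2
    have h3 : (den M α).re * (den M α).im = 0 := by linarith
    rcases mul_eq_zero.1 h3 with h4 | h4
    · rw [h4] at h1
      have : (0 : ℝ) < M.det := by exact_mod_cast hM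
      nlinarith [sq_nonneg (den M α).im]
    · exact h4
  have hc : M 1 0 = 0 := by
    have : (M 1 0 : ℝ) * α.im = 0 := by simpa [den] using hre
    exact_mod_cast (mul_eq_zero.1 this).resolve_right (ne_of_gt hα)
  have hdet := det_eq M
  rw [hc, mul_zero, sub_zero] at hdet
  have h11 : den M α = M 1 1 := by simp [den, hc]
  have hsq : M 1 1 * M 1 1 = M 0 0 * M 1 1 := by
    rw [h11, hdet] at h
    rw [← pow_two]
    exact_mod_cast h
  have hne : M 1 1 ≠ 0 := by
    rintro h0
    rw [h11, h0] at hd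
    simp at hd
  have ha : M 0 0 = M 1 1 := (mul_right_cancel₀ hne hsq).symm
  have hb : M 0 1 = 0 := by
    rw [mob, h11, ha, div_eq_iff (by exact_mod_cast hne)] at hMα
    have : (M 0 1 : ℂ) = 0 := by linear_combination hMα
    exact_mod_cast this
  ext i j
  fin_cases i <;> fin_cases j <;> simp [ha, hb, hc]

lemma den_inv_mul_den {γ : SL(2, ℤ)} {α : ℂ} (hα : α ∈ UH) (h : mob γ α = α) :
    den (γ⁻¹ : SL(2, ℤ)) α * den γ α = 1 := by
  have h1 := den_mul ((γ⁻¹ : SL(2, ℤ)) : M2) (γ : M2) (z := α) (den_ne_zero (sl_det_pos γ) hα)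
  rw [h] at h1
  rw [← h1, ← Matrix.SpecialLinearGroup.coe_mul, inv_mul_cancel]
  simp [den_one]

/-- The difference of `φ v` and its transform vanishes to the order given by ramification. -/
theorem ModFam.order_factor {v : Fin 2 → ZMod ℓ} (hv : v ∈ 𝓕.V) {α : ℂ} (hα : α ∈ UH)
    {N : M2} (hN : 0 < N.det) (hNα : mob N α = α) (hs : ¬IsScaled N) :
    analyticOrderAt (fun z => 𝓕.φ v z - 𝓕.φ v (mob N z)) α = 𝓕.ram v α := by
  obtain ⟨g, hg, hFg, c, hc, hgα⟩ := 𝓕.factor_eventually hv hα hN hNα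
  have ha : AnalyticAt ℂ (fun z => 𝓕.φ v z - 𝓕.φ v (mob N z)) α := by
    refine (𝓕.analyticAt hv hα).sub (AnalyticAt.fun_comp (by rw [hNα]; exact 𝓕.analyticAt hv hα) ?_)
    have : AnalyticAt ℂ (fun z : ℂ => ((N 0 0 : ℂ) * z + N 0 1) / ((N 1 0 : ℂ) * z + N 1 1)) α :=
      AnalyticAt.div (by fun_prop) (by fun_prop) (den_ne_zero hN hα)
    exact this
  refine ha.analyticOrderAt_eq_natCast.2 ⟨g, hg, ?_, hFg⟩
  rw [hgα]
  refine mul_ne_zero hc (sub_ne_zero.2 fun h1 => hs ?_)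
  obtain ⟨γ, h2, -, h3⟩ := 𝓕.exists_stabilizer hv hα h1.symm
  have hd := den_ne_zero hN hα
  have h4 := den_inv_mul_den hα h2
  set M : M2 := ((γ⁻¹ : SL(2, ℤ)) : M2) * N with hM
  have hMd : M.det = N.det := by
    rw [hM, Matrix.det_mul, Matrix.SpecialLinearGroup.det_coe, one_mul]
  have hden : den M α = den (γ⁻¹ : SL(2, ℤ)) α * den N α := by
    rw [hM, den_mul _ _ hd, hNα]
  have hmob : mob M α = α := by
    rw [hM, mob_mul hd, hNα]
    conv_lhs => rw [← h2]
    exact mob_sl_inv_mob γ hα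
  have hsc := scalar_of_den_sq hα (hMd ▸ hN) hmob (by
    rw [hden, mul_pow, hMd]
    have h5 : den N α ^ 2 = den γ α ^ 2 * N.det := by
      rw [← mul_div_assoc, div_eq_iff (pow_ne_zero _ hd), one_mul] at h3
      exact h3.symm
    rw [h5, ← mul_assoc, ← mul_pow, h4, one_pow, one_mul])
  refine ⟨M 1 1, γ, ?_⟩
  calc N = (γ : M2) * M := by
        rw [hM, ← Matrix.mul_assoc, ← Matrix.SpecialLinearGroup.coe_mul, mul_inv_cancel]
        simp
    _ = _ := by conv_lhs => rw [hsc, Matrix.mul_smul, Matrix.mul_one]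

/-- The filter of neighbourhoods of the cusp at infinity. -/
def atInf : Filter ℂ := comap Complex.im atTop

instance : NeBot atInf :=
  comap_neBot fun t ht => by
    obtain ⟨a, ha⟩ := (mem_atTop_sets.1 ht)
    exact ⟨a * I, by simpa using ha a le_rfl⟩

lemma atInf_eventually {P : ℂ → Prop} : (∀ᶠ z in atInf, P z) ↔ ∃ A : ℝ, ∀ z : ℂ,
    A ≤ z.im → P z := by
  rw [atInf, eventually_comap, eventually_atTop]
  exact ⟨fun ⟨A, h⟩ => ⟨A, fun z hz => h _ hz z rfl⟩, fun ⟨A, h⟩ => ⟨A,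
      fun b hb z hz => h z (hz ▸ hb)⟩⟩

lemma eventually_mem_UH : ∀ᶠ z in atInf, z ∈ UH :=
  atInf_eventually.2 ⟨1, fun _ hz => one_pos.trans_le hz⟩

lemma tendsto_im_atInf : Tendsto Complex.im atInf atTop := tendsto_comap

/-- The local parameter of width two at infinity. -/
noncomputable def pp (z : ℂ) : ℂ := nome (z / 2)

lemma pp_ne_zero (z : ℂ) : pp z ≠ 0 := nome_ne_zero _

lemma pp_sq (z : ℂ) : pp z ^ 2 = nome z := by
  have := nome_nat_mul 2 (z / 2)
  rw [pp, ← this]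
  congr 1
  push_cast; ring

lemma pp_add_one (z : ℂ) : pp (z + 1) = - pp z := by
  rw [pp, pp, add_div, nome_add, nome_half]; ring

lemma tendsto_nome_comp {u : ℂ → ℂ} {l : Filter ℂ} (h : Tendsto (fun z => (u z).im) l atTop) :
    Tendsto (fun z => nome (u z)) l (𝓝 0) := by
  rw [tendsto_zero_iff_norm_tendsto_zero]
  simp only [norm_nome]
  refine Real.tendsto_exp_atBot.comp ?_
  exact h.const_mul_atTop_of_neg (by nlinarith [Real.pi_pos])

lemma tendsto_pp : Tendsto pp atInf (𝓝 0) := by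
  refine tendsto_nome_comp (u := fun z => z / 2) ?_
  have : (fun z : ℂ => (z / 2).im) = fun z => z.im / 2 := by ext z; simp
  rw [this]
  exact tendsto_im_atInf.atTop_div_const two_pos

lemma tendsto_nome : Tendsto nome atInf (𝓝 0) := tendsto_nome_comp (u := id) tendsto_im_atInf

lemma tendsto_add_one_atInf : Tendsto (fun z : ℂ => z + 1) atInf atInf := by
  refine tendsto_comap_iff.2 ?_
  have : Complex.im ∘ (fun z : ℂ => z + 1) = Complex.im := by ext z; simp
  rw [this]; exact tendsto_im_atInf

/-- `g` is `exp (α p + l p² + o(p²))` near infinity. -/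
def Jet (g : ℂ → ℂ) (α l : ℂ) : Prop :=
  ∃ ε : ℂ → ℂ, (∀ᶠ z in atInf, g z = cexp (ε z)) ∧
    (fun z => ε z - α * pp z - l * pp z ^ 2) =o[atInf] fun z => pp z ^ 2

namespace Jet

variable {g g' : ℂ → ℂ} {α α' l l' : ℂ}

lemma congr (h : Jet g α l) (hg : ∀ᶠ z in atInf, g z = g' z) : Jet g' α l := by
  obtain ⟨ε, h1, h2⟩ := h
  exact ⟨ε, by filter_upwards [h1, hg] with z h3 h4; rw [← h4, h3], h2⟩

lemma one : Jet (fun _ => 1) 0 0 :=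
  ⟨fun _ => 0, by simp, by simp⟩

lemma mul (h : Jet g α l) (h' : Jet g' α' l') : Jet (fun z => g z * g' z) (α + α') (l + l') := by
  obtain ⟨ε, h1, h2⟩ := h
  obtain ⟨ε', h1', h2'⟩ := h'
  refine ⟨fun z => ε z + ε' z, ?_, ?_⟩
  · filter_upwards [h1, h1'] with z h3 h4
    rw [h3, h4, exp_add]
  · exact (h2.add h2').congr_left fun z => by ring

lemma inv (h : Jet g α l) : Jet (fun z => (g z)⁻¹) (-α) (-l) := by
  obtain ⟨ε, h1, h2⟩ := h
  refine ⟨fun z => - ε z, ?_, ?_⟩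
  · filter_upwards [h1] with z h3
    rw [h3, exp_neg]
  · exact h2.neg_left.congr_left fun z => by ring

lemma div (h : Jet g α l) (h' : Jet g' α' l') : Jet (fun z => g z / g' z) (α - α') (l - l') := by
  have := h.mul h'.inv
  simpa only [div_eq_mul_inv, sub_eq_add_neg] using this

lemma pow (h : Jet g α l) (n : ℕ) : Jet (fun z => g z ^ n) (n * α) (n * l) := by
  induction n with
  | zero => simpa using one
  | succ n ih =>
    have := ih.mul h
    simp only [← pow_succ] at this
    convert this using 1 <;> push_cast <;> ring

lemma prod {ι : Type*} (s : Finset ι) {g : ι → ℂ → ℂ} {α l : ι → ℂ}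
    (h : ∀ i ∈ s, Jet (g i) (α i) (l i)) :
    Jet (fun z => ∏ i ∈ s, g i z) (∑ i ∈ s, α i) (∑ i ∈ s, l i) := by
  classical
  induction s using Finset.induction_on with
  | empty => simpa using one
  | insert i s hi ih =>
    have := (h i (Finset.mem_insert_self i s)).mul
      (ih fun j hj => h j (Finset.mem_insert_of_mem hj))
    simpa only [Finset.prod_insert hi, Finset.sum_insert hi] using this

lemma comp_add_one (h : Jet g α l) : Jet (fun z => g (z + 1)) (-α) l := by
  obtain ⟨ε, h1, h2⟩ := h
  refine ⟨fun z => ε (z + 1), tendsto_add_one_atInf.eventually h1, ?_⟩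
  have := h2.comp_tendsto tendsto_add_one_atInf
  refine this.congr (fun z => ?_) (fun z => ?_) <;> simp only [Function.comp_def,
      pp_add_one] <;> ring

lemma isLittleO_one (hε : (fun z => g z - α * pp z - l * pp z ^ 2) =o[atInf] fun z => pp z ^ 2) :
    Tendsto g atInf (𝓝 0) := by
  have hp := tendsto_pp
  have hp2 : Tendsto (fun z => pp z ^ 2) atInf (𝓝 0) := by simpa using hp.pow 2
  have h3 := hε.isBigO.trans_tendsto hp2
  have h4 : Tendsto (fun z => α * pp z + l * pp z ^ 2) atInf (𝓝 0) := by
    simpa using (hp.const_mul α).add (hp2.const_mul l)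
  have := h3.add h4
  simp only [add_zero] at this
  exact this.congr fun z => by ring

lemma tendsto_one (h : Jet g α l) : Tendsto g atInf (𝓝 1) := by
  obtain ⟨ε, h1, h2⟩ := h
  have h3 := isLittleO_one h2
  have h4 : Tendsto (fun z => cexp (ε z)) atInf (𝓝 1) := by
    have := (continuous_exp.tendsto (0 : ℂ)).comp h3
    rwa [exp_zero] at this
  exact h4.congr' (h1.mono fun z hz => hz.symm)

lemma eq_zero_of_one (h : Jet (fun _ => 1) 0 l) : l = 0 := by
  obtain ⟨ε, h1, h2⟩ := h
  have h3 := isLittleO_one h2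
  have h4 : ∀ᶠ z in atInf, ε z = 0 := by
    have h5 : ∀ᶠ z in atInf, ‖ε z‖ < 1 := by
      have := h3.norm
      rw [norm_zero] at this
      exact this.eventually_lt_const one_pos
    filter_upwards [h1, h5] with z h6 h7
    have h8 := Complex.log_exp (x := ε z)
    have h9 := (Complex.abs_im_le_norm (ε z)).trans h7.le
    have h10 := abs_le.1 h9
    rw [← h8 (by linarith [Real.pi_gt_three]) (by linarith [Real.pi_gt_three]), ← h6,
        Complex.log_one]
  have h5 : (fun z => l * pp z ^ 2) =o[atInf] fun z => pp z ^ 2 := by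
    refine h2.neg_left.congr' ?_ EventuallyEq.rfl
    filter_upwards [h4] with z hz
    rw [hz]; ring
  by_contra hl
  have h6 : (fun z => pp z ^ 2) =o[atInf] fun z => pp z ^ 2 :=
    (Asymptotics.isLittleO_const_mul_left_iff hl).1 h5
  have h7 := Asymptotics.isLittleO_irrefl' (f' := fun z => pp z ^ 2) (l := atInf)
    (Frequently.of_forall fun z => by simpa using pp_ne_zero z)
  exact h7 h6

/-- A function with a first order expansion in `p²` has the corresponding jet. -/
lemma of_isLittleO (h : (fun z => g z - 1 - l * pp z ^ 2) =o[atInf] fun z => pp z ^ 2) :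
    Jet g 0 l := by
  set u : ℂ → ℂ := fun z => g z - 1 with hu
  have hub : u =O[atInf] fun z => pp z ^ 2 := by
    have h1 : (fun z => l * pp z ^ 2) =O[atInf] fun z => pp z ^ 2 :=
      Asymptotics.isBigO_const_mul_self _ _ _
    exact (h.isBigO.add h1).congr_left fun z => by simp [hu]
  have hp2 : Tendsto (fun z => pp z ^ 2) atInf (𝓝 0) := by simpa using tendsto_pp.pow 2
  have hu0 : Tendsto u atInf (𝓝 0) := hub.trans_tendsto hp2
  have hlog : (fun x : ℂ => Complex.log (1 + x) - x) =o[𝓝 0] fun x => x := by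
    have h1 : HasDerivAt (fun x : ℂ => Complex.log (1 + x)) 1 0 := by
      have := ((hasDerivAt_id (0 : ℂ)).const_add 1).clog (by simp)
      simpa using this
    have := h1.isLittleO
    simpa using this
  refine ⟨fun z => Complex.log (g z), ?_, ?_⟩
  · have : ∀ᶠ z in atInf, g z ≠ 0 := by
      have h1 : Tendsto g atInf (𝓝 1) := by simpa [hu] using hu0.add_const 1
      exact h1.eventually_ne one_ne_zero
    filter_upwards [this] with z hz
    rw [exp_log hz]
  · have h1 := (hlog.comp_tendsto hu0).trans_isBigO hub
    refine (h1.add h).congr_left fun z => ?_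
    simp [hu]

lemma of_analytic {F : ℂ → ℂ} {l : ℂ} (h : HasDerivAt F l 0) (h0 : F 0 = 1) :
    Jet (fun z => F (nome z)) 0 l := by
  refine of_isLittleO ?_
  have h1 := h.isLittleO
  have h2 := h1.comp_tendsto tendsto_nome
  refine h2.congr (fun z => ?_) (fun z => ?_)
  · simp [h0, pp_sq]; ring
  · simp [pp_sq]

end Jet

lemma hasDerivAt_jInv_nome :
    ∃ F : ℂ → ℂ, HasDerivAt F 744 0 ∧ F 0 = 1 ∧ ∀ z ∈ UH, jInv z * nome z = F (nome z) := by
  refine ⟨fun x => e4 x ^ 3 / euler x ^ 24, ?_, ?_, ?_⟩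
  · have h1 := (analyticAt_e4.differentiableAt.hasDerivAt).pow 3
    have h2 := hasDerivAt_euler_zero.pow 24
    have := h1.div h2 (by simp [euler_zero])
    refine (this.congr_deriv ?_)
    simp only [Pi.pow_apply, euler_zero, e4_zero, deriv_e4_zero]
    norm_num
  · simp [e4_zero, euler_zero]
  · intro z hz
    rw [jInv_eq hz, F4_eq hz, Dl]
    field_simp [nome_ne_zero z]

lemma jet_jInv_sub (a : ℂ) : Jet (fun z => (jInv z - a) * pp z ^ 2) 0 (744 - a) := by
  obtain ⟨F, hF, hF0, hFj⟩ := hasDerivAt_jInv_nome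
  have h1 : HasDerivAt (fun x => F x - a * x) (744 - a) 0 := by
    have := hF.sub ((hasDerivAt_id (0 : ℂ)).const_mul a)
    exact this.congr_deriv (by simp)
  refine (Jet.of_analytic h1 (by simp [hF0])).congr ?_
  filter_upwards [eventually_mem_UH] with z hz
  rw [← hFj z hz, pp_sq]; ring

lemma exists_quotient {G P : ℂ → ℂ} {z : ℂ} (hG : AnalyticAt ℂ G z) (hP : AnalyticAt ℂ P z)
    (htop : analyticOrderAt P z ≠ ⊤) (h : analyticOrderAt G z = analyticOrderAt P z) :
    ∃ k : ℂ → ℂ, AnalyticAt ℂ k z ∧ k z ≠ 0 ∧ (∀ᶠ w in 𝓝 z, G w = k w * P w) ∧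
      ∀ᶠ w in 𝓝[≠] z, P w ≠ 0 := by
  obtain ⟨p, hp, hp0, hPp⟩ := (hP.analyticOrderAt_ne_top).1 htop
  obtain ⟨g, hg, hg0, hGg⟩ := (hG.analyticOrderAt_ne_top).1 (h ▸ htop)
  have hn : analyticOrderNatAt G z = analyticOrderNatAt P z := by
    simp only [analyticOrderNatAt, h]
  rw [hn] at hGg
  refine ⟨fun w => g w / p w, hg.div hp hp0, div_ne_zero hg0 hp0, ?_, ?_⟩
  · filter_upwards [hPp, hGg, hp.continuousAt.eventually_ne hp0] with w h1 h2 h3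
    rw [h1, h2, smul_eq_mul, smul_eq_mul]
    field_simp
  · filter_upwards [hPp.filter_mono nhdsWithin_le_nhds, self_mem_nhdsWithin,
      (hp.continuousAt.eventually_ne hp0).filter_mono nhdsWithin_le_nhds] with w h1 h2 h3
    rw [h1]
    exact smul_ne_zero (pow_ne_zero _ (sub_ne_zero.2 h2)) h3

/-- Two holomorphic functions with the same divisor differ by a nonvanishing holomorphic factor. -/
lemma exists_global_quotient {G P : ℂ → ℂ} (hG : DifferentiableOn ℂ G UH)
    (hP : DifferentiableOn ℂ P UH) (htop : ∀ z ∈ UH, analyticOrderAt P z ≠ ⊤)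
    (h : ∀ z ∈ UH, analyticOrderAt G z = analyticOrderAt P z) :
    ∃ F : ℂ → ℂ, DifferentiableOn ℂ F UH ∧ (∀ z ∈ UH, F z ≠ 0) ∧ (∀ z ∈ UH, G z = F z * P z) ∧
      ∀ z ∈ UH, ∃ᶠ w in 𝓝 z, P w ≠ 0 := by
  have hloc : ∀ z ∈ UH, ∃ k : ℂ → ℂ, AnalyticAt ℂ k z ∧ k z ≠ 0 ∧
      (∀ᶠ w in 𝓝 z, G w = k w * P w) ∧ ∀ᶠ w in 𝓝[≠] z, P w ≠ 0 := fun z hz =>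
    exists_quotient (hG.analyticAt (isOpen_UH.mem_nhds hz))
      (hP.analyticAt (isOpen_UH.mem_nhds hz)) (htop z hz) (h z hz)
  set F : ℂ → ℂ := fun z => limUnder (𝓝[≠] z) fun w => G w / P w with hF
  have hval : ∀ z, ∀ k : ℂ → ℂ, ContinuousAt k z → (∀ᶠ w in 𝓝 z, G w = k w * P w) →
      (∀ᶠ w in 𝓝[≠] z, P w ≠ 0) → F z = k z := by
    intro z k hk h1 h2
    refine Tendsto.limUnder_eq ((hk.tendsto.mono_left nhdsWithin_le_nhds).congr' ?_)
    filter_upwards [h1.filter_mono nhdsWithin_le_nhds, h2] with w h3 h4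
    rw [h3, mul_div_cancel_right₀ _ h4]
  have heq : ∀ z ∈ UH, ∀ k : ℂ → ℂ, AnalyticAt ℂ k z → (∀ᶠ w in 𝓝 z, G w = k w * P w) →
      F =ᶠ[𝓝 z] k := by
    intro z hz k hk h1
    filter_upwards [h1.eventually_nhds, hk.eventually_analyticAt, isOpen_UH.mem_nhds hz]
      with w h3 h4 h5
    obtain ⟨_, -, -, -, h6⟩ := hloc w h5
    exact hval w k h4.continuousAt h3 h6
  refine ⟨F, fun z hz => ?_, fun z hz => ?_, fun z hz => ?_, fun z hz => ?_⟩ <;>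
    obtain ⟨k, hk, hk0, hGk, hPk⟩ := hloc z hz
  · exact ((heq z hz k hk hGk).differentiableAt_iff.2 hk.differentiableAt).differentiableWithinAt
  · rwa [(heq z hz k hk hGk).eq_of_nhds]
  · rw [(heq z hz k hk hGk).eq_of_nhds, hGk.self_of_nhds]
  · exact hPk.frequently.filter_mono nhdsWithin_le_nhds

lemma quotient_invariant {F G P : ℂ → ℂ} {σ : ℂ → ℂ} (hF : ContinuousOn F UH)
    (hσ : ContinuousOn σ UH) (hσU : ∀ z ∈ UH, σ z ∈ UH)
    (hGF : ∀ z ∈ UH, G z = F z * P z) (hfreq : ∀ z ∈ UH, ∃ᶠ w in 𝓝 z, P w ≠ 0)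
    (hG : ∀ z ∈ UH, G (σ z) = G z) (hP : ∀ z ∈ UH, P (σ z) = P z) :
    ∀ z ∈ UH, F (σ z) = F z := by
  intro z hz
  by_contra hne
  have hn := isOpen_UH.mem_nhds hz
  have h1 : ContinuousAt (fun w => F (σ w)) z :=
    ((hF.comp hσ hσU).continuousAt hn)
  have h2 : ContinuousAt F z := hF.continuousAt hn
  have h3 : ∀ᶠ w in 𝓝 z, F (σ w) ≠ F w :=
    ((h1.sub h2).eventually_ne (sub_ne_zero.2 hne)).mono fun w hw => sub_ne_zero.1 hw
  obtain ⟨w, hw, hw1, hw2⟩ := ((hfreq z hz).and_eventually (h3.and hn)).exists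
  refine hw1 (mul_right_cancel₀ hw ?_)
  rw [← hGF w hw2, ← hP w hw2, ← hGF _ (hσU w hw2), hG w hw2]

lemma analyticOrderAt_finset_prod {ι : Type*} (s : Finset ι) (f : ι → ℂ → ℂ) {z : ℂ}
    (h : ∀ i ∈ s, AnalyticAt ℂ (f i) z) :
    AnalyticAt ℂ (fun w => ∏ i ∈ s, f i w) z ∧
      analyticOrderAt (fun w => ∏ i ∈ s, f i w) z = ∑ i ∈ s, analyticOrderAt (f i) z := by
  classical
  induction s using Finset.induction_on with
  | empty =>
    simp only [Finset.prod_empty, Finset.sum_empty]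
    exact ⟨analyticAt_const, analyticAt_const.analyticOrderAt_eq_zero.2 one_ne_zero⟩
  | insert i s hi ih =>
    obtain ⟨h1, h2⟩ := ih fun j hj => h j (Finset.mem_insert_of_mem hj)
    have h3 := h i (Finset.mem_insert_self i s)
    simp only [Finset.prod_insert hi, Finset.sum_insert hi]
    refine ⟨h3.mul h1, ?_⟩
    rw [← h2]
    exact analyticOrderAt_mul h3 h1

/-- If the divisor of a modular function is that of a product of functions `j - j(αᵢ)`,
the second coefficient at the cusp determines the weighted sum of the `j(αᵢ)`. -/
theorem divisor_sum {G : ℂ → ℂ} (hG : DifferentiableOn ℂ G UH)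
    (hS : ∀ z ∈ UH, G (-1 / z) = G z) (hT : ∀ z ∈ UH, G (z + 1) = G z)
    {ι : Type*} (s : Finset ι) (a : ι → ℂ) (e : ι → ℕ)
    (htop : ∀ i ∈ s, ∀ z ∈ UH, analyticOrderAt (fun w => jInv w - a i) z ≠ ⊤)
    (hord : ∀ z ∈ UH, analyticOrderAt G z =
      ∑ i ∈ s, e i • analyticOrderAt (fun w => jInv w - a i) z)
    {A : ℤ} {C γ : ℂ} (hjet : Jet (fun z => C * G z * pp z ^ A) 0 γ) :
    ∑ i ∈ s, (e i : ℂ) * (a i - 744) = -γ := by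
  set P : ℂ → ℂ := fun z => ∏ i ∈ s, (jInv z - a i) ^ e i with hPdef
  have hPd : DifferentiableOn ℂ P UH :=
    DifferentiableOn.fun_finsetProd fun i _ => (differentiableOn_jInv.sub_const _).pow _
  have hja : ∀ z ∈ UH, ∀ i, AnalyticAt ℂ (fun w => jInv w - a i) z := fun z hz i =>
    (differentiableOn_jInv.sub_const _).analyticAt (isOpen_UH.mem_nhds hz)
  have hPord : ∀ z ∈ UH, analyticOrderAt P z =
      ∑ i ∈ s, e i • analyticOrderAt (fun w => jInv w - a i) z := by
    intro z hz
    rw [(analyticOrderAt_finset_prod s (fun i w => (jInv w - a i) ^ e i)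
      (fun i _ => (hja z hz i).pow (e i))).2]
    exact Finset.sum_congr rfl fun i _ => analyticOrderAt_pow (hja z hz i) (e i)
  have hPtop : ∀ z ∈ UH, analyticOrderAt P z ≠ ⊤ := by
    intro z hz
    rw [hPord z hz]
    refine WithTop.sum_ne_top.2 fun i hi => ?_
    obtain ⟨m, hm⟩ := ENat.ne_top_iff_exists.1 (htop i hi z hz)
    rw [← hm, nsmul_eq_mul]
    exact ENat.natCast_ne_top (e i * m)
  have hPS : ∀ z ∈ UH, P (-1 / z) = P z := fun z hz => by simp only [hPdef, jInv_neg_inv hz]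
  have hPT : ∀ z ∈ UH, P (z + 1) = P z := fun z hz => by simp only [hPdef, jInv_add_one hz]
  obtain ⟨F, hFd, hF0, hGF, hfreq⟩ := exists_global_quotient hG hPd hPtop
    fun z hz => (hord z hz).trans (hPord z hz).symm
  have hsc : ContinuousOn (fun z : ℂ => -1 / z) UH :=
    continuousOn_const.div continuousOn_id fun z hz => UH.ne_zero hz
  have hFS := quotient_invariant hFd.continuousOn hsc (fun z hz => neg_inv_mem hz) hGF hfreq hS hPS
  have hFT := quotient_invariant hFd.continuousOn (by fun_prop) (fun z hz => add_one_mem hz)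
    hGF hfreq hT hPT
  have hPjet : Jet (fun z => P z * pp z ^ (2 * ∑ i ∈ s, e i)) 0
      (∑ i ∈ s, (e i : ℂ) * (744 - a i)) := by
    have := Jet.prod s (fun i _ => (jet_jInv_sub (a i)).pow (e i))
    simp only [mul_zero, Finset.sum_const_zero] at this
    refine this.congr (Eventually.of_forall fun z => ?_)
    simp only [mul_pow, Finset.prod_mul_distrib, hPdef, ← pow_mul, Finset.mul_sum,
      Finset.prod_pow_eq_pow_sum]
  set B : ℤ := A - 2 * ∑ i ∈ s, e i with hB
  have hFjet : Jet (fun z => C * F z * pp z ^ B) 0 (γ - ∑ i ∈ s, (e i : ℂ) * (744 - a i)) := by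
    have h1 := hjet.div hPjet
    rw [sub_zero] at h1
    refine h1.congr ?_
    have h2 : ∀ᶠ z in atInf, P z * pp z ^ (2 * ∑ i ∈ s, e i) ≠ 0 :=
      hPjet.tendsto_one.eventually_ne one_ne_zero
    filter_upwards [h2, eventually_mem_UH] with z h3 h4
    rw [div_eq_iff h3, hGF z h4, hB]
    have h5 : pp z ^ A = pp z ^ (A - 2 * ∑ i ∈ s, (e i : ℤ)) * pp z ^ (2 * ∑ i ∈ s, e i) := by
      rw [← zpow_natCast, ← zpow_add₀ (pp_ne_zero z)]
      congr 1
      push_cast; ring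
    rw [Nat.cast_sum, h5]
    ring
  have hC : C ≠ 0 := by
    rintro rfl
    have := hFjet.tendsto_one
    simp only [zero_mul] at this
    exact zero_ne_one (tendsto_nhds_unique tendsto_const_nhds this)
  have hlim := hFjet.tendsto_one
  have hconst : ∃ c, ∀ z ∈ UH, F z = c := by
    rcases le_or_gt B 0 with hB0 | hB0
    · refine const_of_invariant hFd hFS hFT ?_
      obtain ⟨b, hb⟩ := Int.eq_ofNat_of_zero_le (neg_nonneg.2 hB0)
      have h1 : Tendsto (fun z => C⁻¹ * (C * F z * pp z ^ B) * pp z ^ b) atInf (𝓝 (C⁻¹ * 1 * 0 ^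
          b)) :=
        (hlim.const_mul _).mul (tendsto_pp.pow b)
      have h2 := h1.norm.eventually_lt_const (lt_add_one _)
      obtain ⟨A₀, hA⟩ := atInf_eventually.1 h2
      refine ⟨A₀, ‖C⁻¹ * 1 * 0 ^ b‖ + 1, fun z hz hzU => ?_⟩
      refine le_trans (le_of_eq ?_) (hA z hz).le
      congr 1
      have h3 : pp z ^ B * pp z ^ b = 1 := by
        rw [← zpow_natCast, ← zpow_add₀ (pp_ne_zero z)]
        have : B + (b : ℤ) = 0 := by
          have : -B = (b : ℤ) := hb
          linarith
        rw [this, zpow_zero]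
      rw [mul_assoc, mul_assoc, mul_assoc, h3, mul_one, inv_mul_cancel_left₀ hC]
    · obtain ⟨c, hc⟩ : ∃ c, ∀ z ∈ UH, (F z)⁻¹ = c := by
        refine const_of_invariant (hFd.inv hF0) (fun z hz => by rw [hFS z hz])
          (fun z hz => by rw [hFT z hz]) ?_
        obtain ⟨b, hb⟩ := Int.eq_ofNat_of_zero_le hB0.le
        have h1 : Tendsto (fun z => C * (C * F z * pp z ^ B)⁻¹ * pp z ^ b) atInf
            (𝓝 (C * 1⁻¹ * 0 ^ b)) :=
          ((hlim.inv₀ one_ne_zero).const_mul _).mul (tendsto_pp.pow b)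
        have h2 := h1.norm.eventually_lt_const (lt_add_one _)
        obtain ⟨A₀, hA⟩ := atInf_eventually.1 h2
        refine ⟨A₀, ‖C * 1⁻¹ * 0 ^ b‖ + 1, fun z hz hzU => ?_⟩
        refine le_trans (le_of_eq ?_) (hA z hz).le
        congr 1
        have h3 : pp z ^ B = pp z ^ b := by rw [hb]; exact zpow_natCast _ _
        rw [h3]
        have h4 : pp z ^ b ≠ 0 := pow_ne_zero _ (pp_ne_zero z)
        have := hF0 z hzU
        field_simp
      exact ⟨c⁻¹, fun z hz => by rw [← hc z hz, inv_inv]⟩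
  obtain ⟨c, hc⟩ := hconst
  have hlim2 : Tendsto (fun z => C * c * pp z ^ B) atInf (𝓝 1) := by
    refine hlim.congr' ?_
    filter_upwards [eventually_mem_UH] with z hz
    rw [hc z hz]
  have hc0 : c ≠ 0 := by
    have := hF0 I I_mem_UH
    rwa [hc I I_mem_UH] at this
  have hB0 : B = 0 := by
    have hnear : ∀ b : ℕ, b ≠ 0 → Tendsto (fun z => pp z ^ b) atInf (𝓝 0) := fun b hb => by
      have := tendsto_pp.pow b
      rwa [zero_pow hb] at this
    rcases lt_trichotomy B 0 with h | h | h
    · exfalso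
      obtain ⟨b, hb⟩ := Int.eq_ofNat_of_zero_le (neg_nonneg.2 h.le)
      have hb0 : b ≠ 0 := by rintro rfl; simp at hb; omega
      have h1 := hlim2.mul (hnear b hb0)
      rw [mul_zero] at h1
      have h2 : (fun z => C * c * pp z ^ B * pp z ^ b) = fun _ => C * c := by
        ext z
        have : B = -(b : ℤ) := by have : -B = (b : ℤ) := hb; linarith
        rw [this, _root_.zpow_neg, zpow_natCast, mul_assoc, inv_mul_cancel₀ (pow_ne_zero _
            (pp_ne_zero z)),
          mul_one]
      rw [h2] at h1
      exact mul_ne_zero hC hc0 (tendsto_nhds_unique tendsto_const_nhds h1)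
    · exact h
    · exfalso
      obtain ⟨b, hb⟩ := Int.eq_ofNat_of_zero_le h.le
      have hb0 : b ≠ 0 := by rintro rfl; simp at hb; omega
      have h1 := (hnear b hb0).const_mul (C * c)
      rw [mul_zero] at h1
      have h2 : (fun z => C * c * pp z ^ B) = fun z => C * c * pp z ^ b := by
        ext z; rw [hb]; exact congrArg _ (zpow_natCast _ _)
      rw [h2] at hlim2
      exact zero_ne_one (tendsto_nhds_unique h1 hlim2)
  have hCc : C * c = 1 := by
    simp only [hB0, zpow_zero, mul_one] at hlim2
    exact tendsto_nhds_unique tendsto_const_nhds hlim2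
  have hfin : Jet (fun _ => 1) 0 (γ - ∑ i ∈ s, (e i : ℂ) * (744 - a i)) := by
    refine hFjet.congr ?_
    filter_upwards [eventually_mem_UH] with z hz
    rw [hc z hz, hB0, zpow_zero, mul_one, hCc]
  have h0 := Jet.eq_zero_of_one hfin
  rw [sub_eq_zero] at h0
  rw [h0, ← Finset.sum_neg_distrib]
  exact Finset.sum_congr rfl fun i _ => by ring

/-- Upper triangular integral matrices. -/
def herm (a b d : ℤ) : M2 := !![a, b; 0, d]

lemma det_herm (a b d : ℤ) : (herm a b d).det = a * d := by simp [herm]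

/-- The indices `(d, b)` of the Hermite normal forms of determinant `n`. -/
def hidx (n : ℕ) : Finset (Σ _ : ℕ, ℕ) := n.divisors.sigma fun d => Finset.range d

/-- The Hermite normal form with index `(d, b)`. -/
def hmat (n : ℕ) (i : Σ _ : ℕ, ℕ) : M2 := herm ((n / i.1 : ℕ) : ℤ) i.2 i.1

lemma det_hmat {n : ℕ} {i : Σ _ : ℕ, ℕ} (hi : i ∈ hidx n) : (hmat n i).det = n := by
  simp only [hidx, Finset.mem_sigma, Nat.mem_divisors] at hi
  rw [hmat, det_herm]
  exact_mod_cast Nat.div_mul_cancel hi.1.1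

lemma exists_herm {N : M2} (hN : 0 < N.det) : ∃ (γ : SL(2, ℤ)) (a b d : ℤ),
    0 < a ∧ 0 < d ∧ N = (γ : M2) * herm a b d := by
  set g : ℤ := ((Int.gcd (N 0 0) (N 1 0) : ℕ) : ℤ) with hg
  have hg0 : g ≠ 0 := by
    intro h
    rw [hg, Int.natCast_eq_zero, Int.gcd_eq_zero_iff] at h
    rw [det_eq, h.1, h.2] at hN
    simp at hN
  have hgp : 0 < g := lt_of_le_of_ne (Int.natCast_nonneg _) (Ne.symm hg0)
  obtain ⟨x, hx⟩ : g ∣ N 0 0 := Int.gcd_dvd_left _ _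
  obtain ⟨y, hy⟩ : g ∣ N 1 0 := Int.gcd_dvd_right _ _
  have hco : IsCoprime x y := by
    refine ⟨Int.gcdA (N 0 0) (N 1 0), Int.gcdB (N 0 0) (N 1 0), ?_⟩
    have h := Int.gcd_eq_gcd_ab (N 0 0) (N 1 0)
    refine mul_left_cancel₀ hg0 ?_
    rw [← hg] at h
    linear_combination -h + Int.gcdA (N 0 0) (N 1 0) * (-hx) + Int.gcdB (N 0 0) (N 1 0) * (-hy)
  obtain ⟨γ, h0, h1⟩ := hco.exists_SL2_col 0
  have hinv : ((γ⁻¹ : SL(2, ℤ)) : M2) = !![γ 1 1, - γ 0 1; - γ 1 0, γ 0 0] := by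
    rw [Matrix.SpecialLinearGroup.coe_inv, Matrix.adjugate_fin_two]
  have hdet := γ.2
  rw [Matrix.det_fin_two] at hdet
  set M : M2 := ((γ⁻¹ : SL(2, ℤ)) : M2) * N with hM
  have hNM : N = (γ : M2) * M := by
    rw [hM, ← Matrix.mul_assoc, ← Matrix.SpecialLinearGroup.coe_mul, mul_inv_cancel]
    simp
  have hM0 : M 0 0 = g := by
    simp only [hM, hinv, Matrix.mul_apply, Fin.sum_univ_two]
    simp only [Matrix.of_apply, Matrix.cons_val_zero, Matrix.cons_val_one, Matrix.cons_val',
        Matrix.cons_val_fin_one]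
    rw [hx, hy, ← h0, ← h1]
    linear_combination g * hdet
  have hM1 : M 1 0 = 0 := by
    simp only [hM, hinv, Matrix.mul_apply, Fin.sum_univ_two]
    simp only [Matrix.of_apply, Matrix.cons_val_zero, Matrix.cons_val_one, Matrix.cons_val',
        Matrix.cons_val_fin_one]
    rw [hx, hy, ← h0, ← h1]
    ring
  have hMd : M.det = N.det := by
    rw [hM, Matrix.det_mul, Matrix.SpecialLinearGroup.det_coe, one_mul]
  refine ⟨γ, M 0 0, M 0 1, M 1 1, hM0 ▸ hgp, ?_, ?_⟩
  · rw [← hMd, det_eq, hM1, hM0] at hN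
    exact pos_of_mul_pos_right (by linarith) hgp.le
  · conv_lhs => rw [hNM]
    congr 1
    ext i j
    fin_cases i <;> fin_cases j <;> simp [herm, hM1]

lemma shift_mul_herm (k a b d : ℤ) :
    ((ModularGroup.T ^ k : SL(2, ℤ)) : M2) * herm a b d = herm a (b + k * d) d := by
  rw [ModularGroup.coe_T_zpow]
  ext i j
  fin_cases i <;> fin_cases j <;> simp [herm, Matrix.mul_apply]

lemma exists_hmat {n : ℕ} (hn : n ≠ 0) {N : M2} (hN : N.det = n) :
    ∃ i ∈ hidx n, ∃ γ : SL(2, ℤ), N = (γ : M2) * hmat n i := by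
  obtain ⟨γ, a, b, d, ha, hd, h⟩ := exists_herm (N := N) (by rw [hN]; positivity)
  have hprod : a * d = n := by
    rw [← hN, h, Matrix.det_mul, Matrix.SpecialLinearGroup.det_coe, one_mul, det_herm]
  lift a to ℕ using ha.le
  lift d to ℕ using hd.le
  have hprod' : a * d = n := by exact_mod_cast hprod
  have hd0 : 0 < d := by exact_mod_cast hd
  have hmod := Int.emod_nonneg b (ne_of_gt hd)
  have hlt := Int.emod_lt_of_pos b hd
  refine ⟨⟨d, (b % d).toNat⟩, ?_, γ * ModularGroup.T ^ (b / d), ?_⟩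
  · simp only [hidx, Finset.mem_sigma, Nat.mem_divisors, Finset.mem_range]
    exact ⟨⟨⟨a, by rw [← hprod']; ring⟩, hn⟩, by omega⟩
  · rw [h, Matrix.SpecialLinearGroup.coe_mul, Matrix.mul_assoc, hmat, shift_mul_herm]
    simp only
    rw [Int.toNat_of_nonneg hmod, ← hprod', Nat.mul_div_cancel _ hd0, mul_comm (b / (d : ℤ)),
      Int.emod_add_mul_ediv]

lemma hmat_unique {n : ℕ} {i j : Σ _ : ℕ, ℕ} (hi : i ∈ hidx n) (hj : j ∈ hidx n)
    {γ : SL(2, ℤ)} (h : (γ : M2) * hmat n i = hmat n j) : i = j := by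
  obtain ⟨d, b⟩ := i
  obtain ⟨d', b'⟩ := j
  simp only [hidx, Finset.mem_sigma, Nat.mem_divisors, Finset.mem_range] at hi hj
  obtain ⟨⟨⟨a, rfl⟩, hn⟩, hb⟩ := hi
  obtain ⟨⟨⟨a', hn'⟩, -⟩, hb'⟩ := hj
  have ha0 : 0 < a := Nat.pos_of_ne_zero (right_ne_zero_of_mul hn)
  have hd0 : 0 < d := by omega
  have hd0' : 0 < d' := by omega
  have ha0' : 0 < a' := Nat.pos_of_ne_zero (right_ne_zero_of_mul (hn' ▸ hn))
  have e00 := congrFun (congrFun h 0) 0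
  have e01 := congrFun (congrFun h 0) 1
  have e10 := congrFun (congrFun h 1) 0
  have e11 := congrFun (congrFun h 1) 1
  simp only [hmat, herm, Matrix.mul_apply, Fin.sum_univ_two, Matrix.of_apply, Matrix.cons_val_zero,
    Matrix.cons_val_one, Matrix.cons_val', Matrix.cons_val_fin_one, Nat.mul_div_cancel_left _ hd0,
    mul_zero, add_zero] at e00 e01 e10 e11
  rw [hn', Nat.mul_div_cancel_left _ hd0'] at e00
  have hc : γ 1 0 = 0 := (mul_eq_zero.1 e10).resolve_right (by positivity)
  have hdet := γ.2
  rw [Matrix.det_fin_two, hc, mul_zero, sub_zero] at hdet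
  have hpos : 0 < γ 0 0 := by
    have : 0 < γ 0 0 * (a : ℤ) := by rw [e00]; positivity
    exact pos_of_mul_pos_left this (by positivity)
  have h0 : γ 0 0 = 1 := by
    rcases Int.mul_eq_one_iff_eq_one_or_neg_one.1 hdet with h1 | h1
    · exact h1.1
    · omega
  have h1 : γ 1 1 = 1 := by rw [h0, one_mul] at hdet; exact hdet
  rw [hc, h1, zero_mul, zero_add, one_mul] at e11
  have hdd : d = d' := by exact_mod_cast e11
  subst hdd
  rw [h0, one_mul] at e01
  have hbb : (b : ℤ) = b' := by
    have h2 := Int.emod_eq_of_lt (a := (b : ℤ)) (b := d) (by positivity) (by exact_mod_cast hb)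
    have h3 := Int.emod_eq_of_lt (a := (b' : ℤ)) (b := d) (by positivity) (by exact_mod_cast hb')
    rw [← h2, ← h3, ← e01, Int.add_mul_emod_self_right]
  have : b = b' := by exact_mod_cast hbb
  rw [this]

lemma isScaled_sl_mul {γ : SL(2, ℤ)} {N : M2} : IsScaled ((γ : M2) * N) ↔ IsScaled N := by
  constructor
  · rintro ⟨t, δ, h⟩
    refine ⟨t, γ⁻¹ * δ, ?_⟩
    rw [Matrix.SpecialLinearGroup.coe_mul, ← Matrix.mul_smul, ← h, ← Matrix.mul_assoc,
      ← Matrix.SpecialLinearGroup.coe_mul, inv_mul_cancel]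
    simp
  · rintro ⟨t, δ, rfl⟩
    exact ⟨t, γ * δ, by rw [Matrix.SpecialLinearGroup.coe_mul, Matrix.mul_smul]⟩

lemma isScaled_mul_sl {γ : SL(2, ℤ)} {N : M2} : IsScaled (N * (γ : M2)) ↔ IsScaled N := by
  constructor
  · rintro ⟨t, δ, h⟩
    refine ⟨t, δ * γ⁻¹, ?_⟩
    rw [Matrix.SpecialLinearGroup.coe_mul, ← Matrix.smul_mul, ← h, Matrix.mul_assoc,
      ← Matrix.SpecialLinearGroup.coe_mul, mul_inv_cancel]
    simp
  · rintro ⟨t, δ, rfl⟩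
    exact ⟨t, δ * γ, by rw [Matrix.SpecialLinearGroup.coe_mul, Matrix.smul_mul]⟩

namespace ModFam

variable {ℓ : ℕ} (𝓕 : ModFam ℓ)

open Classical in
/-- The difference of `φ v` and its image under `N`, when it is not degenerate. -/
noncomputable def fac (v : Fin 2 → ZMod ℓ) (N : M2) (z : ℂ) : ℂ :=
  if IsScaled N ∨ act N v ∉ 𝓕.V then 1 else 𝓕.φ v z - 𝓕.φ (act N v) (mob N z)

lemma stable_iff {v : Fin 2 → ZMod ℓ} (γ : SL(2, ℤ)) : act γ v ∈ 𝓕.V ↔ v ∈ 𝓕.V := by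
  refine ⟨fun h => ?_, fun h => 𝓕.stable v h γ⟩
  have := 𝓕.stable _ h γ⁻¹
  rwa [act_sl_inv_act] at this

lemma fac_sl_mul {v : Fin 2 → ZMod ℓ} {N : M2} (hN : 0 < N.det) (γ : SL(2, ℤ)) {z : ℂ}
    (hz : z ∈ UH) : 𝓕.fac v ((γ : M2) * N) z = 𝓕.fac v N z := by
  simp only [fac]
  classical
  refine if_congr ?_ rfl ?_
  · rw [isScaled_sl_mul, act_mul, 𝓕.stable_iff]
  · rw [act_mul, mob_mul (den_ne_zero hN hz), 𝓕.equi _ γ _ (mob_mem hN hz)]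

lemma fac_mul_sl {v : Fin 2 → ZMod ℓ} {N : M2} (γ : SL(2, ℤ)) {z : ℂ} (hz : z ∈ UH) :
    𝓕.fac (act γ v) N (mob γ z) = 𝓕.fac v (N * (γ : M2)) z := by
  simp only [fac]
  classical
  refine if_congr ?_ rfl ?_
  · rw [isScaled_mul_sl, act_mul]
  · rw [act_mul, mob_mul (sl_den γ hz), 𝓕.equi v γ z hz]

/-- The product of all the factors attached to matrices of determinant `n`. -/
noncomputable def prodFac (n : ℕ) (z : ℂ) : ℂ :=
  ∏ v ∈ 𝓕.V, ∏ i ∈ hidx n, 𝓕.fac v (hmat n i) z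

lemma prod_hidx_mul {n : ℕ} (hn : n ≠ 0) (f : M2 → ℂ)
    (hf : ∀ N : M2, N.det = n → ∀ γ : SL(2, ℤ), f ((γ : M2) * N) = f N) (γ : SL(2, ℤ)) :
    ∏ i ∈ hidx n, f (hmat n i * (γ : M2)) = ∏ i ∈ hidx n, f (hmat n i) := by
  classical
  have hdet : ∀ γ : SL(2, ℤ), ∀ i ∈ hidx n, (hmat n i * (γ : M2)).det = n := fun γ i hi => by
    rw [Matrix.det_mul, Matrix.SpecialLinearGroup.det_coe, mul_one, det_hmat hi]
  choose! r hr δ hδ using fun γ : SL(2, ℤ) => fun i hi => exists_hmat hn (hdet γ i hi)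
  have hback : ∀ γ : SL(2, ℤ), ∀ i ∈ hidx n, r γ⁻¹ (r γ i) = i := by
    intro γ i hi
    have h1 := hδ γ i hi
    have h2 := hδ γ⁻¹ _ (hr γ i hi)
    refine (hmat_unique (γ := (δ γ i * δ γ⁻¹ (r γ i))) (hr γ⁻¹ _ (hr γ i hi)) hi ?_)
    rw [Matrix.SpecialLinearGroup.coe_mul, Matrix.mul_assoc, ← h2, ← Matrix.mul_assoc, ← h1,
      Matrix.mul_assoc, ← Matrix.SpecialLinearGroup.coe_mul, mul_inv_cancel]
    simp
  refine Finset.prod_bij' (fun i _ => r γ i) (fun i _ => r γ⁻¹ i) (hr γ) (hr γ⁻¹) (hback γ) ?_ ?_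
  · intro i hi
    have := hback γ⁻¹ i hi
    rwa [inv_inv] at this
  · intro i hi
    rw [hδ γ i hi, hf _ (det_hmat (hr γ i hi))]

lemma prodFac_sl {n : ℕ} (hn : n ≠ 0) (γ : SL(2, ℤ)) {z : ℂ} (hz : z ∈ UH) :
    𝓕.prodFac n (mob γ z) = 𝓕.prodFac n z := by
  have h1 : ∀ v ∈ 𝓕.V, ∏ i ∈ hidx n, 𝓕.fac (act γ v) (hmat n i) (mob γ z) =
      ∏ i ∈ hidx n, 𝓕.fac v (hmat n i) z := by
    intro v _
    simp only [𝓕.fac_mul_sl γ hz]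
    exact prod_hidx_mul hn (fun N => 𝓕.fac v N z)
      (fun N hN γ => 𝓕.fac_sl_mul (by rw [hN]; positivity) γ hz) γ
  rw [prodFac, prodFac, ← Finset.prod_congr rfl h1]
  refine (Finset.prod_bij' (fun v _ => act γ v) (fun v _ => act (γ⁻¹ : SL(2, ℤ)) v)
    (fun v hv => 𝓕.stable v hv γ) (fun v hv => 𝓕.stable v hv γ⁻¹)
    (fun v _ => act_sl_inv_act γ v) (fun v _ => act_act_sl_inv γ v) fun v _ => rfl).symm

lemma analyticAt_fac {v : Fin 2 → ZMod ℓ} (hv : v ∈ 𝓕.V) {N : M2} (hN : 0 < N.det) {α : ℂ}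
    (hα : α ∈ UH) : AnalyticAt ℂ (𝓕.fac v N) α := by
  by_cases h : IsScaled N ∨ act N v ∉ 𝓕.V
  · have : 𝓕.fac v N = fun _ => 1 := by ext z; rw [fac, if_pos h]
    rw [this]; exact analyticAt_const
  · have : 𝓕.fac v N = fun z => 𝓕.φ v z - 𝓕.φ (act N v) (mob N z) := by
      ext z; rw [fac, if_neg h]
    rw [this]
    push Not at h
    refine (𝓕.analyticAt hv hα).sub (AnalyticAt.fun_comp (𝓕.analyticAt h.2 (mob_mem hN hα)) ?_)
    have : AnalyticAt ℂ (fun z : ℂ => ((N 0 0 : ℂ) * z + N 0 1) / ((N 1 0 : ℂ) * z + N 1 1)) α :=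
      AnalyticAt.div (by fun_prop) (by fun_prop) (den_ne_zero hN hα)
    exact this

lemma differentiableOn_prodFac {n : ℕ} (hn : n ≠ 0) : DifferentiableOn ℂ (𝓕.prodFac n) UH := by
  refine DifferentiableOn.fun_finsetProd fun v hv => DifferentiableOn.fun_finsetProd fun i hi => ?_
  exact fun z hz => (𝓕.analyticAt_fac hv (by rw [det_hmat hi]; positivity)
    hz).differentiableAt.differentiableWithinAt

/-- Twice the order of a factor counts the translates of the matrix fixing a point and a vector. -/
lemma order_fac {v : Fin 2 → ZMod ℓ} (hv : v ∈ 𝓕.V) {N : M2} (hN : 0 < N.det)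
    (hs : ¬IsScaled N) {α : ℂ} (hα : α ∈ UH) :
    Finite {γ : SL(2, ℤ) // mob ((γ : M2) * N) α = α ∧ act ((γ : M2) * N) v = v} ∧
    2 * analyticOrderAt (𝓕.fac v N) α =
      Nat.card {γ : SL(2, ℤ) // mob ((γ : M2) * N) α = α ∧ act ((γ : M2) * N) v = v} := by
  have hmul : ∀ γ : SL(2, ℤ), mob ((γ : M2) * N) α = mob γ (mob N α) := fun γ =>
    mob_mul (den_ne_zero hN hα)
  by_cases hex : ∃ γ : SL(2, ℤ), mob ((γ : M2) * N) α = α ∧ act ((γ : M2) * N) v = v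
  · obtain ⟨γ, h1, h2⟩ := hex
    have hdet : 0 < ((γ : M2) * N).det := by
      rw [Matrix.det_mul, Matrix.SpecialLinearGroup.det_coe, one_mul]; exact hN
    have hcard : Nat.card {δ : SL(2, ℤ) // mob ((δ : M2) * N) α = α ∧ act ((δ : M2) * N) v = v} =
        2 * 𝓕.ram v α := by
      rw [← 𝓕.card_stabilizer hv hα]
      refine (Nat.card_congr ((Equiv.mulRight γ).subtypeEquiv fun δ => ?_)).symm
      rw [Equiv.coe_mulRight, Matrix.SpecialLinearGroup.coe_mul, Matrix.mul_assoc,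
        act_mul (δ : M2), mob_mul (den_ne_zero hdet hα), h1, h2]
    have hram := 𝓕.ram_pos hv hα
    refine ⟨Nat.finite_of_card_ne_zero (by rw [hcard]; positivity), ?_⟩
    rw [hcard, Nat.cast_mul]
    congr 1
    rw [← 𝓕.order_factor hv hα hdet h1 (by rwa [isScaled_sl_mul])]
    refine analyticOrderAt_congr ?_
    filter_upwards [isOpen_UH.mem_nhds hα] with z hz
    rw [← 𝓕.fac_sl_mul hN γ hz, fac, if_neg, h2]
    rw [isScaled_sl_mul, h2]
    tauto
  · have hempty : IsEmpty {γ : SL(2, ℤ) // mob ((γ : M2) * N) α = α ∧ act ((γ : M2) * N) v = v} :=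
      ⟨fun γ => hex ⟨γ.1, γ.2⟩⟩
    refine ⟨inferInstance, ?_⟩
    rw [Nat.card_of_isEmpty, (𝓕.analyticAt_fac hv hN hα).analyticOrderAt_eq_zero.2]
    · simp
    · rw [fac]
      split_ifs with h
      · exact one_ne_zero
      · push Not at h
        intro h0
        obtain ⟨γ, h1, h2⟩ := 𝓕.inj _ h.2 v hv _ (mob_mem hN hα) α hα (sub_eq_zero.1 h0).symm
        exact hex ⟨γ, by rw [hmul, h1], by rw [act_mul, h2]⟩

/-- The matrices of determinant `n` fixing a given point and a given vector. -/
def fixSet (n : ℕ) (α : ℂ) (v : Fin 2 → ZMod ℓ) : Set M2 :=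
  {N | N.det = n ∧ ¬IsScaled N ∧ mob N α = α ∧ act N v = v}

lemma order_prod_hidx {n : ℕ} (hn : n ≠ 0) {v : Fin 2 → ZMod ℓ} (hv : v ∈ 𝓕.V) {α : ℂ}
    (hα : α ∈ UH) : (fixSet n α v).Finite ∧
      2 * analyticOrderAt (fun z => ∏ i ∈ hidx n, 𝓕.fac v (hmat n i) z) α =
        (fixSet n α v).ncard := by
  classical
  have hdet : ∀ i ∈ hidx n, 0 < (hmat n i).det := fun i hi => by rw [det_hmat hi]; positivity
  set A : (Σ _ : ℕ, ℕ) → Set M2 := fun i =>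
    {N | ¬IsScaled N ∧ mob N α = α ∧ act N v = v ∧ ∃ γ : SL(2, ℤ), N = (γ : M2) * hmat n i} with hA
  have hAi : ∀ i ∈ hidx n, (A i).Finite ∧
      2 * analyticOrderAt (fun z => 𝓕.fac v (hmat n i) z) α = (A i).ncard := by
    intro i hi
    by_cases hs : IsScaled (hmat n i)
    · have hAe : A i = ∅ := by
        ext N
        simp only [hA, mem_ofPred_eq, mem_empty_iff_false, iff_false]
        rintro ⟨h1, -, -, γ, rfl⟩
        exact h1 (isScaled_sl_mul.2 hs)
      rw [hAe]
      refine ⟨finite_empty, ?_⟩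
      rw [(𝓕.analyticAt_fac hv (hdet i hi) hα).analyticOrderAt_eq_zero.2]
      · simp
      · rw [fac, if_pos (Or.inl hs)]; exact one_ne_zero
    · obtain ⟨h1, h2⟩ := 𝓕.order_fac hv (hdet i hi) hs hα
      have hinj : Function.Injective fun γ : SL(2, ℤ) => (γ : M2) * hmat n i := by
        intro γ δ h
        have h3 := congrArg (fun M : M2 => M * (hmat n i).adjugate) h
        simp only [Matrix.mul_assoc, Matrix.mul_adjugate, Matrix.mul_smul, Matrix.mul_one] at h3
        exact Subtype.ext (smul_right_injective M2 (ne_of_gt (hdet i hi)) h3)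
      have hAim : A i = (fun γ : SL(2, ℤ) => (γ : M2) * hmat n i) ''
          {γ | mob ((γ : M2) * hmat n i) α = α ∧ act ((γ : M2) * hmat n i) v = v} := by
        ext N
        constructor
        · rintro ⟨-, h4, h5, γ, rfl⟩
          exact ⟨γ, ⟨h4, h5⟩, rfl⟩
        · rintro ⟨γ, ⟨h4, h5⟩, rfl⟩
          exact ⟨by rwa [isScaled_sl_mul], h4, h5, γ, rfl⟩
      rw [hAim, Set.ncard_image_of_injective _ hinj]
      exact ⟨Set.Finite.image _ h1, h2⟩
  have hU : fixSet n α v = ⋃ i ∈ hidx n, A i := by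
    ext N
    simp only [fixSet, hA, mem_ofPred_eq, mem_iUnion, exists_prop]
    constructor
    · rintro ⟨h1, h2, h3, h4⟩
      obtain ⟨i, hi, hγ⟩ := exists_hmat hn h1
      exact ⟨i, hi, h2, h3, h4, hγ⟩
    · rintro ⟨i, hi, h2, h3, h4, γ, rfl⟩
      refine ⟨?_, h2, h3, h4⟩
      rw [Matrix.det_mul, Matrix.SpecialLinearGroup.det_coe, one_mul, det_hmat hi]
  have hdisj : ∀ i ∈ hidx n, ∀ j ∈ hidx n, i ≠ j → Disjoint (A i) (A j) := by
    intro i hi j hj hij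
    rw [Set.disjoint_left]
    rintro _ ⟨-, -, -, γ, rfl⟩ ⟨-, -, -, δ, h⟩
    refine hij (hmat_unique (γ := δ⁻¹ * γ) hi hj ?_)
    rw [Matrix.SpecialLinearGroup.coe_mul, Matrix.mul_assoc, h, ← Matrix.mul_assoc,
      ← Matrix.SpecialLinearGroup.coe_mul, inv_mul_cancel]
    simp
  rw [hU]
  refine ⟨Set.Finite.biUnion (hidx n).finite_toSet fun i hi => (hAi i hi).1, ?_⟩
  rw [(analyticOrderAt_finset_prod _ _ fun i hi => 𝓕.analyticAt_fac hv (hdet i hi) hα).2,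
    Finset.mul_sum, Finset.sum_congr rfl fun i hi => (hAi i hi).2]
  have : ∀ s ⊆ hidx n, ((∑ i ∈ s, (A i).ncard : ℕ)) = (⋃ i ∈ s, A i).ncard := by
    intro s
    induction s using Finset.induction_on with
    | empty => simp
    | insert i s his ih =>
      intro hs
      have hi := hs (Finset.mem_insert_self i s)
      have hs' := (Finset.subset_insert i s).trans hs
      have hd : Disjoint (A i) (⋃ j ∈ s, A j) := by
        rw [Set.disjoint_iUnion₂_right]
        intro j hj
        exact hdisj i hi j (hs' hj) (by rintro rfl; exact his hj)
      rw [Finset.sum_insert his, ih hs', Finset.set_biUnion_insert,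
        Set.ncard_union_eq hd (hAi i hi).1
          (Set.Finite.biUnion s.finite_toSet fun j hj => (hAi j (hs' hj)).1)]
  rw [← this _ subset_rfl, Nat.cast_sum]

end ModFam

/-- Composition of a form with an integral substitution. -/
def fcomp (f : ℤ × ℤ × ℤ) (g : M2) : ℤ × ℤ × ℤ :=
  (formVal f (g 0 0) (g 1 0),
    2 * f.1 * g 0 0 * g 0 1 + f.2.1 * (g 0 0 * g 1 1 + g 0 1 * g 1 0) + 2 * f.2.2 * g 1 0 * g 1 1,
    formVal f (g 0 1) (g 1 1))

lemma formVal_fcomp (f : ℤ × ℤ × ℤ) (g : M2) (x y : ℤ) :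
    formVal (fcomp f g) x y = formVal f (g 0 0 * x + g 0 1 * y) (g 1 0 * x + g 1 1 * y) := by
  simp only [formVal, fcomp]; ring

lemma form_ext {f f' : ℤ × ℤ × ℤ} (h : ∀ x y, formVal f x y = formVal f' x y) : f = f' := by
  obtain ⟨a, b, c⟩ := f
  obtain ⟨a', b', c'⟩ := f'
  have h1 := h 1 0
  have h2 := h 0 1
  have h3 := h 1 1
  simp only [formVal] at h1 h2 h3
  ring_nf at h1 h2 h3
  refine Prod.ext h1 (Prod.ext ?_ h2)
  simp only
  linarith

lemma formRel_iff {f f' : ℤ × ℤ × ℤ} : FormRel f f' ↔ ∃ g : SL(2, ℤ), f' = fcomp f g := by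
  refine exists_congr fun g => ⟨fun h => form_ext fun x y => ?_, fun h x y => ?_⟩
  · rw [h, formVal_fcomp]
  · rw [h, formVal_fcomp]

lemma fcomp_mul (f : ℤ × ℤ × ℤ) (g h : M2) : fcomp f (g * h) = fcomp (fcomp f g) h := by
  refine form_ext fun x y => ?_
  simp only [formVal_fcomp, Matrix.mul_apply, Fin.sum_univ_two]
  congr 1 <;> ring

lemma fcomp_one (f : ℤ × ℤ × ℤ) : fcomp f 1 = f := by
  refine form_ext fun x y => ?_
  simp [formVal_fcomp]

lemma fcomp_sl_one (f : ℤ × ℤ × ℤ) : fcomp f ((1 : SL(2, ℤ)) : M2) = f := by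
  rw [Matrix.SpecialLinearGroup.coe_one, fcomp_one]

lemma formRel_refl (f : ℤ × ℤ × ℤ) : FormRel f f := formRel_iff.2 ⟨1, (fcomp_sl_one f).symm⟩

lemma _root_.FormRel.symm {f f' : ℤ × ℤ × ℤ} (h : FormRel f f') : FormRel f' f := by
  obtain ⟨g, rfl⟩ := formRel_iff.1 h
  refine formRel_iff.2 ⟨g⁻¹, ?_⟩
  rw [← fcomp_mul, ← Matrix.SpecialLinearGroup.coe_mul, mul_inv_cancel, fcomp_sl_one]

lemma _root_.FormRel.trans {f f' f'' : ℤ × ℤ × ℤ} (h : FormRel f f') (h' : FormRel f' f'') :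
    FormRel f f'' := by
  obtain ⟨g, rfl⟩ := formRel_iff.1 h
  obtain ⟨g', rfl⟩ := formRel_iff.1 h'
  exact formRel_iff.2 ⟨g * g', by rw [Matrix.SpecialLinearGroup.coe_mul, fcomp_mul]⟩

lemma formRel_equivalence (d : ℤ) :
    Equivalence (fun f f' : { f : ℤ × ℤ × ℤ // IsForm d f } => FormRel f.1 f'.1) :=
  ⟨fun f => formRel_refl f.1, FormRel.symm, FormRel.trans⟩

lemma formRel_out {d : ℤ} (f : { f : ℤ × ℤ × ℤ // IsForm d f }) :
    FormRel (Quot.out (Quot.mk _ f : FormClass d)).1 f.1 :=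
  (formRel_equivalence d).quot_mk_eq_iff _ _ |>.1 (Quot.out_eq _)

lemma disc_fcomp (f : ℤ × ℤ × ℤ) (g : M2) :
    (fcomp f g).2.1 ^ 2 - 4 * (fcomp f g).1 * (fcomp f g).2.2 =
      g.det ^ 2 * (f.2.1 ^ 2 - 4 * f.1 * f.2.2) := by
  simp only [fcomp, formVal, det_eq]; ring

lemma _root_.IsForm.val_pos {d : ℤ} (hd : 0 < d) {f : ℤ × ℤ × ℤ} (hf : IsForm d f) {x y : ℤ}
    (h : x ≠ 0 ∨ y ≠ 0) : 0 < formVal f x y := by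
  obtain ⟨ha, hdisc⟩ := hf
  have h1 : 4 * f.1 * formVal f x y = (2 * f.1 * x + f.2.1 * y) ^ 2 + d * y ^ 2 := by
    simp only [formVal]; linear_combination -y ^ 2 * hdisc
  have h2 : 0 < (2 * f.1 * x + f.2.1 * y) ^ 2 + d * y ^ 2 := by
    by_cases hy : y = 0
    · subst hy
      have hx : x ≠ 0 := by tauto
      have : 2 * f.1 * x ≠ 0 := by positivity
      simp only [mul_zero, add_zero, ne_eq, OfNat.ofNat_ne_zero, not_false_eq_true, zero_pow]
      positivity
    · have : 0 < d * y ^ 2 := by positivity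
      positivity
  rw [← h1] at h2
  exact pos_of_mul_pos_right h2 (by positivity)

lemma sl_col_ne_zero (g : SL(2, ℤ)) (j : Fin 2) : g 0 j ≠ 0 ∨ g 1 j ≠ 0 := by
  by_contra! h
  have := g.2
  rw [Matrix.det_fin_two] at this
  fin_cases j <;> simp_all

lemma _root_.IsForm.comp {d : ℤ} (hd : 0 < d) {f : ℤ × ℤ × ℤ} (hf : IsForm d f) (g : SL(2, ℤ)) :
    IsForm d (fcomp f g) := by
  refine ⟨hf.val_pos hd (sl_col_ne_zero g 0), ?_⟩
  rw [disc_fcomp, hf.2, Matrix.SpecialLinearGroup.det_coe]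
  ring

/-- The quadratic polynomial of a form. -/
noncomputable def fpoly (f : ℤ × ℤ × ℤ) (z : ℂ) : ℂ := f.1 * z ^ 2 + f.2.1 * z + f.2.2

lemma formRoot_mem {d : ℤ} (hd : 0 < d) {f : ℤ × ℤ × ℤ} (hf : IsForm d f) : formRoot f ∈ UH := by
  obtain ⟨ha, hdisc⟩ := hf
  have h1 : 4 * f.1 * f.2.2 - f.2.1 ^ 2 = d := by linarith
  have ha' : (0 : ℝ) < f.1 := by exact_mod_cast ha
  rw [formRoot, h1, mem_UH]
  have h2 : (-(f.2.1 : ℂ) + I * (√((d : ℤ) : ℝ) : ℝ)) / (2 * (f.1 : ℂ)) =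
      ((-(f.2.1 : ℝ) / (2 * f.1) : ℝ) : ℂ) + ((√((d : ℤ) : ℝ) / (2 * f.1) : ℝ) : ℂ) * I := by
    push_cast; ring
  rw [h2]
  have : 0 < √((d : ℤ) : ℝ) := Real.sqrt_pos.2 (by exact_mod_cast hd)
  simp only [add_im, ofReal_im, mul_im, ofReal_re, I_im, I_re, zero_add, mul_one, mul_zero,
      add_zero]
  positivity

lemma fpoly_formRoot {d : ℤ} (hd : 0 < d) {f : ℤ × ℤ × ℤ} (hf : IsForm d f) :
    fpoly f (formRoot f) = 0 := by
  obtain ⟨ha, hdisc⟩ := hf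
  have h1 : 4 * f.1 * f.2.2 - f.2.1 ^ 2 = d := by linarith
  have ha' : (f.1 : ℂ) ≠ 0 := by exact_mod_cast ha.ne'
  rw [formRoot, h1, fpoly]
  have h2 : ((√((d : ℤ) : ℝ) : ℝ) : ℂ) ^ 2 = d := by
    rw [← ofReal_pow, Real.sq_sqrt (by exact_mod_cast hd.le)]; simp
  have h3 : (4 * f.1 * f.2.2 - f.2.1 ^ 2 : ℂ) = d := by
    exact_mod_cast congrArg (Int.cast : ℤ → ℂ) h1
  field_simp
  linear_combination I ^ 2 * h2 + (d : ℂ) * I_sq + h3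

lemma quad_root_unique {a b c a' b' c' : ℝ} {z : ℂ} (hz : 0 < z.im)
    (h : (a : ℂ) * z ^ 2 + b * z + c = 0) (h' : (a' : ℂ) * z ^ 2 + b' * z + c' = 0) :
    a * b' = a' * b ∧ a * c' = a' * c := by
  have e : ((a * b' - a' * b : ℝ) : ℂ) * z + ((a * c' - a' * c : ℝ) : ℂ) = 0 := by
    push_cast; linear_combination a * h' - a' * h
  have him := congrArg Complex.im e
  have hre := congrArg Complex.re e
  simp only [add_im, mul_im, ofReal_re, ofReal_im, zero_mul, add_zero, zero_im, add_re, mul_re,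
    sub_zero, zero_re] at him hre
  have h1 : a * b' - a' * b = 0 := (mul_eq_zero.1 him).resolve_right hz.ne'
  rw [h1, zero_mul, zero_add] at hre
  exact ⟨by linarith, by linarith⟩

lemma form_eq_of_root {d : ℤ} {f f' : ℤ × ℤ × ℤ} (hf : IsForm d f)
    (hf' : IsForm d f') {z : ℂ} (hz : z ∈ UH) (h : fpoly f z = 0) (h' : fpoly f' z = 0) :
    f = f' := by
  obtain ⟨a, b, c⟩ := f
  obtain ⟨a', b', c'⟩ := f'
  obtain ⟨ha, hd1⟩ := hf
  obtain ⟨ha', hd2⟩ := hf'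
  simp only [fpoly] at h h' ha ha' hd1 hd2
  obtain ⟨e1, e2⟩ := quad_root_unique (a := a) (b := b) (c := c) (a' := a') (b' := b') (c' := c')
    (mem_UH.1 hz) (by push_cast; exact h) (by push_cast; exact h')
  have e1' : a * b' = a' * b := by exact_mod_cast e1
  have e2' : a * c' = a' * c := by exact_mod_cast e2
  have hd0 : d ≠ 0 := by
    rintro rfl
    have h1 : ((2 * a : ℝ) : ℂ) * z + (b : ℝ) = 0 := by
      have : (((2 * a : ℝ) : ℂ) * z + (b : ℝ)) ^ 2 = 0 := by
        have h3 : ((b : ℂ) ^ 2 - 4 * a * c) = 0 := by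
          have := congrArg (Int.cast : ℤ → ℂ) hd1
          push_cast at this
          linear_combination this
        push_cast
        linear_combination 4 * a * h + h3
      exact pow_eq_zero_iff (two_ne_zero) |>.1 this
    have h2 := congrArg Complex.im h1
    simp only [add_im, mul_im, ofReal_re, ofReal_im, zero_mul, add_zero, zero_im] at h2
    have : (0 : ℝ) < a := by exact_mod_cast ha
    have hz' := mem_UH.1 hz
    have : 0 < 2 * (a : ℝ) * z.im := by positivity
    linarith
  have h3 : a ^ 2 * d = a' ^ 2 * d := by
    linear_combination a ^ 2 * hd2 - a' ^ 2 * hd1 - (a * b' + a' * b) * e1'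
      + 4 * a' * a * e2'
  have h4 : a = a' := by
    have := mul_right_cancel₀ hd0 h3
    nlinarith
  subst h4
  rw [mul_left_cancel₀ ha.ne' e1', mul_left_cancel₀ ha.ne' e2']

lemma fpoly_fcomp (f : ℤ × ℤ × ℤ) (g : M2) {z : ℂ} (hz : den g z ≠ 0) :
    fpoly (fcomp f g) z = den g z ^ 2 * fpoly f (mob g z) := by
  rw [fpoly, fpoly, mob]
  field_simp
  simp only [fcomp, formVal, den]
  push_cast
  ring

lemma fpoly_formRoot_eq {d : ℤ} (hd : 0 < d) {f : ℤ × ℤ × ℤ} (hf : IsForm d f) {z : ℂ}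
    (hz : z ∈ UH) (h : fpoly f z = 0) : formRoot f = z := by
  have h1 := fpoly_formRoot hd hf
  have h2 := mem_UH.1 (formRoot_mem hd hf)
  have hz' := mem_UH.1 hz
  have ha : (0 : ℝ) < f.1 := by exact_mod_cast hf.1
  set w := formRoot f
  have h3 : (w - z) * (((f.1 : ℝ) : ℂ) * (w + z) + (f.2.1 : ℝ)) = 0 := by
    simp only [fpoly] at h h1
    push_cast
    linear_combination h1 - h
  rcases mul_eq_zero.1 h3 with h4 | h4
  · exact sub_eq_zero.1 h4
  · exfalso
    have h5 := congrArg Complex.im h4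
    simp only [add_im, mul_im, ofReal_re, ofReal_im, zero_mul, add_zero, zero_im] at h5
    have : 0 < (f.1 : ℝ) * (w.im + z.im) := by positivity
    linarith

lemma mob_formRoot_fcomp {d : ℤ} (hd : 0 < d) {f : ℤ × ℤ × ℤ} (hf : IsForm d f) (g : SL(2, ℤ)) :
    mob g (formRoot (fcomp f g)) = formRoot f := by
  have hm := formRoot_mem hd (hf.comp hd g)
  refine (fpoly_formRoot_eq hd hf (sl_mem g hm) ?_).symm
  have := fpoly_formRoot hd (hf.comp hd g)
  rw [fpoly_fcomp f g (sl_den g hm)] at this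
  exact (mul_eq_zero.1 this).resolve_left (pow_ne_zero 2 (sl_den g hm))

lemma fcomp_eq_of_mob {d : ℤ} (hd : 0 < d) {f f' : ℤ × ℤ × ℤ} (hf : IsForm d f)
    (hf' : IsForm d f') {g : SL(2, ℤ)} (h : mob g (formRoot f') = formRoot f) :
    f' = fcomp f g := by
  have hm := formRoot_mem hd hf'
  refine form_eq_of_root hf' (hf.comp hd g) hm (fpoly_formRoot hd hf') ?_
  rw [fpoly_fcomp f g (sl_den g hm), h, fpoly_formRoot hd hf, mul_zero]

lemma formWt_eq {d : ℤ} (hd : 0 < d) {f : ℤ × ℤ × ℤ} (hf : IsForm d f) :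
    formWt f = Nat.card {γ : SL(2, ℤ) // mob γ (formRoot f) = formRoot f} / 2 := by
  rw [formWt]
  congr 1
  refine Nat.card_congr (Equiv.subtypeEquivRight fun g => ⟨fun h => ?_, fun h x y => ?_⟩)
  · have : f = fcomp f g := form_ext fun x y => by rw [formVal_fcomp]; exact h x y
    conv_lhs => rw [this]
    exact mob_formRoot_fcomp hd hf g
  · conv_lhs => rw [fcomp_eq_of_mob hd hf hf h]
    rw [formVal_fcomp]

lemma card_stab_mob (γ : SL(2, ℤ)) {z : ℂ} (hz : z ∈ UH) :
    Nat.card {δ : SL(2, ℤ) // mob δ (mob γ z) = mob γ z} =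
      Nat.card {δ : SL(2, ℤ) // mob δ z = z} := by
  refine (Nat.card_congr ((MulAut.conj γ).toEquiv.subtypeEquiv fun δ => ?_)).symm
  change _ ↔ mob ((γ * δ * γ⁻¹ : SL(2, ℤ)) : M2) (mob γ z) = mob γ z
  rw [mob_sl_mul _ _ (sl_mem γ hz), mob_sl_inv_mob γ hz, mob_sl_mul _ _ hz]
  refine ⟨fun h => by rw [h], fun h => ?_⟩
  rw [← mob_sl_inv_mob γ (sl_mem δ hz), h, mob_sl_inv_mob γ hz]

lemma jInv_mob (γ : SL(2, ℤ)) {z : ℂ} (hz : z ∈ UH) : jInv (mob γ z) = jInv z := by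
  have h := equivariant_act (ℓ := 1) (fun _ => jInv)
    (fun v z hz => jInv_neg_inv hz) (fun v z hz => jInv_add_one hz) γ 0 z hz
  exact h

/-- The summand of the trace attached to a form. -/
noncomputable def jval (f : ℤ × ℤ × ℤ) : ℂ := (jInv (formRoot f) - 744) / (formWt f : ℂ)

lemma _root_.FormRel.root {d : ℤ} (hd : 0 < d) {f f' : ℤ × ℤ × ℤ} (hf : IsForm d f)
    (h : FormRel f f') : ∃ g : SL(2, ℤ), mob g (formRoot f') = formRoot f := by
  obtain ⟨g, rfl⟩ := formRel_iff.1 h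
  exact ⟨g, mob_formRoot_fcomp hd hf g⟩

lemma formWt_congr {d d' : ℤ} (hd : 0 < d) (hd' : 0 < d') {f f' : ℤ × ℤ × ℤ} (hf : IsForm d f)
    (hf' : IsForm d' f') {g : SL(2, ℤ)} (h : mob g (formRoot f') = formRoot f) :
    formWt f = formWt f' := by
  rw [formWt_eq hd hf, formWt_eq hd' hf', ← h, card_stab_mob g (formRoot_mem hd' hf')]

lemma jval_congr {d d' : ℤ} (hd : 0 < d) (hd' : 0 < d') {f f' : ℤ × ℤ × ℤ} (hf : IsForm d f)
    (hf' : IsForm d' f') {g : SL(2, ℤ)} (h : mob g (formRoot f') = formRoot f) :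
    jval f = jval f' := by
  rw [jval, jval, formWt_congr hd hd' hf hf' h, ← h, jInv_mob g (formRoot_mem hd' hf')]

lemma _root_.FormRel.jval_eq {d : ℤ} (hd : 0 < d) {f f' : ℤ × ℤ × ℤ} (hf : IsForm d f)
    (hf' : IsForm d f') (h : FormRel f f') : jval f = jval f' := by
  obtain ⟨g, hg⟩ := h.root hd hf
  exact jval_congr hd hd hf hf' hg

lemma formRel_of_mob {d : ℤ} (hd : 0 < d) {f f' : ℤ × ℤ × ℤ} (hf : IsForm d f)
    (hf' : IsForm d f') {g : SL(2, ℤ)} (h : mob g (formRoot f') = formRoot f) : FormRel f f' :=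
  formRel_iff.2 ⟨g, fcomp_eq_of_mob hd hf hf' h⟩

/-- Every class of forms contains a reduced form. -/
lemma exists_reduced {d : ℤ} (hd : 0 < d) {f : ℤ × ℤ × ℤ} (hf : IsForm d f) :
    ∃ f', IsForm d f' ∧ FormRel f f' ∧ |f'.2.1| ≤ f'.1 ∧ f'.1 ≤ f'.2.2 := by
  have hex : ∃ m : ℕ, ∃ f', IsForm d f' ∧ FormRel f f' ∧ f'.1 = m :=
    ⟨f.1.toNat, f, hf, formRel_refl f, (Int.toNat_of_nonneg hf.1.le).symm⟩
  classical
  obtain ⟨f₁, hf₁, hr₁, hm⟩ := Nat.find_spec hex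
  have hmin : ∀ f', IsForm d f' → FormRel f f' → f₁.1 ≤ f'.1 := by
    intro f' hf' hr'
    have := Nat.find_min' hex ⟨f', hf', hr', (Int.toNat_of_nonneg hf'.1.le).symm⟩
    rw [hm]
    have h0 := hf'.1
    omega
  have ha := hf₁.1
  set a := f₁.1
  set b := f₁.2.1
  set k : ℤ := -((b + a) / (2 * a)) with hk
  have hf₂ := hf₁.comp hd (ModularGroup.T ^ k)
  have hr₂ : FormRel f (fcomp f₁ (ModularGroup.T ^ k : SL(2, ℤ))) :=
    hr₁.trans (formRel_iff.2 ⟨_, rfl⟩)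
  have e1 : (fcomp f₁ (ModularGroup.T ^ k : SL(2, ℤ))).1 = a := by
    rw [ModularGroup.coe_T_zpow]; simp [fcomp, formVal, a]
  have e2 : (fcomp f₁ (ModularGroup.T ^ k : SL(2, ℤ))).2.1 = 2 * a * k + b := by
    rw [ModularGroup.coe_T_zpow]; simp [fcomp, a, b]
  refine ⟨_, hf₂, hr₂, ?_, ?_⟩
  · rw [e1, e2, hk, abs_le]
    have h1 := Int.emod_nonneg (b + a) (b := 2 * a) (by omega)
    have h2 := Int.emod_lt_of_pos (b + a) (b := 2 * a) (by omega)
    have h3 := Int.emod_add_mul_ediv (b + a) (2 * a)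
    constructor <;> linarith
  · rw [e1]
    refine (hmin _ (hf₂.comp hd ModularGroup.S) (hr₂.trans (formRel_iff.2 ⟨_, rfl⟩))).trans
      (le_of_eq ?_)
    rw [fcomp, ModularGroup.coe_S]
    simp [formVal]

lemma reduced_bound {d : ℤ} {f : ℤ × ℤ × ℤ} (hf : IsForm d f) (h1 : |f.2.1| ≤ f.1)
    (h2 : f.1 ≤ f.2.2) : 3 * f.1 ^ 2 ≤ d := by
  have h3 := sq_abs f.2.1
  have h4 : |f.2.1| ^ 2 ≤ f.1 ^ 2 := pow_le_pow_left₀ (abs_nonneg _) h1 2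
  have h5 : f.1 * f.1 ≤ f.1 * f.2.2 := mul_le_mul_of_nonneg_left h2 hf.1.le
  have := hf.2
  nlinarith

lemma finite_formClass {d : ℤ} (hd : 0 < d) : Finite (FormClass d) := by
  have hfin : Finite {p : ℤ × ℤ // p ∈ Icc (-d) d ×ˢ Icc (-d) d} :=
    ((finite_Icc (-d) d).prod (finite_Icc (-d) d)).to_subtype
  have hred : ∀ cl : FormClass d, ∃ f' : { f : ℤ × ℤ × ℤ // IsForm d f }, Quot.mk _ f' = cl ∧
      |f'.1.2.1| ≤ f'.1.1 ∧ f'.1.1 ≤ f'.1.2.2 := by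
    intro cl
    obtain ⟨f', hf', hr, h1, h2⟩ := exists_reduced hd (Quot.out cl).2
    refine ⟨⟨f', hf'⟩, ?_, h1, h2⟩
    rw [← Quot.out_eq cl]
    exact (Quot.sound (r := fun f f' : { f : ℤ × ℤ × ℤ // IsForm d f } => FormRel f.1 f'.1)
      (a := Quot.out cl) (b := ⟨f', hf'⟩) hr).symm
  choose F hF h1 h2 using hred
  refine Finite.of_injective (fun cl => (⟨((F cl).1.1, (F cl).1.2.1), ?_⟩ :
    {p : ℤ × ℤ // p ∈ Icc (-d) d ×ˢ Icc (-d) d})) ?_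
  · have h3 := reduced_bound (F cl).2 (h1 cl) (h2 cl)
    have h4 := (F cl).2.1
    have h5 : (F cl).1.1 ≤ d := by nlinarith
    have h6 := abs_le.1 ((h1 cl).trans h5)
    simp only [mem_prod, mem_Icc]
    exact ⟨⟨by linarith, h5⟩, h6⟩
  · intro x y hxy
    simp only [Subtype.mk.injEq, Prod.mk.injEq] at hxy
    have hx := (F x).2.2
    have hy := (F y).2.2
    rw [hxy.1, hxy.2] at hx
    have h4 : (4 * (F y).1.1) * (F x).1.2.2 = (4 * (F y).1.1) * (F y).1.2.2 := by linarith
    have h5 := mul_left_cancel₀ (by have := (F y).2.1; omega) h4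
    have : F x = F y := Subtype.ext (Prod.ext hxy.1 (Prod.ext hxy.2 h5))
    rw [← hF x, ← hF y, this]

lemma jInv_nonconst : ¬∃ c, ∀ z ∈ UH, jInv z = c := by
  rintro ⟨c, h⟩
  have h1 := h I I_mem_UH
  have h2 := h rho rho_mem
  rw [jInv_I] at h1
  rw [jInv_rho] at h2
  rw [← h2] at h1
  norm_num at h1

/-- The family consisting of the modular invariant. -/
noncomputable def famOne : ModFam 1 where
  φ := fun _ => jInv
  V := {0}
  holo := fun _ _ => differentiableOn_jInv
  stable := fun _ _ _ => by
    rw [Finset.mem_singleton]; exact Subsingleton.elim _ _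
  equi := fun _ γ z hz => jInv_mob γ hz
  inj := fun u _ v _ z hz w hw h => by
    obtain ⟨γ, hγ⟩ := jInv_injective hz hw h
    exact ⟨γ, hγ, Subsingleton.elim _ _⟩
  neg := fun _ => Subsingleton.elim _ _
  nonconst := fun _ _ => jInv_nonconst

/-- The family of the three conjugate eta quotients of level two. -/
noncomputable def famTwo : ModFam 2 where
  φ := lev
  V := {v | v ≠ 0}
  holo := fun v _ => differentiableOn_lev v
  stable := fun v hv γ => by
    simp only [Finset.mem_filter, Finset.mem_univ, true_and] at hv ⊢
    exact act_sl_ne_zero γ hv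
  equi := fun v γ z hz => lev_equivariant γ v hz
  inj := fun u hu v hv z hz w hw h => by
    simp only [Finset.mem_filter, Finset.mem_univ, true_and] at hu hv
    exact lev_injective hu hv hz hw h
  neg := fun v => by
    funext i
    exact ZMod.neg_eq_self_mod_two _
  nonconst := fun v hv => by
    simp only [Finset.mem_filter, Finset.mem_univ, true_and] at hv
    rintro ⟨c, h⟩
    refine jInv_nonconst ⟨(c + 16) ^ 3 / c, fun z hz => ?_⟩
    have h1 := lev_root hv hz
    have h2 := lev_ne_zero hv hz
    rw [h z hz] at h1 h2
    rw [h1, mul_div_assoc, div_self h2, mul_one]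

lemma formWt_eq_ram {d : ℤ} (hd : 0 < d) {f : ℤ × ℤ × ℤ} (hf : IsForm d f) :
    formWt f = famOne.ram 0 (formRoot f) := by
  have h := famOne.card_stabilizer (v := 0) (by simp [famOne]) (formRoot_mem hd hf)
  rw [formWt_eq hd hf]
  have h2 : Nat.card {γ : SL(2, ℤ) // mob γ (formRoot f) = formRoot f} =
      Nat.card {γ : SL(2, ℤ) // mob γ (formRoot f) = formRoot f ∧
        act (γ : M2) (0 : Fin 2 → ZMod 1) = 0} :=
    Nat.card_congr (Equiv.subtypeEquivRight fun g =>
      ⟨fun h => ⟨h, Subsingleton.elim _ _⟩, fun h => h.1⟩)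
  rw [h2, h, Nat.mul_div_cancel_left _ two_pos]

lemma formWt_pos {d : ℤ} (hd : 0 < d) {f : ℤ × ℤ × ℤ} (hf : IsForm d f) : formWt f ≠ 0 := by
  rw [formWt_eq_ram hd hf]
  exact famOne.ram_pos (by simp [famOne]) (formRoot_mem hd hf)

open Classical in
lemma order_jInv_sub {d : ℤ} (hd : 0 < d) {f : ℤ × ℤ × ℤ} (hf : IsForm d f) {z : ℂ}
    (hz : z ∈ UH) : analyticOrderAt (fun w => jInv w - jInv (formRoot f)) z =
      if ∃ g : SL(2, ℤ), mob g z = formRoot f then (formWt f : ℕ∞) else 0 := by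
  have hm := formRoot_mem hd hf
  split_ifs with h
  · obtain ⟨g, hg⟩ := h
    rw [formWt_eq hd hf, ← hg, card_stab_mob g hz, jInv_mob g hz]
    have h1 := famOne.card_stabilizer (v := 0) (by simp [famOne]) hz
    have h2 : Nat.card {γ : SL(2, ℤ) // mob γ z = z} =
        Nat.card {γ : SL(2, ℤ) // mob γ z = z ∧ act (γ : M2) (0 : Fin 2 → ZMod 1) = 0} :=
      Nat.card_congr (Equiv.subtypeEquivRight fun g =>
        ⟨fun h => ⟨h, Subsingleton.elim _ _⟩, fun h => h.1⟩)
    rw [h2, h1, Nat.mul_div_cancel_left _ two_pos]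
    exact famOne.order_eq (v := 0) (by simp [famOne]) hz
  · have hj : AnalyticAt ℂ (fun w => jInv w - jInv (formRoot f)) z :=
      (differentiableOn_jInv.analyticAt (isOpen_UH.mem_nhds hz)).sub analyticAt_const
    rw [hj.analyticOrderAt_eq_zero]
    intro h0
    exact h (jInv_injective hz hm (sub_eq_zero.1 h0))

lemma mob_fixed_iff {N : M2} (hN : 0 < N.det) {z : ℂ} (hz : z ∈ UH) :
    mob N z = z ↔ (N 1 0 : ℂ) * z ^ 2 + ((N 1 1 : ℂ) - N 0 0) * z - N 0 1 = 0 := by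
  rw [mob, div_eq_iff (den_ne_zero hN hz), den]
  constructor <;> intro h <;> linear_combination -h

/-- The form attached to a matrix. -/
def matForm (N : M2) : ℤ × ℤ × ℤ := (N 1 0, N 1 1 - N 0 0, -N 0 1)

lemma fpoly_matForm {N : M2} (hN : 0 < N.det) {z : ℂ} (hz : z ∈ UH) :
    fpoly (matForm N) z = 0 ↔ mob N z = z := by
  rw [mob_fixed_iff hN hz, fpoly, matForm]
  push_cast
  rw [← sub_eq_add_neg]

lemma isForm_matForm {N : M2} (h : 0 < N 1 0) :
    IsForm (4 * N.det - (N 0 0 + N 1 1) ^ 2) (matForm N) := by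
  refine ⟨h, ?_⟩
  simp only [matForm, det_eq]
  ring

lemma fpoly_ne_zero_of_nonpos {d : ℤ} (hd : d ≤ 0) {f : ℤ × ℤ × ℤ} (hf : IsForm d f) {z : ℂ}
    (hz : z ∈ UH) : fpoly f z ≠ 0 := by
  intro h
  have hz' := mem_UH.1 hz
  have ha : (0 : ℝ) < f.1 := by exact_mod_cast hf.1
  have h1 : (2 * f.1 * z + f.2.1 : ℂ) ^ 2 = ((-d : ℤ) : ℝ) := by
    rw [← hf.2]
    simp only [fpoly] at h
    push_cast
    linear_combination 4 * f.1 * h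
  have h2 : (2 * f.1 * z + f.2.1 : ℂ) = ⟨2 * f.1 * z.re + f.2.1, 2 * f.1 * z.im⟩ := by
    apply Complex.ext <;> simp
  rw [h2, sq] at h1
  have hre := congrArg Complex.re h1
  have him := congrArg Complex.im h1
  simp only [mul_re, mul_im, ofReal_re, ofReal_im] at hre him
  set x := 2 * (f.1 : ℝ) * z.re + f.2.1
  have hy : 0 < 2 * (f.1 : ℝ) * z.im := by positivity
  set y := 2 * (f.1 : ℝ) * z.im
  have hx : x = 0 := by
    have : x * y = 0 := by linarith
    exact (mul_eq_zero.1 this).resolve_right hy.ne'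
  have hd' : (0 : ℝ) ≤ ((-d : ℤ) : ℝ) := by exact_mod_cast (by omega : (0 : ℤ) ≤ -d)
  rw [hx] at hre
  nlinarith

lemma enat_two_mul_cancel {x : ℕ∞} {m : ℕ} (h : 2 * x = ((2 : ℕ) : ℕ∞) * m) : x = m := by
  induction x using ENat.recTopCoe with
  | top =>
    rw [ENat.mul_top two_ne_zero, ← Nat.cast_mul] at h
    exact absurd h.symm (ENat.natCast_ne_top _)
  | coe k =>
    have : 2 * k = 2 * m := by exact_mod_cast h
    exact_mod_cast Nat.eq_of_mul_eq_mul_left two_pos this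

namespace ModFam

variable {ℓ : ℕ} (𝓕 : ModFam ℓ)

/-- The matrices with determinant `n`, trace `r`, positive lower left entry that fix a point and a
vector. -/
def posSet (n : ℕ) (r : ℤ) (z : ℂ) (v : Fin 2 → ZMod ℓ) : Set M2 :=
  {N | N ∈ fixSet n z v ∧ 0 < N 1 0 ∧ N 0 0 + N 1 1 = r}

/-- The multiplicity of a point for determinant `n` and trace `r`. -/
noncomputable def wtAt (n : ℕ) (r : ℤ) (z : ℂ) : ℕ := ∑ v ∈ 𝓕.V, (posSet n r z v).ncard

/-- The traces of elliptic matrices of determinant `n`. -/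
noncomputable def traces (n : ℕ) : Finset ℤ := {r ∈ Finset.Icc (-(2 * n : ℤ)) (2 * n) | r ^ 2 < 4 *
    n}

lemma mem_traces {n : ℕ} {r : ℤ} : r ∈ traces n ↔ r ^ 2 < 4 * n := by
  simp only [traces, Finset.mem_filter, Finset.mem_Icc, and_iff_right_iff_imp]
  intro h
  rw [← abs_le]
  by_contra! hlt
  have h1 : (2 * n : ℤ) ^ 2 < |r| ^ 2 := by gcongr
  rw [sq_abs] at h1
  rcases Nat.eq_zero_or_pos n with rfl | hn
  · simp at h1 h
    nlinarith [sq_nonneg r]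
  · have : (1 : ℤ) ≤ n := by exact_mod_cast hn
    nlinarith

lemma posSet_trace {n : ℕ} (hn : n ≠ 0) {r : ℤ} {z : ℂ} (hz : z ∈ UH) {v : Fin 2 → ZMod ℓ} {N : M2}
    (hN : N ∈ posSet n r z v) : r ∈ traces n := by
  obtain ⟨⟨h1, h2, h3, h4⟩, h5, rfl⟩ := hN
  rw [mem_traces]
  by_contra! hlt
  refine fpoly_ne_zero_of_nonpos (d := 4 * N.det - (N 0 0 + N 1 1) ^ 2) (by rw [h1]; linarith)
    (isForm_matForm h5) hz ?_
  rw [fpoly_matForm (by rw [h1]; positivity) hz, h3]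

lemma isScaled_neg {N : M2} : IsScaled (-N) ↔ IsScaled N := by
  constructor
  · rintro ⟨t, γ, h⟩
    exact ⟨-t, γ, by rw [neg_smul, ← h, neg_neg]⟩
  · rintro ⟨t, γ, rfl⟩
    exact ⟨-t, γ, by rw [neg_smul]⟩

lemma neg_mem_fixSet {n : ℕ} {z : ℂ} {v : Fin 2 → ZMod ℓ} {N : M2} (hN : N ∈ fixSet n z v)
    (hv : -v = v) : -N ∈ fixSet n z v := by
  obtain ⟨h1, h2, h3, h4⟩ := hN
  refine ⟨?_, by rwa [isScaled_neg], by rw [mob_neg, h3], by rw [act_neg, h4, hv]⟩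
  rw [← h1, det_eq, det_eq]
  simp

lemma fixSet_lower_ne_zero {n : ℕ} (hn : n ≠ 0) {z : ℂ} (hz : z ∈ UH) {v : Fin 2 → ZMod ℓ}
    {N : M2} (hN : N ∈ fixSet n z v) : N 1 0 ≠ 0 := by
  obtain ⟨h1, h2, h3, h4⟩ := hN
  intro h0
  rw [mob_fixed_iff (by rw [h1]; positivity) hz, h0] at h3
  have hz' := mem_UH.1 hz
  have e : (((N 1 1 - N 0 0 : ℤ) : ℝ) : ℂ) * z + ((-N 0 1 : ℤ) : ℝ) = 0 := by
    push_cast; linear_combination h3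
  have him := congrArg Complex.im e
  have hre := congrArg Complex.re e
  simp only [add_im, mul_im, ofReal_re, ofReal_im, zero_mul, add_zero, zero_im, add_re, mul_re,
    sub_zero, zero_re] at him hre
  have h5 := (mul_eq_zero.1 him).resolve_right hz'.ne'
  rw [h5, zero_mul, zero_add] at hre
  have h6 : N 1 1 - N 0 0 = 0 := by exact_mod_cast h5
  have h7 : -N 0 1 = 0 := by exact_mod_cast hre
  refine h2 ⟨N 0 0, 1, ?_⟩
  ext i j
  fin_cases i <;> fin_cases j <;> simp <;> omega

lemma ncard_fixSet {n : ℕ} (hn : n ≠ 0) {z : ℂ} (hz : z ∈ UH) {v : Fin 2 → ZMod ℓ}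
    (hv : -v = v) (hfin : (fixSet n z v).Finite) :
    (fixSet n z v).ncard = 2 * ∑ r ∈ traces n, (posSet n r z v).ncard := by
  classical
  set P : Set M2 := {N | N ∈ fixSet n z v ∧ 0 < N 1 0} with hP
  have hPfin : P.Finite := hfin.subset fun N hN => hN.1
  have hneg : (fun N : M2 => -N) '' P = {N | N ∈ fixSet n z v ∧ N 1 0 < 0} := by
    ext N
    constructor
    · rintro ⟨M, ⟨hM, hM'⟩, rfl⟩
      exact ⟨neg_mem_fixSet hM hv, by simpa using hM'⟩
    · rintro ⟨hM, hM'⟩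
      exact ⟨-N, ⟨neg_mem_fixSet hM hv, by simpa using hM'⟩, neg_neg N⟩
  have hunion : fixSet n z v = P ∪ (fun N : M2 => -N) '' P := by
    rw [hneg]
    ext N
    constructor
    · intro hN
      rcases lt_or_gt_of_ne (fixSet_lower_ne_zero hn hz hN) with h | h
      · exact Or.inr ⟨hN, h⟩
      · exact Or.inl ⟨hN, h⟩
    · rintro (h | h)
      exacts [h.1, h.1]
  have hdisj : Disjoint P ((fun N : M2 => -N) '' P) := by
    rw [hneg, Set.disjoint_left]
    rintro N ⟨-, h1⟩ ⟨-, h2⟩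
    exact lt_asymm h1 h2
  rw [hunion, Set.ncard_union_eq hdisj hPfin (hPfin.image _),
    Set.ncard_image_of_injective _ neg_injective, ← two_mul]
  congr 1
  rw [Set.ncard_eq_toFinset_card P hPfin,
    Finset.card_eq_sum_card_fiberwise (f := fun N : M2 => N 0 0 + N 1 1) (t := traces n)]
  · refine Finset.sum_congr rfl fun r _ => ?_
    rw [← Set.ncard_coe_finset]
    congr 1
    ext N
    simp [hP, posSet, and_assoc]
  · intro N hN
    simp only [Finite.coe_toFinset] at hN
    exact posSet_trace hn hz ⟨hN.1, hN.2, rfl⟩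

lemma order_prodFac {n : ℕ} (hn : n ≠ 0) {z : ℂ} (hz : z ∈ UH) :
    analyticOrderAt (𝓕.prodFac n) z = ∑ r ∈ traces n, (𝓕.wtAt n r z : ℕ∞) := by
  have han : ∀ v ∈ 𝓕.V, AnalyticAt ℂ (fun z => ∏ i ∈ hidx n, 𝓕.fac v (hmat n i) z) z :=
    fun v hv => Finset.analyticAt_fun_prod _ fun i hi =>
      𝓕.analyticAt_fac hv (by rw [det_hmat hi]; positivity) hz
  have h := (analyticOrderAt_finset_prod 𝓕.V _ han).2
  have h2 : analyticOrderAt (𝓕.prodFac n) z =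
      ∑ v ∈ 𝓕.V, analyticOrderAt (fun z => ∏ i ∈ hidx n, 𝓕.fac v (hmat n i) z) z := h
  have h3 : ∀ v ∈ 𝓕.V, analyticOrderAt (fun z => ∏ i ∈ hidx n, 𝓕.fac v (hmat n i) z) z =
      ((∑ r ∈ traces n, (posSet n r z v).ncard : ℕ) : ℕ∞) := by
    intro v hv
    obtain ⟨h4, h5⟩ := 𝓕.order_prod_hidx hn hv hz
    rw [ncard_fixSet hn hz (𝓕.neg v) h4, Nat.cast_mul] at h5
    exact enat_two_mul_cancel h5
  rw [h2, Finset.sum_congr rfl h3, ← Nat.cast_sum, Finset.sum_comm, Nat.cast_sum]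
  rfl

lemma conj_mem_posSet {n : ℕ} (hn : n ≠ 0) {r : ℤ} (γ : SL(2, ℤ)) {z : ℂ} (hz : z ∈ UH)
    {v : Fin 2 → ZMod ℓ} {N : M2} (hN : N ∈ posSet n r z v) :
    (γ : M2) * N * ((γ⁻¹ : SL(2, ℤ)) : M2) ∈ posSet n r (mob γ z) (act γ v) := by
  obtain ⟨⟨h1, h2, h3, h4⟩, h5, h6⟩ := hN
  have hγz := sl_mem γ hz
  have hinv := mob_sl_inv_mob γ hz
  have hd1 := sl_den γ⁻¹ hγz
  have hdet : 0 < N.det := by rw [h1]; positivity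
  have hdN := den_ne_zero hdet hz
  have e1 : mob ((γ : M2) * N * ((γ⁻¹ : SL(2, ℤ)) : M2)) (mob γ z) = mob γ z := by
    rw [mob_mul hd1, hinv, mob_mul hdN, h3]
  have hdet' : ((γ : M2) * N * ((γ⁻¹ : SL(2, ℤ)) : M2)).det = n := by
    rw [Matrix.det_mul, Matrix.det_mul, Matrix.SpecialLinearGroup.det_coe,
      Matrix.SpecialLinearGroup.det_coe, one_mul, mul_one, h1]
  refine ⟨⟨hdet', ?_, e1, ?_⟩, ?_, ?_⟩
  · rwa [isScaled_mul_sl, isScaled_sl_mul]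
  · rw [act_mul, act_mul, act_sl_inv_act, h4]
  · have h7 : den ((γ : M2) * N * ((γ⁻¹ : SL(2, ℤ)) : M2)) (mob γ z) = den N z := by
      rw [den_mul _ _ hd1, hinv, den_mul _ _ hdN, h3, mul_right_comm]
      have h8 : den (γ : M2) z * den ((γ⁻¹ : SL(2, ℤ)) : M2) (mob γ z) = 1 := by
        have := den_mul ((γ⁻¹ : SL(2, ℤ)) : M2) (γ : M2) (sl_den γ hz)
        rw [← Matrix.SpecialLinearGroup.coe_mul, inv_mul_cancel, Matrix.SpecialLinearGroup.coe_one,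
          den_one] at this
        rw [mul_comm]; exact this.symm
      rw [h8, one_mul]
    have h9 := congrArg Complex.im h7
    simp only [den, add_im, mul_im, intCast_re, intCast_im, zero_mul, add_zero] at h9
    have hpos : 0 < (N 1 0 : ℝ) * z.im := mul_pos (by exact_mod_cast h5) (mem_UH.1 hz)
    rw [← h9] at hpos
    exact_mod_cast pos_of_mul_pos_left hpos (mem_UH.1 hγz).le
  · have h7 : ((γ : M2) * N * ((γ⁻¹ : SL(2, ℤ)) : M2)).trace = N.trace := by
      rw [Matrix.trace_mul_cycle, ← Matrix.SpecialLinearGroup.coe_mul, inv_mul_cancel]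
      simp
    rwa [Matrix.trace_fin_two, Matrix.trace_fin_two, h6] at h7

lemma ncard_posSet_mob {n : ℕ} (hn : n ≠ 0) (r : ℤ) (γ : SL(2, ℤ)) {z : ℂ} (hz : z ∈ UH)
    (v : Fin 2 → ZMod ℓ) :
    (posSet n r (mob γ z) (act γ v)).ncard = (posSet n r z v).ncard := by
  have himg : posSet n r (mob γ z) (act γ v) =
      (fun N : M2 => (γ : M2) * N * ((γ⁻¹ : SL(2, ℤ)) : M2)) '' posSet n r z v := by
    ext N
    constructor
    · intro hN
      have h := conj_mem_posSet hn γ⁻¹ (sl_mem γ hz) hN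
      rw [mob_sl_inv_mob γ hz, act_sl_inv_act, inv_inv] at h
      refine ⟨_, h, ?_⟩
      simp only [← Matrix.mul_assoc]
      rw [← Matrix.SpecialLinearGroup.coe_mul, mul_inv_cancel, Matrix.mul_assoc,
        ← Matrix.SpecialLinearGroup.coe_mul, mul_inv_cancel]
      simp
    · rintro ⟨M, hM, rfl⟩
      exact conj_mem_posSet hn γ hz hM
  rw [himg, Set.ncard_image_of_injective]
  intro M N h
  have h2 := congrArg (fun X : M2 => ((γ⁻¹ : SL(2, ℤ)) : M2) * X * (γ : M2)) h
  simp only [← Matrix.mul_assoc] at h2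
  rw [← Matrix.SpecialLinearGroup.coe_mul, inv_mul_cancel] at h2
  simp only [Matrix.mul_assoc] at h2
  rw [← Matrix.SpecialLinearGroup.coe_mul, inv_mul_cancel] at h2
  simpa using h2

lemma wtAt_mob {n : ℕ} (hn : n ≠ 0) (r : ℤ) (γ : SL(2, ℤ)) {z : ℂ} (hz : z ∈ UH) :
    𝓕.wtAt n r (mob γ z) = 𝓕.wtAt n r z := by
  rw [wtAt, wtAt]
  refine (Finset.sum_bij' (fun v _ => act γ v) (fun v _ => act (γ⁻¹ : SL(2, ℤ)) v)
    (fun v hv => 𝓕.stable v hv γ) (fun v hv => 𝓕.stable v hv γ⁻¹)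
    (fun v _ => act_sl_inv_act γ v) (fun v _ => act_act_sl_inv γ v) fun v _ => ?_).symm
  exact (ncard_posSet_mob hn r γ hz v).symm

lemma sum_class_wt {n : ℕ} (hn : n ≠ 0) {r : ℤ} (hr : r ∈ traces n) {z : ℂ} (hz : z ∈ UH)
    [Fintype (FormClass (4 * n - r ^ 2))] (M : ℕ) (e : FormClass (4 * n - r ^ 2) → ℕ)
    (he : ∀ cl, e cl * formWt (Quot.out cl).1 = M * 𝓕.wtAt n r (formRoot (Quot.out cl).1)) :
    ∑ cl : FormClass (4 * n - r ^ 2),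
      e cl • analyticOrderAt (fun w => jInv w - jInv (formRoot (Quot.out cl).1)) z =
        ((M * 𝓕.wtAt n r z : ℕ) : ℕ∞) := by
  classical
  have hd : 0 < 4 * (n : ℤ) - r ^ 2 := by rw [mem_traces] at hr; linarith
  have hterm : ∀ cl : FormClass (4 * n - r ^ 2),
      e cl • analyticOrderAt (fun w => jInv w - jInv (formRoot (Quot.out cl).1)) z =
        if ∃ g : SL(2, ℤ), mob g z = formRoot (Quot.out cl).1
          then ((M * 𝓕.wtAt n r z : ℕ) : ℕ∞) else 0 := by
    intro cl
    rw [order_jInv_sub hd (Quot.out cl).2 hz]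
    split_ifs with h
    · obtain ⟨g, hg⟩ := h
      rw [← 𝓕.wtAt_mob hn r g hz, hg, ← he, nsmul_eq_mul, Nat.cast_mul]
    · rw [smul_zero]
  rw [Finset.sum_congr rfl fun cl _ => hterm cl]
  by_cases hex : ∃ cl : FormClass (4 * n - r ^ 2), ∃ g : SL(2, ℤ),
      mob g z = formRoot (Quot.out cl).1
  · obtain ⟨cl, hcl⟩ := hex
    rw [Finset.sum_eq_single cl, if_pos hcl]
    · rintro cl' - hne
      rw [if_neg]
      rintro ⟨g', hg'⟩
      obtain ⟨g, hg⟩ := hcl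
      refine hne ?_
      rw [← Quot.out_eq cl', ← Quot.out_eq cl]
      refine Quot.sound (formRel_of_mob hd (Quot.out cl').2 (Quot.out cl).2 (g := g' * g⁻¹) ?_)
      rw [mob_sl_mul _ _ (formRoot_mem hd (Quot.out cl).2), ← hg, mob_sl_inv_mob g hz, hg']
    · intro h
      exact absurd (Finset.mem_univ _) h
  · rw [Finset.sum_eq_zero fun cl _ => if_neg fun h => hex ⟨cl, h⟩]
    suffices h : 𝓕.wtAt n r z = 0 by rw [h]; simp
    refine Finset.sum_eq_zero fun v _ => ?_
    rw [Set.eq_empty_of_forall_notMem (s := posSet n r z v), Set.ncard_empty]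
    rintro N ⟨⟨h1, h2, h3, h4⟩, h5, h6⟩
    have hform := isForm_matForm h5
    rw [h1, h6] at hform
    have hdet : 0 < N.det := by rw [h1]; positivity
    have hroot := fpoly_formRoot_eq hd hform hz ((fpoly_matForm hdet hz).2 h3)
    obtain ⟨g, hg⟩ := (formRel_out ⟨matForm N, hform⟩).root hd
      (Quot.out (Quot.mk _ ⟨matForm N, hform⟩ : FormClass (4 * n - r ^ 2))).2
    exact hex ⟨Quot.mk _ ⟨matForm N, hform⟩, g, by rw [← hg, hroot]⟩

/-- The divisor of the product of all factors, evaluated against its expansion at the cusp. -/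
theorem trace_identity {n : ℕ} (hn : n ≠ 0) {A : ℤ} {C γ : ℂ}
    (hjet : Jet (fun z => C * 𝓕.prodFac n z * pp z ^ A) 0 γ) :
    ∑ r ∈ traces n, ∑ᶠ cl : FormClass (4 * n - r ^ 2),
      (𝓕.wtAt n r (formRoot (Quot.out cl).1) : ℂ) * jval (Quot.out cl).1 = -γ := by
  classical
  have hd : ∀ r : traces n, 0 < 4 * (n : ℤ) - (r : ℤ) ^ 2 := fun r => by
    have := mem_traces.1 r.2; linarith
  let _ : ∀ r : traces n, Fintype (FormClass (4 * n - (r : ℤ) ^ 2)) := fun r =>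
    have := finite_formClass (hd r)
    Fintype.ofFinite _
  let ι := Σ r : traces n, FormClass (4 * n - (r : ℤ) ^ 2)
  let w : ι → ℕ := fun i => formWt (Quot.out i.2).1
  let M : ℕ := ∏ i, w i
  have hw : ∀ i, w i ≠ 0 := fun i => formWt_pos (hd i.1) (Quot.out i.2).2
  have hM : M ≠ 0 := Finset.prod_ne_zero_iff.2 fun i _ => hw i
  let e : ι → ℕ := fun i => M / w i * 𝓕.wtAt n i.1 (formRoot (Quot.out i.2).1)
  have he : ∀ i, e i * w i = M * 𝓕.wtAt n i.1 (formRoot (Quot.out i.2).1) := fun i => by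
    have : M / w i * w i = M := Nat.div_mul_cancel (Finset.dvd_prod_of_mem _ (Finset.mem_univ i))
    calc e i * w i = M / w i * w i * 𝓕.wtAt n i.1 (formRoot (Quot.out i.2).1) := by
          simp only [e]; ring
      _ = _ := by rw [this]
  have hinv := 𝓕.prodFac_sl hn
  have hkey := divisor_sum (G := fun z => 𝓕.prodFac n z ^ M)
    ((𝓕.differentiableOn_prodFac hn).fun_pow M)
    (fun z hz => by rw [← mob_S, hinv _ hz])
    (fun z hz => by rw [← mob_T, hinv _ hz])
    (Finset.univ : Finset ι) (fun i => jInv (formRoot (Quot.out i.2).1)) e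
    (fun i _ z hz => by
      rw [order_jInv_sub (hd i.1) (Quot.out i.2).2 hz]
      split_ifs <;> simp)
    (fun z hz => by
      have hpow := analyticOrderAt_pow
        ((𝓕.differentiableOn_prodFac hn).analyticAt (isOpen_UH.mem_nhds hz)) M
      change analyticOrderAt (𝓕.prodFac n ^ M) z = _
      rw [hpow, 𝓕.order_prodFac hn hz, Fintype.sum_sigma, ← Finset.sum_coe_sort (traces n),
        Finset.smul_sum]
      refine Finset.sum_congr rfl fun r _ => ?_
      rw [𝓕.sum_class_wt hn r.2 hz M (fun cl => e ⟨r, cl⟩) fun cl => he ⟨r, cl⟩]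
      simp)
    (A := M * A) (C := C ^ M) (γ := M * γ)
    ((by simpa using hjet.pow M : Jet (fun z => (C * 𝓕.prodFac n z * pp z ^ A) ^ M) 0 (M * γ)).congr
      (Eventually.of_forall fun z => by
        rw [mul_pow, mul_pow, mul_comm (M : ℤ), _root_.zpow_mul, zpow_natCast]))
  have hM' : (M : ℂ) ≠ 0 := by exact_mod_cast hM
  refine mul_left_cancel₀ hM' ?_
  rw [mul_neg, ← hkey, Fintype.sum_sigma, ← Finset.sum_coe_sort (traces n), Finset.mul_sum]
  refine Finset.sum_congr rfl fun r _ => ?_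
  rw [finsum_eq_sum_of_fintype, Finset.mul_sum]
  refine Finset.sum_congr rfl fun cl _ => ?_
  have h1 : ((w ⟨r, cl⟩ : ℕ) : ℂ) ≠ 0 := by exact_mod_cast hw ⟨r, cl⟩
  have h2 : (e ⟨r, cl⟩ : ℂ) * w ⟨r, cl⟩ = M * 𝓕.wtAt n r (formRoot (Quot.out cl).1) := by
    exact_mod_cast he ⟨r, cl⟩
  rw [jval, ← mul_assoc, ← h2]
  change _ * (_ / ((w ⟨r, cl⟩ : ℕ) : ℂ)) = _
  field_simp

end ModFam

/-- The exponential `exp (2 π i s z)`. -/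
noncomputable def ex (s : ℝ) (z : ℂ) : ℂ := nome (s * z)

lemma ex_ne_zero (s : ℝ) (z : ℂ) : ex s z ≠ 0 := nome_ne_zero _

lemma ex_mul (s t : ℝ) (z : ℂ) : ex s z * ex t z = ex (s + t) z := by
  rw [ex, ex, ex, ← nome_add]; congr 1; push_cast; ring

lemma ex_pow (s : ℝ) (n : ℕ) (z : ℂ) : ex s z ^ n = ex (n * s) z := by
  rw [ex, ex, ← nome_nat_mul]; congr 1; push_cast; ring

lemma ex_half : ex (1 / 2) = pp := by
  ext z; rw [ex, pp]; congr 1; push_cast; ring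

lemma ex_one (z : ℂ) : ex 1 z = pp z ^ 2 := by
  rw [← ex_half, ex_pow]; norm_num

lemma ex_nat_half (n : ℕ) (z : ℂ) : ex (n / 2) z = pp z ^ n := by
  rw [← ex_half, ex_pow]; congr 1; ring

lemma tendsto_ex {s : ℝ} (hs : 0 < s) : Tendsto (ex s) atInf (𝓝 0) := by
  refine tendsto_nome_comp (u := fun z => s * z) ?_
  simp only [im_ofReal_mul]
  exact tendsto_im_atInf.const_mul_atTop hs

lemma ex_isLittleO {s t : ℝ} (h : t < s) : ex s =o[atInf] ex t := by
  have h1 : ex (s - t) =o[atInf] fun _ => (1 : ℂ) :=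
    (Asymptotics.isLittleO_one_iff ℂ).2 (tendsto_ex (sub_pos.2 h))
  have := h1.mul_isBigO (Asymptotics.isBigO_refl (ex t) atInf)
  refine (this.congr_left fun z => ?_).congr_right fun z => one_mul _
  rw [ex_mul]; congr 1; ring

lemma ex_isLittleO_sq {s : ℝ} (h : 1 < s) : ex s =o[atInf] fun z => pp z ^ 2 :=
  (ex_isLittleO h).congr_right ex_one

lemma ex_isLittleO_pp {s : ℝ} (h : 1 / 2 < s) : ex s =o[atInf] pp := by
  have := ex_isLittleO h
  rwa [ex_half] at this

/-- The function `g`, up to a constant and a power of `pp`, has a jet at infinity. -/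
def PJet (g : ℂ → ℂ) (α l : ℂ) : Prop :=
  ∃ (C : ℂ) (A : ℤ), Jet (fun z => C * g z * pp z ^ A) α l

lemma Jet.pjet {g : ℂ → ℂ} {α l : ℂ} (h : Jet g α l) : PJet g α l :=
  ⟨1, 0, by simpa using h⟩

namespace PJet
variable {g g' : ℂ → ℂ} {α l α' l' : ℂ}

lemma congr (h : PJet g α l) (hg : ∀ᶠ z in atInf, g z = g' z) : PJet g' α l := by
  obtain ⟨C, A, h⟩ := h
  exact ⟨C, A, h.congr (hg.mono fun z hz => by rw [hz])⟩

lemma mul (h : PJet g α l) (h' : PJet g' α' l') :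
    PJet (fun z => g z * g' z) (α + α') (l + l') := by
  obtain ⟨C, A, h⟩ := h
  obtain ⟨C', A', h'⟩ := h'
  refine ⟨C * C', A + A', (h.mul h').congr (Eventually.of_forall fun z => ?_)⟩
  rw [zpow_add₀ (pp_ne_zero z)]; ring

lemma inv (h : PJet g α l) : PJet (fun z => (g z)⁻¹) (-α) (-l) := by
  obtain ⟨C, A, h⟩ := h
  refine ⟨C⁻¹, -A, h.inv.congr (Eventually.of_forall fun z => ?_)⟩
  rw [_root_.zpow_neg, mul_inv, mul_inv]

lemma div (h : PJet g α l) (h' : PJet g' α' l') :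
    PJet (fun z => g z / g' z) (α - α') (l - l') := by
  simpa [div_eq_mul_inv, sub_eq_add_neg] using h.mul h'.inv

lemma pow (h : PJet g α l) (n : ℕ) : PJet (fun z => g z ^ n) (n * α) (n * l) := by
  obtain ⟨C, A, h⟩ := h
  refine ⟨C ^ n, A * n, (h.pow n).congr (Eventually.of_forall fun z => ?_)⟩
  rw [_root_.zpow_mul, zpow_natCast]; ring

lemma prod {ι : Type*} (s : Finset ι) {g : ι → ℂ → ℂ} {α l : ι → ℂ}
    (h : ∀ i ∈ s, PJet (g i) (α i) (l i)) :
    PJet (fun z => ∏ i ∈ s, g i z) (∑ i ∈ s, α i) (∑ i ∈ s, l i) := by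
  classical
  induction s using Finset.induction_on with
  | empty => simpa using Jet.one.pjet
  | insert i s hi ih =>
    simp only [Finset.prod_insert hi, Finset.sum_insert hi]
    exact (h i (Finset.mem_insert_self i s)).mul
      (ih fun j hj => h j (Finset.mem_insert_of_mem hj))

lemma const {c : ℂ} (hc : c ≠ 0) : PJet (fun _ => c) 0 0 :=
  ⟨c⁻¹, 0, by simpa [hc] using Jet.one⟩

lemma pp_zpow (n : ℤ) : PJet (fun z => pp z ^ n) 0 0 :=
  ⟨1, -n, Jet.one.congr (Eventually.of_forall fun z => by
    rw [one_mul, ← zpow_add₀ (pp_ne_zero z), add_neg_cancel, zpow_zero])⟩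

lemma const_mul (h : PJet g α l) {c : ℂ} (hc : c ≠ 0) : PJet (fun z => c * g z) α l := by
  simpa using (const hc).mul h

lemma comp_add_one (h : PJet g α l) : PJet (fun z => g (z + 1)) (-α) l := by
  obtain ⟨C, A, h⟩ := h
  refine ⟨C * (-1) ^ A, A, h.comp_add_one.congr (Eventually.of_forall fun z => ?_)⟩
  rw [pp_add_one, ← neg_one_mul (pp z), mul_zpow]; ring

end PJet

lemma exists_log_one_add {ε : ℂ → ℂ} (h : ε =o[atInf] pp) :
    ∃ L : ℂ → ℂ, (∀ᶠ z in atInf, 1 + ε z = cexp (L z)) ∧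
      (fun z => L z - ε z) =o[atInf] fun z => pp z ^ 2 := by
  have h0 : Tendsto ε atInf (𝓝 0) := h.trans_tendsto tendsto_pp
  refine ⟨fun z => log (1 + ε z), ?_, ?_⟩
  · filter_upwards [h0.eventually_ne (show (0 : ℂ) ≠ -1 by norm_num)] with z hz
    rw [exp_log]
    intro h1
    exact hz (by linear_combination h1)
  · have h1 : (fun x : ℂ => log (1 + x) - x) =O[𝓝 0] fun x => x ^ 2 := by
      refine Asymptotics.IsBigO.of_bound 1 ?_
      have : ∀ᶠ x : ℂ in 𝓝 0, ‖x‖ < 1 / 2 :=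
        (continuous_norm.tendsto' (0 : ℂ) 0 norm_zero).eventually_lt_const (by norm_num)
      filter_upwards [this] with x hx
      refine (norm_log_one_add_sub_self_le (by linarith)).trans ?_
      rw [norm_pow, one_mul]
      have h3 : (1 - ‖x‖)⁻¹ ≤ 2 := by
        rw [inv_le_comm₀ (by linarith) (by norm_num)]; linarith
      nlinarith [sq_nonneg ‖x‖]
    have h2 := h1.comp_tendsto h0
    exact h2.trans_isLittleO (h.pow two_pos)

/-- A finite product of factors `1 + εᵢ` with small `εᵢ`. -/
lemma Jet.prod_one_add {ι : Type*} (S : Finset ι) {ε : ι → ℂ → ℂ} {l : ℂ}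
    (h : ∀ i ∈ S, ε i =o[atInf] pp)
    (hs : (fun z => ∑ i ∈ S, ε i z - l * pp z ^ 2) =o[atInf] fun z => pp z ^ 2) :
    Jet (fun z => ∏ i ∈ S, (1 + ε i z)) 0 l := by
  choose! L hL hL' using fun i hi => exists_log_one_add (h i hi)
  refine ⟨fun z => ∑ i ∈ S, L i z, ?_, ?_⟩
  · filter_upwards [(Finset.eventually_all S).2 hL] with z hz
    rw [exp_sum]
    exact Finset.prod_congr rfl hz
  · have h1 := (Asymptotics.IsLittleO.sum hL').add hs
    refine h1.congr_left fun z => ?_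
    simp only [Finset.sum_apply, Finset.sum_sub_distrib]
    ring

/-- Averages over `d`-th roots of unity pick out the coefficients of exponents divisible by `d`. -/
lemma sum_rotate_isBigO {F : ℂ → ℂ} {a : ℕ → ℂ} {d : ℕ} (hd : d ≠ 0)
    (hF : EqMod (d + 1) F fun x => ∑ k ∈ Finset.range (d + 1), a k * x ^ k) {ζ : ℂ}
    (hζ : IsPrimitiveRoot ζ d) {l : Filter ℂ} {y : ℂ → ℂ} (hy : Tendsto y l (𝓝 0)) :
    (fun z => ∑ b ∈ Finset.range d, (F (ζ ^ b * y z) - a 0) - d * a d * y z ^ d) =O[l]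
      fun z => y z ^ (d + 1) := by
  have h1 : ∀ b ∈ Finset.range d, (fun z => F (ζ ^ b * y z) -
      ∑ k ∈ Finset.range (d + 1), a k * (ζ ^ b * y z) ^ k) =O[l] fun z => y z ^ (d + 1) := by
    intro b _
    have ht : Tendsto (fun z => ζ ^ b * y z) l (𝓝 0) := by simpa using hy.const_mul (ζ ^ b)
    refine (hF.comp_tendsto ht).trans ?_
    simp only [Function.comp_def, mul_pow]
    exact Asymptotics.isBigO_const_mul_self _ _ _
  refine (Asymptotics.IsBigO.sum h1).congr_left fun z => ?_
  have h2 : ∑ b ∈ Finset.range d, ∑ k ∈ Finset.range (d + 1), a k * (ζ ^ b * y z) ^ k =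
      d * a 0 + d * a d * y z ^ d := by
    rw [Finset.sum_comm, Finset.sum_range_succ, Finset.sum_eq_single_of_mem 0 (by simp; omega)]
    · have : ∀ b, (ζ ^ b) ^ d = 1 := fun b => by rw [← pow_mul, mul_comm, pow_mul, hζ.pow_eq_one,
        one_pow]
      simp only [mul_pow, this, pow_zero, mul_one, Finset.sum_const, Finset.card_range,
        nsmul_eq_mul, one_mul]
      ring
    · intro k hk hk0
      have hk' : k < d := Finset.mem_range.1 hk
      have h3 : ∑ b ∈ Finset.range d, (ζ ^ k) ^ b = 0 := by
        have hne : ζ ^ k ≠ 1 := hζ.pow_ne_one_of_pos_of_lt hk0 hk'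
        have := mul_neg_geom_sum (ζ ^ k) d
        rw [← pow_mul, mul_comm k, pow_mul, hζ.pow_eq_one, one_pow, sub_self] at this
        exact (mul_eq_zero.1 this).resolve_left (sub_ne_zero.2 hne.symm)
      calc _ = a k * y z ^ k * ∑ b ∈ Finset.range d, (ζ ^ k) ^ b := by
            rw [Finset.mul_sum]
            refine Finset.sum_congr rfl fun b _ => ?_
            rw [mul_pow, ← pow_mul, ← pow_mul, mul_comm b]; ring
        _ = 0 := by rw [h3, mul_zero]
  simp only [Finset.sum_apply, Finset.sum_sub_distrib, h2, Finset.sum_const, Finset.card_range,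
      nsmul_eq_mul]
  ring

/-- `F` has a simple pole at `0` with residue `1` and regular part `A`. -/
def PolePart (F A : ℂ → ℂ) : Prop :=
  AnalyticAt ℂ A 0 ∧ ∀ᶠ x in 𝓝[≠] 0, F x = 1 / x + A x

/-- The relative error in replacing `F x - F y` by `1 / x - 1 / y`. -/
noncomputable def slopeErr (A : ℂ → ℂ) (x y : ℂ) : ℂ := -(x * y * (A x - A y) / (x - y))

lemma sub_eq_slopeErr {A : ℂ → ℂ} {x y : ℂ} (hx : x ≠ 0) (hy : y ≠ 0) (hxy : x ≠ y) :
    (1 / x + A x) - (1 / y + A y) = (1 / x - 1 / y) * (1 + slopeErr A x y) := by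
  have := sub_ne_zero.2 hxy
  rw [slopeErr]
  field_simp
  ring

lemma lipschitz_isBigO {A : ℂ → ℂ} (hA : AnalyticAt ℂ A 0) {l : Filter ℂ} {X Y : ℂ → ℂ}
    (hX : Tendsto X l (𝓝 0)) (hY : Tendsto Y l (𝓝 0)) (hXY : ∀ᶠ z in l, X z ≠ Y z) :
    (fun z => (A (X z) - A (Y z)) / (X z - Y z)) =O[l] fun _ => (1 : ℂ) := by
  have h : HasStrictFDerivAt A (fderiv ℂ A 0) 0 := hA.hasStrictFDerivAt
  have h1 := h.isBigO_sub
  have h2 := h1.comp_tendsto (k := fun z => (X z, Y z)) (l' := l) (by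
    rw [nhds_prod_eq]; exact hX.prodMk hY)
  simp only [Function.comp_def] at h2
  have h3 := h2.mul (Asymptotics.isBigO_refl (fun z => (X z - Y z)⁻¹) l)
  refine (h3.congr_left fun z => (div_eq_mul_inv _ _).symm).congr' EventuallyEq.rfl ?_
  filter_upwards [hXY] with z hz
  exact mul_inv_cancel₀ (sub_ne_zero.2 hz)

lemma slopeErr_isBigO {A : ℂ → ℂ} (hA : AnalyticAt ℂ A 0) {l : Filter ℂ} {X Y : ℂ → ℂ}
    (hX : Tendsto X l (𝓝 0)) (hY : Tendsto Y l (𝓝 0)) (hXY : ∀ᶠ z in l, X z ≠ Y z) :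
    (fun z => slopeErr A (X z) (Y z)) =O[l] fun z => X z * Y z := by
  have := ((Asymptotics.isBigO_refl (fun z => X z * Y z) l).mul
    (lipschitz_isBigO hA hX hY hXY)).neg_left
  refine (this.congr_left fun z => ?_).congr_right fun z => mul_one _
  rw [slopeErr, mul_div_assoc]

lemma slopeErr_add_isBigO {A : ℂ → ℂ} (hA : AnalyticAt ℂ A 0) {l : Filter ℂ} {X Y : ℂ → ℂ}
    (hX : Tendsto X l (𝓝 0)) (hY : Tendsto Y l (𝓝 0)) (hXY : ∀ᶠ z in l, X z ≠ Y z) :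
    (fun z => slopeErr A (X z) (Y z) + X z * (A (Y z) - A 0)) =O[l] fun z => X z ^ 2 * Y z := by
  have hB : AnalyticAt ℂ (dslope A 0) 0 := by
    obtain ⟨p, hp⟩ := hA
    exact ⟨_, hp.has_fpower_series_dslope_fslope⟩
  have hA' : ∀ x, A x = A 0 + x * dslope A 0 x := fun x => by
    have := sub_smul_dslope A 0 x
    rw [sub_zero, smul_eq_mul] at this
    rw [this]; ring
  have := ((Asymptotics.isBigO_refl (fun z => X z ^ 2 * Y z) l).mul
    (lipschitz_isBigO hB hX hY hXY)).neg_left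
  refine (this.congr' ?_ EventuallyEq.rfl).congr_right fun z => mul_one _
  filter_upwards [hXY] with z hz
  have := sub_ne_zero.2 hz
  rw [slopeErr, hA' (X z), hA' (Y z)]
  field_simp
  ring

/-- The product of `F X - F Y_b` compared with the product of `1 / X - 1 / Y_b`. -/
lemma jet_prod_sub {F A : ℂ → ℂ} (hF : PolePart F A) {ι : Type*} (S : Finset ι) {s t : ℝ}
    (hs : 1 / 2 ≤ s) (ht : 0 < t) {w : ι → ℂ} (hw : ∀ b ∈ S, w b ≠ 0)
    (hne : ∀ b ∈ S, ∀ᶠ z in atInf, ex s z ≠ w b * ex t z) {l : ℂ}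
    (hsum : (fun z => ∑ b ∈ S, ex s z * (A (w b * ex t z) - A 0) + l * pp z ^ 2) =o[atInf]
      fun z => pp z ^ 2) {P : ℂ → ℂ}
    (hP : ∀ z, ∏ b ∈ S, (1 / ex s z - 1 / (w b * ex t z)) = P z) {α' l' : ℂ} (hPj : PJet P α' l') :
    PJet (fun z => ∏ b ∈ S, (F (ex s z) - F (w b * ex t z))) α' (l + l') := by
  have hX : Tendsto (ex s) atInf (𝓝 0) := tendsto_ex (by linarith)
  have hY : ∀ b ∈ S, Tendsto (fun z => w b * ex t z) atInf (𝓝 0) := fun b _ => by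
    simpa using (tendsto_ex ht).const_mul (w b)
  have hj : Jet (fun z => ∏ b ∈ S, (1 + slopeErr A (ex s z) (w b * ex t z))) 0 l := by
    refine Jet.prod_one_add S (fun b hb => ?_) ?_
    · refine (slopeErr_isBigO hF.1 hX (hY b hb) (hne b hb)).trans_isLittleO ?_
      have : ex (s + t) =o[atInf] pp := ex_isLittleO_pp (by linarith)
      refine (this.const_mul_left (w b)).congr_left fun z => ?_
      rw [← ex_mul]; ring
    · have h1 : ∀ b ∈ S, (fun z => slopeErr A (ex s z) (w b * ex t z) +
          ex s z * (A (w b * ex t z) - A 0)) =o[atInf] fun z => pp z ^ 2 := by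
        intro b hb
        refine (slopeErr_add_isBigO hF.1 hX (hY b hb) (hne b hb)).trans_isLittleO ?_
        have : ex ((2 : ℕ) * s + t) =o[atInf] fun z => pp z ^ 2 :=
          ex_isLittleO_sq (by push_cast; linarith)
        refine (this.const_mul_left (w b)).congr_left fun z => ?_
        rw [← ex_mul, ← ex_pow]; ring
      refine ((Asymptotics.IsLittleO.sum h1).sub hsum).congr_left fun z => ?_
      rw [Finset.sum_apply, Finset.sum_add_distrib]; ring
  have := hj.pjet.mul hPj
  rw [zero_add] at this
  refine this.congr ?_
  have hF' : ∀ {u : ℂ → ℂ}, Tendsto u atInf (𝓝 0) → (∀ z, u z ≠ 0) →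
      ∀ᶠ z in atInf, F (u z) = 1 / u z + A (u z) := fun hu h0 =>
    (tendsto_nhdsWithin_iff.2 ⟨hu, Eventually.of_forall h0⟩).eventually hF.2
  filter_upwards [hF' hX (ex_ne_zero s), (Finset.eventually_all S).2 fun b hb =>
    hF' (hY b hb) fun z => mul_ne_zero (hw b hb) (ex_ne_zero t z),
    (Finset.eventually_all S).2 hne] with z h1 h2 h3
  rw [← hP, ← Finset.prod_mul_distrib]
  refine Finset.prod_congr rfl fun b hb => ?_
  rw [h1, h2 b hb, sub_eq_slopeErr (ex_ne_zero s z) (mul_ne_zero (hw b hb) (ex_ne_zero t z))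
    (h3 b hb), mul_comm]

lemma prod_sub_rotate {d : ℕ} (hd : 0 < d) {ζ : ℂ} (hζ : IsPrimitiveRoot ζ d) (x y : ℂ) :
    ∏ b ∈ Finset.range d, (x - ζ ^ b * y) = x ^ d - y ^ d := by
  classical
  rw [hζ.pow_sub_pow_eq_prod_sub_mul x y hd]
  refine Finset.prod_bij (fun b _ => ζ ^ b) (fun b _ => ?_) (fun a ha b hb h => ?_)
    (fun w hw => ?_) (fun _ _ => rfl)
  · rw [Polynomial.mem_nthRootsFinset hd, ← pow_mul, mul_comm, pow_mul, hζ.pow_eq_one, one_pow]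
  · exact hζ.pow_inj (Finset.mem_range.1 ha) (Finset.mem_range.1 hb) h
  · obtain ⟨i, hi, rfl⟩ := haveI := NeZero.of_pos hd
      hζ.eq_pow_of_pow_eq_one ((Polynomial.mem_nthRootsFinset hd _).1 hw)
    exact ⟨i, Finset.mem_range.2 hi, rfl⟩

lemma prod_inv_sub_rotate {d : ℕ} (hd : 0 < d) {ζ : ℂ} (hζ : IsPrimitiveRoot ζ d) (x y : ℂ) :
    ∏ b ∈ Finset.range d, (1 / x - 1 / (ζ ^ b * y)) = (1 / x) ^ d - (1 / y) ^ d := by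
  rw [← prod_sub_rotate hd hζ.inv]
  refine Finset.prod_congr rfl fun b _ => ?_
  rw [inv_pow, one_div (ζ ^ b * y), mul_inv, one_div y]

lemma isPrimitiveRoot_nome {d : ℕ} (hd : d ≠ 0) : IsPrimitiveRoot (nome (1 / d)) d := by
  have := Complex.isPrimitiveRoot_exp d hd
  rwa [← mul_one_div] at this

/-- The linear coefficient of `log (1 - p ^ m)`. -/
noncomputable def jetA (m : ℕ) : ℂ := if m = 1 then -1 else 0

/-- The quadratic coefficient of `log (1 - p ^ m)`. -/
noncomputable def jetL (m : ℕ) : ℂ := if m = 1 then -1 / 2 else if m = 2 then -1 else 0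

lemma jet_one_add_of_isLittleO {g : ℂ → ℂ} {l : ℂ}
    (h : (fun z => g z - l * pp z ^ 2) =o[atInf] fun z => pp z ^ 2) :
    Jet (fun z => 1 + g z) 0 l := by
  refine Jet.of_isLittleO (h.congr_left fun z => ?_)
  ring

lemma jet_one_sub_pp_pow {m : ℕ} (hm : m ≠ 0) :
    Jet (fun z => 1 - pp z ^ m) (jetA m) (jetL m) := by
  rcases (show m = 1 ∨ m = 2 ∨ 2 < m by omega) with rfl | rfl | h
  · refine ⟨fun z => log (1 - pp z), ?_, ?_⟩
    · filter_upwards [tendsto_pp.eventually_ne (show (0 : ℂ) ≠ 1 by norm_num)] with z hz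
      rw [exp_log, pow_one]
      exact sub_ne_zero.2 (Ne.symm hz)
    · have h1 : (fun x : ℂ => log (1 - x) + x + x ^ 2 / 2) =O[𝓝 0] fun x => x ^ 3 := by
        refine Asymptotics.IsBigO.of_bound 1 ?_
        have : ∀ᶠ x : ℂ in 𝓝 0, ‖x‖ < 1 / 2 :=
          (continuous_norm.tendsto' (0 : ℂ) 0 norm_zero).eventually_lt_const (by norm_num)
        filter_upwards [this] with x hx
        have h2 := norm_log_sub_logTaylor_le 2 (z := -x) (by rw [norm_neg]; linarith)
        rw [norm_neg] at h2
        have h3 : log (1 + -x) - logTaylor (2 + 1) (-x) = log (1 - x) + x + x ^ 2 / 2 := by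
          simp [logTaylor, Finset.sum_range_succ]; ring_nf
        rw [h3] at h2
        refine h2.trans ?_
        rw [norm_pow, one_mul]
        have h3 : (1 - ‖x‖)⁻¹ ≤ 2 := by
          rw [inv_le_comm₀ (by linarith) (by norm_num)]; linarith
        have h4 : 0 ≤ ‖x‖ ^ 3 := by positivity
        norm_num
        nlinarith
      refine ((h1.comp_tendsto tendsto_pp).trans_isLittleO (k := fun z => pp z ^ 2) ?_).congr_left
        fun z => ?_
      · have := ex_isLittleO_sq (s := (3 : ℕ) / 2) (by norm_num)
        exact this.congr_left (ex_nat_half 3)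
      · simp only [Function.comp_apply, jetA, jetL, if_true]; ring
  · have : Jet (fun z => 1 + -pp z ^ 2) 0 (-1) := jet_one_add_of_isLittleO
      ((Asymptotics.isLittleO_zero _ _).congr_left fun z => by ring)
    simpa [jetA, jetL, sub_eq_add_neg] using this
  · have : Jet (fun z => 1 + -pp z ^ m) 0 0 := by
      refine jet_one_add_of_isLittleO ?_
      have h1 := (ex_isLittleO_sq (s := (m : ℕ) / 2) (by
        have : (2 : ℝ) < m := by exact_mod_cast h
        linarith)).neg_left
      refine h1.congr_left fun z => ?_
      rw [ex_nat_half]; ring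
    have h1 : m ≠ 1 := by omega
    have h2 : m ≠ 2 := by omega
    simpa [jetA, jetL, h1, h2, sub_eq_add_neg] using this

lemma pjet_sub_zpow {m k : ℕ} (h : m ≠ k) :
    PJet (fun z => (1 / pp z) ^ m - (1 / pp z) ^ k) (jetA ((m : ℤ) - k).natAbs)
      (jetL ((m : ℤ) - k).natAbs) := by
  have key : ∀ m k : ℕ, k < m → PJet (fun z => (1 / pp z) ^ m - (1 / pp z) ^ k)
      (jetA ((m : ℤ) - k).natAbs) (jetL ((m : ℤ) - k).natAbs) := by
    intro m k h
    obtain ⟨e, rfl⟩ := Nat.exists_eq_add_of_lt h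
    have he : (((k + e + 1 : ℕ) : ℤ) - k).natAbs = e + 1 := by omega
    rw [he]
    have := (PJet.pp_zpow (-((k + e + 1 : ℕ) : ℤ))).mul (jet_one_sub_pp_pow e.succ_ne_zero).pjet
    rw [zero_add, zero_add] at this
    refine this.congr (Eventually.of_forall fun z => ?_)
    have := pp_ne_zero z
    rw [_root_.zpow_neg, zpow_natCast, mul_sub, mul_one, one_div, inv_pow, inv_pow, add_assoc,
      pow_add, mul_inv, mul_assoc, inv_mul_cancel₀ (pow_ne_zero _ this), mul_one]
  rcases lt_or_gt_of_ne h with h | h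
  · have h1 := (key k m h).const_mul (neg_ne_zero.2 one_ne_zero)
    rw [← Int.natAbs_neg, neg_sub]
    exact h1.congr (Eventually.of_forall fun z => by ring)
  · exact key m k h

/-- `c` is the sequence of Taylor coefficients of `A` at `0`. -/
def HasCoefs (A : ℂ → ℂ) (c : ℕ → ℂ) : Prop :=
  ∀ N : ℕ, EqMod (N + 1) A fun x => ∑ k ∈ Finset.range (N + 1), c k * x ^ k

lemma sub_apply_zero_isBigO {A : ℂ → ℂ} (hA : AnalyticAt ℂ A 0) {l : Filter ℂ} {Y : ℂ → ℂ}
    (hY : Tendsto Y l (𝓝 0)) : (fun z => A (Y z) - A 0) =O[l] Y := by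
  have h := hA.differentiableAt.isBigO_sub
  have := h.comp_tendsto hY
  simpa [Function.comp_def] using this

lemma rotate_ne {d : ℕ} {ζ : ℂ} (hζ : IsPrimitiveRoot ζ d) (hd : d ≠ 0) {s t : ℝ} (hst : s ≠ t)
    (b : ℕ) : ∀ᶠ z in atInf, ex s z ≠ ζ ^ b * ex t z := by
  have hz : ζ ^ b ≠ 0 := pow_ne_zero _ (hζ.ne_zero hd)
  have key : ∀ s t : ℝ, t < s → ∀ w : ℂ, w ≠ 0 → ∀ᶠ z in atInf, w * ex t z ≠ ex s z := by
    intro s t h w hw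
    filter_upwards [(tendsto_ex (sub_pos.2 h)).eventually_ne hw.symm] with z hz h1
    have h2 : ex s z = ex (s - t) z * ex t z := by rw [ex_mul]; congr 1; ring
    rw [h2] at h1
    exact hz (mul_right_cancel₀ (ex_ne_zero t z) h1).symm
  rcases lt_or_gt_of_ne hst with h | h
  · filter_upwards [key t s h (ζ ^ b)⁻¹ (inv_ne_zero hz)] with z h1 h2
    exact h1 (by rw [h2, inv_mul_cancel_left₀ hz])
  · filter_upwards [key s t h (ζ ^ b) hz] with z h1 h2
    exact h1 h2.symm

lemma prod_erase_rotate {d : ℕ} {ζ : ℂ} (hζ : IsPrimitiveRoot ζ d) (s : ℕ) :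
    PJet (fun z => ∏ b ∈ (Finset.range d).erase 0, (1 / pp z ^ s - 1 / (ζ ^ b * pp z ^ s))) 0 0 :=
        by
  have := PJet.prod ((Finset.range d).erase 0) (g := fun b z => (1 - 1 / ζ ^ b) * pp z ^ (-(s : ℤ)))
    (α := fun _ => 0) (l := fun _ => 0) (fun b hb => ?_)
  · simp only [Finset.sum_const_zero] at this
    refine this.congr (Eventually.of_forall fun z => Finset.prod_congr rfl fun b _ => ?_)
    rw [_root_.zpow_neg, zpow_natCast, one_div (ζ ^ b * _), mul_inv]
    ring
  · refine (PJet.pp_zpow _).const_mul ?_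
    simp only [Finset.mem_erase, Finset.mem_range] at hb
    have h1 : ζ ^ b ≠ 1 := hζ.pow_ne_one_of_pos_of_lt hb.1 hb.2
    rw [sub_ne_zero, ne_comm, one_div]
    simpa using h1

lemma pjet_coreTwo_ne {F A : ℂ → ℂ} (hF : PolePart F A) {a d : ℕ} (ha : a ≠ 0) (hd : d ≠ 0)
    (had : a ≠ d) {ζ : ℂ} (hζ : IsPrimitiveRoot ζ d) :
    PJet (fun z => ∏ b ∈ Finset.range d, (F (ex 1 z) - F (ζ ^ b * ex (a / d) z))) 0
      (if ((a : ℤ) - d).natAbs = 1 then -1 else 0) := by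
  have ha' : (0 : ℝ) < a := by exact_mod_cast Nat.pos_of_ne_zero ha
  have hd' : (0 : ℝ) < d := by exact_mod_cast Nat.pos_of_ne_zero hd
  have hp : (0 : ℝ) < a / d := div_pos ha' hd'
  have hP := pjet_sub_zpow (m := 2 * d) (k := 2 * a) (by omega)
  have he : (((2 * d : ℕ) : ℤ) - (2 * a : ℕ)).natAbs = 2 * ((a : ℤ) - d).natAbs := by omega
  rw [he] at hP
  have := jet_prod_sub hF (Finset.range d) (s := 1) (t := a / d) (w := fun b => ζ ^ b)
    (by norm_num) hp (fun b _ => pow_ne_zero _ (hζ.ne_zero hd))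
    (fun b _ => rotate_ne hζ hd (by
      rw [ne_eq, eq_comm, div_eq_one_iff_eq hd'.ne']; exact_mod_cast had) b) (l := 0) ?_
    (fun z => prod_inv_sub_rotate (Nat.pos_of_ne_zero hd) hζ _ _)
    (hP.congr (Eventually.of_forall fun z => ?_))
  · convert this using 1
    · simp [jetA]
    · simp only [jetL, zero_add]
      split_ifs <;> first | rfl | omega
  · refine Asymptotics.IsLittleO.congr_left (f₁ := ∑ b ∈ Finset.range d, fun z =>
      ex 1 z * (A (ζ ^ b * ex (a / d) z) - A 0)) (Asymptotics.IsLittleO.sum fun b _ => ?_)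
      fun z => by simp
    have h1 := (Asymptotics.isBigO_refl (ex 1) atInf).mul (sub_apply_zero_isBigO hF.1
      (show Tendsto (fun z => ζ ^ b * ex (a / d) z) atInf (𝓝 0) by
        simpa using (tendsto_ex hp).const_mul (ζ ^ b)))
    refine h1.trans_isLittleO ?_
    refine ((ex_isLittleO_sq (s := 1 + a / d) (by linarith)).const_mul_left (ζ ^ b)).congr_left
      fun z => ?_
    rw [← ex_mul]; ring
  · have h1 : ex (a / d) z ^ d = pp z ^ (2 * a) := by
      rw [ex_pow, ← ex_nat_half]; congr 1; push_cast; field_simp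
    rw [ex_one, _root_.one_div_pow (ex _ z), h1, ← _root_.one_div_pow, ← _root_.one_div_pow,
        ← pow_mul]

lemma pjet_coreTwo_eq {F A : ℂ → ℂ} (hF : PolePart F A) {d : ℕ} (hd : d ≠ 0) {ζ : ℂ}
    (hζ : IsPrimitiveRoot ζ d) :
    PJet (fun z => ∏ b ∈ (Finset.range d).erase 0, (F (ex 1 z) - F (ζ ^ b * ex 1 z))) 0 0 := by
  have hP := prod_erase_rotate hζ 2
  have := jet_prod_sub hF ((Finset.range d).erase 0) (s := 1) (t := 1) (w := fun b => ζ ^ b)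
    (by norm_num) one_pos (fun b _ => pow_ne_zero _ (hζ.ne_zero hd))
    (fun b hb => Eventually.of_forall fun z hz => ?_) (l := 0) ?_
    (fun z => rfl) (hP.congr (Eventually.of_forall fun z => by simp only [ex_one]))
  · simpa using this
  · simp only [Finset.mem_erase, Finset.mem_range] at hb
    have h1 : ζ ^ b ≠ 1 := hζ.pow_ne_one_of_pos_of_lt hb.1 hb.2
    exact h1 (mul_right_cancel₀ (ex_ne_zero 1 z) (by rw [one_mul, ← hz]))
  · refine Asymptotics.IsLittleO.congr_left (f₁ := ∑ b ∈ (Finset.range d).erase 0, fun z =>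
      ex 1 z * (A (ζ ^ b * ex 1 z) - A 0)) (Asymptotics.IsLittleO.sum fun b _ => ?_)
      fun z => by simp
    have h1 := (Asymptotics.isBigO_refl (ex 1) atInf).mul (sub_apply_zero_isBigO hF.1
      (show Tendsto (fun z => ζ ^ b * ex 1 z) atInf (𝓝 0) by
        simpa using (tendsto_ex one_pos).const_mul (ζ ^ b)))
    refine h1.trans_isLittleO ?_
    refine ((ex_isLittleO_sq (s := 1 + 1) (by norm_num)).const_mul_left (ζ ^ b)).congr_left
      fun z => ?_
    rw [← ex_mul]; ring

/-- The averaged regular part, multiplied by the inverse of the polar term. -/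
lemma sum_regular {A : ℂ → ℂ} {c : ℕ → ℂ} (hc : HasCoefs A c) (h0 : A 0 = c 0) {a d : ℕ}
    (ha : a ≠ 0) (hd : d ≠ 0) {ζ : ℂ} (hζ : IsPrimitiveRoot ζ d) {u ω : ℂ} (hu : u ^ d = ω) :
    (fun z => ∑ b ∈ Finset.range d, pp z * (A (ζ ^ b * (u * ex (a / (2 * d)) z)) - A 0) -
      (if a = 1 then ω * d * c d else 0) * pp z ^ 2) =o[atInf] fun z => pp z ^ 2 := by
  have ha' : (1 : ℝ) ≤ a := by exact_mod_cast Nat.one_le_iff_ne_zero.2 ha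
  have hd' : (0 : ℝ) < d := by exact_mod_cast Nat.pos_of_ne_zero hd
  have hp : (0 : ℝ) < a / (2 * d) := by positivity
  have h1 := sum_rotate_isBigO hd (hc d) hζ (l := atInf) (y := fun z => u * ex (a / (2 * d)) z)
    (by simpa using (tendsto_ex hp).const_mul u)
  have h2 := (Asymptotics.isBigO_refl pp atInf).mul h1
  have hy : ∀ z, ex (a / (2 * d)) z ^ d = pp z ^ a := fun z => by
    rw [ex_pow, ← ex_nat_half]; congr 1; field_simp
  have h3 : (fun z => pp z * (u * ex (a / (2 * d)) z) ^ (d + 1)) =o[atInf] fun z => pp z ^ 2 := by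
    refine ((ex_isLittleO_sq (s := (1 + a : ℕ) / 2 + a / (2 * d)) ?_).const_mul_left
      (u ^ (d + 1))).congr_left fun z => ?_
    · push_cast; linarith
    · rw [← ex_mul, ex_nat_half, mul_pow, pow_succ (ex _ z), hy]; ring
  have h4 := h2.trans_isLittleO h3
  have h5 : (fun z => pp z * (d * c d * (u * ex (a / (2 * d)) z) ^ d) -
      (if a = 1 then ω * d * c d else 0) * pp z ^ 2) =o[atInf] fun z => pp z ^ 2 := by
    simp only [mul_pow, hy, hu]
    split_ifs with h
    · subst h
      refine (Asymptotics.isLittleO_zero _ _).congr_left fun z => ?_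
      rw [pow_one]; ring
    · have : (2 : ℝ) ≤ a := by exact_mod_cast (show 2 ≤ a by omega)
      refine ((ex_isLittleO_sq (s := (1 + a : ℕ) / 2) (by push_cast; linarith)).const_mul_left
        (d * c d * ω)).congr_left fun z => ?_
      rw [ex_nat_half]; ring
  refine (h4.add h5).congr_left fun z => ?_
  rw [← Finset.mul_sum, h0]
  ring

lemma pjet_coreOne_ne {F A : ℂ → ℂ} {c : ℕ → ℂ} (hF : PolePart F A) (hc : HasCoefs A c)
    (h0 : A 0 = c 0) {a d : ℕ} (ha : a ≠ 0) (hd : d ≠ 0) (had : a ≠ d) {ζ : ℂ}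
    (hζ : IsPrimitiveRoot ζ d) :
    PJet (fun z => ∏ b ∈ Finset.range d, (F (pp z) - F (ζ ^ b * ex (a / (2 * d)) z)))
      (jetA ((a : ℤ) - d).natAbs)
      (-(if a = 1 then d * c d else 0) + jetL ((a : ℤ) - d).natAbs) := by
  have ha' : (0 : ℝ) < a := by exact_mod_cast Nat.pos_of_ne_zero ha
  have hd' : (0 : ℝ) < d := by exact_mod_cast Nat.pos_of_ne_zero hd
  have hp : (0 : ℝ) < a / (2 * d) := by positivity
  have hP := pjet_sub_zpow (m := d) (k := a) (by omega)
  rw [show ((d : ℤ) - a).natAbs = ((a : ℤ) - d).natAbs by omega] at hP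
  have := jet_prod_sub hF (Finset.range d) (s := 1 / 2) (t := a / (2 * d)) (w := fun b => ζ ^ b)
    le_rfl hp (fun b _ => pow_ne_zero _ (hζ.ne_zero hd))
    (fun b _ => rotate_ne hζ hd (by
      rw [ne_eq, eq_comm, div_eq_iff (by positivity)]
      intro h
      exact had (by exact_mod_cast (show (a : ℝ) = d by rw [h]; ring))) b)
    (l := -(if a = 1 then d * c d else 0)) ?_
    (fun z => prod_inv_sub_rotate (Nat.pos_of_ne_zero hd) hζ _ _)
    (hP.congr (Eventually.of_forall fun z => ?_))
  · rw [ex_half] at this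
    exact this
  · refine (sum_regular hc h0 ha hd hζ (one_pow d)).congr_left fun z => ?_
    simp only [ex_half, one_mul]
    ring
  · have h1 : ex (a / (2 * d)) z ^ d = pp z ^ a := by
      rw [ex_pow, ← ex_nat_half]; congr 1; field_simp
    rw [ex_half, _root_.one_div_pow (ex _ z), h1, ← _root_.one_div_pow]

lemma pjet_coreOne_eq {F A : ℂ → ℂ} {c : ℕ → ℂ} (hF : PolePart F A) (hc : HasCoefs A c)
    (h0 : A 0 = c 0) {d : ℕ} (hd : d ≠ 0) {ζ : ℂ} (hζ : IsPrimitiveRoot ζ d) :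
    PJet (fun z => ∏ b ∈ (Finset.range d).erase 0, (F (pp z) - F (ζ ^ b * pp z))) 0
      (c 1 - if d = 1 then d * c d else 0) := by
  have hd' : (0 : ℝ) < d := by exact_mod_cast Nat.pos_of_ne_zero hd
  have hP := prod_erase_rotate hζ 1
  have := jet_prod_sub hF ((Finset.range d).erase 0) (s := 1 / 2) (t := 1 / 2)
    (w := fun b => ζ ^ b) le_rfl one_half_pos (fun b _ => pow_ne_zero _ (hζ.ne_zero hd))
    (fun b hb => Eventually.of_forall fun z hz => ?_)
    (l := c 1 - if d = 1 then d * c d else 0) ?_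
    (fun z => rfl) (hP.congr (Eventually.of_forall fun z => by simp only [ex_half, pow_one]))
  · rw [ex_half, add_zero] at this
    exact this
  · simp only [Finset.mem_erase, Finset.mem_range] at hb
    have h1 : ζ ^ b ≠ 1 := hζ.pow_ne_one_of_pos_of_lt hb.1 hb.2
    exact h1 (mul_right_cancel₀ (ex_ne_zero _ z) (by rw [one_mul, ← hz]))
  · have h1 := sum_regular hc h0 hd hd hζ (one_pow d)
    have h2 := sum_regular hc h0 one_ne_zero one_ne_zero IsPrimitiveRoot.one (one_pow 1)
    refine (h1.sub h2).congr_left fun z => ?_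
    have e1 : (d : ℝ) / (2 * d) = 1 / 2 := by field_simp
    have e2 : ((1 : ℕ) : ℝ) / (2 * (1 : ℕ)) = 1 / 2 := by norm_num
    rw [e1, e2, ex_half, ← Finset.add_sum_erase _ _ (Finset.mem_range.2 (Nat.pos_of_ne_zero hd))]
    simp only [Finset.sum_range_one, one_mul, pow_zero, if_true, Nat.cast_one]
    split_ifs <;> ring

section Coefficients
open Polynomial

/-- The polynomial `∏ (1 - X ^ e m) ^ 24`. -/
noncomputable def truncProd (e : ℕ → ℕ) (N : ℕ) : ℤ[X] :=
  ∏ m ∈ Finset.Icc 1 N, ((1 : ℤ[X]) - X ^ e m) ^ 24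

lemma X_pow_dvd_truncProd_sub {e : ℕ → ℕ} (he : ∀ m, m ≤ e m) {k N : ℕ} (h : k ≤ N) :
    (X : ℤ[X]) ^ (k + 1) ∣ truncProd e N - truncProd e k := by
  induction N, h using Nat.le_induction with
  | base => simp
  | succ N hN ih =>
    have h1 : truncProd e (N + 1) - truncProd e k = (truncProd e N - truncProd e k) +
        truncProd e N * ((1 - X ^ e (N + 1)) ^ 24 - 1 ^ 24) := by
      rw [truncProd, Finset.prod_Icc_succ_top (by omega), ← truncProd]; ring
    rw [h1]
    refine dvd_add ih (dvd_mul_of_dvd_right (dvd_trans ?_ (sub_dvd_pow_sub_pow _ _ 24)) _)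
    rw [sub_sub_cancel_left, dvd_neg]
    exact pow_dvd_pow _ (by have := he (N + 1); omega)

lemma X_pow_dvd_sum_sub (c : ℤ → ℤ) {k N : ℕ} (h : k ≤ N) :
    (X : ℤ[X]) ^ (k + 1) ∣ ∑ n ∈ Finset.range (N + 2), C (c ((n : ℤ) - 1)) * X ^ n -
      ∑ n ∈ Finset.range (k + 2), C (c ((n : ℤ) - 1)) * X ^ n := by
  rw [← Finset.sum_range_add_sum_Ico _ (show k + 2 ≤ N + 2 by omega), add_sub_cancel_left]
  refine Finset.dvd_sum fun n hn => dvd_mul_of_dvd_right (pow_dvd_pow _ ?_) _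
  have := Finset.mem_Ico.1 hn
  omega

lemma X_pow_dvd_of_isEtaQuotCoeff {c : ℤ → ℤ} (hc : IsEtaQuotCoeff c) (N : ℕ) :
    (X : ℤ[X]) ^ (N + 1) ∣ (∑ n ∈ Finset.range (N + 2), C (c ((n : ℤ) - 1)) * X ^ n) *
      truncProd (fun m => 2 * m) N - truncProd (fun m => m) N := by
  rw [X_pow_dvd_iff]
  intro k hk
  have hk' : k ≤ N := by omega
  have h0 : ((∑ n ∈ Finset.range (k + 2), C (c ((n : ℤ) - 1)) * X ^ n) *
      truncProd (fun m => 2 * m) k - truncProd (fun m => m) k).coeff k = 0 := by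
    rw [coeff_sub, sub_eq_zero]
    exact hc.2 k
  have h1 := X_pow_dvd_truncProd_sub (e := fun m => 2 * m) (fun m => by omega) hk'
  have h2 := X_pow_dvd_truncProd_sub (e := fun m => m) (fun m => le_rfl) hk'
  have h3 := X_pow_dvd_sum_sub c hk'
  have h4 := dvd_sub (dvd_add (h3.mul_right (truncProd (fun m => 2 * m) N)) (h1.mul_left
    (∑ n ∈ Finset.range (k + 2), C (c ((n : ℤ) - 1)) * X ^ n))) h2
  have h5 := X_pow_dvd_iff.1 h4 k (by omega)
  clear h1 h2 h3 h4
  revert h0 h5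
  generalize truncProd (fun m => 2 * m) N = A
  generalize truncProd (fun m => m) N = B
  generalize truncProd (fun m => 2 * m) k = A'
  generalize truncProd (fun m => m) k = B'
  generalize ∑ n ∈ Finset.range (N + 2), C (c ((n : ℤ) - 1)) * X ^ n = D
  generalize ∑ n ∈ Finset.range (k + 2), C (c ((n : ℤ) - 1)) * X ^ n = D'
  intro h0 h5
  have h6 : D * A - B = ((D - D') * A + D' * (A - A') - (B - B')) + (D' * A' - B') := by ring
  rw [h6, coeff_add, h5, h0, add_zero]

lemma eqMod_of_X_pow_dvd {p q : ℤ[X]} {n : ℕ} (h : (X : ℤ[X]) ^ n ∣ p - q) :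
    EqMod n (fun x => aeval x p) (fun x => aeval x q) := by
  obtain ⟨r, hr⟩ := h
  have h1 : Continuous fun x : ℂ => aeval x r := r.continuous_aeval
  have h2 := (Asymptotics.isBigO_refl (fun x : ℂ => x ^ n) (𝓝 0)).mul
    ((h1.tendsto (0 : ℂ)).isBigO_one ℂ)
  simp only [mul_one] at h2
  refine h2.congr_left fun x => ?_
  rw [← map_sub, hr]
  simp

end Coefficients

/-- The function `∏_{m ≤ N} (1 - x ^ e m) ^ 24`. -/
noncomputable def truncFun (e : ℕ → ℕ) (N : ℕ) (x : ℂ) : ℂ :=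
  ∏ m ∈ Finset.Icc 1 N, (1 - x ^ e m) ^ 24

lemma continuous_truncFun (e : ℕ → ℕ) (N : ℕ) : Continuous (truncFun e N) := by
  unfold truncFun; fun_prop

lemma truncFun_zero {e : ℕ → ℕ} (he : ∀ m, m ≤ e m) (N : ℕ) : truncFun e N 0 = 1 := by
  refine Finset.prod_eq_one fun m hm => ?_
  have := he m
  have := (Finset.mem_Icc.1 hm).1
  rw [zero_pow (by omega), sub_zero, one_pow]

lemma EqMod.div_right {n : ℕ} {f g h : ℂ → ℂ} (hfg : EqMod n (fun x => f x * h x) g)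
    (hh : ContinuousAt h 0) (h0 : h 0 ≠ 0) : EqMod n f fun x => g x / h x := by
  have h1 := Asymptotics.IsBigO.mul hfg ((hh.inv₀ h0).tendsto.isBigO_one ℂ)
  simp only [mul_one] at h1
  refine h1.congr' ?_ EventuallyEq.rfl
  filter_upwards [hh.eventually_ne h0] with x hx
  simp only [Pi.inv_apply]
  field_simp

lemma etaQ_eqMod_sum {c : ℤ → ℤ} (hc : IsEtaQuotCoeff c) (N : ℕ) :
    EqMod (N + 1) etaQ fun x => ∑ k ∈ Finset.range (N + 1), (c ((k : ℤ) - 1) : ℂ) * x ^ k := by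
  have h1 := eqMod_of_X_pow_dvd (X_pow_dvd_of_isEtaQuotCoeff hc N)
  have h2 : ∀ e : ℕ → ℕ, ∀ x : ℂ, Polynomial.aeval x (truncProd e N) = truncFun e N x := by
    intro e x
    simp [truncProd, truncFun]
  simp only [map_mul, h2] at h1
  have h3 := etaQ_eqMod N
  have hD := (continuous_truncFun (fun m => 2 * m) N).continuousAt (x := 0)
  have hD0 : truncFun (fun m => 2 * m) N 0 ≠ 0 := by
    rw [truncFun_zero fun m => by omega]; exact one_ne_zero
  have h4 : EqMod (N + 1) etaQ fun x => truncFun (fun m => m) N x / truncFun (fun m => 2 * m) N x :=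
    EqMod.div_right h3 hD hD0
  refine (h4.trans (h1.div_right hD hD0).symm).trans ?_
  have h5 : EqMod (N + 1) (fun x => ∑ k ∈ Finset.range (N + 2), (c ((k : ℤ) - 1) : ℂ) * x ^ k)
      fun x => ∑ k ∈ Finset.range (N + 1), (c ((k : ℤ) - 1) : ℂ) * x ^ k := by
    refine (Asymptotics.isBigO_const_mul_self (c (((N + 1 : ℕ) : ℤ) - 1) : ℂ)
      (fun x : ℂ => x ^ (N + 1)) (𝓝 0)).congr_left fun x => ?_
    dsimp only
    rw [Finset.sum_range_succ _ (N + 1)]; ring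
  simpa using h5

/-- The regular part of `etaQ x / x`. -/
noncomputable def etaReg : ℂ → ℂ := dslope etaQ 0

lemma analyticAt_dslope {f : ℂ → ℂ} (hf : AnalyticAt ℂ f 0) : AnalyticAt ℂ (dslope f 0) 0 := by
  obtain ⟨p, hp⟩ := hf
  exact ⟨_, hp.has_fpower_series_dslope_fslope⟩

lemma eq_add_mul_dslope (f : ℂ → ℂ) (x : ℂ) : f x = f 0 + x * dslope f 0 x := by
  have := sub_smul_dslope f 0 x
  rw [sub_zero, smul_eq_mul] at this
  rw [this]; ring

lemma polePart_div {f : ℂ → ℂ} (hf : AnalyticAt ℂ f 0) (h0 : f 0 = 1) :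
    PolePart (fun x => f x / x) (dslope f 0) := by
  refine ⟨analyticAt_dslope hf, ?_⟩
  filter_upwards [self_mem_nhdsWithin] with x hx
  have hx' : x ≠ 0 := hx
  rw [eq_add_mul_dslope f x, h0]
  field_simp

lemma polePart_etaQ : PolePart (fun x => etaQ x / x) etaReg :=
  polePart_div analyticAt_etaQ_zero etaQ_zero

lemma etaReg_zero : etaReg 0 = -24 := by
  rw [etaReg, dslope_same, hasDerivAt_etaQ_zero.deriv]

lemma etaReg_zero_eq {c : ℤ → ℤ} (hc : IsEtaQuotCoeff c) : etaReg 0 = c (0 : ℕ) := by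
  have h := etaQ_eqMod_sum hc 1
  simp only [Finset.sum_range_succ, Finset.range_zero, Finset.sum_empty] at h
  have := deriv_eq_of_eqMod_two (f := etaQ) (c (-1) : ℂ) (c 0 : ℂ) (by simpa using h)
    analyticAt_etaQ_zero.continuousAt
  rw [etaReg, dslope_same, this.deriv]
  simp

lemma hasCoefs_etaReg {c : ℤ → ℤ} (hc : IsEtaQuotCoeff c) :
    HasCoefs etaReg fun k => (c k : ℂ) := by
  intro N
  have h := etaQ_eqMod_sum hc (N + 1)
  have hm1 : (c (-1) : ℂ) = 1 := by
    have h0 := etaQ_eqMod_sum hc 0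
    have : Tendsto (fun x => etaQ x - (c (-1) : ℂ)) (𝓝 0) (𝓝 0) := by
      refine Asymptotics.IsBigO.trans_tendsto (g'' := fun x : ℂ => x ^ (0 + 1)) ?_ ?_
      · simpa [EqMod] using h0
      · simp only [zero_add, pow_one]
        exact tendsto_id
    have h2 := analyticAt_etaQ_zero.continuousAt.tendsto.sub_const (c (-1) : ℂ)
    have h3 := tendsto_nhds_unique h2 this
    rw [etaQ_zero] at h3
    linear_combination -h3
  obtain ⟨K, hK⟩ := h.bound
  refine Asymptotics.IsBigO.of_bound K ?_
  filter_upwards [hK] with x hx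
  rcases eq_or_ne x 0 with rfl | hx0
  · rw [etaReg_zero_eq hc]
    simp [Finset.sum_range_succ']
  · have h1 : etaQ x - ∑ k ∈ Finset.range (N + 1 + 1), (c ((k : ℤ) - 1) : ℂ) * x ^ k =
        x * (etaReg x - ∑ k ∈ Finset.range (N + 1), (c k : ℂ) * x ^ k) := by
      rw [eq_add_mul_dslope etaQ x, etaQ_zero, Finset.sum_range_succ', mul_sub, Finset.mul_sum]
      simp only [Nat.cast_add, Nat.cast_one, add_sub_cancel_right, Nat.cast_zero, zero_sub, hm1,
        pow_zero, mul_one, etaReg]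
      have : ∀ k : ℕ, (c k : ℂ) * x ^ (k + 1) = x * (c k * x ^ k) := fun k => by ring
      simp only [this]
      ring
    rw [h1, norm_mul, pow_succ', norm_mul, mul_left_comm] at hx
    exact le_of_mul_le_mul_left hx (norm_pos_iff.2 hx0)

lemma prod_range_mul_of_periodic {f : ℕ → ℂ} {e : ℕ} (hf : Function.Periodic f e) (k : ℕ) :
    ∏ b ∈ Finset.range (k * e), f b = (∏ b ∈ Finset.range e, f b) ^ k := by
  induction k with
  | zero => simp
  | succ k ih =>
    rw [add_one_mul, Finset.prod_range_add, ih, pow_succ]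
    congr 1
    refine Finset.prod_congr rfl fun b _ => ?_
    rw [add_comm]
    exact hf.nat_mul k b

lemma prod_one_sub_rotate_pow {d m : ℕ} (hd : 0 < d) (hm : m ≠ 0) {ζ : ℂ}
    (hζ : IsPrimitiveRoot ζ d) (y : ℂ) :
    ∏ b ∈ Finset.range d, (1 - (ζ ^ b * y) ^ m) =
      (1 - y ^ (d * (m / d.gcd m))) ^ d.gcd m := by
  have hg : 0 < d.gcd m := Nat.gcd_pos_of_pos_left _ hd
  obtain ⟨e, he⟩ := Nat.gcd_dvd_left d m
  obtain ⟨k, hk⟩ := Nat.gcd_dvd_right d m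
  have hη : IsPrimitiveRoot (ζ ^ m) e := by
    have h1 := IsPrimitiveRoot.orderOf (ζ ^ m)
    rw [orderOf_pow' ζ hm, ← hζ.eq_orderOf] at h1
    rwa [show d / d.gcd m = e from Nat.div_eq_of_eq_mul_right hg he] at h1
  have hee : 0 < e := Nat.pos_of_ne_zero (by rintro rfl; omega)
  have h2 : ∀ b, (1 - (ζ ^ b * y) ^ m : ℂ) = 1 - (ζ ^ m) ^ b * y ^ m := fun b => by
    rw [mul_pow, ← pow_mul, ← pow_mul, mul_comm b m]
  have h3 : Function.Periodic (fun b => (1 - (ζ ^ m) ^ b * y ^ m : ℂ)) e := fun b => by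
    simp only [pow_add, hη.pow_eq_one, mul_one]
  simp only [h2]
  have h4 := prod_range_mul_of_periodic h3 (d.gcd m)
  rw [← he] at h4
  rw [h4, prod_sub_rotate hee hη, one_pow, ← pow_mul]
  congr 3
  rw [show m / d.gcd m = k from Nat.div_eq_of_eq_mul_right hg hk]
  calc m * e = d.gcd m * k * e := by rw [← hk]
    _ = d.gcd m * e * k := by ring
    _ = d * k := by rw [← he]

lemma jet_prod_one_sub_rotate {a d m : ℕ} (ha : a ≠ 0) (hd : d ≠ 0) (hm : m ≠ 0) {ζ : ℂ}
    (hζ : IsPrimitiveRoot ζ d) :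
    Jet (fun z => ∏ b ∈ Finset.range d, (1 - (ζ ^ b * ex (a / d) z) ^ m)) 0
      (-(if a = 1 ∧ m ∣ d then (m : ℂ) else 0)) := by
  have hg : 0 < d.gcd m := Nat.gcd_pos_of_pos_left _ (Nat.pos_of_ne_zero hd)
  obtain ⟨k, hk⟩ := Nat.gcd_dvd_right d m
  have hkm : m / d.gcd m = k := Nat.div_eq_of_eq_mul_right hg hk
  have hk0 : k ≠ 0 := by rintro rfl; omega
  have hd' : (d : ℝ) ≠ 0 := by exact_mod_cast hd
  have h1 := (jet_one_sub_pp_pow (m := 2 * (a * k)) (by positivity)).pow (d.gcd m)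
  have hA : jetA (2 * (a * k)) = 0 := if_neg (by omega)
  have hL : (d.gcd m : ℂ) * jetL (2 * (a * k)) = -(if a = 1 ∧ m ∣ d then (m : ℂ) else 0) := by
    rw [jetL, if_neg (by omega)]
    by_cases h : a = 1 ∧ m ∣ d
    · have h2 : d.gcd m = m := Nat.gcd_eq_right h.2
      have h3 : k = 1 := by rw [← hkm, h2]; exact Nat.div_self (Nat.pos_of_ne_zero hm)
      rw [if_pos h, h.1, h3, h2]
      simp
    · rw [if_neg h, if_neg]
      · simp
      · intro h2
        have h3 : a * k = 1 := by omega
        rw [mul_eq_one] at h3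
        refine h ⟨h3.1, ?_⟩
        rw [hk, h3.2, mul_one]
        exact Nat.gcd_dvd_left d m
  rw [hA, mul_zero, hL] at h1
  refine h1.congr (Eventually.of_forall fun z => ?_)
  rw [prod_one_sub_rotate_pow (Nat.pos_of_ne_zero hd) hm hζ, hkm, ex_pow]
  congr 2
  rw [← ex_nat_half]
  congr 1
  push_cast
  field_simp

lemma jet_prod_truncFun {a d N : ℕ} (ha : a ≠ 0) (hd : d ≠ 0) {ζ : ℂ}
    (hζ : IsPrimitiveRoot ζ d) {e : ℕ → ℕ} (he : ∀ m, m ≤ e m) :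
    Jet (fun z => ∏ b ∈ Finset.range d, truncFun e N (ζ ^ b * ex (a / d) z)) 0
      (-(24 * ∑ m ∈ Finset.Icc 1 N, if a = 1 ∧ e m ∣ d then (e m : ℂ) else 0)) := by
  have h1 := Jet.prod (Finset.Icc 1 N) (fun m hm => (jet_prod_one_sub_rotate ha hd (m := e m)
    (by have := he m; have := (Finset.mem_Icc.1 hm).1; omega) hζ).pow 24)
  simp only [mul_zero, Finset.sum_const_zero, ← Finset.mul_sum, Finset.sum_neg_distrib, mul_neg,
    Nat.cast_ofNat] at h1
  refine h1.congr (Eventually.of_forall fun z => ?_)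
  simp only [truncFun]
  rw [Finset.prod_comm]
  exact Finset.prod_congr rfl fun m _ => (Finset.prod_pow _ _ _).symm

/-- The sum of the odd divisors of `n`. -/
def sigmaOdd (n : ℕ) : ℕ := ∑ d ∈ n.divisors.filter (fun d => Odd d), d

lemma sum_dvd_sub_sum_two_mul_dvd {d : ℕ} (hd : d ≠ 0) :
    ∑ m ∈ Finset.Icc 1 d, (if m ∣ d then (m : ℂ) else 0) -
      ∑ m ∈ Finset.Icc 1 d, (if 2 * m ∣ d then ((2 * m : ℕ) : ℂ) else 0) = sigmaOdd d := by
  have h1 : ∑ m ∈ Finset.Icc 1 d, (if m ∣ d then (m : ℂ) else 0) =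
      ∑ m ∈ d.divisors, (m : ℂ) := by
    rw [← Finset.sum_filter]
    refine Finset.sum_congr (Finset.ext fun m => ?_) fun _ _ => rfl
    simp only [Finset.mem_filter, Finset.mem_Icc, Nat.mem_divisors]
    exact ⟨fun h => ⟨h.2, hd⟩, fun h => ⟨⟨Nat.pos_of_ne_zero (by rintro rfl; simp_all),
      Nat.le_of_dvd (Nat.pos_of_ne_zero hd) h.1⟩, h.1⟩⟩
  have h2 : ∑ m ∈ Finset.Icc 1 d, (if 2 * m ∣ d then ((2 * m : ℕ) : ℂ) else 0) =
      ∑ m ∈ d.divisors.filter (fun m => ¬ Odd m), (m : ℂ) := by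
    rw [← Finset.sum_filter]
    refine Finset.sum_bij' (fun m _ => 2 * m) (fun m _ => m / 2) ?_ ?_ ?_ ?_ ?_
    · intro m hm
      simp only [Finset.mem_filter, Nat.mem_divisors] at hm ⊢
      exact ⟨⟨hm.2, hd⟩, by simp⟩
    · intro m hm
      simp only [Finset.mem_filter, Nat.mem_divisors, Finset.mem_Icc, Nat.not_odd_iff_even] at hm ⊢
      have h := Nat.le_of_dvd (Nat.pos_of_ne_zero hd) hm.1.1
      have h0 : m ≠ 0 := by rintro rfl; simp_all
      obtain ⟨k, rfl⟩ := hm.2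
      have : 2 * ((k + k) / 2) = k + k := by omega
      rw [this]
      exact ⟨by omega, hm.1.1⟩
    · intro m _; simp
    · intro m hm
      simp only [Finset.mem_filter, Nat.not_odd_iff_even] at hm
      obtain ⟨k, rfl⟩ := hm.2
      omega
    · intro m _; rfl
  rw [h1, h2, ← Finset.sum_filter_add_sum_filter_not d.divisors (fun m => Odd m), sigmaOdd]
  push_cast
  ring

lemma etaQ_mul_div_eqMod (N : ℕ) :
    EqMod (N + 1) (fun x => etaQ x * truncFun (fun m => 2 * m) N x / truncFun (fun m => m) N x)
      fun _ => 1 := by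
  have h0 : truncFun (fun m => m) N 0 ≠ 0 := by
    rw [truncFun_zero fun m => le_rfl]; exact one_ne_zero
  have hc : ContinuousAt (truncFun (fun m => m) N) 0 := (continuous_truncFun _ _).continuousAt
  have h1 := Asymptotics.IsBigO.mul (etaQ_eqMod N) ((hc.inv₀ h0).tendsto.isBigO_one ℂ)
  simp only [mul_one] at h1
  refine h1.congr' ?_ EventuallyEq.rfl
  filter_upwards [hc.eventually_ne h0] with x hx
  change (etaQ x * truncFun (fun m => 2 * m) N x - truncFun (fun m => m) N x) *
    (truncFun (fun m => m) N x)⁻¹ = _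
  field_simp

lemma jet_prod_etaQ {a d : ℕ} (ha : a ≠ 0) (hd : d ≠ 0) {ζ : ℂ} (hζ : IsPrimitiveRoot ζ d) :
    Jet (fun z => ∏ b ∈ Finset.range d, etaQ (ζ ^ b * ex (a / d) z)) 0
      (-(if a = 1 then (24 * sigmaOdd d : ℂ) else 0)) := by
  have ha' : (1 : ℝ) ≤ a := by exact_mod_cast Nat.one_le_iff_ne_zero.2 ha
  have hd' : (0 : ℝ) < d := by exact_mod_cast Nat.pos_of_ne_zero hd
  have hp : (0 : ℝ) < a / d := by positivity
  set N := truncFun (fun m => m) d with hN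
  set D := truncFun (fun m => 2 * m) d with hD
  have hN0 : N 0 = 1 := truncFun_zero (fun m => le_rfl) d
  have hD0 : D 0 = 1 := truncFun_zero (fun m => by omega) d
  have hNc : ContinuousAt N 0 := (continuous_truncFun _ _).continuousAt
  have hDc : ContinuousAt D 0 := (continuous_truncFun _ _).continuousAt
  have hY : ∀ b, Tendsto (fun z => ζ ^ b * ex (a / d) z) atInf (𝓝 0) := fun b => by
    simpa using (tendsto_ex hp).const_mul (ζ ^ b)
  have hE := etaQ_mul_div_eqMod d
  rw [← hN, ← hD] at hE
  have hε : ∀ b, (fun z => etaQ (ζ ^ b * ex (a / d) z) * D (ζ ^ b * ex (a / d) z) /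
      N (ζ ^ b * ex (a / d) z) - 1) =o[atInf] fun z => pp z ^ 2 := fun b => by
    have h1 : (fun z => (ζ ^ b * ex (a / d) z) ^ (d + 1)) =o[atInf] fun z => pp z ^ 2 := by
      have h2 := (ex_isLittleO_sq (s := (d + 1 : ℕ) * (a / d : ℝ)) (by
        push_cast
        rw [add_mul, mul_div_cancel₀ _ hd'.ne']; linarith)).const_mul_left ((ζ ^ b) ^ (d + 1))
      refine h2.congr_left fun z => ?_
      rw [mul_pow, ex_pow]
    exact (hE.comp_tendsto (hY b)).trans_isLittleO h1
  have hpp : (fun z => pp z ^ 2) =o[atInf] pp := by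
    have := ex_isLittleO_pp (s := 1) (by norm_num)
    exact this.congr_left ex_one
  have hR := Jet.prod_one_add (Finset.range d) (l := 0) (fun b _ => (hε b).trans hpp) (by
    simp only [zero_mul, sub_zero]
    have := Asymptotics.IsLittleO.sum (s := Finset.range d) fun b _ => hε b
    refine this.congr_left fun z => ?_
    simp)
  have h1 := jet_prod_truncFun (N := d) ha hd hζ (e := fun m => m) (fun m => le_rfl)
  have h2 := jet_prod_truncFun (N := d) ha hd hζ (e := fun m => 2 * m) (fun m => by omega)
  have h3 := (hR.mul h1).div h2
  have hl : (0 + -(24 * ∑ m ∈ Finset.Icc 1 d, if a = 1 ∧ m ∣ d then (m : ℂ) else 0)) -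
      -(24 * ∑ m ∈ Finset.Icc 1 d, if a = 1 ∧ 2 * m ∣ d then ((2 * m : ℕ) : ℂ) else 0) =
      -(if a = 1 then (24 * sigmaOdd d : ℂ) else 0) := by
    by_cases h : a = 1
    · simp only [h, true_and, if_true, ← sum_dvd_sub_sum_two_mul_dvd hd]
      ring
    · simp [h]
  rw [hl, add_zero, sub_zero] at h3
  refine h3.congr ?_
  have hev : ∀ᶠ z in atInf, ∀ b ∈ Finset.range d, N (ζ ^ b * ex (a / d) z) ≠ 0 ∧
      D (ζ ^ b * ex (a / d) z) ≠ 0 := by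
    refine (Finset.eventually_all _).2 fun b _ => ?_
    have e1 := (hY b).eventually (hNc.eventually_ne (by rw [hN0]; exact one_ne_zero))
    have e2 := (hY b).eventually (hDc.eventually_ne (by rw [hD0]; exact one_ne_zero))
    exact e1.and e2
  filter_upwards [hev] with z hz
  rw [← Finset.prod_mul_distrib, ← Finset.prod_div_distrib]
  refine Finset.prod_congr rfl fun b hb => ?_
  obtain ⟨h4, h5⟩ := hz b hb
  rw [add_sub_cancel, ← hN, ← hD]
  field_simp

lemma jet_prod_etaQ_erase {d : ℕ} (hd : d ≠ 0) {ζ : ℂ} (hζ : IsPrimitiveRoot ζ d) :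
    Jet (fun z => ∏ b ∈ (Finset.range d).erase 0, etaQ (ζ ^ b * ex 1 z)) 0
      (24 - (if d = 1 then 24 else 0)) := by
  have h1 := jet_prod_etaQ hd hd hζ
  have hd' : (d : ℝ) ≠ 0 := by exact_mod_cast hd
  rw [div_self hd'] at h1
  have h2 := Jet.of_analytic hasDerivAt_etaQ_zero etaQ_zero
  have h3 := h1.div h2
  have hl : -(if d = 1 then (24 * sigmaOdd d : ℂ) else 0) - -24 = 24 - (if d = 1 then 24 else 0) :=
      by
    by_cases h : d = 1
    · subst h
      have : sigmaOdd 1 = 1 := by decide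
      simp [this]
    · simp [h]
  rw [hl, sub_zero] at h3
  refine h3.congr ?_
  filter_upwards [eventually_mem_UH] with z hz
  have h4 : (0 : ℕ) ∈ Finset.range d := Finset.mem_range.2 (Nat.pos_of_ne_zero hd)
  rw [← Finset.mul_prod_erase _ _ h4, pow_zero, one_mul, ex_one, pp_sq,
    mul_div_cancel_left₀ _ (etaQ_ne_zero (norm_nome_lt_one hz))]

/-- The expansion of `etaQ (pp z)`. -/
lemma jet_etaQ_pp : Jet (fun z => etaQ (pp z)) (-24) (-12) := by
  have hN0 : truncFun (fun m => m) 2 0 ≠ 0 := by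
    rw [truncFun_zero fun m => le_rfl]; exact one_ne_zero
  have hD0 : truncFun (fun m => 2 * m) 2 0 ≠ 0 := by
    rw [truncFun_zero fun m => by omega]; exact one_ne_zero
  have h0 : Jet (fun z => 1 + (etaQ (pp z) * truncFun (fun m => 2 * m) 2 (pp z) /
      truncFun (fun m => m) 2 (pp z) - 1)) 0 0 := by
    refine jet_one_add_of_isLittleO ?_
    simp only [zero_mul, sub_zero]
    refine ((etaQ_mul_div_eqMod 2).comp_tendsto tendsto_pp).trans_isLittleO ?_
    have := (ex_isLittleO_sq (s := (3 : ℕ) / 2) (by norm_num)).congr_left (ex_nat_half 3)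
    exact this
  have h1 : ∀ e : ℕ → ℕ, (∀ m, m ≤ e m) → Jet (fun z => truncFun e 2 (pp z))
      (∑ m ∈ Finset.Icc 1 2, 24 * jetA (e m)) (∑ m ∈ Finset.Icc 1 2, 24 * jetL (e m)) := by
    intro e he
    have := Jet.prod (Finset.Icc 1 2) fun m hm => (jet_one_sub_pp_pow (m := e m)
      (by have := he m; have := (Finset.mem_Icc.1 hm).1; omega)).pow 24
    exact_mod_cast this
  have h2 := (h0.mul (h1 (fun m => m) fun m => le_rfl)).div
    (h1 (fun m => 2 * m) fun m => by omega)
  have hI : Finset.Icc 1 2 = ({1, 2} : Finset ℕ) := rfl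
  rw [hI] at h2
  simp only [Finset.sum_pair (show (1 : ℕ) ≠ 2 by omega), jetA, jetL] at h2
  norm_num at h2
  refine h2.congr ?_
  filter_upwards [tendsto_pp.eventually ((continuous_truncFun (fun m => m)
      2).continuousAt.eventually_ne hN0),
    tendsto_pp.eventually ((continuous_truncFun (fun m => 2 * m) 2).continuousAt.eventually_ne hD0)]
    with z h3 h4
  field_simp

lemma isScaled_herm {a d : ℕ} (ha : a ≠ 0) (hd : d ≠ 0) {b : ℤ} :
    IsScaled (herm a b d) ↔ a = d ∧ (d : ℤ) ∣ b := by
  constructor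
  · rintro ⟨t, γ, h⟩
    have h00 : (a : ℤ) = t * (γ : M2) 0 0 := by simpa [herm] using congrFun (congrFun h 0) 0
    have h01 : b = t * (γ : M2) 0 1 := by simpa [herm] using congrFun (congrFun h 0) 1
    have h10 : (0 : ℤ) = t * (γ : M2) 1 0 := by simpa [herm] using congrFun (congrFun h 1) 0
    have h11 : (d : ℤ) = t * (γ : M2) 1 1 := by simpa [herm] using congrFun (congrFun h 1) 1
    have hdet : (γ : M2) 0 0 * (γ : M2) 1 1 - (γ : M2) 0 1 * (γ : M2) 1 0 = 1 := by
      rw [← det_eq]; exact γ.2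
    have ht : t ≠ 0 := by rintro rfl; apply ha; simpa using h00
    have hc : (γ : M2) 1 0 = 0 := by
      rcases mul_eq_zero.1 h10.symm with h | h
      · exact absurd h ht
      · exact h
    rw [hc, mul_zero, sub_zero] at hdet
    have had : (γ : M2) 0 0 = (γ : M2) 1 1 := by
      rcases Int.mul_eq_one_iff_eq_one_or_neg_one.1 hdet with h | h <;> rw [h.1, h.2]
    have had' : (a : ℤ) = d := by rw [h00, h11, had]
    refine ⟨by exact_mod_cast had', ?_⟩
    rcases Int.mul_eq_one_iff_eq_one_or_neg_one.1 hdet with h | h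
    · rw [h11, h01, h.2, mul_one]; exact dvd_mul_right _ _
    · rw [h11, h01, h.2, mul_neg_one]; exact (neg_dvd).2 (dvd_mul_right _ _)
  · rintro ⟨rfl, k, rfl⟩
    refine ⟨a, ModularGroup.T ^ k, ?_⟩
    rw [ModularGroup.coe_T_zpow]
    ext i j
    fin_cases i <;> fin_cases j <;> simp [herm]

lemma isScaled_herm_of_lt {a d b : ℕ} (ha : a ≠ 0) (hb : b < d) :
    IsScaled (herm a b d) ↔ a = d ∧ b = 0 := by
  rw [isScaled_herm ha (by omega)]
  refine and_congr_right fun _ => ⟨fun h => ?_, fun h => by simp [h]⟩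
  exact Nat.eq_zero_of_dvd_of_lt (by exact_mod_cast h) hb

lemma mob_herm (a b d : ℤ) (z : ℂ) : mob (herm a b d) z = (a * z + b) / d := by
  simp [mob, den, herm]

lemma nome_mob_herm (a b d : ℕ) (z : ℂ) :
    nome (mob (herm a b d) z) = nome (1 / d) ^ b * ex (a / d) z := by
  rw [mob_herm, ex, ← nome_nat_mul, ← nome_add]
  congr 1
  push_cast
  ring

lemma herm_mob_mem {a d : ℕ} (ha : a ≠ 0) (hd : d ≠ 0) (b : ℤ) {z : ℂ} (hz : z ∈ UH) :
    mob (herm a b d) z ∈ UH := by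
  refine mob_mem ?_ hz
  rw [det_herm]
  positivity

/-- The part of the product over the Hermite normal forms with given diagonal. -/
noncomputable def ModFam.block {ℓ : ℕ} (𝓕 : ModFam ℓ) (v : Fin 2 → ZMod ℓ) (a d : ℕ) (z : ℂ) : ℂ :=
  ∏ b ∈ Finset.range d, 𝓕.fac v (herm a b d) z

lemma ModFam.prod_hidx_eq {ℓ : ℕ} (𝓕 : ModFam ℓ) (v : Fin 2 → ZMod ℓ) (n : ℕ) (z : ℂ) :
    ∏ i ∈ hidx n, 𝓕.fac v (hmat n i) z = ∏ d ∈ n.divisors, 𝓕.block v (n / d) d z := by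
  rw [hidx, Finset.prod_sigma]
  rfl

lemma PJet.prod_hidx {ℓ : ℕ} {𝓕 : ModFam ℓ} {v : Fin 2 → ZMod ℓ} {n : ℕ} {α l : ℕ → ℂ}
    (h : ∀ a d, a ≠ 0 → d ≠ 0 → a * d = n → PJet (𝓕.block v a d) (α d) (l d)) :
    PJet (fun z => ∏ i ∈ hidx n, 𝓕.fac v (hmat n i) z) (∑ d ∈ n.divisors, α d)
      (∑ d ∈ n.divisors, l d) := by
  simp only [𝓕.prod_hidx_eq]
  refine PJet.prod _ fun d hd => ?_
  rw [Nat.mem_divisors] at hd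
  have h0 := Nat.pos_of_dvd_of_pos hd.1 (Nat.pos_of_ne_zero hd.2)
  exact h _ _ (Nat.div_pos (Nat.le_of_dvd (Nat.pos_of_ne_zero hd.2) hd.1) h0).ne' h0.ne'
    (Nat.div_mul_cancel hd.1)

lemma exists_polePart_jInv : ∃ F A : ℂ → ℂ, PolePart F A ∧ ∀ z ∈ UH, jInv z = F (nome z) := by
  have h0 : euler 0 ≠ 0 := by rw [euler_zero]; exact one_ne_zero
  have h1 : AnalyticAt ℂ (fun x => e4 x ^ 3 / euler x ^ 24) 0 :=
    (analyticAt_e4.pow 3).div ((analyticAt_euler (by simp)).pow 24) (pow_ne_zero _ h0)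
  refine ⟨_, _, polePart_div h1 (by simp [e4_zero, euler_zero]), fun z hz => ?_⟩
  rw [jInv_eq hz, F4_eq hz, Dl, div_div, mul_comm (nome z)]

lemma famOne_fac {a d b : ℕ} (ha : a ≠ 0) (hb : b < d) (z : ℂ) :
    famOne.fac 0 (herm a b d) z =
      if a = d ∧ b = 0 then 1 else jInv z - jInv (mob (herm a b d) z) := by
  classical
  have h : act (herm a b d) (0 : Fin 2 → ZMod 1) ∈ famOne.V := by
    rw [act_zero]; simp [famOne]
  rw [ModFam.fac]
  refine if_congr ?_ rfl rfl
  rw [isScaled_herm_of_lt ha hb]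
  exact or_iff_left (not_not.2 h)

lemma pjet_block_famOne {a d : ℕ} (ha : a ≠ 0) (hd : d ≠ 0) :
    PJet (famOne.block 0 a d) 0 (if ((a : ℤ) - d).natAbs = 1 then -1 else 0) := by
  obtain ⟨F, A, hF, hj⟩ := exists_polePart_jInv
  have hζ := isPrimitiveRoot_nome hd
  have hjw : ∀ z ∈ UH, ∀ b : ℕ, jInv z - jInv (mob (herm a b d) z) =
      F (ex 1 z) - F (nome (1 / d) ^ b * ex (a / d) z) := fun z hz b => by
    rw [hj z hz, hj _ (herm_mob_mem ha hd b hz), nome_mob_herm, ex_one, pp_sq]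
  by_cases had : a = d
  · subst had
    have h1 := pjet_coreTwo_eq hF hd hζ
    rw [if_neg (by simp)]
    refine h1.congr ?_
    filter_upwards [eventually_mem_UH] with z hz
    have h4 : (0 : ℕ) ∈ Finset.range a := Finset.mem_range.2 (Nat.pos_of_ne_zero hd)
    rw [ModFam.block, ← Finset.mul_prod_erase _ _ h4, famOne_fac ha (Nat.pos_of_ne_zero hd),
      if_pos ⟨rfl, rfl⟩, one_mul]
    refine Finset.prod_congr rfl fun b hb => ?_
    have hb' := Finset.mem_erase.1 hb
    rw [famOne_fac ha (Finset.mem_range.1 hb'.2), if_neg (fun h => hb'.1 h.2), hjw z hz,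
      div_self (by exact_mod_cast hd : (a : ℝ) ≠ 0)]
  · refine (pjet_coreTwo_ne hF ha hd had hζ).congr ?_
    filter_upwards [eventually_mem_UH] with z hz
    refine Finset.prod_congr rfl fun b hb => ?_
    rw [famOne_fac ha (Finset.mem_range.1 hb), if_neg (fun h => had h.1), hjw z hz]

lemma pjet_prodFac_famOne (n : ℕ) : PJet (famOne.prodFac n) 0
    (-(n.divisors.filter fun d => (((n / d : ℕ) : ℤ) - d).natAbs = 1).card) := by
  have h := PJet.prod_hidx (𝓕 := famOne) (v := 0) (n := n) (α := fun _ => 0)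
    (l := fun d => if (((n / d : ℕ) : ℤ) - d).natAbs = 1 then -1 else 0)
    fun a d ha hd had => by
      have := pjet_block_famOne ha hd
      rwa [← had, Nat.mul_div_cancel _ (Nat.pos_of_ne_zero hd)]
  rw [Finset.sum_const_zero, ← Finset.sum_filter, Finset.sum_const, nsmul_eq_mul, mul_neg_one] at h
  refine h.congr (Eventually.of_forall fun z => ?_)
  simp [ModFam.prodFac, famOne]

lemma mem_famTwo {v : Fin 2 → ZMod 2} : v ∈ famTwo.V ↔ v ≠ 0 := by simp [famTwo]

lemma famTwo_fac_of_eq_zero {v : Fin 2 → ZMod 2} {N : M2} (h : act N v = 0) (z : ℂ) :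
    famTwo.fac v N z = 1 := by
  rw [ModFam.fac, if_pos (Or.inr (by rw [mem_famTwo]; simpa using h))]

lemma famTwo_fac_of_isScaled {v : Fin 2 → ZMod 2} {N : M2} (h : IsScaled N) (z : ℂ) :
    famTwo.fac v N z = 1 := by
  rw [ModFam.fac, if_pos (Or.inl h)]

lemma famTwo_fac {v w : Fin 2 → ZMod 2} {N : M2} (hN : ¬IsScaled N) (h : act N v = w)
    (hw : w ≠ 0) (z : ℂ) : famTwo.fac v N z = lev v z - lev w (mob N z) := by
  rw [ModFam.fac, h, if_neg (by rw [mem_famTwo]; tauto)]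
  rfl

lemma cast_zmod_two_of_odd {a : ℕ} (h : Odd a) : (a : ZMod 2) = 1 :=
  (ZMod.natCast_eq_one_iff_odd).2 h

lemma cast_zmod_two_of_even {a : ℕ} (h : Even a) : (a : ZMod 2) = 0 :=
  (ZMod.natCast_eq_zero_iff_even).2 h

lemma act_herm_one_zero (a d : ℕ) (b : ℤ) :
    act (herm a b d) (![1, 0] : Fin 2 → ZMod 2) = ![(a : ZMod 2), 0] := by
  funext i
  fin_cases i <;> simp [act_apply, herm]

lemma act_herm_zero_one (a d : ℕ) (b : ℤ) :
    act (herm a b d) (![0, 1] : Fin 2 → ZMod 2) = ![(b : ZMod 2), (d : ZMod 2)] := by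
  funext i
  fin_cases i <;> simp [act_apply, herm]

/-! ### The cusp expansion for the vector `(1, 0)` -/

lemma lev_10_sub {z w : ℂ} (hz : z ∈ UH) (hw : w ∈ UH) :
    lev ![1, 0] z - lev ![1, 0] w =
      -4096 * (etaQ (nome z) / nome z - etaQ (nome w) / nome w) *
        (nome z / etaQ (nome z)) * (nome w / etaQ (nome w)) := by
  have h1 := nome_ne_zero z
  have h2 := nome_ne_zero w
  have h3 := etaQ_ne_zero (norm_nome_lt_one hz)
  have h4 := etaQ_ne_zero (norm_nome_lt_one hw)
  rw [lev_10_eq hz, lev_10_eq hw]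
  field_simp
  ring

lemma pjet_nome : PJet nome 0 0 := by
  refine (PJet.pp_zpow 2).congr (Eventually.of_forall fun z => ?_)
  rw [← pp_sq]
  norm_cast

lemma pjet_etaQ_nome : PJet (fun z => etaQ (nome z)) 0 (-24) :=
  (Jet.of_analytic hasDerivAt_etaQ_zero etaQ_zero).pjet

lemma pjet_prod_rotate {a d : ℕ} (hd : d ≠ 0) {ζ : ℂ} (hζ : ζ ≠ 0) :
    PJet (fun z => ∏ b ∈ Finset.range d, (ζ ^ b * ex (a / d) z)) 0 0 := by
  have h1 : (∏ b ∈ Finset.range d, ζ ^ b) ≠ 0 :=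
    Finset.prod_ne_zero_iff.2 fun b _ => pow_ne_zero _ hζ
  refine ((PJet.pp_zpow ((2 * a : ℕ) : ℤ)).const_mul h1).congr (Eventually.of_forall fun z => ?_)
  rw [Finset.prod_mul_distrib, Finset.prod_const, Finset.card_range, ex_pow, zpow_natCast,
    ← ex_nat_half]
  congr 2
  have : (d : ℝ) ≠ 0 := by exact_mod_cast hd
  push_cast
  field_simp

/-- The second coefficient of the expansion of a block for `(1, 0)`. -/
noncomputable def coefA (a d : ℕ) : ℂ :=
  24 * d + (if a = 1 then 24 * (sigmaOdd d : ℂ) else 0) - (if a = d then 48 else 0) -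
    (if ((a : ℤ) - d).natAbs = 1 then 1 else 0)

lemma pjet_block_10_of_even {a d : ℕ} (ha' : Even a) : PJet (famTwo.block ![1, 0] a d) 0 0 := by
  refine (PJet.const one_ne_zero).congr (Eventually.of_forall fun z => ?_)
  rw [ModFam.block, Finset.prod_eq_one]
  intro b _
  refine famTwo_fac_of_eq_zero ?_ z
  rw [act_herm_one_zero, cast_zmod_two_of_even ha']
  funext i
  fin_cases i <;> rfl

lemma pjet_block_10_of_odd {a d : ℕ} (hd : d ≠ 0) (ha' : Odd a) :
    PJet (famTwo.block ![1, 0] a d) 0 (coefA a d) := by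
  have ha : a ≠ 0 := by rintro rfl; simp at ha'
  have hζ := isPrimitiveRoot_nome hd
  set ζ := nome (1 / d) with hζd
  have hζ0 : ζ ≠ 0 := nome_ne_zero _
  have hfac : ∀ z ∈ UH, ∀ b : ℕ, ¬IsScaled (herm a b d) → famTwo.fac ![1, 0] (herm a b d) z =
      -4096 * (etaQ (ex 1 z) / ex 1 z - etaQ (ζ ^ b * ex (a / d) z) / (ζ ^ b * ex (a / d) z)) *
        (nome z / etaQ (nome z)) * (ζ ^ b * ex (a / d) z / etaQ (ζ ^ b * ex (a / d) z)) := by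
    intro z hz b hN
    have h1 : act (herm a b d) (![1, 0] : Fin 2 → ZMod 2) = ![1, 0] := by
      rw [act_herm_one_zero, cast_zmod_two_of_odd ha']
    rw [famTwo_fac hN h1 (by decide), lev_10_sub hz (herm_mob_mem ha hd b hz), nome_mob_herm,
      ex_one, pp_sq]
  by_cases had : a = d
  · subst had
    have hd1 : ((a : ℕ) : ℝ) / a = 1 := div_self (by exact_mod_cast hd)
    have h4 : (0 : ℕ) ∈ Finset.range a := Finset.mem_range.2 (Nat.pos_of_ne_zero hd)
    have k1 := pjet_coreTwo_eq polePart_etaQ hd hζ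
    have k2 := (pjet_nome.div pjet_etaQ_nome).pow ((Finset.range a).erase 0).card
    have k3 := (jet_prod_etaQ_erase hd hζ).pjet
    have k4 : PJet (fun z => ∏ b ∈ (Finset.range a).erase 0, (ζ ^ b * ex 1 z)) 0 0 := by
      have h := (pjet_prod_rotate (a := a) hd hζ0).div pjet_nome
      rw [sub_self] at h
      refine h.congr (Eventually.of_forall fun z => ?_)
      rw [hd1, ← Finset.mul_prod_erase _ _ h4, pow_zero, one_mul, ex_one, pp_sq,
        mul_div_cancel_left₀ _ (nome_ne_zero z)]
    have k5 := ((k1.mul k2).mul (k4.div k3)).const_mul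
      (pow_ne_zero ((Finset.range a).erase 0).card (show (-4096 : ℂ) ≠ 0 by norm_num))
    have hcard : (((Finset.range a).erase 0).card : ℂ) = a - 1 := by
      rw [Finset.card_erase_of_mem h4, Finset.card_range, Nat.cast_sub (Nat.one_le_iff_ne_zero.2
          hd),
        Nat.cast_one]
    have hα : (0 : ℂ) + (((Finset.range a).erase 0).card : ℂ) * (0 - 0) + (0 - 0) = 0 := by simp
    have hl : (0 : ℂ) + (((Finset.range a).erase 0).card : ℂ) * (0 - -24) +
        (0 - (24 - if a = 1 then 24 else 0)) = coefA a a := by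
      have : sigmaOdd 1 = 1 := by decide
      rw [hcard, coefA, if_pos rfl]
      by_cases h : a = 1
      · subst h; simp [this]; norm_num
      · simp [h]; ring
    rw [hα, hl] at k5
    refine k5.congr ?_
    filter_upwards [eventually_mem_UH] with z hz
    rw [ModFam.block, ← Finset.mul_prod_erase _ _ h4, famTwo_fac_of_isScaled
      ((isScaled_herm_of_lt ha (Nat.pos_of_ne_zero hd)).2 ⟨rfl, rfl⟩), one_mul,
      ← Finset.prod_const, ← Finset.prod_const, ← Finset.prod_div_distrib,
      ← Finset.prod_mul_distrib, ← Finset.prod_mul_distrib, ← Finset.prod_mul_distrib]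
    refine Finset.prod_congr rfl fun b hb => ?_
    have hb' := Finset.mem_erase.1 hb
    rw [hfac z hz b (fun h => hb'.1 ((isScaled_herm_of_lt ha (Finset.mem_range.1 hb'.2)).1 h).2),
      hd1]
    ring
  · have k1 := pjet_coreTwo_ne polePart_etaQ ha hd had hζ
    have k2 := (pjet_nome.div pjet_etaQ_nome).pow d
    have k3 := (jet_prod_etaQ ha hd hζ).pjet
    have k4 := pjet_prod_rotate (a := a) hd hζ0
    have k5 := ((k1.mul k2).mul (k4.div k3)).const_mul
      (pow_ne_zero d (show (-4096 : ℂ) ≠ 0 by norm_num))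
    have hα : (0 : ℂ) + (d : ℂ) * (0 - 0) + (0 - 0) = 0 := by simp
    have hl : (if ((a : ℤ) - d).natAbs = 1 then -1 else 0 : ℂ) + (d : ℂ) * (0 - -24) +
        (0 - -(if a = 1 then (24 * sigmaOdd d : ℂ) else 0)) = coefA a d := by
      rw [coefA, if_neg had]
      split_ifs <;> ring
    rw [hα, hl] at k5
    refine k5.congr ?_
    filter_upwards [eventually_mem_UH] with z hz
    have hpow : ∀ x : ℂ, x ^ d = ∏ _b ∈ Finset.range d, x := fun x => by
      rw [Finset.prod_const, Finset.card_range]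
    rw [ModFam.block, hpow, hpow, ← Finset.prod_div_distrib,
      ← Finset.prod_mul_distrib, ← Finset.prod_mul_distrib, ← Finset.prod_mul_distrib]
    refine Finset.prod_congr rfl fun b hb => ?_
    rw [hfac z hz b (fun h => had ((isScaled_herm_of_lt ha (Finset.mem_range.1 hb)).1 h).1)]
    ring

lemma prod_range_coprime_mul {f : ℤ → ℂ} {d k : ℕ} (hf : Function.Periodic f d) (hd : d ≠ 0)
    (hk : k.Coprime d) : ∏ b ∈ Finset.range d, f (k * b : ℕ) = ∏ b ∈ Finset.range d, f b := by
  have hmaps : ∀ b ∈ Finset.range d, k * b % d ∈ Finset.range d := fun b _ =>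
    Finset.mem_range.2 (Nat.mod_lt _ (Nat.pos_of_ne_zero hd))
  have hinj : Set.InjOn (fun b => k * b % d) (Finset.range d) := by
    intro b hb c hc h
    have h1 : k * b ≡ k * c [MOD d] := h
    have h2 := Nat.ModEq.cancel_left_of_coprime (by rwa [Nat.coprime_comm] at hk) h1
    rwa [Nat.ModEq, Nat.mod_eq_of_lt (Finset.mem_range.1 hb),
      Nat.mod_eq_of_lt (Finset.mem_range.1 hc)] at h2
  refine Finset.prod_nbij (fun b => k * b % d) hmaps hinj
    (Finset.surjOn_of_injOn_of_card_le _ hmaps hinj le_rfl) fun b _ => ?_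
  have h1 := hf.int_mul (k * b / d : ℕ) (k * b % d : ℕ)
  rw [← h1]
  congr 1
  have := Nat.mod_add_div (k * b) d
  push_cast at this ⊢
  zify at this
  linarith

lemma ModFam.fac_herm_periodic {ℓ : ℕ} (𝓕 : ModFam ℓ) (v : Fin 2 → ZMod ℓ) {a d : ℕ} (ha : a ≠ 0)
    (hd : d ≠ 0) {z : ℂ} (hz : z ∈ UH) :
    Function.Periodic (fun b : ℤ => 𝓕.fac v (herm a b d) z) d := fun b => by
  dsimp only
  rw [show b + (d : ℤ) = b + 1 * d by ring, ← shift_mul_herm, 𝓕.fac_sl_mul (by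
    rw [det_herm]; positivity) _ hz]

/-- The first coefficient of the expansion of a block for `(0, 1)`. -/
noncomputable def coefB₁ (a d : ℕ) : ℂ :=
  if Odd d then jetA ((a : ℤ) - d).natAbs else -12 * d

/-- The second coefficient of the expansion of a block for `(0, 1)`. -/
noncomputable def coefB (c : ℤ → ℤ) (a d : ℕ) : ℂ :=
  if Odd d then (if a = d then (c 1 : ℂ) else 0) - (if a = 1 then (d * c d : ℂ) else 0) +
    jetL ((a : ℤ) - d).natAbs
  else -6 * d - (if a = 1 then (d * c d : ℂ) else 0)

lemma pjet_block_01_of_odd {c : ℤ → ℤ} (hc : IsEtaQuotCoeff c) {a d : ℕ} (ha : a ≠ 0)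
    (hd' : Odd d) : PJet (famTwo.block ![0, 1] a d) (coefB₁ a d) (coefB c a d) := by
  have hd : d ≠ 0 := by rintro rfl; simp at hd'
  have hζ := isPrimitiveRoot_nome hd
  set ζ := nome (1 / d) with hζd
  rw [coefB₁, coefB, if_pos hd', if_pos hd']
  have hblock : ∀ z ∈ UH, famTwo.block ![0, 1] a d z =
      ∏ b ∈ Finset.range d, famTwo.fac ![0, 1] (herm a (2 * b : ℕ) d) z := fun z hz =>
    (prod_range_coprime_mul (famTwo.fac_herm_periodic _ ha hd hz) hd
      (Nat.coprime_two_left.2 hd')).symm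
  have hscal : ∀ b < d, IsScaled (herm a (2 * b : ℕ) d) ↔ a = d ∧ b = 0 := by
    intro b hb
    rw [isScaled_herm ha hd]
    refine and_congr_right fun _ => ⟨fun h => ?_, fun h => by simp [h]⟩
    have h1 : d ∣ 2 * b := by exact_mod_cast h
    exact Nat.eq_zero_of_dvd_of_lt (Nat.Coprime.dvd_of_dvd_mul_left
      (Nat.coprime_comm.1 (Nat.coprime_two_left.2 hd')) h1) hb
  have hfac : ∀ z ∈ UH, ∀ b : ℕ, ¬IsScaled (herm a (2 * b : ℕ) d) →
      famTwo.fac ![0, 1] (herm a (2 * b : ℕ) d) z =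
      etaQ (pp z) / pp z - etaQ (ζ ^ b * ex (a / (2 * d)) z) / (ζ ^ b * ex (a / (2 * d)) z) := by
    intro z hz b hN
    have h1 : act (herm a (2 * b : ℕ) d) (![0, 1] : Fin 2 → ZMod 2) = ![0, 1] := by
      rw [act_herm_zero_one, cast_zmod_two_of_odd hd', Int.cast_natCast,
        cast_zmod_two_of_even (even_two_mul b)]
    have h2 : nome (mob (herm a (2 * b : ℕ) d) z / 2) = ζ ^ b * ex (a / (2 * d)) z := by
      rw [mob_herm, ex, hζd, ← nome_nat_mul, ← nome_add]
      congr 1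
      push_cast
      field_simp
      ring
    rw [famTwo_fac hN h1 (by decide), lev_01_eq hz, lev_01_eq (herm_mob_mem ha hd _ hz), h2, pp]
  by_cases had : a = d
  · subst had
    have h4 : (0 : ℕ) ∈ Finset.range a := Finset.mem_range.2 (Nat.pos_of_ne_zero hd)
    have k := pjet_coreOne_eq polePart_etaQ (hasCoefs_etaReg hc) (etaReg_zero_eq hc) hd hζ
    have e1 : jetA ((a : ℤ) - a).natAbs = 0 := by simp [jetA]
    have e2 : jetL ((a : ℤ) - a).natAbs = 0 := by simp [jetL]
    rw [e1, e2, if_pos rfl, add_zero]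
    refine k.congr ?_
    filter_upwards [eventually_mem_UH] with z hz
    rw [hblock z hz, ← Finset.mul_prod_erase _ _ h4, famTwo_fac_of_isScaled
      ((hscal 0 (Nat.pos_of_ne_zero hd)).2 ⟨rfl, rfl⟩), one_mul]
    refine Finset.prod_congr rfl fun b hb => ?_
    have hb' := Finset.mem_erase.1 hb
    rw [hfac z hz b (fun h => hb'.1 ((hscal b (Finset.mem_range.1 hb'.2)).1 h).2), ← ex_half]
    have h5 : (a : ℝ) ≠ 0 := by exact_mod_cast ha
    rw [show (a : ℝ) / (2 * a) = 1 / 2 by field_simp]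
  · have k := pjet_coreOne_ne polePart_etaQ (hasCoefs_etaReg hc) (etaReg_zero_eq hc) ha hd had hζ
    rw [if_neg had, zero_sub]
    refine k.congr ?_
    filter_upwards [eventually_mem_UH] with z hz
    rw [hblock z hz]
    refine Finset.prod_congr rfl fun b hb => ?_
    rw [hfac z hz b (fun h => had ((hscal b (Finset.mem_range.1 hb)).1 h).1)]

lemma prod_range_two_mul {f : ℕ → ℂ} (e : ℕ) :
    ∏ b ∈ Finset.range (2 * e), f b = ∏ b ∈ Finset.range e, f (2 * b) * f (2 * b + 1) := by
  induction e with
  | zero => simp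
  | succ e ih =>
    rw [show 2 * (e + 1) = 2 * e + 1 + 1 by ring, Finset.prod_range_succ, Finset.prod_range_succ,
      ih, Finset.prod_range_succ, mul_assoc]

lemma lev_10_eq_etaReg {z : ℂ} (hz : z ∈ UH) :
    lev ![1, 0] z = -48 - etaReg (pp z) - etaReg (-pp z) := by
  have h1 := lev_sum hz
  have h2 := pp_ne_zero z
  have hp : pp z = nome (z / 2) := rfl
  rw [lev_01_eq hz, lev_11_eq hz, ← hp, eq_add_mul_dslope etaQ (pp z),
    eq_add_mul_dslope etaQ (-pp z), etaQ_zero, ← etaReg, add_div, add_div,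
    mul_div_cancel_left₀ _ h2, mul_div_cancel_left₀ _ (neg_ne_zero.2 h2), div_neg] at h1
  linear_combination h1

lemma pjet_block_01_of_even {c : ℤ → ℤ} (hc : IsEtaQuotCoeff c) {a d : ℕ} (ha : a ≠ 0)
    (hd : d ≠ 0) (hd' : Even d) : PJet (famTwo.block ![0, 1] a d) (coefB₁ a d) (coefB c a d) := by
  obtain ⟨e, he⟩ := hd'.two_dvd
  have hζ := isPrimitiveRoot_nome hd
  set ζ := nome (1 / d) with hζd
  set u := nome (1 / (2 * d)) with hu
  have hdC : (d : ℂ) ≠ 0 := by exact_mod_cast hd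
  have hud : u ^ d = -1 := by
    rw [hu, ← nome_nat_mul, ← nome_half]; congr 1; field_simp
  have hζe : ζ ^ e = -1 := by
    rw [hζd, ← nome_nat_mul, ← nome_half]; congr 1; rw [he]; push_cast
    have : (e : ℂ) ≠ 0 := by rintro h; apply hdC; rw [he]; push_cast; rw [h, mul_zero]
    field_simp
  rw [coefB₁, coefB, if_neg (Nat.not_odd_iff_even.2 hd'), if_neg (Nat.not_odd_iff_even.2 hd')]
  have ha' : (0 : ℝ) < a := by exact_mod_cast Nat.pos_of_ne_zero ha
  have hdR : (0 : ℝ) < d := by exact_mod_cast Nat.pos_of_ne_zero hd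
  set s : ℕ → ℂ → ℂ := fun b z => ζ ^ b * (u * ex (a / (2 * d)) z) with hs
  have hs0 : ∀ b, Tendsto (s b) atInf (𝓝 0) := fun b => by
    simpa using ((tendsto_ex (show (0 : ℝ) < a / (2 * d) by positivity)).const_mul u).const_mul
      (ζ ^ b)
  have hsneg : ∀ b z, -s b z = s (e + b) z := fun b z => by
    simp only [hs, pow_add, hζe]; ring
  set δ : ℕ → ℂ → ℂ := fun b z => etaReg (s b z) - etaReg 0 with hδ
  have hA : AnalyticAt ℂ etaReg 0 := analyticAt_dslope analyticAt_etaQ_zero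
  have hδ0 : ∀ b, Tendsto (δ b) atInf (𝓝 0) := fun b => by
    simpa using (hA.continuousAt.tendsto.comp (hs0 b)).sub_const (etaReg 0)
  have hfac : ∀ z ∈ UH, ∀ b : ℕ, famTwo.fac ![0, 1] (herm a (2 * b + 1 : ℕ) d) z =
      etaQ (pp z) / pp z * (1 + pp z * (δ b z + δ (e + b) z) / etaQ (pp z)) := by
    intro z hz b
    have h1 : act (herm a (2 * b + 1 : ℕ) d) (![0, 1] : Fin 2 → ZMod 2) = ![1, 0] := by
      rw [act_herm_zero_one, cast_zmod_two_of_even hd', Int.cast_natCast,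
        cast_zmod_two_of_odd (odd_two_mul_add_one b)]
    have hN : ¬IsScaled (herm a (2 * b + 1 : ℕ) d) := by
      rw [isScaled_herm ha hd]
      rintro ⟨-, h⟩
      have h2 : d ∣ 2 * b + 1 := by exact_mod_cast h
      have := hd'.two_dvd.trans h2
      omega
    have h2 : pp (mob (herm a (2 * b + 1 : ℕ) d) z) = s b z := by
      simp only [hs]
      rw [pp, mob_herm, ex, hζd, hu, ← nome_nat_mul, ← nome_add, ← nome_add]
      congr 1
      push_cast
      field_simp
      ring
    have hE := etaQ_ne_zero (norm_nome_lt_one (half_mem hz))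
    change etaQ (pp z) ≠ 0 at hE
    have hX := pp_ne_zero z
    have hpp : pp z = nome (z / 2) := rfl
    rw [famTwo_fac hN h1 (by decide), lev_01_eq hz, lev_10_eq_etaReg (herm_mob_mem ha hd _ hz), h2,
      hsneg, ← hpp]
    simp only [hδ, etaReg_zero]
    field_simp
    ring
  have hE1 : Tendsto (fun z => (etaQ (pp z))⁻¹) atInf (𝓝 1) := by
    have := (analyticAt_etaQ_zero.continuousAt.tendsto.comp tendsto_pp).inv₀
      (by rw [etaQ_zero]; exact one_ne_zero)
    simpa [etaQ_zero, Function.comp_def] using this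
  have hreg := sum_regular (hasCoefs_etaReg hc) (etaReg_zero_eq hc) ha hd hζ hud
  have hprod : Jet (fun z => ∏ b ∈ Finset.range e,
      (1 + pp z * (δ b z + δ (e + b) z) / etaQ (pp z))) 0 (-(if a = 1 then (d * c d : ℂ) else 0))
          := by
    refine Jet.prod_one_add _ (fun b _ => ?_) ?_
    · have h1 : Tendsto (fun z => (δ b z + δ (e + b) z) * (etaQ (pp z))⁻¹) atInf (𝓝 0) := by
        simpa using ((hδ0 b).add (hδ0 (e + b))).mul hE1
      have h2 := (Asymptotics.isBigO_refl pp atInf).mul_isLittleO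
        ((Asymptotics.isLittleO_one_iff ℂ).2 h1)
      simp only [mul_one] at h2
      exact h2.congr_left fun z => by rw [div_eq_mul_inv, mul_assoc]
    · have hsum : ∀ z, ∑ b ∈ Finset.range e, pp z * (δ b z + δ (e + b) z) =
          ∑ b ∈ Finset.range d, pp z * (etaReg (ζ ^ b * (u * ex (a / (2 * d)) z)) - etaReg 0) := by
        intro z
        rw [he, two_mul, Finset.sum_range_add, ← Finset.sum_add_distrib, ← two_mul, ← he]
        exact Finset.sum_congr rfl fun b _ => by simp only [hδ, hs, mul_add]
      have h1 := hreg.mul_isBigO (hE1.isBigO_one ℂ)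
      have h2 : (fun z => (etaQ (pp z))⁻¹ - 1) =o[atInf] fun _ => (1 : ℂ) :=
        (Asymptotics.isLittleO_one_iff ℂ).2 (by simpa using hE1.sub_const 1)
      have h3 := ((Asymptotics.isBigO_refl (fun z => pp z ^ 2) atInf).mul_isLittleO
          h2).const_mul_left
        (if a = 1 then -1 * (d : ℂ) * c d else 0)
      simp only [mul_one] at h1 h3
      refine (h1.add h3).congr_left fun z => ?_
      rw [← Finset.sum_div, hsum, div_eq_mul_inv]
      split_ifs <;> ring
  have hk := ((jet_etaQ_pp.pjet.div (PJet.pp_zpow 1)).pow e).mul hprod.pjet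
  have hα : (e : ℂ) * (-24 - 0) + 0 = -12 * d := by rw [he]; push_cast; ring
  have hl : (e : ℂ) * (-12 - 0) + -(if a = 1 then (d * c d : ℂ) else 0) =
      -6 * d - (if a = 1 then (d * c d : ℂ) else 0) := by
    rw [show (-6 * d : ℂ) = -12 * e by rw [he]; push_cast; ring]; ring
  rw [hα, hl] at hk
  refine hk.congr ?_
  filter_upwards [eventually_mem_UH] with z hz
  have hpow : ∀ x : ℂ, x ^ e = ∏ _b ∈ Finset.range e, x := fun x => by
    rw [Finset.prod_const, Finset.card_range]
  rw [ModFam.block, show Finset.range d = Finset.range (2 * e) by rw [he], prod_range_two_mul,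
    hpow, ← Finset.prod_mul_distrib]
  refine Finset.prod_congr rfl fun b _ => ?_
  rw [hfac z hz b, famTwo_fac_of_eq_zero, one_mul, zpow_one]
  rw [act_herm_zero_one, cast_zmod_two_of_even hd', Int.cast_natCast,
    cast_zmod_two_of_even (even_two_mul b)]
  funext i
  fin_cases i <;> rfl

lemma pjet_block_01 {c : ℤ → ℤ} (hc : IsEtaQuotCoeff c) {a d : ℕ} (ha : a ≠ 0) (hd : d ≠ 0) :
    PJet (famTwo.block ![0, 1] a d) (coefB₁ a d) (coefB c a d) := by
  rcases Nat.even_or_odd d with h | h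
  · exact pjet_block_01_of_even hc ha hd h
  · exact pjet_block_01_of_odd hc ha h

lemma famTwo_V : famTwo.V = {![1, 0], ![0, 1], ![1, 1]} := by
  ext v
  rw [mem_famTwo, mem_nonzero_iff]
  simp

/-- The second coefficient of the expansion of the full product. -/
noncomputable def coefTwo (c : ℤ → ℤ) (n : ℕ) : ℂ :=
  ∑ d ∈ n.divisors, (if Odd (n / d) then coefA (n / d) d else 0) +
    2 * ∑ d ∈ n.divisors, coefB c (n / d) d

lemma pjet_prodFac_famTwo {c : ℤ → ℤ} (hc : IsEtaQuotCoeff c) {n : ℕ} (hn : n ≠ 0) :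
    PJet (famTwo.prodFac n) 0 (coefTwo c n) := by
  have hdiv : ∀ a d : ℕ, d ≠ 0 → a * d = n → n / d = a := fun a d hd had => by
    rw [← had, Nat.mul_div_cancel _ (Nat.pos_of_ne_zero hd)]
  have h10 := PJet.prod_hidx (𝓕 := famTwo) (v := ![1, 0]) (n := n) (α := fun _ => 0)
    (l := fun d => if Odd (n / d) then coefA (n / d) d else 0) fun a d ha hd had => by
      simp only [hdiv a d hd had]
      split_ifs with h
      · exact pjet_block_10_of_odd hd h
      · exact pjet_block_10_of_even (Nat.not_odd_iff_even.1 h)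
  have h01 := PJet.prod_hidx (𝓕 := famTwo) (v := ![0, 1]) (n := n)
    (α := fun d => coefB₁ (n / d) d) (l := fun d => coefB c (n / d) d) fun a d ha hd had => by
      simp only [hdiv a d hd had]
      exact pjet_block_01 hc ha hd
  have h11 := h01.comp_add_one
  have hT : ∀ z ∈ UH, ∏ i ∈ hidx n, famTwo.fac ![0, 1] (hmat n i) (z + 1) =
      ∏ i ∈ hidx n, famTwo.fac ![1, 1] (hmat n i) z := by
    intro z hz
    have hv : act (ModularGroup.T : SL(2, ℤ)) (![1, 1] : Fin 2 → ZMod 2) = ![0, 1] := by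
      rw [act_T]; decide
    have h1 : ∀ N : M2, famTwo.fac ![0, 1] N (z + 1) =
        famTwo.fac ![1, 1] (N * (ModularGroup.T : SL(2, ℤ))) z := fun N => by
      rw [← famTwo.fac_mul_sl ModularGroup.T hz, hv, mob_T]
    simp only [h1]
    refine ModFam.prod_hidx_mul hn (fun N => famTwo.fac ![1, 1] N z) (fun N hN γ => ?_) _
    refine famTwo.fac_sl_mul ?_ γ hz
    rw [hN]; positivity
  have hk := h10.mul (h01.mul h11)
  rw [Finset.sum_const_zero, add_neg_cancel, add_zero, ← two_mul] at hk
  refine hk.congr ?_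
  filter_upwards [eventually_mem_UH] with z hz
  rw [hT z hz, ModFam.prodFac, famTwo_V, Finset.prod_insert (by decide),
    Finset.prod_insert (by decide), Finset.prod_singleton]

section Coefficients
open Polynomial

lemma exists_one_sub_pow {R : Type*} [CommRing R] (y : R) (n : ℕ) :
    ∃ r : R, (1 - y) ^ n = 1 - n * y + n.choose 2 * y ^ 2 + y ^ 3 * r := by
  induction n with
  | zero => exact ⟨0, by simp⟩
  | succ n ih =>
    obtain ⟨r, hr⟩ := ih
    refine ⟨r - y * r - n.choose 2, ?_⟩
    rw [pow_succ, hr, Nat.choose_succ_succ' n 1, Nat.choose_one_right]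
    push_cast
    ring

lemma coeff_two_mul_aux (P S T : ℤ[X]) :
    (P * ((1 - 24 * X ^ 2 + X ^ 3 * S) * (1 + X ^ 3 * T))).coeff 2 =
      P.coeff 2 - 24 * P.coeff 0 := by
  have h : P * ((1 - 24 * X ^ 2 + X ^ 3 * S) * (1 + X ^ 3 * T)) =
      P - 24 * (P * X ^ 2) + (P * S + P * (1 - 24 * X ^ 2 + X ^ 3 * S) * T) * X ^ 3 := by ring
  rw [h, coeff_add, coeff_sub, coeff_mul_X_pow', if_neg (by norm_num), add_zero,
    show (24 : ℤ[X]) = C 24 by simp, coeff_C_mul, coeff_mul_X_pow', if_pos le_rfl]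

lemma coeff_one_of_isEtaQuotCoeff {c : ℤ → ℤ} (hc : IsEtaQuotCoeff c) : c 1 = 276 := by
  have h0 := hc.2 0
  have h2 := hc.2 2
  have h00 : c (-1) = 1 := by
    simpa [Finset.sum_range_succ, coeff_X] using h0
  obtain ⟨r, hr⟩ := exists_one_sub_pow (X : ℤ[X]) 24
  obtain ⟨s, hs⟩ := exists_one_sub_pow (X ^ 2 : ℤ[X]) 24
  obtain ⟨t, ht⟩ := exists_one_sub_pow (X ^ 4 : ℤ[X]) 24
  have hI : Finset.Icc 1 2 = {1, 2} := rfl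
  have hch : (Nat.choose 24 2 : ℤ[X]) = 276 := by norm_num [Nat.choose]
  rw [hI, Finset.prod_pair (by norm_num), Finset.prod_pair (by norm_num)] at h2
  norm_num [Finset.sum_range_succ] at h2
  push_cast at hr hs ht
  rw [hch] at hr hs ht
  have hs' : (1 - X ^ 2 : ℤ[X]) ^ 24 = 1 - 24 * X ^ 2 + X ^ 3 * (276 * X + X ^ 3 * s) := by
    rw [hs]; ring
  have ht' : (1 - X ^ 4 : ℤ[X]) ^ 24 =
      1 + X ^ 3 * (-24 * X + 276 * X ^ 5 + X ^ 9 * t) := by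
    rw [ht]; ring
  have h1 : (1 - X ^ 2 : ℤ[X]) ^ 24 = (1 - 24 * X ^ 2 + X ^ 3 * (276 * X + X ^ 3 * s)) *
      (1 + X ^ 3 * 0) := by rw [hs']; ring
  rw [ht', hs', coeff_two_mul_aux, ← hs', h1, coeff_two_mul_aux, hr, h00,
    show (24 : ℤ[X]) = C 24 by simp, show (276 : ℤ[X]) = C 276 by simp] at h2
  simp [coeff_X, coeff_X_pow_mul', coeff_one] at h2
  have h3 : ((c 0 : ℤ) : ℤ[X]).coeff 1 = 0 := by
    rw [← C_eq_intCast, coeff_C, if_neg one_ne_zero]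
  omega

end Coefficients

lemma sum_divisors_odd_sub_even {n : ℕ} (hn : n ≠ 0) :
    ∑ d ∈ n.divisors, (if Odd (n / d) then (d : ℂ) else -d) = sigmaOdd n := by
  rw [← sum_dvd_sub_sum_two_mul_dvd hn, ← Finset.sum_sub_distrib]
  have hsub : n.divisors ⊆ Finset.Icc 1 n := fun d hd =>
    Finset.mem_Icc.2 ⟨Nat.pos_of_mem_divisors hd, Nat.divisor_le hd⟩
  rw [← Finset.sum_subset hsub]
  · refine Finset.sum_congr rfl fun d hd => ?_
    have hd0 := Nat.pos_of_mem_divisors hd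
    obtain ⟨a, rfl⟩ := Nat.dvd_of_mem_divisors hd
    rw [Nat.mul_div_cancel_left a hd0, if_pos (dvd_mul_right d a)]
    have h : 2 * d ∣ d * a ↔ ¬Odd a := by
      rw [mul_comm 2 d, Nat.mul_dvd_mul_iff_left hd0, Nat.not_odd_iff_even, even_iff_two_dvd]
    by_cases ho : Odd a
    · rw [if_pos ho, if_neg (by rw [h]; exact not_not.2 ho), sub_zero]
    · rw [if_neg ho, if_pos (h.2 ho)]
      push_cast
      ring
  · intro d _ hd
    have h1 : ¬d ∣ n := fun h => hd (Nat.mem_divisors.2 ⟨h, hn⟩)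
    rw [if_neg h1, if_neg fun h => h1 (dvd_of_mul_left_dvd h), sub_zero]

lemma sum_divisors_ite_one {n : ℕ} (hn : n ≠ 0) (f : ℕ → ℂ) :
    ∑ d ∈ n.divisors, (if n / d = 1 then f d else 0) = f n := by
  rw [Finset.sum_eq_single n]
  · rw [Nat.div_self (Nat.pos_of_ne_zero hn), if_pos rfl]
  · intro d hd hdn
    rw [if_neg]
    intro h
    obtain ⟨a, rfl⟩ := Nat.dvd_of_mem_divisors hd
    rw [Nat.mul_div_cancel_left a (Nat.pos_of_mem_divisors hd)] at h
    simp [h] at hdn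
  · exact fun h => absurd (Nat.mem_divisors_self n hn) h

lemma sum_divisors_ite_eq {n : ℕ} (hn : n ≠ 0) (x : ℂ) :
    ∑ d ∈ n.divisors, (if n / d = d then x else 0) = if IsSquare n then x else 0 := by
  have key : ∀ d ∈ n.divisors, (n / d = d ↔ n = d * d) := fun d hd => by
    rw [Nat.div_eq_iff_eq_mul_left (Nat.pos_of_mem_divisors hd) (Nat.dvd_of_mem_divisors hd)]
  split_ifs with h
  · obtain ⟨t, rfl⟩ := h
    have ht : t ∈ (t * t).divisors := Nat.mem_divisors.2 ⟨dvd_mul_right _ _, hn⟩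
    rw [Finset.sum_eq_single t]
    · rw [if_pos ((key t ht).2 rfl)]
    · intro d hd hdt
      rw [if_neg]
      rw [key d hd]
      exact fun h => hdt (Nat.mul_self_inj.1 h).symm
    · exact fun h => absurd ht h
  · exact Finset.sum_eq_zero fun d hd => if_neg fun h' => h ⟨d, (key d hd).1 h'⟩

/-- The number of divisors `d` of `n` with `|n / d - d| = k`. -/
def gapCount (n k : ℕ) : ℕ :=
  (n.divisors.filter fun d => (((n / d : ℕ) : ℤ) - d).natAbs = k).card

lemma coefTwo_of_odd {c : ℤ → ℤ} (hc : IsEtaQuotCoeff c) {n : ℕ} (hn : Odd n) :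
    coefTwo c n = 48 * sigmaOdd n - 2 * (n * c n) - 2 * gapCount n 2 +
      if IsSquare n then 504 else 0 := by
  have hn0 : n ≠ 0 := by rintro rfl; simp at hn
  have key : ∀ d ∈ n.divisors, (if Odd (n / d) then coefA (n / d) d else 0) +
      2 * coefB c (n / d) d = 24 * (if Odd (n / d) then (d : ℂ) else -d) +
      (if n / d = 1 then 24 * (sigmaOdd d : ℂ) - 2 * (d * c d) else 0) +
      (if n / d = d then 504 else 0) -
      2 * (if (((n / d : ℕ) : ℤ) - d).natAbs = 2 then 1 else 0) := by
    intro d hd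
    obtain ⟨a, rfl⟩ := Nat.dvd_of_mem_divisors hd
    obtain ⟨h1, h2⟩ := Nat.odd_mul.1 hn
    rw [Nat.mul_div_cancel_left a (Nat.pos_of_mem_divisors hd)]
    have h3 : ((a : ℤ) - d).natAbs ≠ 1 := by
      obtain ⟨x, rfl⟩ := h1
      obtain ⟨y, rfl⟩ := h2
      omega
    simp only [coefA, coefB, jetL, if_pos h1, if_pos h2, if_neg h3,
      coeff_one_of_isEtaQuotCoeff hc]
    split_ifs <;> push_cast <;> ring
  rw [coefTwo, Finset.mul_sum, ← Finset.sum_add_distrib, Finset.sum_congr rfl key,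
    Finset.sum_sub_distrib, Finset.sum_add_distrib, Finset.sum_add_distrib, ← Finset.mul_sum,
    ← Finset.mul_sum, sum_divisors_odd_sub_even hn0,
    sum_divisors_ite_one hn0 fun d => 24 * (sigmaOdd d : ℂ) - 2 * (d * c d),
    sum_divisors_ite_eq hn0, gapCount, Finset.card_filter]
  push_cast
  ring

lemma coefTwo_of_even {c : ℤ → ℤ} {n : ℕ} (hn0 : n ≠ 0) (hn : Even n) :
    coefTwo c n = 48 * sigmaOdd n - 2 * (n * c n) - gapCount n 1 := by
  have hs : ∑ d ∈ n.divisors, (if Odd d then 0 else (d : ℂ)) =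
      2 * ∑ d ∈ n.divisors, (if Odd (n / d) then 0 else (d : ℂ)) := by
    have h1 := sum_divisors_odd_sub_even hn0
    have h2 : ∑ d ∈ n.divisors, (if Odd d then (d : ℂ) else 0) = sigmaOdd n := by
      rw [sigmaOdd, ← Finset.sum_filter]
      push_cast
      rfl
    have h3 : ∑ d ∈ n.divisors, (if Odd d then 0 else (d : ℂ)) =
        ∑ d ∈ n.divisors, (d : ℂ) - ∑ d ∈ n.divisors, (if Odd d then (d : ℂ) else 0) := by
      rw [← Finset.sum_sub_distrib]
      exact Finset.sum_congr rfl fun d _ => by split_ifs <;> ring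
    rw [h3, h2, ← h1, ← Finset.sum_sub_distrib, Finset.mul_sum]
    exact Finset.sum_congr rfl fun d _ => by split_ifs <;> ring
  have key : ∀ d ∈ n.divisors, (if Odd (n / d) then coefA (n / d) d else 0) +
      2 * coefB c (n / d) d = 24 * (if Odd (n / d) then (d : ℂ) else -d) +
      (if n / d = 1 then 24 * (sigmaOdd d : ℂ) - 2 * (d * c d) else 0) -
      (if (((n / d : ℕ) : ℤ) - d).natAbs = 1 then 1 else 0) +
      (24 * (if Odd (n / d) then 0 else (d : ℂ)) - 12 * (if Odd d then 0 else (d : ℂ))) := by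
    intro d hd
    obtain ⟨a, rfl⟩ := Nat.dvd_of_mem_divisors hd
    rw [Nat.mul_div_cancel_left a (Nat.pos_of_mem_divisors hd)]
    rcases Nat.even_or_odd a with ha | ha <;> rcases Nat.even_or_odd d with hd' | hd'
    · have h3 : ((a : ℤ) - d).natAbs ≠ 1 := by
        obtain ⟨x, rfl⟩ := ha
        obtain ⟨y, rfl⟩ := hd'
        omega
      simp only [coefA, coefB, if_neg (Nat.not_odd_iff_even.2 ha),
        if_neg (Nat.not_odd_iff_even.2 hd'), if_neg h3]
      have : a ≠ 1 := by rintro rfl; simp at ha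
      simp only [if_neg this]
      ring
    · have h1 : a ≠ d := by rintro rfl; exact (Nat.not_odd_iff_even.2 ha) hd'
      have h2 : a ≠ 1 := by rintro rfl; simp at ha
      have h3 : ((a : ℤ) - d).natAbs ≠ 2 := by
        obtain ⟨x, rfl⟩ := ha
        obtain ⟨y, rfl⟩ := hd'
        omega
      simp only [coefA, coefB, jetL, if_neg (Nat.not_odd_iff_even.2 ha), if_pos hd', if_neg h1,
        if_neg h2, if_neg h3]
      split_ifs <;> ring
    · have h1 : a ≠ d := by rintro rfl; exact (Nat.not_odd_iff_even.2 hd') ha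
      simp only [coefA, coefB, if_neg (Nat.not_odd_iff_even.2 hd'), if_pos ha, if_neg h1]
      split_ifs <;> ring
    · exact absurd hn (Nat.not_even_iff_odd.2 (hd'.mul ha))
  rw [coefTwo, Finset.mul_sum, ← Finset.sum_add_distrib, Finset.sum_congr rfl key,
    Finset.sum_add_distrib, Finset.sum_sub_distrib, Finset.sum_sub_distrib, Finset.sum_add_distrib,
    ← Finset.mul_sum, ← Finset.mul_sum, ← Finset.mul_sum, sum_divisors_odd_sub_even hn0,
    sum_divisors_ite_one hn0 fun d => 24 * (sigmaOdd d : ℂ) - 2 * (d * c d), hs,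
    gapCount, Finset.card_filter]
  push_cast
  ring

/-- The sum of the singular moduli of discriminant `-d`. -/
noncomputable def clSum (d : ℤ) : ℂ := ∑ᶠ cl : FormClass d, jval (Quot.out cl).1

/-- The form `f` is divisible by `k`. -/
def FormDvd (k : ℤ) (f : ℤ × ℤ × ℤ) : Prop := ∃ f', f = k • f'

lemma formVal_smul (k : ℤ) (f : ℤ × ℤ × ℤ) (x y : ℤ) :
    formVal (k • f) x y = k * formVal f x y := by
  simp only [formVal, Prod.smul_fst, Prod.smul_snd, smul_eq_mul]; ring

lemma fcomp_smul (k : ℤ) (f : ℤ × ℤ × ℤ) (g : M2) : fcomp (k • f) g = k • fcomp f g :=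
  form_ext fun x y => by simp only [formVal_fcomp, formVal_smul]

lemma _root_.FormRel.formDvd {k : ℤ} {f f' : ℤ × ℤ × ℤ} (h : FormRel f f') (hf : FormDvd k f) :
    FormDvd k f' := by
  obtain ⟨g, rfl⟩ := formRel_iff.1 h
  obtain ⟨e, rfl⟩ := hf
  exact ⟨fcomp e g, fcomp_smul k e g⟩

lemma isForm_smul {k : ℤ} (hk : 0 < k) {d : ℤ} {f : ℤ × ℤ × ℤ} :
    IsForm (k ^ 2 * d) (k • f) ↔ IsForm d f := by
  simp only [IsForm, Prod.smul_fst, Prod.smul_snd, smul_eq_mul]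
  refine and_congr (mul_pos_iff_of_pos_left hk) ?_
  have h : (k * f.2.1) ^ 2 - 4 * (k * f.1) * (k * f.2.2) =
    k ^ 2 * (f.2.1 ^ 2 - 4 * f.1 * f.2.2) := by ring
  rw [h, ← mul_neg]
  exact mul_right_inj' (by positivity)

lemma formRel_smul {k : ℤ} (hk : 0 < k) {f f' : ℤ × ℤ × ℤ} :
    FormRel (k • f) (k • f') ↔ FormRel f f' := by
  refine exists_congr fun g => forall_congr' fun x => forall_congr' fun y => ?_
  simp only [formVal_smul]
  exact mul_right_inj' hk.ne'

lemma formRoot_smul {k : ℤ} (hk : 0 < k) {d : ℤ} (hd : 0 < d) {f : ℤ × ℤ × ℤ} (hf : IsForm d f) :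
    formRoot (k • f) = formRoot f := by
  refine fpoly_formRoot_eq (by positivity) ((isForm_smul hk).2 hf) (formRoot_mem hd hf) ?_
  have h := fpoly_formRoot hd hf
  simp only [fpoly, Prod.smul_fst, Prod.smul_snd, smul_eq_mul] at h ⊢
  push_cast
  linear_combination (k : ℂ) * h

lemma jval_smul {k : ℤ} (hk : 0 < k) {d : ℤ} (hd : 0 < d) {f : ℤ × ℤ × ℤ} (hf : IsForm d f) :
    jval (k • f) = jval f :=
  jval_congr (by positivity) hd ((isForm_smul hk).2 hf) hf (g := 1)
    (by rw [formRoot_smul hk hd hf, Matrix.SpecialLinearGroup.coe_one, mob_one])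

lemma out_eq_of_formRel {d : ℤ} {c c' : FormClass d}
    (h : FormRel (Quot.out c).1 (Quot.out c').1) : c = c' := by
  rw [← Quot.out_eq c, ← Quot.out_eq c']
  exact Quot.sound h

open Classical in
lemma finsum_formDvd {k : ℤ} (hk : 0 < k) {d : ℤ} (hd : 0 < d) :
    ∑ᶠ cl : FormClass (k ^ 2 * d), (if FormDvd k (Quot.out cl).1 then jval (Quot.out cl).1 else 0) =
      clSum d := by
  have hkd : 0 < k ^ 2 * d := by positivity
  have := finite_formClass hd
  have := finite_formClass hkd
  let _ := Fintype.ofFinite (FormClass d)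
  let _ := Fintype.ofFinite (FormClass (k ^ 2 * d))
  rw [clSum, finsum_eq_sum_of_fintype, finsum_eq_sum_of_fintype, ← Finset.sum_filter]
  let φ : FormClass d → FormClass (k ^ 2 * d) := fun cl =>
    Quot.mk _ ⟨k • (Quot.out cl).1, (isForm_smul hk).2 (Quot.out cl).2⟩
  have hφ : ∀ cl, FormRel (Quot.out (φ cl)).1 (k • (Quot.out cl).1) := fun cl => formRel_out _
  refine (Finset.sum_bij (fun cl _ => φ cl) (fun cl _ => ?_) (fun cl _ cl' _ h => ?_)
    (fun cl hcl => ?_) (fun cl _ => ?_)).symm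
  · exact Finset.mem_filter.2 ⟨Finset.mem_univ _, (hφ cl).symm.formDvd ⟨_, rfl⟩⟩
  · have h1 := hφ cl
    change φ cl = φ cl' at h
    rw [h] at h1
    exact out_eq_of_formRel ((formRel_smul hk).1 (h1.symm.trans (hφ cl')))
  · obtain ⟨e, he⟩ := (Finset.mem_filter.1 hcl).2
    have hE : IsForm d e := (isForm_smul hk).1 (he ▸ (Quot.out cl).2)
    refine ⟨Quot.mk _ ⟨e, hE⟩, Finset.mem_univ _, out_eq_of_formRel ?_⟩
    rw [he]
    exact (hφ _).trans ((formRel_smul hk).2 (formRel_out ⟨e, hE⟩))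
  · rw [(hφ cl).jval_eq hkd (Quot.out (φ cl)).2 ((isForm_smul hk).2 (Quot.out cl).2),
      jval_smul hk hd (Quot.out cl).2]

lemma clSum_eq_zero {d : ℤ} (h : d % 4 = 1 ∨ d % 4 = 2) : clSum d = 0 := by
  have : IsEmpty (FormClass d) := by
    refine ⟨fun cl => ?_⟩
    have h1 := (Quot.out cl).2.2
    set f := (Quot.out cl).1
    obtain ⟨x, hx | hx⟩ := Int.even_or_odd' f.2.1 <;> rw [hx] at h1
    · have : d = 4 * (f.1 * f.2.2 - x ^ 2) := by linear_combination h1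
      omega
    · have : d = 4 * (f.1 * f.2.2 - x ^ 2 - x) - 1 := by linear_combination h1
      omega
  rw [clSum, finsum_of_isEmpty]

lemma clSum_of_unique {d : ℤ} (hd : 0 < d) {f : ℤ × ℤ × ℤ} (hf : IsForm d f)
    (h : ∀ f', IsForm d f' → FormRel f' f) : clSum d = jval f := by
  have : Unique (FormClass d) :=
    { default := Quot.mk _ ⟨f, hf⟩
      uniq := fun cl => by
        rw [← Quot.out_eq cl]
        exact Quot.sound (h _ (Quot.out cl).2) }
  rw [clSum, finsum_unique]
  exact (h _ (Quot.out (default : FormClass d)).2).jval_eq hd (Quot.out (default : FormClass d)).2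
      hf

lemma formWt_eq_card {f : ℤ × ℤ × ℤ} (S : Finset (ℤ × ℤ × ℤ × ℤ))
    (hS : ∀ p q r s : ℤ, (p, q, r, s) ∈ S ↔ p * s - q * r = 1 ∧ f = fcomp f !![p, q; r, s]) :
    formWt f = S.card / 2 := by
  rw [formWt, ← Set.ncard_coe_finset S]
  congr 1
  let φ : SL(2, ℤ) → ℤ × ℤ × ℤ × ℤ := fun g => (g 0 0, g 0 1, g 1 0, g 1 1)
  have hφ : Function.Injective φ := by
    intro g h e
    simp only [φ, Prod.mk.injEq] at e
    ext i j
    fin_cases i <;> fin_cases j <;> simp_all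
  have himg : (S : Set (ℤ × ℤ × ℤ × ℤ)) = φ '' {g | ∀ x y : ℤ,
      formVal f x y = formVal f (g.1 0 0 * x + g.1 0 1 * y) (g.1 1 0 * x + g.1 1 1 * y)} := by
    ext ⟨p, q, r, s⟩
    rw [Finset.mem_coe, hS]
    constructor
    · rintro ⟨h1, h2⟩
      refine ⟨⟨!![p, q; r, s], by rw [Matrix.det_fin_two_of]; exact h1⟩, fun x y => ?_, rfl⟩
      conv_lhs => rw [h2]
      rw [formVal_fcomp]
    · rintro ⟨g, hg, he⟩
      simp only [φ, Prod.mk.injEq] at he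
      obtain ⟨rfl, rfl, rfl, rfl⟩ := he
      have hd := g.2
      rw [Matrix.det_fin_two] at hd
      refine ⟨hd, form_ext fun x y => ?_⟩
      rw [hg, formVal_fcomp]
      simp
  rw [himg, Set.ncard_image_of_injective _ hφ]
  rfl

lemma formWt_one_zero_one : formWt (1, 0, 1) = 2 := by
  rw [formWt_eq_card ({(1, 0, 0, 1), (-1, 0, 0, -1), (0, 1, -1, 0), (0, -1, 1, 0)} : Finset _)]
  · rfl
  · intro p q r s
    constructor
    · intro h
      simp only [Finset.mem_insert, Finset.mem_singleton, Prod.mk.injEq] at h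
      rcases h with ⟨rfl, rfl, rfl, rfl⟩ | ⟨rfl, rfl, rfl, rfl⟩ | ⟨rfl, rfl, rfl, rfl⟩ |
        ⟨rfl, rfl, rfl, rfl⟩ <;> simp [fcomp, formVal]
    · rintro ⟨h1, h2⟩
      simp [fcomp, formVal] at h2
      obtain ⟨h3, h4, h5⟩ := h2
      have b1 : -1 ≤ p := by nlinarith
      have b2 : p ≤ 1 := by nlinarith
      have b3 : -1 ≤ q := by nlinarith
      have b4 : q ≤ 1 := by nlinarith
      have b5 : -1 ≤ r := by nlinarith
      have b6 : r ≤ 1 := by nlinarith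
      have b7 : -1 ≤ s := by nlinarith
      have b8 : s ≤ 1 := by nlinarith
      interval_cases p <;> interval_cases q <;> interval_cases r <;> interval_cases s <;>
        first
        | decide
        | exact absurd h1 (by decide)
        | exact absurd h3 (by decide)
        | exact absurd h4 (by decide)

lemma formWt_one_one_one : formWt (1, 1, 1) = 3 := by
  rw [formWt_eq_card ({(1, 0, 0, 1), (-1, 0, 0, -1), (0, 1, -1, -1), (0, -1, 1, 1),
    (1, 1, -1, 0), (-1, -1, 1, 0)} : Finset _)]
  · rfl
  · intro p q r s
    constructor
    · intro h
      simp only [Finset.mem_insert, Finset.mem_singleton, Prod.mk.injEq] at h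
      rcases h with ⟨rfl, rfl, rfl, rfl⟩ | ⟨rfl, rfl, rfl, rfl⟩ | ⟨rfl, rfl, rfl, rfl⟩ |
        ⟨rfl, rfl, rfl, rfl⟩ | ⟨rfl, rfl, rfl, rfl⟩ | ⟨rfl, rfl, rfl, rfl⟩ <;>
        simp [fcomp, formVal]
    · rintro ⟨h1, h2⟩
      simp [fcomp, formVal] at h2
      obtain ⟨h3, h4, h5⟩ := h2
      have b1 : -1 ≤ p := by nlinarith [sq_nonneg (p + 2 * r)]
      have b2 : p ≤ 1 := by nlinarith [sq_nonneg (p + 2 * r)]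
      have b3 : -1 ≤ q := by nlinarith [sq_nonneg (q + 2 * s)]
      have b4 : q ≤ 1 := by nlinarith [sq_nonneg (q + 2 * s)]
      have b5 : -1 ≤ r := by nlinarith [sq_nonneg (2 * p + r)]
      have b6 : r ≤ 1 := by nlinarith [sq_nonneg (2 * p + r)]
      have b7 : -1 ≤ s := by nlinarith [sq_nonneg (2 * q + s)]
      have b8 : s ≤ 1 := by nlinarith [sq_nonneg (2 * q + s)]
      interval_cases p <;> interval_cases q <;> interval_cases r <;> interval_cases s <;>
        first
        | decide
        | exact absurd h1 (by decide)
        | exact absurd h3 (by decide)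
        | exact absurd h4 (by decide)

lemma clSum_four : clSum 4 = 492 := by
  have hf : IsForm 4 (1, 0, 1) := by norm_num [IsForm]
  rw [clSum_of_unique (by norm_num) hf, jval, formWt_one_zero_one,
    fpoly_formRoot_eq (by norm_num) hf I_mem_UH, jInv_I]
  · norm_num
  · simp [fpoly]
  · intro f h
    obtain ⟨⟨a, b, c⟩, h1, h2, h3, h4⟩ := exists_reduced (by norm_num) h
    have h5 := reduced_bound h1 h3 h4
    obtain ⟨h6, h7⟩ := h1
    simp only [abs_le] at h3 h4 h5 h6 h7
    have : a = 1 := by nlinarith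
    subst this
    obtain ⟨h8, h9⟩ := h3
    interval_cases b
    · omega
    · obtain rfl : c = 1 := by omega
      exact h2
    · omega

lemma clSum_three : clSum 3 = -248 := by
  have hf : IsForm 3 (1, 1, 1) := by norm_num [IsForm]
  rw [clSum_of_unique (by norm_num) hf, jval, formWt_one_one_one,
    fpoly_formRoot_eq (by norm_num) hf rho_mem, jInv_rho]
  · norm_num
  · simp [fpoly, rho_sq]
  · intro f h
    obtain ⟨⟨a, b, c⟩, h1, h2, h3, h4⟩ := exists_reduced (by norm_num) h
    have h5 := reduced_bound h1 h3 h4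
    obtain ⟨h6, h7⟩ := h1
    simp only [abs_le] at h3 h4 h5 h6 h7
    have : a = 1 := by nlinarith
    subst this
    obtain ⟨h8, h9⟩ := h3
    interval_cases b
    · obtain rfl : c = 1 := by omega
      refine h2.trans (formRel_iff.2 ⟨ModularGroup.T, ?_⟩)
      simp [fcomp, formVal, ModularGroup.coe_T]
    · omega
    · obtain rfl : c = 1 := by omega
      exact h2

/-- The matrix of trace `r` attached to a form. -/
def fmat (r : ℤ) (f : ℤ × ℤ × ℤ) : M2 := !![(r - f.2.1) / 2, -f.2.2; f.1, (r + f.2.1) / 2]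

lemma exists_fmat_eq {n r : ℤ} {f : ℤ × ℤ × ℤ} (hf : IsForm (4 * n - r ^ 2) f) :
    ∃ u w, r - f.2.1 = 2 * u ∧ r + f.2.1 = 2 * w ∧ u * w + f.1 * f.2.2 = n ∧
      fmat r f = !![u, -f.2.2; f.1, w] := by
  have h := hf.2
  have hpar : (r - f.2.1) % 2 = 0 := by
    have h1 : (r - f.2.1) * (r + f.2.1) = 4 * (n - f.1 * f.2.2) := by linear_combination -h
    by_contra h0
    have h2 : Odd (r - f.2.1) := by rw [Int.odd_iff]; omega
    have h3 : Odd (r + f.2.1) := by rw [Int.odd_iff]; omega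
    have h4 := Int.odd_iff.1 (h2.mul h3)
    omega
  refine ⟨(r - f.2.1) / 2, (r + f.2.1) / 2, by omega, by omega, ?_, rfl⟩
  have h1 : 2 * ((r - f.2.1) / 2) = r - f.2.1 := by omega
  have h2 : 2 * ((r + f.2.1) / 2) = r + f.2.1 := by omega
  have h3 : (2 * ((r - f.2.1) / 2)) * (2 * ((r + f.2.1) / 2)) = r ^ 2 - f.2.1 ^ 2 := by
    rw [h1, h2]; ring
  linarith

lemma det_fmat {n r : ℤ} {f : ℤ × ℤ × ℤ} (hf : IsForm (4 * n - r ^ 2) f) : (fmat r f).det = n := by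
  obtain ⟨u, w, -, -, h, h'⟩ := exists_fmat_eq hf
  rw [h', Matrix.det_fin_two_of, ← h]
  ring

lemma posSet_formRoot {ℓ : ℕ} {n : ℕ} (hn : n ≠ 0) {r : ℤ} (hr : r ^ 2 < 4 * n) {f : ℤ × ℤ × ℤ}
    (hf : IsForm (4 * n - r ^ 2) f) (v : Fin 2 → ZMod ℓ) :
    ModFam.posSet n r (formRoot f) v = {N | N = fmat r f ∧ ¬IsScaled N ∧ act N v = v} := by
  have hd : (0 : ℤ) < 4 * n - r ^ 2 := by linarith
  have hz := formRoot_mem hd hf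
  obtain ⟨u, w, h1, h2, h3, h4⟩ := exists_fmat_eq hf
  have hn' : (0 : ℤ) < n := by positivity
  ext N
  constructor
  · rintro ⟨⟨a1, a2, a3, a4⟩, a5, a6⟩
    refine ⟨?_, a2, a4⟩
    have h5 := isForm_matForm a5
    rw [a1, a6] at h5
    have h6 : matForm N = f := form_eq_of_root h5 hf hz
      ((fpoly_matForm (by rw [a1]; exact hn') hz).2 a3) (fpoly_formRoot hd hf)
    rw [h4, ← h6]
    rw [← h6] at h1 h2
    simp only [matForm] at h1 h2 ⊢
    ext i j
    fin_cases i <;> fin_cases j <;> simp <;> omega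
  · rintro ⟨rfl, a1, a2⟩
    have hdet := det_fmat hf
    refine ⟨⟨hdet, a1, ?_, a2⟩, ?_, ?_⟩
    · rw [← fpoly_matForm (by rw [hdet]; exact hn') hz]
      have h5 : matForm (fmat r f) = f := by
        rw [h4, matForm]
        ext <;> simp
        omega
      rw [h5]
      exact fpoly_formRoot hd hf
    · rw [h4]; simpa using hf.1
    · rw [h4]; simp; omega

open Classical in
lemma ModFam.wtAt_formRoot {ℓ : ℕ} (𝓕 : ModFam ℓ) {n : ℕ} (hn : n ≠ 0) {r : ℤ} (hr : r ^ 2 < 4 * n)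
    {f : ℤ × ℤ × ℤ} (hf : IsForm (4 * n - r ^ 2) f) :
    𝓕.wtAt n r (formRoot f) =
      if IsScaled (fmat r f) then 0 else ∑ v ∈ 𝓕.V, if act (fmat r f) v = v then 1 else 0 := by
  have key : ∀ v : Fin 2 → ZMod ℓ, (ModFam.posSet n r (formRoot f) v).ncard =
      if ¬IsScaled (fmat r f) ∧ act (fmat r f) v = v then 1 else 0 := by
    intro v
    rw [posSet_formRoot hn hr hf]
    split_ifs with h
    · rw [Set.ncard_eq_one]
      refine ⟨fmat r f, Set.ext fun N => ⟨fun hN => hN.1, fun hN => ?_⟩⟩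
      obtain rfl : N = fmat r f := hN
      exact ⟨rfl, h⟩
    · rw [Set.eq_empty_of_forall_notMem (s := {N | _}), Set.ncard_empty]
      rintro N ⟨rfl, hN⟩
      exact h hN
  simp only [ModFam.wtAt, key]
  split_ifs with h
  · simp [h]
  · simp [h]

open Classical in
lemma wtAt_famOne {n : ℕ} (hn : n ≠ 0) {r : ℤ} (hr : r ^ 2 < 4 * n)
    {f : ℤ × ℤ × ℤ} (hf : IsForm (4 * n - r ^ 2) f) :
    famOne.wtAt n r (formRoot f) = if IsScaled (fmat r f) then 0 else 1 := by
  rw [famOne.wtAt_formRoot hn hr hf]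
  refine if_congr Iff.rfl rfl ?_
  change ∑ v ∈ {0}, _ = 1
  rw [Finset.sum_singleton, if_pos (act_zero _)]

open Classical in
lemma card_fixed_two {N : M2} {u q s w : ZMod 2} (hu : ((N 0 0 : ℤ) : ZMod 2) = u)
    (hq : ((N 0 1 : ℤ) : ZMod 2) = q) (hs : ((N 1 0 : ℤ) : ZMod 2) = s)
    (hw : ((N 1 1 : ℤ) : ZMod 2) = w) :
    ∑ v ∈ famTwo.V, (if act N v = v then 1 else 0) = (if u = 1 ∧ s = 0 then 1 else 0) +
      ((if q = 0 ∧ w = 1 then 1 else 0) + (if u + q = 1 ∧ s + w = 1 then 1 else 0)) := by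
  have h : ∀ x y : ZMod 2, act N ![x, y] = ![x, y] ↔ u * x + q * y = x ∧ s * x + w * y = y := by
    intro x y
    rw [funext_iff, Fin.forall_fin_two, act_apply, act_apply, hu, hq, hs, hw]
    simp
  rw [famTwo_V, Finset.sum_insert (by decide), Finset.sum_insert (by decide), Finset.sum_singleton]
  simp only [h, mul_zero, mul_one, add_zero, zero_add]

lemma isScaled_fmat_iff {t : ℕ} (ht : t ≠ 0) {r : ℤ} (hr : r ^ 2 < 4 * (t ^ 2 : ℕ))
    {f : ℤ × ℤ × ℤ} (hf : IsForm (4 * (t ^ 2 : ℕ) - r ^ 2) f) :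
    IsScaled (fmat r f) ↔ (r = 0 ∨ r = t ∨ r = -t) ∧ FormDvd t f := by
  obtain ⟨u, w, h1, h2, h3, h4⟩ := exists_fmat_eq hf
  have hdet := det_fmat hf
  have ht' : (0 : ℤ) < t := by positivity
  push_cast at hr h3 hdet
  constructor
  · intro h
    have hpos : ∃ γ : SL(2, ℤ), fmat r f = (t : ℤ) • (γ : M2) := by
      obtain ⟨s, γ, hγ⟩ := h
      have h5 : s ^ 2 = (t : ℤ) ^ 2 := by
        rw [hγ, Matrix.det_smul, Matrix.SpecialLinearGroup.det_coe] at hdet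
        simpa using hdet
      rcases sq_eq_sq_iff_eq_or_eq_neg.1 h5 with rfl | rfl
      · exact ⟨γ, hγ⟩
      · exact ⟨-γ, by rw [hγ, Matrix.SpecialLinearGroup.coe_neg, smul_neg, neg_smul]⟩
    obtain ⟨γ, hγ⟩ := hpos
    rw [h4] at hγ
    have e00 := congrFun (congrFun hγ 0) 0
    have e01 := congrFun (congrFun hγ 0) 1
    have e10 := congrFun (congrFun hγ 1) 0
    have e11 := congrFun (congrFun hγ 1) 1
    simp at e00 e01 e10 e11
    have hr' : r = t * (γ 0 0 + γ 1 1) := by linarith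
    refine ⟨?_, (γ 1 0, γ 1 1 - γ 0 0, -γ 0 1), ?_⟩
    · set x := γ 0 0 + γ 1 1
      rw [hr'] at hr
      have hx : x ^ 2 < 4 := by nlinarith [mul_pow (t : ℤ) x 2, sq_nonneg (t : ℤ)]
      have x1 : -2 < x := by nlinarith
      have x2 : x < 2 := by nlinarith
      rw [hr']
      interval_cases x <;> simp
    · ext
      · simp [e10]
      · simp; linarith
      · simp; linarith
  · rintro ⟨hr', f', rfl⟩
    simp only [Prod.smul_fst, Prod.smul_snd, smul_eq_mul] at h1 h2 h3 h4
    obtain ⟨s, rfl⟩ : ∃ s : ℤ, r = t * s := by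
      rcases hr' with rfl | rfl | rfl
      exacts [⟨0, by ring⟩, ⟨1, by ring⟩, ⟨-1, by ring⟩]
    have hf' : IsForm (4 * 1 - s ^ 2) f' := by
      rw [← isForm_smul ht']
      convert hf using 1
      push_cast
      ring
    refine ⟨t, ⟨fmat s f', det_fmat hf'⟩, ?_⟩
    obtain ⟨u', w', k1, k2, -, k4⟩ := exists_fmat_eq hf'
    have e1 : u = t * u' := by
      have : 2 * u = 2 * (t * u') := by linear_combination (t : ℤ) * k1 - h1
      omega
    have e2 : w = t * w' := by
      have : 2 * w = 2 * (t * w') := by linear_combination (t : ℤ) * k2 - h2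
      omega
    change _ = (t : ℤ) • fmat s f'
    rw [h4, k4, e1, e2]
    ext i j
    fin_cases i <;> fin_cases j <;> simp

lemma isSquare_of_isScaled_fmat {n : ℕ} {r : ℤ} {f : ℤ × ℤ × ℤ} (hf : IsForm (4 * n - r ^ 2) f)
    (h : IsScaled (fmat r f)) : ∃ t : ℕ, n = t ^ 2 := by
  obtain ⟨s, γ, hγ⟩ := h
  have hdet := det_fmat hf
  rw [hγ, Matrix.det_smul, Matrix.SpecialLinearGroup.det_coe] at hdet
  refine ⟨s.natAbs, ?_⟩
  zify
  rw [sq_abs]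
  simpa using hdet.symm

open ModFam

open Classical in
lemma finsum_formDvd_of_eq {k : ℤ} (hk : 0 < k) {d d' : ℤ} (hd : 0 < d) (h : d' = k ^ 2 * d) :
    ∑ᶠ cl : FormClass d', (if FormDvd k (Quot.out cl).1 then jval (Quot.out cl).1 else 0) =
      clSum d := by
  subst h
  exact finsum_formDvd hk hd

open Classical in
/-- The contribution of the scaled matrices of determinant `n` and trace `r`. -/
noncomputable def sclSum (n : ℕ) (r : ℤ) : ℂ :=
  ∑ᶠ cl : FormClass (4 * n - r ^ 2),
    if IsScaled (fmat r (Quot.out cl).1) then jval (Quot.out cl).1 else 0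

lemma sclSum_sq {t : ℕ} (ht : t ≠ 0) {r : ℤ} (hr : r ^ 2 < 4 * (t ^ 2 : ℕ)) :
    sclSum (t ^ 2) r = if r = 0 then 492 else if r = t ∨ r = -t then -248 else 0 := by
  classical
  have ht' : (0 : ℤ) < t := by positivity
  have key : sclSum (t ^ 2) r = ∑ᶠ cl : FormClass (4 * (t ^ 2 : ℕ) - r ^ 2),
      if (r = 0 ∨ r = t ∨ r = -t) ∧ FormDvd t (Quot.out cl).1 then jval (Quot.out cl).1 else 0 :=
    finsum_congr fun cl => if_congr (isScaled_fmat_iff ht hr (Quot.out cl).2) rfl rfl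
  rw [key]
  split_ifs with h0 h1
  · rw [← clSum_four, ← finsum_formDvd_of_eq (d' := 4 * (t ^ 2 : ℕ) - r ^ 2) ht' (by norm_num)
      (by rw [h0]; push_cast; ring)]
    exact finsum_congr fun cl => if_congr (by simp [h0]) rfl rfl
  · rw [← clSum_three, ← finsum_formDvd_of_eq (d' := 4 * (t ^ 2 : ℕ) - r ^ 2) ht' (by norm_num)
      (by rcases h1 with rfl | rfl <;> (push_cast; ring))]
    exact finsum_congr fun cl => if_congr (by simp [h1]) rfl rfl
  · simp [h0, h1]

lemma sclSum_eq_zero {n : ℕ} (hn : ¬IsSquare n) (r : ℤ) : sclSum n r = 0 := by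
  classical
  rw [sclSum]
  refine finsum_eq_zero_of_forall_eq_zero fun cl => if_neg fun h => hn ?_
  obtain ⟨t, rfl⟩ := isSquare_of_isScaled_fmat (Quot.out cl).2 h
  exact IsSquare.sq t

lemma sum_sclSum {n : ℕ} (hn : n ≠ 0) :
    ∑ r ∈ traces n, sclSum n r = if IsSquare n then -4 else 0 := by
  split_ifs with h
  · obtain ⟨t, rfl⟩ := (isSquare_iff_exists_sq n).1 h
    have ht : t ≠ 0 := by rintro rfl; simp at hn
    have ht' : (0 : ℤ) < t := by positivity
    have hsub : ({0, (t : ℤ), -(t : ℤ)} : Finset ℤ) ⊆ traces (t ^ 2) := by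
      intro r hr
      simp only [Finset.mem_insert, Finset.mem_singleton] at hr
      rw [mem_traces]
      push_cast
      rcases hr with rfl | rfl | rfl <;> nlinarith
    rw [← Finset.sum_subset hsub]
    · have hval : ∀ r ∈ ({0, (t : ℤ), -(t : ℤ)} : Finset ℤ), sclSum (t ^ 2) r =
          if r = 0 then 492 else if r = t ∨ r = -t then -248 else 0 := fun r hr =>
        sclSum_sq ht (mem_traces.1 (hsub hr))
      rw [Finset.sum_congr rfl hval, Finset.sum_insert, Finset.sum_pair]
      · simp [ht]
        norm_num
      · omega
      · simp only [Finset.mem_insert, Finset.mem_singleton]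
        omega
    · intro r hr hr'
      simp only [Finset.mem_insert, Finset.mem_singleton, not_or] at hr'
      rw [sclSum_sq ht (mem_traces.1 hr), if_neg hr'.1, if_neg (not_or.2 hr'.2)]
  · exact Finset.sum_eq_zero fun r _ => sclSum_eq_zero h r

lemma sum_sclSum_even {n : ℕ} (hn : Odd n) :
    ∑ r ∈ traces n with Even r, sclSum n r = if IsSquare n then 492 else 0 := by
  split_ifs with h
  · obtain ⟨t, rfl⟩ := (isSquare_iff_exists_sq n).1 h
    have hto : Odd t := (Nat.odd_pow_iff two_ne_zero).1 hn
    have ht : t ≠ 0 := by rintro rfl; simp at hto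
    have ht' : (0 : ℤ) < t := by positivity
    have hto' : Odd (t : ℤ) := by exact_mod_cast hto
    rw [Finset.sum_eq_single 0]
    · rw [sclSum_sq ht (by push_cast; positivity), if_pos rfl]
    · intro r hr hr0
      obtain ⟨h1, h2⟩ := Finset.mem_filter.1 hr
      rw [sclSum_sq ht (mem_traces.1 h1), if_neg hr0, if_neg]
      rintro (rfl | rfl)
      · exact Int.not_even_iff_odd.2 hto' h2
      · exact Int.not_even_iff_odd.2 hto'.neg h2
    · intro h0
      refine absurd (Finset.mem_filter.2 ⟨mem_traces.2 ?_, Even.zero⟩) h0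
      push_cast
      positivity
  · exact Finset.sum_eq_zero fun r _ => sclSum_eq_zero h r

lemma disc_pos {n : ℕ} {r : ℤ} (hr : r ∈ traces n) : (0 : ℤ) < 4 * n - r ^ 2 := by
  have := mem_traces.1 hr
  linarith

/-- The trace relation of level one. -/
theorem sum_clSum_one {n : ℕ} (hn : n ≠ 0) :
    ∑ r ∈ traces n, clSum (4 * n - r ^ 2) = gapCount n 1 - if IsSquare n then 4 else 0 := by
  classical
  obtain ⟨C, A, hjet⟩ := pjet_prodFac_famOne n
  have h := famOne.trace_identity hn hjet
  have key : ∀ r ∈ traces n, ∑ᶠ cl : FormClass (4 * n - r ^ 2),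
      (famOne.wtAt n r (formRoot (Quot.out cl).1) : ℂ) * jval (Quot.out cl).1 =
      clSum (4 * n - r ^ 2) - sclSum n r := by
    intro r hr
    have := finite_formClass (disc_pos hr)
    rw [clSum, sclSum, ← finsum_sub_distrib (Set.toFinite _) (Set.toFinite _)]
    refine finsum_congr fun cl => ?_
    rw [wtAt_famOne hn (mem_traces.1 hr) (Quot.out cl).2]
    split_ifs <;> simp
  rw [Finset.sum_congr rfl key, Finset.sum_sub_distrib, sum_sclSum hn, neg_neg] at h
  rw [gapCount, ← h]
  split_ifs <;> ring

lemma formDvd_two_iff {f : ℤ × ℤ × ℤ} :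
    FormDvd 2 f ↔ (f.1 : ZMod 2) = 0 ∧ (f.2.1 : ZMod 2) = 0 ∧ (f.2.2 : ZMod 2) = 0 := by
  simp only [ZMod.intCast_zmod_eq_zero_iff_dvd]
  constructor
  · rintro ⟨f', rfl⟩
    exact ⟨⟨f'.1, rfl⟩, ⟨f'.2.1, rfl⟩, ⟨f'.2.2, rfl⟩⟩
  · rintro ⟨⟨a, ha⟩, ⟨b, hb⟩, ⟨c, hc⟩⟩
    exact ⟨(a, b, c), Prod.ext ha (Prod.ext hb hc)⟩

open Classical in
lemma card_fixed_fmat {n : ℕ} {r : ℤ} {f : ℤ × ℤ × ℤ} (hf : IsForm (4 * n - r ^ 2) f) :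
    ∑ v ∈ famTwo.V, (if act (fmat r f) v = v then 1 else 0) =
      if Odd n then (if Even r then 1 + 2 * (if FormDvd 2 f then 1 else 0) else 0)
        else if Even r then 0 else 1 := by
  obtain ⟨u, w, h1, h2, h3, h4⟩ := exists_fmat_eq hf
  have e1 : (r : ZMod 2) = u + w := by
    rw [show r = u + w by omega]; push_cast; rfl
  have e2 : (f.2.1 : ZMod 2) = w - u := by
    rw [show f.2.1 = w - u by omega]; push_cast; rfl
  have e3 : (n : ZMod 2) = u * w + f.1 * f.2.2 := by
    rw [← Int.cast_natCast, ← h3]; push_cast; rfl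
  rw [card_fixed_two rfl rfl rfl rfl, h4]
  have hE : Even r ↔ (u + w : ZMod 2) = 0 := by
    rw [← e1, ZMod.intCast_zmod_eq_zero_iff_dvd, even_iff_two_dvd]; rfl
  have hO : Odd n ↔ (u * w + f.1 * f.2.2 : ZMod 2) = 1 := by
    rw [← e3, ZMod.natCast_eq_one_iff_odd]
  simp only [hE, hO, formDvd_two_iff, e2]
  simp
  generalize (u : ZMod 2) = U
  generalize (w : ZMod 2) = W
  generalize (f.1 : ZMod 2) = A
  generalize (f.2.2 : ZMod 2) = C
  clear * -
  revert U W A C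
  decide

lemma not_formDvd_two {n : ℕ} (hn : Odd n) {r : ℤ} (hr : r ∈ traces n) (hre : Even r)
    {f : ℤ × ℤ × ℤ} (hf : IsForm (4 * n - r ^ 2) f) (h : IsScaled (fmat r f)) : ¬FormDvd 2 f := by
  obtain ⟨t, rfl⟩ := isSquare_of_isScaled_fmat hf h
  have hto : Odd t := (Nat.odd_pow_iff two_ne_zero).1 hn
  have ht : t ≠ 0 := by rintro rfl; simp at hto
  have hto' : Odd (t : ℤ) := by exact_mod_cast hto
  rintro ⟨⟨a, b, c⟩, rfl⟩
  have hr0 : r = 0 := by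
    rcases ((isScaled_fmat_iff ht (mem_traces.1 hr) hf).1 h).1 with h0 | rfl | rfl
    · exact h0
    · exact absurd hre (Int.not_even_iff_odd.2 hto')
    · exact absurd hre (Int.not_even_iff_odd.2 hto'.neg)
  have hd := hf.2
  subst hr0
  simp only [Prod.smul_fst, Prod.smul_snd, smul_eq_mul] at hd
  push_cast at hd
  obtain ⟨x, hx⟩ := hto'
  have h1 : b ^ 2 = 4 * (a * c - x ^ 2 - x) - 1 := by rw [hx] at hd; linarith
  obtain ⟨y, rfl | rfl⟩ := Int.even_or_odd' b
  · have : (2 * y) ^ 2 = 4 * y ^ 2 := by ring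
    omega
  · have : (2 * y + 1) ^ 2 = 4 * (y ^ 2 + y) + 1 := by ring
    omega

/-- The trace relation of level two for odd determinant. -/
theorem sum_clSum_two_of_odd {c : ℤ → ℤ} (hc : IsEtaQuotCoeff c) {n : ℕ} (hn : Odd n) :
    ∑ r ∈ traces n with Even r, (clSum (4 * n - r ^ 2) + 2 * clSum ((4 * n - r ^ 2) / 4)) =
      2 * (n * c n) - 48 * sigmaOdd n + 2 * gapCount n 2 - if IsSquare n then 12 else 0 := by
  classical
  have hn0 : n ≠ 0 := by rintro rfl; simp at hn
  obtain ⟨C, A, hjet⟩ := pjet_prodFac_famTwo hc hn0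
  have h := famTwo.trace_identity hn0 hjet
  have key : ∀ r ∈ traces n, ∑ᶠ cl : FormClass (4 * n - r ^ 2),
      (famTwo.wtAt n r (formRoot (Quot.out cl).1) : ℂ) * jval (Quot.out cl).1 =
      if Even r then
        clSum (4 * n - r ^ 2) + 2 * clSum ((4 * n - r ^ 2) / 4) - sclSum n r else 0 := by
    intro r hr
    have hd := disc_pos hr
    have := finite_formClass hd
    split_ifs with hre
    · have hdiv : (4 * n - r ^ 2 : ℤ) = 2 ^ 2 * ((4 * n - r ^ 2) / 4) := by
        obtain ⟨s, rfl⟩ := hre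
        have : (4 * n - (s + s) ^ 2 : ℤ) = 4 * (n - s ^ 2) := by ring
        omega
      rw [← finsum_formDvd_of_eq (d' := 4 * n - r ^ 2) two_pos (by omega) hdiv, clSum, sclSum,
        ← smul_eq_mul 2, smul_finsum,
        ← finsum_add_distrib (Set.toFinite _) (Set.toFinite _),
        ← finsum_sub_distrib (Set.toFinite _) (Set.toFinite _)]
      refine finsum_congr fun cl => ?_
      rw [famTwo.wtAt_formRoot hn0 (mem_traces.1 hr) (Quot.out cl).2,
        card_fixed_fmat (Quot.out cl).2, if_pos hn, if_pos hre]
      by_cases hs : IsScaled (fmat r (Quot.out cl).1)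
      · simp [hs, not_formDvd_two hn hr hre (Quot.out cl).2 hs]
      · simp only [if_neg hs]
        split_ifs <;> (push_cast; simp; try ring)
    · refine finsum_eq_zero_of_forall_eq_zero fun cl => ?_
      rw [famTwo.wtAt_formRoot hn0 (mem_traces.1 hr) (Quot.out cl).2,
        card_fixed_fmat (Quot.out cl).2, if_pos hn, if_neg hre]
      simp
  rw [Finset.sum_congr rfl key, ← Finset.sum_filter, Finset.sum_sub_distrib, sum_sclSum_even hn,
    coefTwo_of_odd hc hn, sub_eq_iff_eq_add] at h
  rw [h]
  split_ifs <;> ring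

/-- The trace relation of level two for even determinant. -/
theorem sum_clSum_two_of_even {c : ℤ → ℤ} (hc : IsEtaQuotCoeff c) {n : ℕ} (hn0 : n ≠ 0)
    (hn : Even n) : ∑ r ∈ traces n with Odd r, clSum (4 * n - r ^ 2) =
      2 * (n * c n) - 48 * sigmaOdd n + gapCount n 1 := by
  classical
  obtain ⟨C, A, hjet⟩ := pjet_prodFac_famTwo hc hn0
  have h := famTwo.trace_identity hn0 hjet
  have key : ∀ r ∈ traces n, ∑ᶠ cl : FormClass (4 * n - r ^ 2),
      (famTwo.wtAt n r (formRoot (Quot.out cl).1) : ℂ) * jval (Quot.out cl).1 =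
      if Odd r then clSum (4 * n - r ^ 2) else 0 := by
    intro r hr
    split_ifs with hro
    · refine finsum_congr fun cl => ?_
      have hs : ¬IsScaled (fmat r (Quot.out cl).1) := by
        intro hs
        obtain ⟨t, rfl⟩ := isSquare_of_isScaled_fmat (Quot.out cl).2 hs
        have hte : Even (t : ℤ) := by exact_mod_cast (Nat.even_pow.1 hn).1
        have ht : t ≠ 0 := by rintro rfl; simp at hn0
        rcases ((isScaled_fmat_iff ht (mem_traces.1 hr) (Quot.out cl).2).1 hs).1 with
          rfl | rfl | rfl
        · simp at hro
        · exact Int.not_even_iff_odd.2 hro hte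
        · exact Int.not_even_iff_odd.2 hro hte.neg
      rw [famTwo.wtAt_formRoot hn0 (mem_traces.1 hr) (Quot.out cl).2,
        card_fixed_fmat (Quot.out cl).2, if_neg hs, if_neg (Nat.not_odd_iff_even.2 hn),
        if_neg (Int.not_even_iff_odd.2 hro), Nat.cast_one, one_mul]
    · refine finsum_eq_zero_of_forall_eq_zero fun cl => ?_
      rw [famTwo.wtAt_formRoot hn0 (mem_traces.1 hr) (Quot.out cl).2,
        card_fixed_fmat (Quot.out cl).2, if_neg (Nat.not_odd_iff_even.2 hn),
        if_pos (Int.not_odd_iff_even.1 hro)]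
      simp
  rw [Finset.sum_congr rfl key, ← Finset.sum_filter, coefTwo_of_even hn0 hn] at h
  rw [h]
  ring

/-- The complex trace of singular moduli. -/
noncomputable def trC (d : ℤ) : ℂ :=
  (if 0 < d then clSum d else 0) + 2 * (if d = 0 then 1 else 0) - if d = -1 then 1 else 0

lemma traceSM_eq (d : ℤ) : traceSM d = (trC d).re := by
  rw [traceSM, trC]
  split_ifs with h1 h2 h3 h4 h5 h6 <;> first | omega | simp
  · rw [clSum_eq_zero (by omega), zero_re]
  · rfl

/-- An interval containing all traces which contribute. -/
noncomputable def rng (n : ℕ) : Finset ℤ := Finset.Icc (-(2 * n + 2 : ℤ)) (2 * n + 2)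

lemma mem_rng_of_sq_le {n : ℕ} {r : ℤ} (h : r ^ 2 ≤ 4 * n + 4) : r ∈ rng n := by
  rw [rng, Finset.mem_Icc, ← abs_le]
  refine abs_le_of_sq_le_sq (h.trans ?_) (by positivity)
  nlinarith

lemma sum_ite_card {n : ℕ} (p q : ℤ → Prop) [DecidablePred p] [DecidablePred q] :
    ∑ r ∈ rng n with p r, (if q r then (1 : ℂ) else 0) =
      ((rng n).filter fun r => p r ∧ q r).card := by
  rw [← Finset.sum_filter, Finset.filter_filter, Finset.sum_const, nsmul_eq_mul, mul_one]

lemma sum_trC (n : ℕ) (p : ℤ → Prop) [DecidablePred p] (φ : ℤ → ℤ)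
    (hφ : ∀ r, p r → (0 < φ r ↔ r ^ 2 < 4 * n)) :
    ∑ r ∈ rng n with p r, trC (φ r) = (∑ r ∈ traces n with p r, clSum (φ r)) +
      2 * ((rng n).filter fun r => p r ∧ φ r = 0).card -
      ((rng n).filter fun r => p r ∧ φ r = -1).card := by
  simp only [trC]
  rw [Finset.sum_sub_distrib, Finset.sum_add_distrib, ← Finset.mul_sum, sum_ite_card, sum_ite_card,
    ← Finset.sum_filter, Finset.filter_filter]
  congr 3
  ext r
  simp only [Finset.mem_filter, mem_traces]
  constructor
  · rintro ⟨-, h1, h2⟩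
    exact ⟨(hφ r h1).1 h2, h1⟩
  · rintro ⟨h1, h2⟩
    exact ⟨mem_rng_of_sq_le (by linarith), h2, (hφ r h2).2 h1⟩

lemma card_sq_eq {n : ℕ} (hn : n ≠ 0) :
    ((rng n).filter fun r : ℤ => r ^ 2 = 4 * n).card = if IsSquare n then 2 else 0 := by
  split_ifs with h
  · obtain ⟨t, rfl⟩ := (isSquare_iff_exists_sq n).1 h
    have ht : t ≠ 0 := by rintro rfl; simp at hn
    have : ((rng (t ^ 2)).filter fun r : ℤ => r ^ 2 = 4 * (t ^ 2 : ℕ)) =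
        ({2 * (t : ℤ), -(2 * (t : ℤ))} : Finset ℤ) := by
      ext r
      have key : r ^ 2 = 4 * (t ^ 2 : ℕ) ↔ r = 2 * (t : ℤ) ∨ r = -(2 * (t : ℤ)) := by
        rw [← sq_eq_sq_iff_eq_or_eq_neg]
        push_cast
        rw [mul_pow]
        norm_num
      rw [Finset.mem_filter, key, Finset.mem_insert, Finset.mem_singleton, and_iff_right_iff_imp]
      exact fun h => mem_rng_of_sq_le (by rw [key.2 h]; linarith)
    rw [this, Finset.card_pair (by omega)]
  · rw [Finset.card_eq_zero, Finset.filter_eq_empty_iff]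
    intro r _ hr
    obtain ⟨x, rfl | rfl⟩ := Int.even_or_odd' r
    · refine h ⟨x.natAbs, ?_⟩
      zify
      rw [← sq, sq_abs]
      linarith
    · ring_nf at hr
      omega

lemma card_sq_eq_gap {n k : ℕ} (hn : n ≠ 0) (hk : 0 < k) (hk2 : k ≤ 2) :
    ((rng n).filter fun r : ℤ => r ^ 2 = 4 * n + k ^ 2).card = gapCount n k := by
  rw [gapCount]
  symm
  refine Finset.card_bij
    (fun d _ => if (d : ℕ) < n / d then ((n / d : ℕ) : ℤ) + (d : ℤ) else -(((n / d : ℕ) : ℤ) + (d :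
        ℤ))) ?_ ?_ ?_
  · intro d hd
    obtain ⟨h1, h2⟩ := Finset.mem_filter.1 hd
    have h3 : (d : ℤ) * (n / d : ℕ) = n := by
      exact_mod_cast Nat.mul_div_cancel' (Nat.dvd_of_mem_divisors h1)
    have h4 : (((n / d : ℕ) : ℤ) - d) ^ 2 = k ^ 2 := by rw [← h2, Int.natAbs_sq]
    have h5 : (((n / d : ℕ) : ℤ) + d) ^ 2 = 4 * n + k ^ 2 := by rw [← h4, ← h3]; ring
    have h6 : (if (d : ℕ) < n / d then ((n / d : ℕ) : ℤ) + (d : ℤ) else -(((n / d : ℕ) : ℤ) + (d :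
        ℤ))) ^ 2 =
        4 * n + k ^ 2 := by
      split_ifs
      · exact h5
      · rw [neg_sq, h5]
    refine Finset.mem_filter.2 ⟨mem_rng_of_sq_le ?_, h6⟩
    rw [h6]
    have : (k : ℤ) ≤ 2 := by exact_mod_cast hk2
    nlinarith
  · intro d hd e he h
    obtain ⟨h1, h2⟩ := Finset.mem_filter.1 hd
    obtain ⟨h3, h4⟩ := Finset.mem_filter.1 he
    have h5 := Nat.pos_of_mem_divisors h1
    have h6 := Nat.pos_of_mem_divisors h3
    split_ifs at h <;> omega
  · intro r hr
    have h1 := (Finset.mem_filter.1 hr).2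
    obtain ⟨m, hm⟩ : ∃ m : ℤ, |r| = k + 2 * m := by
      have : (2 : ℤ) ∣ |r| - k := by
        have h : (2 : ℤ) ∣ (|r| - k) ^ 2 := by
          refine ⟨2 * n + k ^ 2 - |r| * k, ?_⟩
          have := sq_abs r
          linear_combination this + h1
        exact Int.prime_two.dvd_of_dvd_pow h
      obtain ⟨m, hm⟩ := this
      exact ⟨m, by linarith⟩
    have h2 : m * (m + k) = n := by
      have := sq_abs r
      rw [hm] at this
      linarith
    have hn' : (0 : ℤ) < n := by positivity
    have hk' : (0 : ℤ) < k := by positivity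
    have hm0 : 0 < m := by
      by_contra! hcon
      have : 0 ≤ |r| := abs_nonneg r
      nlinarith
    lift m to ℕ using hm0.le
    have hm0' : 0 < m := by exact_mod_cast hm0
    have h3 : m * (m + k) = n := by exact_mod_cast h2
    have h4 : n / m = m + k := by rw [← h3, Nat.mul_div_cancel_left _ hm0']
    have h5 : n / (m + k) = m := by rw [← h3, Nat.mul_div_cancel _ (by omega)]
    rcases le_or_gt 0 r with hr0 | hr0
    · rw [abs_of_nonneg hr0] at hm
      refine ⟨m, Finset.mem_filter.2 ⟨Nat.mem_divisors.2 ⟨⟨_, h3.symm⟩, hn⟩, ?_⟩, ?_⟩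
      · rw [h4]; omega
      · rw [h4, if_pos (by omega)]; push_cast; omega
    · rw [abs_of_neg hr0] at hm
      refine ⟨m + k, Finset.mem_filter.2 ⟨Nat.mem_divisors.2 ⟨⟨m, by rw [mul_comm, h3]⟩, hn⟩, ?_⟩,
        ?_⟩
      · rw [h5]; omega
      · rw [h5, if_neg (by omega)]; push_cast; omega

lemma sum_trC_one {n : ℕ} (hn : n ≠ 0) : ∑ r ∈ rng n, trC (4 * n - r ^ 2) = 0 := by
  have h := sum_trC n (fun _ => True) (fun r => 4 * n - r ^ 2) (fun r _ => by simp)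
  simp only [Finset.filter_true, true_and] at h
  have e0 : ((rng n).filter fun r => 4 * (n : ℤ) - r ^ 2 = 0) =
      (rng n).filter fun r : ℤ => r ^ 2 = 4 * n := Finset.filter_congr fun r _ => by omega
  have e1 : ((rng n).filter fun r => 4 * (n : ℤ) - r ^ 2 = -1) =
      (rng n).filter fun r : ℤ => r ^ 2 = 4 * n + (1 : ℕ) ^ 2 :=
    Finset.filter_congr fun r _ => by push_cast; omega
  rw [h, sum_clSum_one hn, e0, e1, card_sq_eq hn, card_sq_eq_gap hn one_pos one_le_two]
  split_ifs <;> (push_cast; ring)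

lemma sum_trC_two_of_even {c : ℤ → ℤ} (hc : IsEtaQuotCoeff c) {n : ℕ} (hn0 : n ≠ 0)
    (hn : Even n) : ∑ r ∈ rng n with Odd r, trC (4 * n - r ^ 2) =
      2 * (n * c n) - 48 * sigmaOdd n := by
  have e0 : ((rng n).filter fun r => Odd r ∧ 4 * (n : ℤ) - r ^ 2 = 0) = ∅ := by
    refine Finset.filter_eq_empty_iff.2 fun r _ ⟨h1, h2⟩ => ?_
    obtain ⟨x, rfl⟩ := h1
    ring_nf at h2
    omega
  have e1 : ((rng n).filter fun r => Odd r ∧ 4 * (n : ℤ) - r ^ 2 = -1) =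
      (rng n).filter fun r : ℤ => r ^ 2 = 4 * n + (1 : ℕ) ^ 2 := by
    refine Finset.filter_congr fun r _ => ⟨fun h => by push_cast; omega, fun h => ⟨?_, ?_⟩⟩
    · refine Int.not_even_iff_odd.1 fun ⟨x, hx⟩ => ?_
      rw [hx] at h
      push_cast at h
      ring_nf at h
      omega
    · push_cast at h
      omega
  rw [sum_trC n Odd (fun r => 4 * n - r ^ 2) (fun r _ => by simp), sum_clSum_two_of_even hc hn0 hn,
    e0, e1, card_sq_eq_gap hn0 one_pos one_le_two]
  simp

lemma sum_trC_two_of_odd {c : ℤ → ℤ} (hc : IsEtaQuotCoeff c) {n : ℕ} (hn : Odd n) :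
    ∑ r ∈ rng n with Even r, (trC (4 * n - r ^ 2) + 2 * trC ((4 * n - r ^ 2) / 4)) =
      2 * (n * c n) - 48 * sigmaOdd n := by
  have hn0 : n ≠ 0 := by rintro rfl; simp at hn
  have hsq : ∀ r : ℤ, Even r → ∃ x, r ^ 2 = 4 * x := by
    rintro _ ⟨x, rfl⟩
    exact ⟨x ^ 2, by ring⟩
  have hev : ∀ r x : ℤ, r ^ 2 = 4 * x → Even r := fun r x h => by
    refine Int.not_odd_iff_even.1 fun ⟨y, hy⟩ => ?_
    rw [hy] at h
    ring_nf at h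
    omega
  have e0 : ((rng n).filter fun r => Even r ∧ 4 * (n : ℤ) - r ^ 2 = 0) =
      (rng n).filter fun r : ℤ => r ^ 2 = 4 * n :=
    Finset.filter_congr fun r _ => ⟨fun h => by omega, fun h => ⟨hev r _ h, by omega⟩⟩
  have e1 : ((rng n).filter fun r => Even r ∧ 4 * (n : ℤ) - r ^ 2 = -1) = ∅ := by
    refine Finset.filter_eq_empty_iff.2 fun r _ ⟨h1, h2⟩ => ?_
    obtain ⟨x, hx⟩ := hsq r h1
    omega
  have e2 : ((rng n).filter fun r => Even r ∧ (4 * (n : ℤ) - r ^ 2) / 4 = 0) =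
      (rng n).filter fun r : ℤ => r ^ 2 = 4 * n := by
    refine Finset.filter_congr fun r _ => ⟨fun ⟨h1, h2⟩ => ?_, fun h => ⟨hev r _ h, by omega⟩⟩
    obtain ⟨x, hx⟩ := hsq r h1
    omega
  have e3 : ((rng n).filter fun r => Even r ∧ (4 * (n : ℤ) - r ^ 2) / 4 = -1) =
      (rng n).filter fun r : ℤ => r ^ 2 = 4 * n + (2 : ℕ) ^ 2 := by
    refine Finset.filter_congr fun r _ => ⟨fun ⟨h1, h2⟩ => ?_, fun h => ?_⟩
    · obtain ⟨x, hx⟩ := hsq r h1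
      push_cast
      omega
    · push_cast at h
      exact ⟨hev r (n + 1) (by linarith), by omega⟩
  have hpos : ∀ r : ℤ, Even r → (0 < (4 * (n : ℤ) - r ^ 2) / 4 ↔ r ^ 2 < 4 * n) := by
    intro r hr
    obtain ⟨x, hx⟩ := hsq r hr
    omega
  have h := sum_clSum_two_of_odd hc hn
  rw [Finset.sum_add_distrib, ← Finset.mul_sum] at h ⊢
  rw [sum_trC n Even (fun r => 4 * n - r ^ 2) (fun r _ => by simp),
    sum_trC n Even (fun r => (4 * n - r ^ 2) / 4) hpos, e0, e1, e2, e3, card_sq_eq hn0,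
    card_sq_eq_gap hn0 two_pos le_rfl, Finset.card_empty]
  rw [← sub_eq_zero] at h ⊢
  rw [← h]
  split_ifs <;> (push_cast; ring)

lemma trC_of_lt {d : ℤ} (hd : d < -1) : trC d = 0 := by
  rw [trC, if_neg (by omega), if_neg (by omega), if_neg (by omega)]
  ring

lemma finsum_trC (n : ℕ) :
    ∑ᶠ r : ℤ, traceSM (n - r ^ 2) = (∑ r ∈ rng n with Even r, trC ((4 * n - r ^ 2) / 4)).re := by
  have hsupp : Function.support (fun r : ℤ => traceSM (n - r ^ 2)) ⊆
      (Finset.Icc (-(n + 1 : ℤ)) (n + 1) : Finset ℤ) := by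
    intro r hr
    rw [Finset.coe_Icc, Set.mem_Icc, ← abs_le]
    by_contra! hcon
    refine hr ?_
    have : (n + 1 : ℤ) ^ 2 < r ^ 2 := by
      rw [← sq_abs r]
      gcongr
    simp only
    rw [traceSM_eq, trC_of_lt (by nlinarith), zero_re]
  rw [finsum_eq_sum_of_support_subset _ hsupp, re_sum]
  refine Finset.sum_nbij' (fun s => 2 * s) (fun r => r / 2) ?_ ?_ ?_ ?_ ?_
  · intro s hs
    rw [Finset.mem_Icc] at hs
    rw [Finset.mem_filter, rng, Finset.mem_Icc]
    exact ⟨by omega, even_two_mul s⟩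
  · intro r hr
    rw [Finset.mem_filter, rng, Finset.mem_Icc] at hr
    rw [Finset.mem_Icc]
    omega
  · intro s _
    simp
  · intro r hr
    obtain ⟨x, rfl⟩ := (Finset.mem_filter.1 hr).2
    omega
  · intro s _
    have : (4 * n - (2 * s) ^ 2 : ℤ) = 4 * (n - s ^ 2) := by ring
    rw [traceSM_eq, this, Int.mul_ediv_cancel_left _ four_ne_zero]

lemma sum_odd_trC (n : ℕ) : (∑ r ∈ rng n with Odd r, trC (4 * n - r ^ 2)).re =
    2 * ∑ᶠ (r : ℤ) (_ : 1 ≤ r ∧ Odd r), traceSM (4 * n - r ^ 2) := by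
  have h1 : ∑ᶠ (r : ℤ) (_ : 1 ≤ r ∧ Odd r), traceSM (4 * n - r ^ 2) =
      ∑ r ∈ rng n with 1 ≤ r ∧ Odd r, traceSM (4 * n - r ^ 2) := by
    refine finsum_mem_eq_sum_of_inter_support_eq _ (s := {r : ℤ | 1 ≤ r ∧ Odd r}) ?_
    ext r
    simp only [Set.mem_inter_iff, Finset.coe_filter, Set.mem_ofPred_eq, and_congr_left_iff]
    intro hr
    refine (and_iff_right ?_).symm
    by_contra hcon
    refine hr ?_
    have : ¬ r ^ 2 ≤ 4 * n + 4 := fun h => hcon (mem_rng_of_sq_le h)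
    simp only
    rw [traceSM_eq, trC_of_lt (by linarith), zero_re]
  have h2 : ∑ r ∈ rng n with (Odd r ∧ ¬1 ≤ r), traceSM (4 * n - r ^ 2) =
      ∑ r ∈ rng n with 1 ≤ r ∧ Odd r, traceSM (4 * n - r ^ 2) := by
    refine Finset.sum_nbij' (fun r => -r) (fun r => -r) ?_ ?_ ?_ ?_ ?_
    · intro r hr
      simp only [Finset.mem_filter, rng, Finset.mem_Icc, odd_neg] at hr ⊢
      obtain ⟨x, hx⟩ := hr.2.1
      exact ⟨by omega, by omega, hr.2.1⟩
    · intro r hr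
      simp only [Finset.mem_filter, rng, Finset.mem_Icc, odd_neg] at hr ⊢
      exact ⟨by omega, hr.2.2, by omega⟩
    · simp
    · simp
    · simp
  rw [re_sum, h1, ← Finset.sum_filter_add_sum_filter_not _ (fun r => 1 ≤ r), Finset.filter_filter,
    Finset.filter_filter, two_mul]
  simp only [← traceSM_eq, h2]
  congr 2
  exact Finset.filter_congr fun r _ => and_comm

lemma finsum_trC_of_even {n : ℕ} (hn0 : n ≠ 0) (hn : Even n) :
    ∑ᶠ r : ℤ, traceSM (n - r ^ 2) = 0 := by
  obtain ⟨m, hm⟩ := hn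
  obtain ⟨k, hk | hk⟩ := Nat.even_or_odd' m
  · have hk0 : k ≠ 0 := by omega
    have hnk : (n : ℤ) = 4 * k := by omega
    rw [hnk, finsum_eq_sum_of_support_subset (s := rng k), ← zero_re, ← sum_trC_one hk0, re_sum]
    · exact Finset.sum_congr rfl fun r _ => traceSM_eq _
    · intro r hr
      by_contra hcon
      refine hr ?_
      have : ¬ r ^ 2 ≤ 4 * k + 4 := fun h => hcon (mem_rng_of_sq_le h)
      simp only
      rw [traceSM_eq, trC_of_lt (by linarith), zero_re]
  · refine finsum_eq_zero_of_forall_eq_zero fun r => ?_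
    rw [traceSM]
    obtain ⟨x, rfl | rfl⟩ := Int.even_or_odd' r
    · have : (2 * x) ^ 2 = 4 * x ^ 2 := by ring
      rw [if_neg (by omega), if_neg (by omega), if_pos (by omega)]
    · have : (2 * x + 1) ^ 2 = 4 * (x ^ 2 + x) + 1 := by ring
      rw [if_neg (by omega), if_neg (by omega), if_pos (by omega)]

end Ohta

open Ohta in
/-- Ohta's formula: for `n ≥ 1`,
`n c(n) = ∑_{r ∈ ℤ} t(n − r²) + (−1)ⁿ ∑_{r ≥ 1 odd} t(4n − r²) + 24 ∑_{d ∣ n, d odd} d`. -/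
theorem ohta_formula (c : ℤ → ℤ) (hc : IsEtaQuotCoeff c) (n : ℕ) (hn : 0 < n) :
    (n : ℝ) * (c n : ℝ) =
      (∑ᶠ r : ℤ, traceSM ((n : ℤ) - r ^ 2)) +
        (-1 : ℝ) ^ n * ∑ᶠ (r : ℤ) (_ : 1 ≤ r ∧ Odd r), traceSM (4 * (n : ℤ) - r ^ 2) +
        24 * ∑ d ∈ n.divisors.filter (fun d => Odd d), (d : ℝ) := by
  have hσ : ∑ d ∈ n.divisors.filter (fun d => Odd d), (d : ℝ) = sigmaOdd n := by
    rw [sigmaOdd]; push_cast; rfl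
  have hodd := sum_odd_trC n
  rw [hσ]
  rcases Nat.even_or_odd n with he | ho
  · have h := congrArg Complex.re (sum_trC_two_of_even hc hn.ne' he)
    have hre : (2 * (n * c n) - 48 * sigmaOdd n : ℂ).re = 2 * (n * c n) - 48 * sigmaOdd n := by
      exact_mod_cast Complex.ofReal_re (2 * (n * c n) - 48 * sigmaOdd n)
    rw [hre] at h
    rw [finsum_trC_of_even hn.ne' he, he.neg_one_pow]
    linarith
  · have h := congrArg Complex.re (sum_trC_two_of_odd hc ho)
    have hre : (2 * (n * c n) - 48 * sigmaOdd n : ℂ).re = 2 * (n * c n) - 48 * sigmaOdd n := by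
      exact_mod_cast Complex.ofReal_re (2 * (n * c n) - 48 * sigmaOdd n)
    have h1 := congrArg Complex.re (sum_trC_one hn.ne')
    rw [← Finset.sum_filter_add_sum_filter_not _ Even, Complex.add_re, Complex.zero_re] at h1
    simp only [Int.not_even_iff_odd] at h1
    rw [hre, Finset.sum_add_distrib, ← Finset.mul_sum, Complex.add_re] at h
    have h2 : ∀ z : ℂ, (2 * z).re = 2 * z.re := fun z => by simp
    rw [h2] at h
    rw [finsum_trC, ho.neg_one_pow]
    linarith
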